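/- For every integer m ≥ 1 there exists a real number V with 0 < V < ∞ such that, as the degree d → ∞, the standardized number of real roots (N_{P_d} − d^{m/2})/d^{m/4} of the m×m KSS system converges in distribution to a centered Gaussian random variable with variance V; that is, the laws of (N_{P_d} − d^{m/2})/d^{m/4} converge weakly to the Gaussian measure on ℝ with mean 0 and variance V. -/

import Mathlib

open MeasureTheory ProbabilityTheory Real Filter Nat

/-- Index set for the coefficients of the `m × m` KSS system of degree `d`:
a pair of an equation index `ℓ ∈ {1,…,m}` and a multi-index `j ∈ ℕ^m` with `|j| ≤ d`
(encoded with entries in `Fin (d+1)`). -/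
abbrev kssIndex (m d : ℕ) :=
  Fin m × {j : Fin m → Fin (d + 1) // (∑ k, (j k : ℕ)) ≤ d}

/-- Variance `d! / (j_1! ⋯ j_m! (d - |j|)!)` of the coefficient `a^{(ℓ)}_j`. -/
noncomputable def kssVar (m d : ℕ) (i : kssIndex m d) : NNReal :=
  (d ! : NNReal) / ((∏ k, ((i.2.1 k : ℕ))! : ℕ) * ((d - ∑ k, (i.2.1 k : ℕ))! : ℕ))

/-- The law of the coefficients: product of independent centered Gaussian measures. -/
noncomputable def kssMeasure (m d : ℕ) : Measure (kssIndex m d → ℝ) :=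
  Measure.pi fun i => gaussianReal 0 (kssVar m d i)

/-- The polynomial `P_ℓ(t) = ∑_{|j| ≤ d} a^{(ℓ)}_j t^j`. -/
noncomputable def kssPoly (m d : ℕ) (ω : kssIndex m d → ℝ) (ℓ : Fin m)
    (t : Fin m → ℝ) : ℝ :=
  ∑ j : {j : Fin m → Fin (d + 1) // (∑ k, (j k : ℕ)) ≤ d},
    ω (ℓ, j) * ∏ k, t k ^ (j.1 k : ℕ)

/-- The number of roots of the system `P_d = 0` in `ℝ^m`. -/
noncomputable def kssCount (m d : ℕ) (ω : kssIndex m d → ℝ) : ℕ :=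
  Set.ncard {t : Fin m → ℝ | ∀ ℓ, kssPoly m d ω ℓ t = 0}

noncomputable section
set_option linter.unusedSectionVars false

section

/-- Standard Gaussian measure on `ι → ℝ`. -/
def stdG (ι : Type*) [Fintype ι] : Measure (ι → ℝ) := Measure.pi fun _ => gaussianReal 0 1

section Basic
variable {ι κ : Type*} [Fintype ι] [Fintype κ]

instance : IsProbabilityMeasure (stdG ι) := by unfold stdG; infer_instance

lemma stdG_charFun (c : ι → ℝ) :
    ∫ ω, Complex.exp ((c ⬝ᵥ ω : ℝ) * Complex.I) ∂(stdG ι)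
      = Complex.exp (-(c ⬝ᵥ c : ℝ) / 2) := by
  have h : ∀ ω : ι → ℝ, Complex.exp ((c ⬝ᵥ ω : ℝ) * Complex.I)
      = ∏ i, Complex.exp (c i * ω i * Complex.I) := by
    intro ω
    rw [← Complex.exp_sum, ← Finset.sum_mul]
    simp [dotProduct]
  simp_rw [h, stdG]
  rw [integral_fintype_prod_eq_prod
    (f := fun i (x : ℝ) => Complex.exp (c i * x * Complex.I))]
  have h2 : ∀ i, ∫ x, Complex.exp (c i * x * Complex.I) ∂(gaussianReal 0 1)
      = Complex.exp (-(c i * c i) / 2) := by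
    intro i
    have := charFun_gaussianReal (μ := 0) (v := 1) (c i)
    rw [charFun_apply_real] at this
    rw [this]
    congr 1
    simp; ring
  simp_rw [h2, ← Complex.exp_sum]
  congr 1
  simp [dotProduct, Finset.sum_div, neg_div]

lemma stdG_charFunDual_map [DecidableEq κ] (a : κ → ι → ℝ) (L : StrongDual ℝ (κ → ℝ)) :
    charFunDual ((stdG ι).map (fun ω k => a k ⬝ᵥ ω)) L
      = Complex.exp (-(∑ k, ∑ l,
          L (Pi.single k 1) * L (Pi.single l 1)
            * (a k ⬝ᵥ a l) : ℝ) / 2) := by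
  have hm : Measurable (fun (ω : ι → ℝ) k => a k ⬝ᵥ ω) := by
    unfold dotProduct; fun_prop
  rw [charFunDual_apply, integral_map hm.aemeasurable (by fun_prop)]
  have h1 : ∀ ω : ι → ℝ, L (fun k => a k ⬝ᵥ ω)
      = (fun i => ∑ k, L (Pi.single k 1) * a k i) ⬝ᵥ ω := by
    intro ω
    have : (fun k => a k ⬝ᵥ ω) = ∑ k, (a k ⬝ᵥ ω) • (Pi.single k (1:ℝ) : κ → ℝ) := by
      ext j
      simp [Finset.sum_apply, Pi.single_apply]
    rw [this, map_sum]
    simp only [map_smul, smul_eq_mul, dotProduct, Finset.sum_mul]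
    rw [Finset.sum_comm]
    refine Finset.sum_congr rfl fun i _ => Finset.sum_congr rfl fun k _ => by ring
  simp_rw [h1]
  rw [stdG_charFun]
  congr 4
  simp only [dotProduct, Finset.sum_mul, Finset.mul_sum]
  rw [Finset.sum_comm]
  refine Finset.sum_congr rfl fun k _ => ?_
  rw [Finset.sum_comm]
  refine Finset.sum_congr rfl fun l _ => Finset.sum_congr rfl fun i _ => by ring

lemma stdG_map_rows {ι' : Type*} [Fintype ι'] (a : κ → ι → ℝ) (b : κ → ι' → ℝ)
    (h : ∀ k l, a k ⬝ᵥ a l = b k ⬝ᵥ b l) :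
    (stdG ι).map (fun ω k => a k ⬝ᵥ ω) = (stdG ι').map (fun ω k => b k ⬝ᵥ ω) := by
  classical
  have hma : Measurable (fun (ω : ι → ℝ) k => a k ⬝ᵥ ω) := by
    unfold dotProduct; fun_prop
  have hmb : Measurable (fun (ω : ι' → ℝ) k => b k ⬝ᵥ ω) := by
    unfold dotProduct; fun_prop
  have := Measure.isProbabilityMeasure_map (μ := stdG ι) hma.aemeasurable
  have := Measure.isProbabilityMeasure_map (μ := stdG ι') hmb.aemeasurable
  apply Measure.ext_of_charFunDual
  ext L
  rw [stdG_charFunDual_map, stdG_charFunDual_map]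
  simp_rw [h]

lemma stdG_sum_measurePreserving :
    MeasurePreserving (fun w : ι ⊕ κ → ℝ => ((fun i => w (Sum.inl i)), fun k => w (Sum.inr k)))
      (stdG (ι ⊕ κ)) ((stdG ι).prod (stdG κ)) := by
  exact measurePreserving_sumPiEquivProdPi (X := fun _ : ι ⊕ κ => ℝ)
    (fun _ => gaussianReal 0 1)

lemma stdG_map_prod_rows {η : Type*} [Fintype η] (a : η → ι → ℝ) (b : η → κ → ℝ) {ι' : Type*} [Fintype ι']
    (c : η → ι' → ℝ)
    (h : ∀ k l, a k ⬝ᵥ a l + b k ⬝ᵥ b l = c k ⬝ᵥ c l) :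
    ((stdG ι).prod (stdG κ)).map (fun p k => a k ⬝ᵥ p.1 + b k ⬝ᵥ p.2)
      = (stdG ι').map (fun ω k => c k ⬝ᵥ ω) := by
  rw [← stdG_sum_measurePreserving.map_eq, Measure.map_map (by unfold dotProduct; fun_prop)
    (by fun_prop)]
  rw [← stdG_map_rows (fun k => Sum.elim (a k) (b k)) c (by
    intro k l; rw [← h]; simp [dotProduct])]
  congr 1
  ext w k
  simp [dotProduct]

lemma stdG_upd_measurePreserving (e : κ → ι) (he : Function.Injective e) :
    MeasurePreserving (fun p : (ι → ℝ) × (κ → ℝ) => Function.extend e p.2 p.1)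
      ((stdG ι).prod (stdG κ)) (stdG ι) := by
  classical
  have hrep : (fun p : (ι → ℝ) × (κ → ℝ) => Function.extend e p.2 p.1)
      = fun p i => (if ∃ k, e k = i then 0 else Pi.single i 1) ⬝ᵥ p.1
          + (fun k => if e k = i then 1 else 0) ⬝ᵥ p.2 := by
    ext p i
    by_cases h : ∃ k, e k = i
    · obtain ⟨k, rfl⟩ := h
      simp only [he.extend_apply, exists_apply_eq_apply, if_true, dotProduct, he.eq_iff]
      simp
    · rw [Function.extend_apply' _ _ _ h, if_neg h]
      push Not at h
      simp [dotProduct, h, Pi.single_apply]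
  constructor
  · rw [hrep]; unfold dotProduct; fun_prop
  · rw [hrep]
    have := stdG_map_prod_rows (κ := κ) (fun i : ι => if ∃ k, e k = i then 0 else Pi.single i (1:ℝ))
      (fun i k => if e k = i then 1 else 0) (fun i => (Pi.single i 1 : ι → ℝ)) (by
        intro i j
        by_cases hij : i = j
        · subst hij
          by_cases h : ∃ k, e k = i
          · obtain ⟨k, rfl⟩ := h
            simp [dotProduct, he.eq_iff, Pi.single_apply]
          · rw [if_neg h]
            push Not at h
            simp [dotProduct, h]
        · have hk : ∀ k, ¬ (e k = i ∧ e k = j) := fun k h => hij (h.1.symm.trans h.2)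
          have h0 : (fun k => if e k = i then (1:ℝ) else 0) ⬝ᵥ (fun k => if e k = j then (1:ℝ) else 0) = 0 := by
            apply Finset.sum_eq_zero
            intro k _
            by_cases h1 : e k = i
            · have : ¬ e k = j := fun h2 => hk k ⟨h1, h2⟩
              simp [this]
            · simp [h1]
          rw [h0]
          by_cases h1 : ∃ k, e k = i <;> by_cases h2 : ∃ k, e k = j <;>
            simp [h1, h2, Ne.symm hij, dotProduct, Pi.single_apply])
    rw [this]
    conv_rhs => rw [← Measure.map_id (μ := stdG ι)]
    congr 1
    ext ω i
    simp

/-- Density of `stdG`. -/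
def gpdf (κ : Type*) [Fintype κ] (u : κ → ℝ) : ℝ :=
  (√(2 * π))⁻¹ ^ Fintype.card κ * Real.exp (-(u ⬝ᵥ u) / 2)

lemma gpdf_eq (u : κ → ℝ) : gpdf κ u = ∏ k, gaussianPDFReal 0 1 (u k) := by
  simp only [gpdf, gaussianPDFReal, Finset.prod_mul_distrib, Finset.prod_const, Finset.card_univ,
    ← Real.exp_sum, dotProduct]
  simp [Finset.sum_div, pow_two, neg_div]

lemma gpdf_pos (u : κ → ℝ) : 0 < gpdf κ u := by
  unfold gpdf; positivity

lemma continuous_gpdf : Continuous (gpdf κ) := by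
  unfold gpdf dotProduct; fun_prop

@[fun_prop]
lemma measurable_gpdf : Measurable (gpdf κ) := continuous_gpdf.measurable

lemma gpdf_le (u : κ → ℝ) : gpdf κ u ≤ (√(2 * π))⁻¹ ^ Fintype.card κ := by
  unfold gpdf
  have : Real.exp (-(u ⬝ᵥ u) / 2) ≤ 1 := by
    rw [Real.exp_le_one_iff]
    have : 0 ≤ u ⬝ᵥ u := Finset.sum_nonneg fun i _ => mul_self_nonneg (u i)
    linarith
  have h0 : 0 ≤ (√(2 * π))⁻¹ ^ Fintype.card κ := by positivity
  nlinarith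

lemma stdG_eq_withDensity :
    stdG κ = volume.withDensity (fun u => ENNReal.ofReal (gpdf κ u)) := by
  unfold stdG
  refine (Measure.pi_eq fun s hs => ?_)
  rw [withDensity_apply _ (MeasurableSet.univ_pi hs), volume_pi, Measure.restrict_pi_pi]
  have hint : ∀ i, Integrable (gaussianPDFReal 0 1) (volume.restrict (s i)) :=
    fun i => (integrable_gaussianPDFReal 0 1).restrict
  simp_rw [gpdf_eq]
  rw [← ofReal_integral_eq_lintegral_ofReal
    (Integrable.fintype_prod (f := fun _ => gaussianPDFReal 0 1) hint)
    (ae_of_all _ fun u => Finset.prod_nonneg fun i _ => gaussianPDFReal_nonneg 0 1 _),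
    integral_fintype_prod_eq_prod (f := fun _ => gaussianPDFReal 0 1),
    ENNReal.ofReal_prod_of_nonneg fun i _ => integral_nonneg fun x => gaussianPDFReal_nonneg 0 1 _]
  refine Finset.prod_congr rfl fun i _ => ?_
  rw [gaussianReal_apply_eq_integral _ one_ne_zero]

end Basic
end

section

/-- Number of elements of a set, as an extended nonnegative real. -/
def cnt {X : Type*} (S : Set X) : ENNReal := (S.encard : ENNReal)

section Area

lemma cnt_iUnion {X : Type*} {S : ℕ → Set X} (h : Pairwise (Function.onFun Disjoint S)) :
    cnt (⋃ n, S n) = ∑' n, cnt (S n) := by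
  let _ : MeasurableSpace X := ⊤
  have hc : ∀ S : Set X, cnt S = Measure.count S := fun S => by
    rw [Measure.count_apply MeasurableSpace.measurableSet_top]; rfl
  simp_rw [hc]
  exact measure_iUnion h fun _ => MeasurableSpace.measurableSet_top

lemma cnt_union {X : Type*} {S T : Set X} (h : Disjoint S T) :
    cnt (S ∪ T) = cnt S + cnt T := by
  simp [cnt, Set.encard_union_eq h]

lemma cnt_mono {X : Type*} {S T : Set X} (h : S ⊆ T) : cnt S ≤ cnt T := by
  unfold cnt; exact_mod_cast Set.encard_le_encard h

@[simp] lemma cnt_empty {X : Type*} : cnt (∅ : Set X) = 0 := by simp [cnt]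

lemma cnt_injOn_fiber {X Y : Type*} {g : X → Y} {P : Set X} (h : Set.InjOn g P) (y : Y) :
    cnt {x ∈ P | g x = y} = (g '' P).indicator 1 y := by
  by_cases hy : y ∈ g '' P
  · obtain ⟨x, hx, rfl⟩ := hy
    have : {x' ∈ P | g x' = g x} = {x} := by
      ext x'; constructor
      · rintro ⟨h1, h2⟩; exact h h1 hx h2
      · rintro rfl; exact ⟨hx, rfl⟩
    rw [this, Set.indicator_of_mem (Set.mem_image_of_mem g hx)]; simp [cnt]
  · have : {x' ∈ P | g x' = y} = ∅ := by
      ext x'; simp only [Set.mem_ofPred_eq, Set.mem_empty_iff_false, iff_false]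
      rintro ⟨h1, h2⟩; exact hy ⟨x', h1, h2⟩
    rw [this, Set.indicator_of_notMem hy]; simp

variable {E : Type*} [NormedAddCommGroup E] [NormedSpace ℝ E] [FiniteDimensional ℝ E]
  [MeasurableSpace E] [BorelSpace E] (μ : Measure E) [μ.IsAddHaarMeasure]

lemma exists_injOn_partition {g : E → E} {g' : E → E →L[ℝ] E} {S : Set E}
    (hg : ∀ x ∈ S, HasFDerivWithinAt g (g' x) S x) (hdet : ∀ x ∈ S, (g' x).det ≠ 0) :
    ∃ t : ℕ → Set E, Pairwise (Function.onFun Disjoint t) ∧ (∀ n, MeasurableSet (t n)) ∧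
      S ⊆ ⋃ n, t n ∧ ∀ n, Set.InjOn g (S ∩ t n) := by
  classical
  let r : (E →L[ℝ] E) → NNReal := fun A =>
    if h : A.det ≠ 0 then
      (if ‖((A.toContinuousLinearEquivOfDetNeZero h).symm : E →L[ℝ] E)‖₊ = 0 then 1 else
        ‖((A.toContinuousLinearEquivOfDetNeZero h).symm : E →L[ℝ] E)‖₊⁻¹ / 2)
    else 1
  have rpos : ∀ A, r A ≠ 0 := by
    intro A
    simp only [r]
    split_ifs with h1 h2
    · exact one_ne_zero
    · simpa using h2
    · exact one_ne_zero
  obtain ⟨t, A, h1, h2, h3, h4, h5⟩ :=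
    exists_partition_approximatesLinearOn_of_hasFDerivWithinAt g S g' hg r rpos
  refine ⟨t, h1, h2, h3, fun n => ?_⟩
  rcases S.eq_empty_or_nonempty with rfl | hS
  · simp
  obtain ⟨y, hy, hA⟩ := h5 hS n
  have hd : (A n).det ≠ 0 := hA ▸ hdet y hy
  have h4n := h4 n
  rw [← (A n).coe_toContinuousLinearEquivOfDetNeZero hd] at h4n
  refine h4n.injOn ?_
  rw [(A n).coe_toContinuousLinearEquivOfDetNeZero hd]
  simp only [r, dif_pos hd]
  split_ifs with h0
  · left
    rw [nnnorm_eq_zero] at h0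
    refine ⟨fun a b => ?_⟩
    have : ∀ a : E, a = 0 := fun a => by
      have h := congrArg (fun f : E →L[ℝ] E =>
        f ((A n).toContinuousLinearEquivOfDetNeZero hd a)) h0
      exact (((A n).toContinuousLinearEquivOfDetNeZero hd).symm_apply_apply a).symm.trans h
    rw [this a, this b]
  · right
    exact NNReal.half_lt_self (by simpa using h0)

/-- Area formula with multiplicity. -/
theorem lintegral_abs_det_mul_eq_lintegral_cnt {g : E → E} {g' : E → E →L[ℝ] E} {S U : Set E}
    (hS : MeasurableSet S) (hU : IsOpen U) (hSU : S ⊆ U)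
    (hg : ∀ x ∈ U, HasFDerivAt g (g' x) x) (hc : ContinuousOn g' U)
    {h : E → ENNReal} (hh : Measurable h) :
    ∫⁻ x in S, ENNReal.ofReal |(g' x).det| * h (g x) ∂μ
      = ∫⁻ y, cnt {x ∈ S | g x = y} * h y ∂μ := by
  have hcd : ContinuousOn (fun x => (g' x).det) U :=
    ContinuousLinearMap.continuous_det.comp_continuousOn hc
  have hV : IsOpen (U ∩ (fun x => (g' x).det) ⁻¹' {0}ᶜ) :=
    hcd.isOpen_inter_preimage hU isOpen_compl_singleton
  set V := U ∩ (fun x => (g' x).det) ⁻¹' {0}ᶜ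
  have hS1 : MeasurableSet (S ∩ V) := hS.inter hV.measurableSet
  have hd1 : ∀ x ∈ S ∩ V, (g' x).det ≠ 0 := fun x hx => hx.2.2
  have hd0 : ∀ x ∈ S \ V, (g' x).det = 0 := fun x hx => by
    by_contra h; exact hx.2 ⟨hSU hx.1, h⟩
  obtain ⟨t, t1, t2, t3, t4⟩ := exists_injOn_partition
    (fun x hx => (hg x (hSU hx.1)).hasFDerivWithinAt) hd1
  set P : ℕ → Set E := fun n => S ∩ V ∩ t n
  have hPm : ∀ n, MeasurableSet (P n) := fun n => hS1.inter (t2 n)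
  have hPd : Pairwise (Function.onFun Disjoint P) := fun i j hij =>
    (t1 hij).mono Set.inter_subset_right Set.inter_subset_right
  have hPU : S ∩ V = ⋃ n, P n := by
    rw [← Set.inter_iUnion]; exact (Set.inter_eq_left.2 t3).symm
  have hgP : ∀ n, ∀ x ∈ P n, HasFDerivWithinAt g (g' x) (P n) x := fun n x hx =>
    (hg x (hSU hx.1.1)).hasFDerivWithinAt
  have hnull : μ (g '' (S \ V)) = 0 :=
    addHaar_image_eq_zero_of_det_fderivWithin_eq_zero μ
      (fun x hx => (hg x (hSU hx.1)).hasFDerivWithinAt) hd0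
  have hL : ∫⁻ x in S, ENNReal.ofReal |(g' x).det| * h (g x) ∂μ
      = ∑' n, ∫⁻ y, (g '' P n).indicator 1 y * h y ∂μ := by
    rw [← lintegral_inter_add_sdiff _ S hV.measurableSet]
    have : ∫⁻ x in S \ V, ENNReal.ofReal |(g' x).det| * h (g x) ∂μ = 0 := by
      rw [setLIntegral_congr_fun (g := fun _ => 0) (hS.diff hV.measurableSet)]
      · simp
      · intro x hx; simp [hd0 x hx]
    rw [this, add_zero, hPU, lintegral_iUnion hPm hPd]
    refine tsum_congr fun n => ?_
    rw [← lintegral_image_eq_lintegral_abs_det_fderiv_mul μ (hPm n) (hgP n) (t4 n),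
      ← lintegral_indicator (measurable_image_of_fderivWithin (hPm n) (hgP n) (t4 n))]
    refine lintegral_congr fun y => ?_
    by_cases hy : y ∈ g '' P n <;> simp [hy]
  rw [hL, ← lintegral_tsum]
  · have hae : ∀ᵐ y ∂μ, y ∉ g '' (S \ V) := measure_eq_zero_iff_ae_notMem.1 hnull
    refine lintegral_congr_ae ?_
    filter_upwards [hae] with y hy
    rw [ENNReal.tsum_mul_right]
    congr 1
    have : {x ∈ S | g x = y} = ⋃ n, {x ∈ P n | g x = y} := by
      ext x
      simp only [Set.mem_ofPred_eq, Set.mem_iUnion, exists_and_right]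
      rw [← Set.mem_iUnion, ← hPU]
      refine ⟨fun ⟨h1, h2⟩ => ⟨⟨h1, ?_⟩, h2⟩, fun ⟨h1, h2⟩ => ⟨h1.1, h2⟩⟩
      by_contra hxV
      exact hy ⟨x, ⟨h1, hxV⟩, h2⟩
    rw [this, cnt_iUnion]
    · exact tsum_congr fun n => (cnt_injOn_fiber (t4 n) y).symm
    · intro i j hij
      exact (hPd hij).mono (fun x hx => hx.1) (fun x hx => hx.1)
  · intro n
    exact ((measurable_one.indicator
      (measurable_image_of_fderivWithin (hPm n) (hgP n) (t4 n))).mul hh).aemeasurable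

end Area
end

section

section MeasCount

variable {Ω X Y : Type*} [TopologicalSpace Ω] [MeasurableSpace Ω] [OpensMeasurableSpace Ω]
  [MetricSpace X] [SecondCountableTopology X] [TopologicalSpace Y] [T1Space Y]

lemma isClosed_exists_zero {F : Ω → X → Y} (hF : Continuous (Function.uncurry F)) (y : Y)
    {K : Set X} (hK : IsCompact K) : IsClosed {ω | ∃ x ∈ K, F ω x = y} := by
  have : CompactSpace K := isCompact_iff_compactSpace.1 hK
  have h1 : IsClosed {p : Ω × K | F p.1 p.2 = y} :=
    isClosed_singleton.preimage (hF.comp (by fun_prop : Continuous fun p : Ω × K => (p.1, (p.2 : X))))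
  have h2 := isClosedMap_fst_of_compactSpace (X := Ω) (Y := K) _ h1
  convert! h2 using 1
  ext ω
  simp

lemma measurableSet_exists_zero {F : Ω → X → Y} (hF : Continuous (Function.uncurry F)) (y : Y)
    {S : Set X} (hS : IsSigmaCompact S) : MeasurableSet {ω | ∃ x ∈ S, F ω x = y} := by
  obtain ⟨K, hK, rfl⟩ := hS
  have : {ω | ∃ x ∈ ⋃ n, K n, F ω x = y} = ⋃ n, {ω | ∃ x ∈ K n, F ω x = y} := by
    ext ω; simp; tauto
  rw [this]
  exact MeasurableSet.iUnion fun n => (isClosed_exists_zero hF y (hK n)).measurableSet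

omit [SecondCountableTopology X] in
lemma IsSigmaCompact.inter_isOpen {S B : Set X} (hS : IsSigmaCompact S) (hB : IsOpen B) :
    IsSigmaCompact (S ∩ B) := by
  obtain ⟨K, hK, rfl⟩ := hS
  obtain ⟨C, hC, -, hCB, -⟩ := hB.exists_iUnion_isClosed
  rw [← hCB, Set.iUnion_inter]
  refine isSigmaCompact_iUnion _ fun n => ?_
  rw [Set.inter_iUnion]
  exact isSigmaCompact_iUnion _ fun k => ((hK n).inter_right (hC k)).isSigmaCompact

omit [SecondCountableTopology X] in
lemma IsSigmaCompact.inter_isClosed {S B : Set X} (hS : IsSigmaCompact S) (hB : IsClosed B) :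
    IsSigmaCompact (S ∩ B) := by
  obtain ⟨K, hK, rfl⟩ := hS
  rw [Set.iUnion_inter]
  exact isSigmaCompact_iUnion _ fun n => ((hK n).inter_right hB).isSigmaCompact

omit [MetricSpace X] [SecondCountableTopology X] in
lemma natCast_le_encard_iff [TopologicalSpace X] [T2Space X] [SecondCountableTopology X]
    (Z : Set X) (k : ℕ) :
    (k : ℕ∞) ≤ Z.encard ↔ ∃ f : Fin k → TopologicalSpace.countableBasis X,
      (Pairwise fun i j => Disjoint (f i : Set X) (f j)) ∧ ∀ i, ∃ x ∈ Z, x ∈ (f i : Set X) := by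
  constructor
  · intro h
    obtain ⟨T, hTZ, hT⟩ := Set.exists_subset_encard_eq h
    have hfin : T.Finite := Set.finite_of_encard_eq_coe hT
    obtain ⟨U, hU, hUd⟩ := hfin.t2_separation
    have hcard : Nat.card T = k := by
      have := hfin.cast_ncard_eq; rw [hT] at this
      rw [Nat.card_coe_set_eq]; exact_mod_cast this
    have := hfin.to_subtype
    let e : Fin k ≃ T := (finCongr hcard.symm).trans (Finite.equivFin T).symm
    have hb : ∀ i, ∃ b ∈ TopologicalSpace.countableBasis X, (e i : X) ∈ b ∧ b ⊆ U (e i) := fun i =>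
      (TopologicalSpace.isBasis_countableBasis X).exists_subset_of_mem_open (hU _).1 (hU _).2
    choose b hb1 hb2 hb3 using hb
    refine ⟨fun i => ⟨b i, hb1 i⟩, fun i j hij => ?_, fun i => ⟨e i, hTZ (e i).2, hb2 i⟩⟩
    refine (hUd (e i).2 (e j).2 fun h => hij (e.injective (Subtype.ext h))).mono (hb3 i) (hb3 j)
  · rintro ⟨f, hf, hx⟩
    choose x hxZ hxf using hx
    have hinj : Function.Injective x := by
      intro i j hij
      by_contra hne
      exact Set.disjoint_left.1 (hf hne) (hxf i) (hij ▸ hxf j)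
    have h1 : Set.range x ⊆ Z := by rintro _ ⟨i, rfl⟩; exact hxZ i
    have h2 := Set.encard_le_encard h1
    have h3 : (Set.range x).encard = k := by
      rw [← Set.image_univ, hinj.injOn.encard_image]
      simp
    rwa [h3] at h2

/-- The number of zeros in a σ-compact set is a measurable function of the parameter. -/
lemma measurable_cnt_zeros {F : Ω → X → Y} (hF : Continuous (Function.uncurry F)) (y : Y)
    {S : Set X} (hS : IsSigmaCompact S) : Measurable fun ω => cnt {x ∈ S | F ω x = y} := by
  have hk : ∀ k : ℕ, MeasurableSet {ω | (k : ℕ∞) ≤ {x ∈ S | F ω x = y}.encard} := by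
    intro k
    simp_rw [natCast_le_encard_iff]
    have hctb : Countable (TopologicalSpace.countableBasis X) :=
      TopologicalSpace.countable_countableBasis X
    have : {ω | ∃ f : Fin k → TopologicalSpace.countableBasis X,
      (Pairwise fun i j => Disjoint (f i : Set X) (f j)) ∧
        ∀ i, ∃ x ∈ {x ∈ S | F ω x = y}, x ∈ (f i : Set X)} =
      ⋃ f : Fin k → TopologicalSpace.countableBasis X,
        ⋃ _ : Pairwise fun i j => Disjoint (f i : Set X) (f j), ⋂ i,
          {ω | ∃ x ∈ S ∩ (f i : Set X), F ω x = y} := by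
      ext ω
      simp only [Set.mem_ofPred_eq, Set.mem_iUnion, Set.mem_iInter, exists_prop, Set.mem_inter_iff]
      refine exists_congr fun f => and_congr Iff.rfl (forall_congr' fun i => exists_congr fun x => ?_)
      tauto
    rw [this]
    refine MeasurableSet.iUnion fun f => MeasurableSet.iUnion fun _ => MeasurableSet.iInter fun i => ?_
    exact measurableSet_exists_zero hF y
      (hS.inter_isOpen (TopologicalSpace.isOpen_of_mem_countableBasis (f i).2))
  refine measurable_of_Ioi fun a => ?_
  have : (fun ω => cnt {x ∈ S | F ω x = y}) ⁻¹' Set.Ioi a =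
      ⋃ k : ℕ, ⋃ _ : a < (k : ENNReal), {ω | (k : ℕ∞) ≤ {x ∈ S | F ω x = y}.encard} := by
    ext ω
    simp only [Set.mem_preimage, Set.mem_Ioi, Set.mem_iUnion, Set.mem_ofPred_eq, exists_prop, cnt]
    constructor
    · intro h
      cases hn : {x ∈ S | F ω x = y}.encard with
      | top =>
        rw [hn] at h
        obtain ⟨k, hk⟩ := ENNReal.exists_nat_gt h.ne
        exact ⟨k, hk, le_top⟩
      | coe n => rw [hn] at h; exact ⟨n, by simpa using h, le_rfl⟩
    · rintro ⟨k, h1, h2⟩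
      refine h1.trans_le ?_
      have : ((k : ℕ∞) : ENNReal) ≤ ({x ∈ S | F ω x = y}.encard : ENNReal) := by exact_mod_cast h2
      simpa using this
  rw [this]
  exact MeasurableSet.iUnion fun k => MeasurableSet.iUnion fun _ => hk k

end MeasCount
end

section

section Palm
variable {ι κ : Type*} [Fintype ι] [Fintype κ] [DecidableEq κ]

/-- Square submatrix of the rows `a` formed by the columns `e`. -/
def subB (a : κ → ι → ℝ) (e : κ → ι) : Matrix κ κ ℝ := Matrix.of fun k l => a k (e l)

omit [Fintype ι] [Fintype κ] [DecidableEq κ] in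
lemma continuous_extend (e : κ → ι) (he : Function.Injective e) :
    Continuous fun p : (ι → ℝ) × (κ → ℝ) => Function.extend e p.2 p.1 := by
  refine continuous_pi fun i => ?_
  by_cases h : ∃ k, e k = i
  · obtain ⟨k, rfl⟩ := h
    simp only [he.extend_apply]; fun_prop
  · simp only [Function.extend_apply' _ _ _ h]; fun_prop

omit [DecidableEq κ] in
lemma dot_extend (a : ι → ℝ) (e : κ → ι) (he : Function.Injective e) (u : κ → ℝ) (ω : ι → ℝ) :
    a ⬝ᵥ Function.extend e u ω = (fun l => a (e l)) ⬝ᵥ u + a ⬝ᵥ Function.extend e (0 : κ → ℝ) ω := by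
  have h1 : Function.extend e u ω
      = Function.extend e u (0 : ι → ℝ) + Function.extend e (0 : κ → ℝ) ω := by
    ext i
    by_cases h : ∃ k, e k = i
    · obtain ⟨k, rfl⟩ := h
      simp [he.extend_apply]
    · simp [Function.extend_apply' _ _ _ h]
  rw [h1, dotProduct_add]
  congr 1
  unfold dotProduct
  symm
  refine Fintype.sum_of_injective e he _ _ ?_ ?_
  · intro i hi
    rw [Function.extend_apply' _ _ _ (by simpa using hi)]; simp
  · intro k; simp [he.extend_apply]

lemma rows_extend (a : κ → ι → ℝ) (e : κ → ι) (he : Function.Injective e) (u : κ → ℝ) (ω : ι → ℝ) :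
    (fun k => a k ⬝ᵥ Function.extend e u ω)
      = (subB a e).mulVec u + fun k => a k ⬝ᵥ Function.extend e (0 : κ → ℝ) ω := by
  ext k
  rw [dot_extend _ e he]
  rfl

/-- The value of the resampled coordinates for which the rows take the value `v`. -/
def palmTheta (a : κ → ι → ℝ) (e : κ → ι) (v : κ → ℝ) (ω : ι → ℝ) : κ → ℝ :=
  (subB a e)⁻¹.mulVec (v - fun k => a k ⬝ᵥ Function.extend e (0 : κ → ℝ) ω)

lemma continuous_palmTheta (a : κ → ι → ℝ) (e : κ → ι) (he : Function.Injective e) :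
    Continuous fun p : (κ → ℝ) × (ι → ℝ) => palmTheta a e p.1 p.2 := by
  unfold palmTheta
  have h0 : Continuous fun p : (κ → ℝ) × (ι → ℝ) => Function.extend e (0 : κ → ℝ) p.2 :=
    (continuous_extend e he).comp (by fun_prop : Continuous fun p : (κ → ℝ) × (ι → ℝ) => (p.2, (0 : κ → ℝ)))
  refine Continuous.matrix_mulVec (by fun_prop) (continuous_fst.sub ?_)
  refine continuous_pi fun k => ?_
  exact Continuous.dotProduct continuous_const h0

lemma lintegral_mulVec_add (M : Matrix κ κ ℝ) (hM : M.det ≠ 0) (w : κ → ℝ)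
    {G : (κ → ℝ) → (κ → ℝ) → ENNReal} (hG : Measurable (Function.uncurry G)) :
    ∫⁻ u, G u (M.mulVec u + w) = ∫⁻ v, ENNReal.ofReal |M.det|⁻¹ * G (M⁻¹.mulVec (v - w)) v := by
  have hu : IsUnit M.det := isUnit_iff_ne_zero.2 hM
  have h1 : ∀ u, M⁻¹.mulVec (M.mulVec u) = u := fun u => by
    rw [Matrix.mulVec_mulVec, Matrix.nonsing_inv_mul _ hu, Matrix.one_mulVec]
  have hmM : Measurable (Matrix.toLin' M) :=
    (Matrix.toLin' M).continuous_of_finiteDimensional.measurable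
  have hmI : Measurable fun u : κ → ℝ => M⁻¹.mulVec u :=
    (Continuous.matrix_mulVec continuous_const continuous_id).measurable
  have h2 := Real.map_matrix_volume_pi_eq_smul_volume_pi hM
  have hm2 : Measurable fun v => G (M⁻¹.mulVec v) (v + w) :=
    hG.comp (by fun_prop : Measurable fun v => (M⁻¹.mulVec v, v + w))
  calc ∫⁻ u, G u (M.mulVec u + w)
      = ∫⁻ u, G (M⁻¹.mulVec (Matrix.toLin' M u)) (Matrix.toLin' M u + w) := by
        simp [Matrix.toLin'_apply, h1, -Matrix.mulVec_mulVec]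
    _ = ∫⁻ v, G (M⁻¹.mulVec v) (v + w) ∂(Measure.map (Matrix.toLin' M) volume) := by
        rw [lintegral_map hm2 hmM]
    _ = ENNReal.ofReal |M.det|⁻¹ * ∫⁻ v, G (M⁻¹.mulVec v) (v + w) := by
        rw [h2, lintegral_smul_measure, abs_inv]; rfl
    _ = ENNReal.ofReal |M.det|⁻¹ * ∫⁻ v, G (M⁻¹.mulVec (v - w)) v := by
        congr 1
        rw [← lintegral_sub_right_eq_self _ w]
        simp
    _ = _ := by
        rw [lintegral_const_mul]
        exact hG.comp (by fun_prop : Measurable fun v => (M⁻¹.mulVec (v - w), v))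

/-- Orthogonal residual plus a prescribed value of the rows. -/
def palmShift (a : κ → ι → ℝ) (v : κ → ℝ) (ω : ι → ℝ) : ι → ℝ :=
  fun i => ω i + ∑ k, (v k - a k ⬝ᵥ ω) * a k i

lemma continuous_palmShift (a : κ → ι → ℝ) :
    Continuous fun p : (κ → ℝ) × (ι → ℝ) => palmShift a p.1 p.2 := by
  unfold palmShift dotProduct; fun_prop

omit [DecidableEq κ] in
lemma dot_palmShift (a : κ → ι → ℝ) (v : κ → ℝ) (ω : ι → ℝ) (b : ι → ℝ) :
    b ⬝ᵥ palmShift a v ω = b ⬝ᵥ ω + ∑ k, (v k - a k ⬝ᵥ ω) * (b ⬝ᵥ a k) := by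
  have : palmShift a v ω = ω + ∑ k, (v k - a k ⬝ᵥ ω) • a k := by
    ext i; simp [palmShift]
  rw [this, dotProduct_add, dotProduct_sum]
  simp

lemma rows_palmShift {a : κ → ι → ℝ} (ha : ∀ k l, a k ⬝ᵥ a l = if k = l then 1 else 0)
    (v : κ → ℝ) (ω : ι → ℝ) (k : κ) : a k ⬝ᵥ palmShift a v ω = v k := by
  rw [dot_palmShift]; simp [ha]

lemma palmShift_measurePreserving {a : κ → ι → ℝ} (ha : ∀ k l, a k ⬝ᵥ a l = if k = l then 1 else 0) :
    MeasurePreserving (fun p : (ι → ℝ) × (κ → ℝ) => palmShift a p.2 p.1)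
      ((stdG ι).prod (stdG κ)) (stdG ι) := by
  classical
  have hrep : (fun p : (ι → ℝ) × (κ → ℝ) => palmShift a p.2 p.1)
      = fun p i => (Pi.single i 1 - ∑ k, a k i • a k : ι → ℝ) ⬝ᵥ p.1 + (fun k => a k i) ⬝ᵥ p.2 := by
    ext p i
    simp only [sub_dotProduct, sum_dotProduct, palmShift, single_one_dotProduct, smul_dotProduct,
      smul_eq_mul]
    have h1 : (fun k => a k i) ⬝ᵥ p.2 = ∑ k, p.2 k * a k i :=
      Finset.sum_congr rfl fun k _ => mul_comm _ _
    rw [h1]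
    simp only [sub_mul, Finset.sum_sub_distrib]
    have h2 : ∑ k, (a k ⬝ᵥ p.1) * a k i = ∑ k, a k i * (a k ⬝ᵥ p.1) :=
      Finset.sum_congr rfl fun k _ => mul_comm _ _
    rw [h2]; ring
  constructor
  · exact ((continuous_palmShift a).comp continuous_swap).measurable
  · rw [hrep]
    rw [stdG_map_prod_rows _ _ (fun i : ι => (Pi.single i 1 : ι → ℝ))]
    · conv_rhs => rw [← Measure.map_id (μ := stdG ι)]
      congr 1
      ext ω i
      simp
    · intro i j
      have h1 : ∀ j, (∑ k, a k i • a k) ⬝ᵥ (Pi.single j 1 : ι → ℝ) = ∑ k, a k i * a k j := by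
        intro j; rw [dotProduct_single_one]; simp
      have h2 : (∑ k, a k i • a k) ⬝ᵥ (∑ k, a k j • a k) = ∑ k, a k i * a k j := by
        rw [sum_dotProduct]
        refine Finset.sum_congr rfl fun k _ => ?_
        rw [dotProduct_sum]
        simp [ha, mul_comm]
      have h3 : (Pi.single i 1 : ι → ℝ) ⬝ᵥ (∑ k, a k j • a k) = ∑ k, a k i * a k j := by
        rw [single_one_dotProduct]; simp [mul_comm]
      have h4 : (fun k => a k i) ⬝ᵥ (fun k => a k j) = ∑ k, a k i * a k j := rfl
      rw [sub_dotProduct, dotProduct_sub, dotProduct_sub, h1, h2, h3, h4]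
      ring

variable (a : κ → ι → ℝ) (e : κ → ι) (he : Function.Injective e)

omit [DecidableEq κ] in
lemma measurable_rows : Measurable fun ω : ι → ℝ => fun k => a k ⬝ᵥ ω := by
  unfold dotProduct; fun_prop

/-- The left-hand side density in the Palm identity. -/
def palmW (v : κ → ℝ) (ω : ι → ℝ) : ENNReal :=
  ENNReal.ofReal (|(subB a e).det|⁻¹ * gpdf κ (palmTheta a e v ω))

include he in
lemma continuous_palmW : Continuous fun p : (κ → ℝ) × (ι → ℝ) => palmW a e p.1 p.2 :=
  ENNReal.continuous_ofReal.comp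
    (continuous_const.mul (continuous_gpdf.comp (continuous_palmTheta a e he)))

lemma palmW_le (v : κ → ℝ) (ω : ι → ℝ) :
    palmW a e v ω ≤ ENNReal.ofReal (|(subB a e).det|⁻¹ * (√(2 * π))⁻¹ ^ Fintype.card κ) :=
  ENNReal.ofReal_le_ofReal (mul_le_mul_of_nonneg_left (gpdf_le _) (by positivity))

include he in
lemma continuous_palmExtend : Continuous fun p : (κ → ℝ) × (ι → ℝ) =>
    Function.extend e (palmTheta a e p.1 p.2) p.2 :=
  (continuous_extend e he).comp (continuous_snd.prodMk (continuous_palmTheta a e he))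

include he in
lemma palm_test (hB : (subB a e).det ≠ 0) (ha : ∀ k l, a k ⬝ᵥ a l = if k = l then 1 else 0)
    {g : (κ → ℝ) → ENNReal} (hg : Measurable g) {H : (ι → ℝ) → ENNReal} (hH : Measurable H) :
    ∫⁻ v, g v * ∫⁻ ω, palmW a e v ω * H (Function.extend e (palmTheta a e v ω) ω) ∂(stdG ι)
      = ∫⁻ v, g v * (ENNReal.ofReal (gpdf κ v) * ∫⁻ ω, H (palmShift a v ω) ∂(stdG ι)) := by
  have hr := measurable_rows a
  have hme := (continuous_extend e he).measurable
  have hpt := (continuous_palmTheta a e he).measurable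
  have hmW := (continuous_palmW a e he).measurable
  have hpe := (continuous_palmExtend a e he).measurable
  have hps := (continuous_palmShift a).measurable
  have hgp : Measurable fun u => ENNReal.ofReal (gpdf κ u) := by fun_prop
  have hf : Measurable fun ω : ι → ℝ => g (fun k => a k ⬝ᵥ ω) * H ω := (hg.comp hr).mul hH
  have hA : ∫⁻ ω, g (fun k => a k ⬝ᵥ ω) * H ω ∂(stdG ι)
      = ∫⁻ v, g v * (ENNReal.ofReal (gpdf κ v) * ∫⁻ ω, H (palmShift a v ω) ∂(stdG ι)) := by
    rw [← (palmShift_measurePreserving ha).lintegral_comp hf]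
    simp only [rows_palmShift ha]
    have hm1 : Measurable fun p : (ι → ℝ) × (κ → ℝ) => g p.2 * H (palmShift a p.2 p.1) :=
      (hg.comp measurable_snd).mul (hH.comp (hps.comp measurable_swap))
    rw [lintegral_prod_symm' _ hm1, stdG_eq_withDensity (κ := κ),
      lintegral_withDensity_eq_lintegral_mul _ hgp]
    · refine lintegral_congr fun v => ?_
      simp only [Pi.mul_apply]
      rw [lintegral_const_mul]
      · ring
      · exact hH.comp (hps.comp (by fun_prop : Measurable fun ω : ι → ℝ => (v, ω)))
    · exact Measurable.lintegral_prod_left' hm1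
  have hBB : ∫⁻ ω, g (fun k => a k ⬝ᵥ ω) * H ω ∂(stdG ι)
      = ∫⁻ v, g v * ∫⁻ ω, palmW a e v ω * H (Function.extend e (palmTheta a e v ω) ω) ∂(stdG ι) := by
    rw [← (stdG_upd_measurePreserving e he).lintegral_comp hf]
    rw [lintegral_prod _ (show Measurable fun p : (ι → ℝ) × (κ → ℝ) =>
      g (fun k => a k ⬝ᵥ Function.extend e p.2 p.1) * H (Function.extend e p.2 p.1) from
        hf.comp hme).aemeasurable]
    have : ∀ ω : ι → ℝ, ∫⁻ u, g (fun k => a k ⬝ᵥ Function.extend e u ω) * H (Function.extend e u ω)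
          ∂(stdG κ)
        = ∫⁻ v, g v * (palmW a e v ω * H (Function.extend e (palmTheta a e v ω) ω)) := by
      intro ω
      have hmω : Measurable fun u : κ → ℝ => Function.extend e u ω :=
        hme.comp (by fun_prop : Measurable fun u : κ → ℝ => (ω, u))
      rw [stdG_eq_withDensity, lintegral_withDensity_eq_lintegral_mul _ hgp
        (show Measurable fun u : κ → ℝ => g (fun k => a k ⬝ᵥ Function.extend e u ω) *
          H (Function.extend e u ω) from hf.comp hmω)]
      refine Eq.trans (lintegral_congr fun u => ?_) (Eq.trans
        (lintegral_mulVec_add (subB a e) hB (fun k => a k ⬝ᵥ Function.extend e (0 : κ → ℝ) ω)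
          (G := fun u v => ENNReal.ofReal (gpdf κ u) * (g v * H (Function.extend e u ω))) ?_) ?_)
      · rw [Pi.mul_apply, rows_extend a e he u ω]
      rotate_left
      · refine lintegral_congr fun v => ?_
        rw [palmW, ENNReal.ofReal_mul (by positivity), palmTheta]
        ring
      · exact (hgp.comp measurable_fst).mul ((hg.comp measurable_snd).mul
          (hH.comp (hmω.comp measurable_fst)))
    simp only [this]
    rw [lintegral_lintegral_swap]
    · refine lintegral_congr fun v => ?_
      rw [lintegral_const_mul]
      exact (hmW.comp (by fun_prop : Measurable fun ω : ι → ℝ => (v, ω))).mul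
        (hH.comp (hpe.comp (by fun_prop : Measurable fun ω : ι → ℝ => (v, ω))))
    · exact ((hg.comp measurable_snd).mul ((hmW.comp measurable_swap).mul
        (hH.comp (hpe.comp measurable_swap)))).aemeasurable
  rw [← hA, ← hBB]

include he in
lemma palm_orthonormal (hB : (subB a e).det ≠ 0)
    (ha : ∀ k l, a k ⬝ᵥ a l = if k = l then 1 else 0)
    {H : (ι → ℝ) → ENNReal} (hH : Measurable H) (v : κ → ℝ) :
    ∫⁻ ω, palmW a e v ω * H (Function.extend e (palmTheta a e v ω) ω) ∂(stdG ι)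
      = ENNReal.ofReal (gpdf κ v) * ∫⁻ ω, H (palmShift a v ω) ∂(stdG ι) := by
  have hcW := continuous_palmW a e he
  have hce := continuous_palmExtend a e he
  have hcs := continuous_palmShift a
  have hW : ∀ v, Measurable (palmW a e v) := fun v =>
    (hcW.comp (by fun_prop : Continuous fun ω : ι → ℝ => (v, ω))).measurable
  have hE : ∀ v, Measurable fun ω => Function.extend e (palmTheta a e v ω) ω := fun v =>
    (hce.comp (by fun_prop : Continuous fun ω : ι → ℝ => (v, ω))).measurable
  have hSh : ∀ v, Measurable (palmShift a v) := fun v =>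
    (hcs.comp (by fun_prop : Continuous fun ω : ι → ℝ => (v, ω))).measurable
  -- bounded continuous test functions
  have hbc : ∀ f : BoundedContinuousFunction (ι → ℝ) NNReal,
      ∫⁻ ω, palmW a e v ω * f (Function.extend e (palmTheta a e v ω) ω) ∂(stdG ι)
      = ENNReal.ofReal (gpdf κ v) * ∫⁻ ω, f (palmShift a v ω) ∂(stdG ι) := by
    intro f
    obtain ⟨C, hC⟩ : ∃ C : NNReal, ∀ ω, f ω ≤ C := by
      exact ⟨_, BoundedContinuousFunction.NNReal.upper_bound f⟩
    have hfm : Measurable fun ω => (f ω : ENNReal) :=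
      (ENNReal.continuous_coe.comp f.continuous).measurable
    have hc1 : Continuous fun v =>
        ∫⁻ ω, palmW a e v ω * f (Function.extend e (palmTheta a e v ω) ω) ∂(stdG ι) := by
      rw [continuous_iff_continuousAt]
      intro v0
      refine tendsto_lintegral_filter_of_dominated_convergence
        (fun _ => ENNReal.ofReal (|(subB a e).det|⁻¹ * (√(2 * π))⁻¹ ^ Fintype.card κ) * C)
        (Eventually.of_forall fun v => (hW v).mul (hfm.comp (hE v)))
        (Eventually.of_forall fun v => ae_of_all _ fun ω =>
          mul_le_mul' (palmW_le a e v ω) (ENNReal.coe_le_coe.2 (hC _))) ?_ (ae_of_all _ fun ω => ?_)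
      · rw [lintegral_const]
        exact (ENNReal.mul_lt_top (ENNReal.mul_lt_top ENNReal.ofReal_lt_top ENNReal.coe_lt_top)
          (measure_lt_top _ _)).ne
      · have h1 : Tendsto (fun v => palmW a e v ω) (nhds v0) (nhds (palmW a e v0 ω)) :=
          (hcW.comp (by fun_prop : Continuous fun v : κ → ℝ => (v, ω))).tendsto v0
        have h2 : Tendsto (fun v => (f (Function.extend e (palmTheta a e v ω) ω) : ENNReal))
            (nhds v0) (nhds (f (Function.extend e (palmTheta a e v0 ω) ω))) :=
          ((ENNReal.continuous_coe.comp f.continuous).comp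
            (hce.comp (by fun_prop : Continuous fun v : κ → ℝ => (v, ω)))).tendsto v0
        exact ENNReal.Tendsto.mul h1 (Or.inr ENNReal.coe_ne_top) h2 (Or.inr ENNReal.ofReal_ne_top)
    have hc2 : Continuous fun v =>
        ENNReal.ofReal (gpdf κ v) * ∫⁻ ω, f (palmShift a v ω) ∂(stdG ι) := by
      have hfin : ∀ v, ∫⁻ ω, f (palmShift a v ω) ∂(stdG ι) ≠ ⊤ := fun v => by
        refine ne_top_of_le_ne_top (b := ∫⁻ ω, C ∂(stdG ι)) (by simp) (lintegral_mono fun ω => ?_)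
        exact ENNReal.coe_le_coe.2 (hC _)
      have h3 : Continuous fun v => ∫⁻ ω, (f (palmShift a v ω) : ENNReal) ∂(stdG ι) := by
        rw [continuous_iff_continuousAt]
        intro v0
        refine tendsto_lintegral_filter_of_dominated_convergence (fun _ => C)
          (Eventually.of_forall fun v => (hfm.comp (hSh v)))
          (Eventually.of_forall fun v => ae_of_all _ fun ω => ENNReal.coe_le_coe.2 (hC _)) (by simp)
          (ae_of_all _ fun ω => ?_)
        exact ((ENNReal.continuous_coe.comp f.continuous).comp
            (hcs.comp (by fun_prop : Continuous fun v : κ → ℝ => (v, ω)))).tendsto v0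
      rw [continuous_iff_continuousAt]
      intro v0
      exact ENNReal.Tendsto.mul
        ((ENNReal.continuous_ofReal.comp continuous_gpdf).tendsto v0) (Or.inr (hfin v0))
        (h3.tendsto v0) (Or.inr ENNReal.ofReal_ne_top)
    have hae : (fun v =>
        ∫⁻ ω, palmW a e v ω * f (Function.extend e (palmTheta a e v ω) ω) ∂(stdG ι)) =ᵐ[volume]
        fun v => ENNReal.ofReal (gpdf κ v) * ∫⁻ ω, f (palmShift a v ω) ∂(stdG ι) := by
      refine ae_eq_of_forall_setLIntegral_eq_of_sigmaFinite hc1.measurable hc2.measurable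
        fun s hs _ => ?_
      have := palm_test a e he hB ha (measurable_one.indicator hs) hfm
      rw [← lintegral_indicator hs, ← lintegral_indicator hs]
      convert this using 2
      · ext v; by_cases hv : v ∈ s <;> simp [hv]
      · ext v; by_cases hv : v ∈ s <;> simp [hv]
    exact congrFun ((hc1.ae_eq_iff_eq volume hc2).1 hae) v
  let ν1 := ((stdG ι).withDensity (palmW a e v)).map fun ω => Function.extend e (palmTheta a e v ω) ω
  let ν2 := ENNReal.ofReal (gpdf κ v) • (stdG ι).map (palmShift a v)
  have hν1 : ∀ H : (ι → ℝ) → ENNReal, Measurable H → ∫⁻ ω, H ω ∂ν1 =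
      ∫⁻ ω, palmW a e v ω * H (Function.extend e (palmTheta a e v ω) ω) ∂(stdG ι) := by
    intro H hH
    rw [lintegral_map hH (hE v), lintegral_withDensity_eq_lintegral_mul _ (hW v)
      (show Measurable fun ω => H (Function.extend e (palmTheta a e v ω) ω) from hH.comp (hE v))]
    rfl
  have hν2 : ∀ H : (ι → ℝ) → ENNReal, Measurable H → ∫⁻ ω, H ω ∂ν2 =
      ENNReal.ofReal (gpdf κ v) * ∫⁻ ω, H (palmShift a v ω) ∂(stdG ι) := by
    intro H hH
    rw [lintegral_smul_measure, lintegral_map hH (hSh v)]; rfl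
  have : IsFiniteMeasure ν1 := by
    constructor
    rw [Measure.map_apply (hE v) MeasurableSet.univ, Set.preimage_univ, withDensity_apply _ .univ]
    refine lt_of_le_of_lt (lintegral_mono fun ω => palmW_le a e v ω) ?_
    rw [lintegral_const]
    exact ENNReal.mul_lt_top ENNReal.ofReal_lt_top (measure_lt_top _ _)
  have heq : ν1 = ν2 := by
    refine ext_of_forall_lintegral_eq_of_IsFiniteMeasure fun f => ?_
    have hfm : Measurable fun ω => (f ω : ENNReal) :=
      (ENNReal.continuous_coe.comp f.continuous).measurable
    rw [hν1 _ hfm, hν2 _ hfm, hbc]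
  rw [← hν1 H hH, ← hν2 H hH, heq]

include he in
/-- Conditioning identity: resampling the coordinates `e` so that the rows `a` take the value `v`
is, up to the density factor, the same as shifting along the orthonormalised rows `R a`. -/
lemma palm_general (hB : (subB a e).det ≠ 0) (R : Matrix κ κ ℝ) (hR : R.det ≠ 0)
    (ha : ∀ k l, (∑ i, R k i • a i) ⬝ᵥ (∑ i, R l i • a i) = if k = l then 1 else 0)
    {H : (ι → ℝ) → ENNReal} (hH : Measurable H) (v : κ → ℝ) :
    ∫⁻ ω, palmW a e v ω * H (Function.extend e (palmTheta a e v ω) ω) ∂(stdG ι)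
      = ENNReal.ofReal (|R.det| * gpdf κ (R.mulVec v)) *
        ∫⁻ ω, H (palmShift (fun k => ∑ i, R k i • a i) (R.mulVec v) ω) ∂(stdG ι) := by
  set a' : κ → ι → ℝ := fun k => ∑ i, R k i • a i
  have hsub : subB a' e = R * subB a e := by
    ext k l; simp [subB, a', Matrix.mul_apply]
  have hdet : (subB a' e).det = R.det * (subB a e).det := by rw [hsub, Matrix.det_mul]
  have hrow : ∀ ω, (fun k => a' k ⬝ᵥ ω) = R.mulVec fun k => a k ⬝ᵥ ω := by
    intro ω; ext k
    simp only [a', sum_dotProduct, smul_dotProduct, smul_eq_mul]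
    rfl
  have hth : ∀ ω, palmTheta a' e (R.mulVec v) ω = palmTheta a e v ω := by
    intro ω
    unfold palmTheta
    rw [hrow, ← Matrix.mulVec_sub, hsub, Matrix.mul_inv_rev, Matrix.mulVec_mulVec, Matrix.mul_assoc,
      Matrix.nonsing_inv_mul _ (isUnit_iff_ne_zero.2 hR), Matrix.mul_one]
  have hW : ∀ ω, palmW a e v ω = ENNReal.ofReal |R.det| * palmW a' e (R.mulVec v) ω := by
    intro ω
    rw [palmW, palmW, hth, hdet, ← ENNReal.ofReal_mul (abs_nonneg _)]
    congr 1
    rw [abs_mul, mul_inv, ← mul_assoc, ← mul_assoc, mul_inv_cancel₀ (abs_ne_zero.2 hR), one_mul]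
  have := palm_orthonormal a' e he (hdet ▸ mul_ne_zero hR hB) ha hH (R.mulVec v)
  simp only [hth] at this
  rw [ENNReal.ofReal_mul (abs_nonneg _), mul_assoc, ← this,
    ← lintegral_const_mul' _ _ ENNReal.ofReal_ne_top]
  simp only [hW, mul_assoc]

end Palm
end

section

lemma hasFDerivAt_clm_apply_of_eq_zero {X Y Z : Type*} [NormedAddCommGroup X] [NormedSpace ℝ X]
    [NormedAddCommGroup Y] [NormedSpace ℝ Y] [NormedAddCommGroup Z] [NormedSpace ℝ Z]
    {A : X → Y →L[ℝ] Z} {g : X → Y} {g' : X →L[ℝ] Y} {x : X} (hA : ContinuousAt A x)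
    (hg : HasFDerivAt g g' x) (h0 : g x = 0) :
    HasFDerivAt (fun y => A y (g y)) ((A x).comp g') x := by
  have h1 : HasFDerivAt (fun y => A x (g y)) ((A x).comp g') x := (A x).hasFDerivAt.comp x hg
  have h2 : HasFDerivAt (fun y => (A y - A x) (g y)) (0 : X →L[ℝ] Z) x := by
    rw [hasFDerivAt_iff_isLittleO]
    simp only [h0, map_zero, sub_zero, zero_apply]
    have hb : (fun y => g y) =O[nhds x] fun y => y - x := by
      have := hg.isBigO_sub
      simpa [h0] using this
    have ho : (fun y => A y - A x) =o[nhds x] fun _ => (1 : ℝ) := by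
      rw [Asymptotics.isLittleO_one_iff]
      have := hA.tendsto.sub_const (A x)
      simpa using this
    have h3 : (fun y => (A y - A x) (g y)) =O[nhds x] fun y => ‖A y - A x‖ * ‖g y‖ :=
      Asymptotics.isBigO_of_le _ fun y => by
        simpa using (A y - A x).le_opNorm (g y)
    refine h3.trans_isLittleO ?_
    simpa using (ho.norm_left.mul_isBigO hb.norm_norm).norm_right
  have := h1.add h2
  refine (this.congr_fderiv (by simp)).congr_of_eventuallyEq (Eventually.of_forall fun y => ?_)
  simp

section RicePalm
variable {ι κ : Type*} [Fintype ι] [Fintype κ] [DecidableEq κ]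

lemma palmTheta_eq_iff (a : κ → ι → ℝ) (e : κ → ι) (he : Function.Injective e)
    (hB : (subB a e).det ≠ 0) (v : κ → ℝ) (ω : ι → ℝ) (u : κ → ℝ) :
    palmTheta a e v ω = u ↔ (fun k => a k ⬝ᵥ Function.extend e u ω) = v := by
  have hu : IsUnit (subB a e).det := isUnit_iff_ne_zero.2 hB
  rw [rows_extend a e he, palmTheta]
  constructor
  · rintro rfl
    rw [Matrix.mulVec_mulVec, Matrix.mul_nonsing_inv _ hu, Matrix.one_mulVec, sub_add_cancel]
  · rintro rfl
    rw [add_sub_cancel_right, Matrix.mulVec_mulVec, Matrix.nonsing_inv_mul _ hu, Matrix.one_mulVec]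

variable {a : (κ → ℝ) → κ → ι → ℝ} {c : (κ → ℝ) → κ → ℝ}
  {D : (κ → ℝ) → (ι → ℝ) → ((κ → ℝ) →L[ℝ] (κ → ℝ))} {e : κ → ι}

lemma measurable_palmTheta_uncurry (he : Function.Injective e)
    (ha : Continuous a) (hc : Continuous c) :
    Measurable fun p : (κ → ℝ) × (ι → ℝ) => palmTheta (a p.1) e (- c p.1) p.2 := by
  have hB : Continuous fun p : (κ → ℝ) × (ι → ℝ) => subB (a p.1) e := by
    unfold subB
    refine continuous_matrix fun k l => ?_
    simp only [Matrix.of_apply]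
    fun_prop
  have h0 : Continuous fun p : (κ → ℝ) × (ι → ℝ) => Function.extend e (0 : κ → ℝ) p.2 :=
    (continuous_extend e he).comp
      (by fun_prop : Continuous fun p : (κ → ℝ) × (ι → ℝ) => (p.2, (0 : κ → ℝ)))
  have hw : Continuous fun p : (κ → ℝ) × (ι → ℝ) =>
      (- c p.1 - fun k => a p.1 k ⬝ᵥ Function.extend e (0 : κ → ℝ) p.2) := by
    refine (hc.comp continuous_fst).neg.sub (continuous_pi fun k => ?_)
    exact Continuous.dotProduct (by fun_prop) h0
  have hadj : Continuous fun p : (κ → ℝ) × (ι → ℝ) => (subB (a p.1) e).adjugate.mulVec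
      (- c p.1 - fun k => a p.1 k ⬝ᵥ Function.extend e (0 : κ → ℝ) p.2) :=
    Continuous.matrix_mulVec hB.matrix_adjugate hw
  have : (fun p : (κ → ℝ) × (ι → ℝ) => palmTheta (a p.1) e (- c p.1) p.2) = fun p =>
      (subB (a p.1) e).det⁻¹ • (subB (a p.1) e).adjugate.mulVec
      (- c p.1 - fun k => a p.1 k ⬝ᵥ Function.extend e (0 : κ → ℝ) p.2) := by
    ext1 p
    rw [palmTheta, Matrix.inv_def, Ring.inverse_eq_inv', Matrix.smul_mulVec]
  rw [this]
  exact hB.matrix_det.measurable.inv.smul hadj.measurable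

lemma continuousOn_inv_subB (ha : Continuous a) :
    ContinuousOn (fun x => (subB (a x) e)⁻¹) {x | (subB (a x) e).det ≠ 0} := by
  have hB : Continuous fun x => subB (a x) e := by
    unfold subB
    refine continuous_matrix fun k l => ?_
    simp only [Matrix.of_apply]
    fun_prop
  have : (fun x => (subB (a x) e)⁻¹) = fun x =>
      (subB (a x) e).det⁻¹ • (subB (a x) e).adjugate := by
    ext1 x; rw [Matrix.inv_def, Ring.inverse_eq_inv']
  rw [this]
  exact (hB.matrix_det.continuousOn.inv₀ fun x hx => hx).smul hB.matrix_adjugate.continuousOn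

lemma continuousOn_palmTheta (ha : Continuous a) (hc : Continuous c)
    (ω : ι → ℝ) :
    ContinuousOn (fun x => palmTheta (a x) e (- c x) ω) {x | (subB (a x) e).det ≠ 0} := by
  unfold palmTheta
  have h1 := continuousOn_inv_subB (e := e) ha
  have hw : Continuous fun x =>
      (- c x - fun k => a x k ⬝ᵥ Function.extend e (0 : κ → ℝ) ω) := by
    refine hc.neg.sub (continuous_pi fun k => ?_)
    exact Continuous.dotProduct (by fun_prop) continuous_const
  exact (Continuous.matrix_mulVec continuous_fst continuous_snd : Continuous
    fun p : Matrix κ κ ℝ × (κ → ℝ) => p.1.mulVec p.2).comp_continuousOn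
      (h1.prodMk hw.continuousOn)

/-- Continuous linear map of a square matrix. -/
def matCLM (M : Matrix κ κ ℝ) : (κ → ℝ) →L[ℝ] (κ → ℝ) := LinearMap.toContinuousLinearMap M.toLin'

@[simp] lemma matCLM_apply (M : Matrix κ κ ℝ) (v : κ → ℝ) : matCLM M v = M.mulVec v := rfl

lemma continuous_matCLM : Continuous (matCLM : Matrix κ κ ℝ → _) := by
  have : (matCLM : Matrix κ κ ℝ → _) = fun M => (LinearMap.toContinuousLinearMap (𝕜 := ℝ)
    (E := κ → ℝ) (F' := κ → ℝ)).toLinearMap.comp (Matrix.toLin' (R := ℝ) (m := κ) (n := κ)).toLinearMap M := rfl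
  rw [this]
  exact LinearMap.continuous_of_finiteDimensional _

lemma det_matCLM (M : Matrix κ κ ℝ) : (matCLM M).det = M.det := by
  rw [matCLM, ContinuousLinearMap.det, LinearMap.coe_toContinuousLinearMap, LinearMap.det_toLin']

lemma hasFDerivAt_palmTheta (he : Function.Injective e) (ha : Continuous a)
    (hD : ∀ x ω, HasFDerivAt (fun x k => a x k ⬝ᵥ ω + c x k) (D x ω) x) (ω : ι → ℝ)
    {x : κ → ℝ} (hx : (subB (a x) e).det ≠ 0) :
    HasFDerivAt (fun x => palmTheta (a x) e (- c x) ω)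
      (-((matCLM (subB (a x) e)⁻¹).comp
        (D x (Function.extend e (palmTheta (a x) e (- c x) ω) ω)))) x := by
  set u := palmTheta (a x) e (- c x) ω with hu
  have hU : IsOpen {x | (subB (a x) e).det ≠ 0} := by
    have hB : Continuous fun x => subB (a x) e := by
      unfold subB
      refine continuous_matrix fun k l => ?_
      simp only [Matrix.of_apply]
      fun_prop
    exact isOpen_ne_fun hB.matrix_det continuous_const
  have hz : (fun k => a x k ⬝ᵥ Function.extend e u ω + c x k) = 0 := by
    have := (palmTheta_eq_iff (a x) e he hx (-c x) ω u).1 rfl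
    ext k
    have := congrFun this k
    simp only [Pi.neg_apply] at this
    simp [this]
  have hcA : ContinuousAt (fun x => matCLM (subB (a x) e)⁻¹) x :=
    continuous_matCLM.continuousAt.comp
      ((continuousOn_inv_subB ha).continuousAt (hU.mem_nhds hx))
  have h1 := (hasFDerivAt_clm_apply_of_eq_zero hcA (hD x (Function.extend e u ω)) hz).const_sub u
  refine h1.congr_of_eventuallyEq ?_
  filter_upwards [hU.mem_nhds hx] with y hy
  have hB : IsUnit (subB (a y) e).det := isUnit_iff_ne_zero.2 hy
  have h2 : (fun k => a y k ⬝ᵥ Function.extend e u ω + c y k) = (subB (a y) e).mulVec u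
      - (- c y - fun k => a y k ⬝ᵥ Function.extend e (0 : κ → ℝ) ω) := by
    have := rows_extend (a y) e he u ω
    ext k
    have := congrFun this k
    simp only [Pi.sub_apply, Pi.add_apply, Pi.neg_apply] at this ⊢
    rw [this]; ring
  rw [h2, matCLM_apply, Matrix.mulVec_sub, Matrix.mulVec_mulVec, Matrix.nonsing_inv_mul _ hB,
    Matrix.one_mulVec, sub_sub_cancel]
  rfl

/-- Kac–Rice formula for a Gaussian field depending affinely on a standard Gaussian vector. -/
theorem rice_palm (he : Function.Injective e) (ha : Continuous a) (hc : Continuous c)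
    (hD : ∀ x ω, HasFDerivAt (fun x k => a x k ⬝ᵥ ω + c x k) (D x ω) x)
    (hDc : Continuous (Function.uncurry D)) {S : Set (κ → ℝ)} (hS : IsSigmaCompact S)
    (hB : ∀ x ∈ S, (subB (a x) e).det ≠ 0) (R : (κ → ℝ) → Matrix κ κ ℝ)
    (hR : ∀ x ∈ S, (R x).det ≠ 0)
    (hort : ∀ x ∈ S, ∀ k l, (∑ i, R x k i • a x i) ⬝ᵥ (∑ i, R x l i • a x i)
      = if k = l then 1 else 0) :
    ∫⁻ ω, cnt {x ∈ S | (fun k => a x k ⬝ᵥ ω + c x k) = 0} ∂(stdG ι)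
      = ∫⁻ x in S, ENNReal.ofReal (|(R x).det| * gpdf κ ((R x).mulVec (- c x))) *
        ∫⁻ ω, ENNReal.ofReal
          |(D x (palmShift (fun k => ∑ i, R x k i • a x i) ((R x).mulVec (- c x)) ω)).det|
          ∂(stdG ι) := by
  have hSm : MeasurableSet S := by
    obtain ⟨K, hK, rfl⟩ := hS
    exact MeasurableSet.iUnion fun n => (hK n).measurableSet
  have hF : Continuous (Function.uncurry fun (ω : ι → ℝ) (x : κ → ℝ) =>
      (fun k => a x k ⬝ᵥ ω + c x k)) := by
    refine continuous_pi fun k => ?_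
    simp only [Function.uncurry]
    exact (Continuous.dotProduct (by fun_prop) (by fun_prop)).add (by fun_prop)
  have hcm := measurable_cnt_zeros hF 0 hS
  have hBc : Continuous fun x => subB (a x) e := by
    unfold subB
    refine continuous_matrix fun k l => ?_
    simp only [Matrix.of_apply]
    fun_prop
  have hU : IsOpen {x | (subB (a x) e).det ≠ 0} := isOpen_ne_fun hBc.matrix_det continuous_const
  have hme := (continuous_extend (ι := ι) e he).measurable
  have hgp : Measurable fun u => ENNReal.ofReal (gpdf κ u) := by fun_prop
  have hdet : Continuous fun L : (κ → ℝ) →L[ℝ] (κ → ℝ) => L.det :=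
    ContinuousLinearMap.continuous_det
  rw [← (stdG_upd_measurePreserving e he).lintegral_comp hcm,
    lintegral_prod _ (show Measurable fun p : (ι → ℝ) × (κ → ℝ) =>
      cnt {x ∈ S | (fun k => a x k ⬝ᵥ Function.extend e p.2 p.1 + c x k) = 0} from
        hcm.comp hme).aemeasurable]
  have hinner : ∀ ω : ι → ℝ,
      ∫⁻ u, cnt {x ∈ S | (fun k => a x k ⬝ᵥ Function.extend e u ω + c x k) = 0} ∂(stdG κ)
      = ∫⁻ x in S, palmW (a x) e (- c x) ω * ENNReal.ofReal
          |(D x (Function.extend e (palmTheta (a x) e (- c x) ω) ω)).det| := by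
    intro ω
    have hmω : Measurable fun u : κ → ℝ => Function.extend e u ω :=
      hme.comp (by fun_prop : Measurable fun u : κ → ℝ => (ω, u))
    rw [stdG_eq_withDensity, lintegral_withDensity_eq_lintegral_mul _ hgp
      (show Measurable fun u : κ → ℝ =>
        cnt {x ∈ S | (fun k => a x k ⬝ᵥ Function.extend e u ω + c x k) = 0} from hcm.comp hmω)]
    have hset : ∀ u : κ → ℝ, {x ∈ S | (fun k => a x k ⬝ᵥ Function.extend e u ω + c x k) = 0}
        = {x ∈ S | palmTheta (a x) e (- c x) ω = u} := by
      intro u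
      ext x
      simp only [Set.mem_ofPred_eq]
      refine and_congr_right fun hx => ?_
      rw [palmTheta_eq_iff (a x) e he (hB x hx)]
      constructor
      · intro h; ext k
        have := congrFun h k
        simp only [Pi.zero_apply, Pi.neg_apply] at this ⊢
        linarith
      · intro h; ext k
        have := congrFun h k
        simp only [Pi.zero_apply, Pi.neg_apply] at this ⊢
        linarith
    simp only [Pi.mul_apply, hset]
    have hθc := continuousOn_palmTheta (e := e) ha hc ω
    have harea := lintegral_abs_det_mul_eq_lintegral_cnt volume hSm hU hB
      (g := fun x => palmTheta (a x) e (- c x) ω)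
      (g' := fun x => -((matCLM (subB (a x) e)⁻¹).comp
        (D x (Function.extend e (palmTheta (a x) e (- c x) ω) ω))))
      (fun x hx => hasFDerivAt_palmTheta he ha hD ω hx) ?_ hgp
    · simp only [mul_comm (ENNReal.ofReal (gpdf κ _))]
      rw [← harea]
      refine setLIntegral_congr_fun hSm fun x hx => ?_
      have hdd : ∀ L : (κ → ℝ) →L[ℝ] (κ → ℝ), |(-((matCLM (subB (a x) e)⁻¹).comp L)).det|
          = |(subB (a x) e).det|⁻¹ * |L.det| := by
        intro L
        have h1 : (-((matCLM (subB (a x) e)⁻¹).comp L))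
            = (-1 : ℝ) • ((matCLM (subB (a x) e)⁻¹) * L) := by
          ext v; simp
        rw [h1, ContinuousLinearMap.det, ContinuousLinearMap.toLinearMap_smul, LinearMap.det_smul]
        have h2 : LinearMap.det (((matCLM (subB (a x) e)⁻¹ * L : (κ → ℝ) →L[ℝ] (κ → ℝ))) :
            (κ → ℝ) →ₗ[ℝ] (κ → ℝ)) = (matCLM (subB (a x) e)⁻¹).det * L.det := by
          rw [ContinuousLinearMap.det, ContinuousLinearMap.det, ← map_mul]; rfl
        rw [h2, det_matCLM, Matrix.det_nonsing_inv, Ring.inverse_eq_inv', abs_mul, abs_mul,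
          abs_pow, abs_neg, abs_one, one_pow, one_mul, abs_inv]
      simp only [hdd]
      rw [palmW, ← ENNReal.ofReal_mul (by positivity), ← ENNReal.ofReal_mul
        (mul_nonneg (by positivity) (gpdf_pos _).le)]
      congr 1; ring
    · refine ContinuousOn.neg ?_
      have hA : ContinuousOn (fun x => matCLM (subB (a x) e)⁻¹) {x | (subB (a x) e).det ≠ 0} :=
        continuous_matCLM.comp_continuousOn (continuousOn_inv_subB ha)
      refine hA.clm_comp ?_
      have hx : ContinuousOn (fun x => Function.extend e (palmTheta (a x) e (- c x) ω) ω)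
          {x | (subB (a x) e).det ≠ 0} :=
        (continuous_extend e he).comp_continuousOn (continuousOn_const.prodMk hθc)
      exact hDc.comp_continuousOn (continuousOn_id.prodMk hx)
  simp only [hinner]
  have hmθ := measurable_palmTheta_uncurry he ha hc
  have hmB : Measurable fun p : (κ → ℝ) × (ι → ℝ) => (subB (a p.1) e).det :=
    (hBc.matrix_det.comp continuous_fst).measurable
  have hmE : Measurable fun p : (κ → ℝ) × (ι → ℝ) =>
      Function.extend e (palmTheta (a p.1) e (- c p.1) p.2) p.2 :=
    hme.comp (measurable_snd.prodMk hmθ)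
  have hmD : Measurable fun p : (κ → ℝ) × (ι → ℝ) =>
      ENNReal.ofReal |(Function.uncurry D p).det| :=
    ENNReal.measurable_ofReal.comp (hdet.comp hDc).abs.measurable
  rw [lintegral_lintegral_swap]
  · refine setLIntegral_congr_fun hSm fun x hx => ?_
    refine palm_general (a x) e he (hB x hx) (R x) (hR x hx) (hort x hx)
      (H := fun ω => ENNReal.ofReal |(D x ω).det|) ?_ (- c x)
    exact hmD.comp (by fun_prop : Measurable fun ω : ι → ℝ => (x, ω))
  · have hm : Measurable fun p : (κ → ℝ) × (ι → ℝ) => palmW (a p.1) e (- c p.1) p.2 *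
        ENNReal.ofReal
          |(D p.1 (Function.extend e (palmTheta (a p.1) e (- c p.1) p.2) p.2)).det| := by
      refine Measurable.mul ?_ (hmD.comp (measurable_fst.prodMk hmE))
      unfold palmW
      exact ENNReal.measurable_ofReal.comp ((hmB.abs.inv).mul (measurable_gpdf.comp hmθ))
    exact (hm.comp measurable_swap).aemeasurable

end RicePalm
end

section

section RicePalm
variable {ι κ : Type*} [Fintype ι] [Fintype κ] [DecidableEq κ]

lemma exists_subB_det_ne_zero (a : κ → ι → ℝ) (R : Matrix κ κ ℝ)
    (h : ∀ k l, (∑ i, R k i • a i) ⬝ᵥ (∑ i, R l i • a i) = if k = l then 1 else 0) :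
    ∃ e : κ ↪ ι, (subB a e).det ≠ 0 := by
  classical
  let M : Matrix κ ι ℝ := Matrix.of a
  have h1 : (R * M) * (R * M).transpose = 1 := by
    ext k l
    have := h k l
    rw [Matrix.one_apply, ← this, Matrix.mul_apply]
    simp [dotProduct, Matrix.mul_apply, M]
  have hR : R * (M * (R * M).transpose) = 1 := by rw [← Matrix.mul_assoc, h1]
  have h2 : M * ((R * M).transpose * R) = 1 := by
    rw [← Matrix.mul_assoc]; exact mul_eq_one_comm.1 hR
  have hspan : Submodule.span ℝ (Set.range M.col) = ⊤ := by
    rw [← Matrix.range_mulVecLin, LinearMap.range_eq_top]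
    intro v
    refine ⟨((R * M).transpose * R).mulVec v, ?_⟩
    rw [Matrix.mulVecLin_apply, Matrix.mulVec_mulVec, h2, Matrix.one_mulVec]
  obtain ⟨κ', f, hf, hsp, hli⟩ := exists_linearIndependent' ℝ M.col
  rw [hspan] at hsp
  let b : Module.Basis κ' ℝ (κ → ℝ) := Module.Basis.mk hli hsp.ge
  have : Fintype κ' := FiniteDimensional.fintypeBasisIndex b
  have hcard : Fintype.card κ = Fintype.card κ' := by
    rw [← Module.finrank_eq_card_basis b, Module.finrank_fintype_fun_eq_card]
  let σ : κ ≃ κ' := Fintype.equivOfCardEq hcard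
  refine ⟨⟨f ∘ σ, hf.comp σ.injective⟩, ?_⟩
  have hu : LinearIndependent ℝ (subB a (f ∘ σ)).col := hli.comp σ σ.injective
  have := Matrix.linearIndependent_cols_iff_isUnit.1 hu
  exact ((Matrix.isUnit_iff_isUnit_det _).1 this).ne_zero

variable {a : (κ → ℝ) → κ → ι → ℝ} {c : (κ → ℝ) → κ → ℝ}
  {D : (κ → ℝ) → (ι → ℝ) → ((κ → ℝ) →L[ℝ] (κ → ℝ))}

/-- Kac–Rice formula for a nondegenerate Gaussian field depending affinely on a standard
Gaussian vector; `R` orthonormalises the rows of the field. -/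
theorem rice_palm' (ha : Continuous a) (hc : Continuous c)
    (hD : ∀ x ω, HasFDerivAt (fun x k => a x k ⬝ᵥ ω + c x k) (D x ω) x)
    (hDc : Continuous (Function.uncurry D)) {S : Set (κ → ℝ)} (hS : IsSigmaCompact S)
    (R : (κ → ℝ) → Matrix κ κ ℝ) (hR : ∀ x ∈ S, (R x).det ≠ 0)
    (hort : ∀ x ∈ S, ∀ k l, (∑ i, R x k i • a x i) ⬝ᵥ (∑ i, R x l i • a x i)
      = if k = l then 1 else 0) :
    ∫⁻ ω, cnt {x ∈ S | (fun k => a x k ⬝ᵥ ω + c x k) = 0} ∂(stdG ι)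
      = ∫⁻ x in S, ENNReal.ofReal (|(R x).det| * gpdf κ ((R x).mulVec (- c x))) *
        ∫⁻ ω, ENNReal.ofReal
          |(D x (palmShift (fun k => ∑ i, R x k i • a x i) ((R x).mulVec (- c x)) ω)).det|
          ∂(stdG ι) := by
  classical
  have hF : Continuous (Function.uncurry fun (ω : ι → ℝ) (x : κ → ℝ) =>
      (fun k => a x k ⬝ᵥ ω + c x k)) := by
    refine continuous_pi fun k => ?_
    simp only [Function.uncurry]
    exact (Continuous.dotProduct (by fun_prop) (by fun_prop)).add (by fun_prop)
  have hU : ∀ e : κ ↪ ι, IsOpen {x | (subB (a x) e).det ≠ 0} := by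
    intro e
    have hBc : Continuous fun x => subB (a x) e := by
      unfold subB
      refine continuous_matrix fun k l => ?_
      simp only [Matrix.of_apply]
      fun_prop
    exact isOpen_ne_fun hBc.matrix_det continuous_const
  have key : ∀ 𝓕 : Finset (κ ↪ ι), ∀ T ⊆ S, IsSigmaCompact T →
      (∀ x ∈ T, ∃ e ∈ 𝓕, (subB (a x) e).det ≠ 0) →
      ∫⁻ ω, cnt {x ∈ T | (fun k => a x k ⬝ᵥ ω + c x k) = 0} ∂(stdG ι)
      = ∫⁻ x in T, ENNReal.ofReal (|(R x).det| * gpdf κ ((R x).mulVec (- c x))) *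
        ∫⁻ ω, ENNReal.ofReal
          |(D x (palmShift (fun k => ∑ i, R x k i • a x i) ((R x).mulVec (- c x)) ω)).det|
          ∂(stdG ι) := by
    intro 𝓕
    induction 𝓕 using Finset.induction_on with
    | empty =>
      intro T _ _ hT
      have : T = ∅ := Set.eq_empty_of_forall_notMem fun x hx => by simpa using hT x hx
      subst this
      simp
    | insert e 𝓕 _ ih =>
      intro T hTS hT hcov
      set U := {x | (subB (a x) e).det ≠ 0} with hUdef
      have h1 := hT.inter_isOpen (hU e)
      have h2 := hT.inter_isClosed (hU e).isClosed_compl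
      have hsplit : T = (T ∩ U) ∪ (T ∩ Uᶜ) := by rw [← Set.inter_union_distrib_left]; simp
      have hdisj : Disjoint (T ∩ U) (T ∩ Uᶜ) :=
        (disjoint_compl_right (a := U)).mono Set.inter_subset_right Set.inter_subset_right
      have hm2 : MeasurableSet (T ∩ Uᶜ) := by
        obtain ⟨K, hK, hKe⟩ := h2
        rw [← hKe]; exact MeasurableSet.iUnion fun n => (hK n).measurableSet
      have hcnt : ∀ ω, cnt {x ∈ T | (fun k => a x k ⬝ᵥ ω + c x k) = 0}
          = cnt {x ∈ T ∩ U | (fun k => a x k ⬝ᵥ ω + c x k) = 0}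
          + cnt {x ∈ T ∩ Uᶜ | (fun k => a x k ⬝ᵥ ω + c x k) = 0} := by
        intro ω
        rw [← cnt_union (hdisj.mono (fun x hx => hx.1) (fun x hx => hx.1))]
        congr 1
        ext x
        simp only [Set.mem_ofPred_eq, Set.mem_union, Set.mem_inter_iff, Set.mem_compl_iff]
        tauto
      simp only [hcnt]
      rw [lintegral_add_left (measurable_cnt_zeros hF 0 h1),
        rice_palm e.injective ha hc hD hDc h1 (fun x hx => hx.2) R (fun x hx => hR x (hTS hx.1))
          (fun x hx => hort x (hTS hx.1)),
        ih (T ∩ Uᶜ) (fun x hx => hTS hx.1) h2, ← lintegral_union hm2 hdisj, ← hsplit]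
      intro x hx
      obtain ⟨e', he', hd⟩ := hcov x hx.1
      rcases Finset.mem_insert.1 he' with rfl | h
      · exact absurd hd hx.2
      · exact ⟨e', h, hd⟩
  refine key Finset.univ S subset_rfl hS fun x hx => ?_
  obtain ⟨e, he⟩ := exists_subB_det_ne_zero (a x) (R x) (hort x hx)
  exact ⟨e, Finset.mem_univ _, he⟩

end RicePalm
end

section

/-- Multi-indices of total degree at most `d`. -/
abbrev Jx (m d : ℕ) := {j : Fin m → Fin (d + 1) // (∑ k, (j k : ℕ)) ≤ d}

variable {m d : ℕ}

/-- Degree of the homogenising variable. -/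
def Jx.deg0 (j : Jx m d) : ℕ := d - ∑ k, (j.1 k : ℕ)

/-- Multinomial coefficient attached to a multi-index. -/
def mw (j : Jx m d) : ℝ := (d ! : ℝ) / ((∏ k, ((j.1 k : ℕ))! : ℕ) * ((j.deg0)! : ℕ))

lemma mw_pos (j : Jx m d) : 0 < mw j := by
  unfold mw
  have : 0 < ∏ k, ((j.1 k : ℕ))! := Finset.prod_pos fun k _ => Nat.factorial_pos _
  positivity

/-- Monomial of a multi-index, homogenised. -/
def monoE (x : Fin (m + 1) → ℝ) (j : Jx m d) : ℝ :=
  (∏ k : Fin m, x k.succ ^ (j.1 k : ℕ)) * x 0 ^ j.deg0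

/-- Feature map of the homogeneous KSS kernel. -/
def homE (x : Fin (m + 1) → ℝ) (j : Jx m d) : ℝ := √(mw j) * monoE x j

lemma sum_mw_mul_monoE (x : Fin (m + 1) → ℝ) : ∑ j : Jx m d, mw j * monoE x j = (∑ i, x i) ^ d := by
  rw [Finset.sum_pow_eq_sum_piAntidiag]
  symm
  have hb : ∀ k ∈ (Finset.univ : Finset (Fin (m + 1))).piAntidiag d, ∑ i, k i = d := by
    intro k hk
    simpa using hk
  have hb1 : ∀ k : Fin (m + 1) → ℕ, ∑ i, k i = d → k 0 + ∑ i : Fin m, k i.succ = d := by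
    intro k hk; rw [← Fin.sum_univ_succ]; exact hk
  have hb2 : ∀ k : Fin (m + 1) → ℕ, ∑ i, k i = d → ∀ i, k i < d + 1 := by
    intro k hk i
    have := Finset.single_le_sum (f := k) (fun _ _ => Nat.zero_le _) (Finset.mem_univ i)
    omega
  refine Finset.sum_bij' (i := fun k hk => (⟨fun i => ⟨k i.succ, hb2 k (hb k hk) _⟩, by
      have := hb1 k (hb k hk); simp only; omega⟩ : Jx m d))
    (j := fun j _ => Fin.cons j.deg0 (fun i => (j.1 i : ℕ))) ?_ ?_ ?_ ?_ ?_
  · intro k hk; exact Finset.mem_univ _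
  · intro j _
    simp only [Finset.mem_piAntidiag, Fin.sum_univ_succ, Fin.cons_zero, Fin.cons_succ]
    refine ⟨?_, by simp⟩
    have := j.2
    unfold Jx.deg0
    omega
  · intro k hk
    have := hb1 k (hb k hk)
    ext i
    refine Fin.cases ?_ (fun i => ?_) i
    · simp only [Fin.cons_zero, Jx.deg0]; omega
    · simp
  · intro j _
    ext i
    simp
  · intro k hk
    have h1 := hb1 k (hb k hk)
    have hdeg : Jx.deg0 (⟨fun i => ⟨k i.succ, hb2 k (hb k hk) _⟩, by
      have := hb1 k (hb k hk); simp only; omega⟩ : Jx m d) = k 0 := by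
      unfold Jx.deg0; simp only; omega
    have h2 := Nat.multinomial_spec (Finset.univ) k
    rw [hb k hk, Fin.prod_univ_succ] at h2
    unfold mw monoE
    rw [hdeg, Fin.prod_univ_succ, ← h2]
    have : (∏ i : Fin m, ((k i.succ)! : ℝ)) ≠ 0 :=
      Finset.prod_ne_zero_iff.2 fun i _ => by positivity
    have h0 : ((k 0)! : ℝ) ≠ 0 := by positivity
    push_cast
    field_simp

lemma homE_dot (x y : Fin (m + 1) → ℝ) :
    (homE x : Jx m d → ℝ) ⬝ᵥ homE y = (x ⬝ᵥ y) ^ d := by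
  unfold dotProduct
  rw [← sum_mw_mul_monoE]
  refine Finset.sum_congr rfl fun j _ => ?_
  have h1 : √(mw j) * √(mw j) = mw j := Real.mul_self_sqrt (mw_pos j).le
  have h2 : monoE x j * monoE y j = monoE (fun i => x i * y i) j := by
    simp only [monoE, mul_pow, Finset.prod_mul_distrib]; ring
  rw [← h2, ← h1]; unfold homE; ring

lemma contDiff_homE : ContDiff ℝ 2 (homE : (Fin (m + 1) → ℝ) → Jx m d → ℝ) := by
  unfold homE monoE
  fun_prop

/-- Directional derivative of the homogeneous feature map. -/
def dhomE (x a : Fin (m + 1) → ℝ) : Jx m d → ℝ := fderiv ℝ homE x a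

/-- Scalar product with a fixed vector. -/
def dotCLM {ι : Type*} [Fintype ι] (y : ι → ℝ) : (ι → ℝ) →L[ℝ] ℝ :=
  ∑ i, y i • (ContinuousLinearMap.proj i : (ι → ℝ) →L[ℝ] ℝ)

lemma hasFDerivAt_dot_const {ι : Type*} [Fintype ι] (y x : ι → ℝ) :
    HasFDerivAt (fun x : ι → ℝ => x ⬝ᵥ y) (dotCLM y) x := by
  have : (fun x : ι → ℝ => x ⬝ᵥ y) = fun x => dotCLM y x := by
    ext x; simp [dotCLM, dotProduct, mul_comm]
  rw [this]
  exact ContinuousLinearMap.hasFDerivAt _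

lemma dotCLM_apply {ι : Type*} [Fintype ι] (y x : ι → ℝ) :
    dotCLM y x = x ⬝ᵥ y := by
  simp [dotCLM, dotProduct, mul_comm]

lemma HasFDerivAt.dot_const {ι X : Type*} [Fintype ι] [NormedAddCommGroup X] [NormedSpace ℝ X]
    {E : X → ι → ℝ} {E' : X →L[ℝ] (ι → ℝ)} {x : X} (h : HasFDerivAt E E' x) (w : ι → ℝ) :
    HasFDerivAt (fun x => E x ⬝ᵥ w)
      ((dotCLM w).comp E') x :=
  (hasFDerivAt_dot_const w (E x)).comp x h

lemma hasFDerivAt_homE (x : Fin (m + 1) → ℝ) :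
    HasFDerivAt (homE : (Fin (m + 1) → ℝ) → Jx m d → ℝ) (fderiv ℝ homE x) x :=
  (contDiff_homE.differentiable (by norm_num) x).hasFDerivAt

lemma dhomE_dot_homE (x a y : Fin (m + 1) → ℝ) :
    (dhomE x a : Jx m d → ℝ) ⬝ᵥ homE y = d * (x ⬝ᵥ y) ^ (d - 1) * (a ⬝ᵥ y) := by
  have h1 := (hasFDerivAt_homE (d := d) x).dot_const (homE y)
  have h2 := (hasFDerivAt_dot_const y x).pow d
  have h3 : (fun x => (homE x : Jx m d → ℝ) ⬝ᵥ homE y) = fun x => (x ⬝ᵥ y) ^ d := by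
    ext x; exact homE_dot x y
  rw [h3] at h1
  have := congrArg (fun L => L a) (h1.unique h2)
  simp only [ContinuousLinearMap.comp_apply, smul_apply, dotCLM_apply,
    smul_eq_mul] at this
  rw [dhomE, this]
  simp

lemma dhomE_dot_dhomE (x a y b : Fin (m + 1) → ℝ) :
    (dhomE x a : Jx m d → ℝ) ⬝ᵥ dhomE y b = d * (x ⬝ᵥ y) ^ (d - 1) * (a ⬝ᵥ b)
      + d * (d - 1 : ℕ) * (x ⬝ᵥ y) ^ (d - 2) * (a ⬝ᵥ y) * (x ⬝ᵥ b) := by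
  have h1 := (hasFDerivAt_homE (d := d) y).dot_const (dhomE x a)
  have h2 := (((hasFDerivAt_dot_const x y).pow (d - 1)).mul (hasFDerivAt_dot_const a y)).const_mul
    (d : ℝ)
  have h3 : (fun y => (homE y : Jx m d → ℝ) ⬝ᵥ dhomE x a) =
      fun y => (d : ℝ) * ((y ⬝ᵥ x) ^ (d - 1) * (y ⬝ᵥ a)) := by
    ext y
    rw [dotProduct_comm, dhomE_dot_homE, dotProduct_comm x y, dotProduct_comm a y]; ring
  rw [h3] at h1
  have := congrArg (fun L => L b) (h1.unique h2)
  simp only [ContinuousLinearMap.comp_apply, smul_apply,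
    add_apply, dotCLM_apply, smul_eq_mul] at this
  rw [dotProduct_comm, dhomE, this]
  rw [dotProduct_comm y x, dotProduct_comm b a, dotProduct_comm y a, dotProduct_comm b x,
    Nat.sub_sub]
  simp
  ring
end

section

variable {m d : ℕ}

/-- Homogeneous coordinates of a point of `ℝ^m`. -/
def xh (t : Fin m → ℝ) : Fin (m + 1) → ℝ := Fin.cons 1 t

/-- Norm of the homogeneous coordinates. -/
def nrm (t : Fin m → ℝ) : ℝ := √(1 + t ⬝ᵥ t)

/-- Point of the unit sphere in central projection. -/
def vs (t : Fin m → ℝ) : Fin (m + 1) → ℝ := (nrm t)⁻¹ • xh t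

@[simp] lemma xh_zero (t : Fin m → ℝ) : xh t 0 = 1 := rfl
@[simp] lemma xh_succ (t : Fin m → ℝ) (k : Fin m) : xh t k.succ = t k := rfl

lemma dot_self_nonneg {ι : Type*} [Fintype ι] (t : ι → ℝ) : 0 ≤ t ⬝ᵥ t :=
  Finset.sum_nonneg fun i _ => mul_self_nonneg _

lemma one_add_dot_pos (t : Fin m → ℝ) : 0 < 1 + t ⬝ᵥ t := by
  have := dot_self_nonneg t; linarith

lemma nrm_pos (t : Fin m → ℝ) : 0 < nrm t := Real.sqrt_pos.2 (one_add_dot_pos t)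

lemma nrm_sq (t : Fin m → ℝ) : nrm t ^ 2 = 1 + t ⬝ᵥ t := Real.sq_sqrt (one_add_dot_pos t).le

lemma xh_dot (s t : Fin m → ℝ) : xh s ⬝ᵥ xh t = 1 + s ⬝ᵥ t := by
  simp [dotProduct, Fin.sum_univ_succ]

lemma vs_dot (s t : Fin m → ℝ) : vs s ⬝ᵥ vs t = (nrm s)⁻¹ * (nrm t)⁻¹ * (1 + s ⬝ᵥ t) := by
  rw [vs, vs, smul_dotProduct, dotProduct_smul, xh_dot, smul_eq_mul, smul_eq_mul]; ring

lemma vs_dot_self (t : Fin m → ℝ) : vs t ⬝ᵥ vs t = 1 := by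
  rw [vs_dot, ← nrm_sq]
  have := (nrm_pos t).ne'
  field_simp

lemma vs_zero_coord (t : Fin m → ℝ) : vs t 0 = (nrm t)⁻¹ := by simp [vs]

lemma contDiff_nrm : ContDiff ℝ 2 (nrm : (Fin m → ℝ) → ℝ) := by
  unfold nrm dotProduct
  refine ContDiff.sqrt (by fun_prop) fun t => (one_add_dot_pos t).ne'

lemma contDiff_xh : ContDiff ℝ 2 (xh : (Fin m → ℝ) → _) := by
  rw [contDiff_pi]
  intro i
  refine Fin.cases ?_ (fun k => ?_) i
  · simp only [xh_zero]; fun_prop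
  · simp only [xh_succ]; fun_prop

lemma contDiff_vs : ContDiff ℝ 2 (vs : (Fin m → ℝ) → _) :=
  (contDiff_nrm.inv fun t => (nrm_pos t).ne').smul contDiff_xh

/-- Coordinate derivative of `vs`. -/
def dvs (t : Fin m → ℝ) (k : Fin m) : Fin (m + 1) → ℝ := fderiv ℝ vs t (Pi.single k 1)

lemma dot_vs_dvs (t : Fin m → ℝ) (k : Fin m) : vs t ⬝ᵥ dvs t k = 0 := by
  have hv : HasFDerivAt vs (fderiv ℝ vs t) t :=
    (contDiff_vs.differentiable (by norm_num) t).hasFDerivAt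
  have h1 : HasFDerivAt (fun t : Fin m → ℝ => ∑ i, vs t i * vs t i)
      (∑ i, (vs t i • (ContinuousLinearMap.proj i).comp (fderiv ℝ vs t)
        + vs t i • (ContinuousLinearMap.proj i).comp (fderiv ℝ vs t))) t := by
    refine HasFDerivAt.fun_sum fun i _ => ?_
    have := (hasFDerivAt_pi'.1 hv i)
    exact this.mul this
  have h2 : (fun t : Fin m → ℝ => ∑ i, vs t i * vs t i) = fun _ => 1 := by
    ext t; exact vs_dot_self t
  rw [h2] at h1
  have := congrArg (fun L => L (Pi.single k 1)) (h1.unique (hasFDerivAt_const _ _))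
  simp only [sum_apply, add_apply, smul_apply, ContinuousLinearMap.comp_apply,
    ContinuousLinearMap.proj_apply, smul_eq_mul, zero_apply] at this
  have h3 : ∑ i, vs t i * fderiv ℝ vs t (Pi.single k 1) i = 0 := by
    simp only [← two_mul, ← Finset.mul_sum] at this
    linarith
  exact h3

lemma dot_dvs_of_orthogonal (t : Fin m → ℝ) (k : Fin m) (w : Fin (m + 1) → ℝ)
    (hw : w ⬝ᵥ vs t = 0) : w ⬝ᵥ dvs t k = (nrm t)⁻¹ * w k.succ := by
  have hx : w ⬝ᵥ xh t = 0 := by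
    rw [vs, dotProduct_smul, smul_eq_mul] at hw
    exact (mul_eq_zero.1 hw).resolve_left (inv_ne_zero (nrm_pos t).ne')
  have hn : HasFDerivAt (fun t : Fin m → ℝ => (nrm t)⁻¹) (fderiv ℝ (fun t => (nrm t)⁻¹) t) t :=
    ((contDiff_nrm.inv fun t => (nrm_pos t).ne').differentiable (by norm_num) t).hasFDerivAt
  have hxh : HasFDerivAt (fun t : Fin m → ℝ => xh t ⬝ᵥ w)
      (dotCLM (fun k : Fin m => w k.succ)) t := by
    have : (fun t : Fin m → ℝ => xh t ⬝ᵥ w) = fun t => w 0 + t ⬝ᵥ fun k => w k.succ := by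
      ext t; simp [dotProduct, Fin.sum_univ_succ]
    rw [this]
    exact (hasFDerivAt_dot_const _ _).const_add _
  have h1 := hn.mul hxh
  have hv : HasFDerivAt vs (fderiv ℝ vs t) t :=
    (contDiff_vs.differentiable (by norm_num) t).hasFDerivAt
  have h2 := hv.dot_const w
  have h3 : ((fun t : Fin m → ℝ => (nrm t)⁻¹) * fun t => xh t ⬝ᵥ w) = fun t => vs t ⬝ᵥ w := by
    ext t; simp only [Pi.mul_apply]; rw [vs, smul_dotProduct, smul_eq_mul]
  rw [h3] at h1
  have := congrArg (fun L => L (Pi.single k 1)) (h2.unique h1)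
  simp only [ContinuousLinearMap.comp_apply, dotCLM_apply, add_apply, smul_apply,
    smul_eq_mul, dotProduct_comm (xh t) w, hx, zero_mul, add_zero] at this
  rw [dotProduct_comm, dvs, this]
  simp

/-- Orthogonal frames, as matrices whose rows are orthonormal. -/
lemma frame_expand (O : Matrix (Fin (m + 1)) (Fin (m + 1)) ℝ) (hO : O * O.transpose = 1)
    (w : Fin (m + 1) → ℝ) : w = ∑ i, (O i ⬝ᵥ w) • O i := by
  have h : O.transpose * O = 1 := mul_eq_one_comm.1 hO
  have : O.transpose.mulVec (O.mulVec w) = w := by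
    rw [Matrix.mulVec_mulVec, h, Matrix.one_mulVec]
  conv_lhs => rw [← this]
  ext k
  simp only [Matrix.mulVec, Matrix.transpose_apply, Finset.sum_apply, Pi.smul_apply, smul_eq_mul]
  exact Finset.sum_congr rfl fun i _ => mul_comm _ _

lemma frame_dot (O : Matrix (Fin (m + 1)) (Fin (m + 1)) ℝ) (hO : O * O.transpose = 1)
    (i j : Fin (m + 1)) : O i ⬝ᵥ O j = if i = j then 1 else 0 := by
  have := congrFun (congrFun hO i) j
  rw [Matrix.mul_apply, Matrix.one_apply] at this
  exact this

lemma dvs_eq (O : Matrix (Fin (m + 1)) (Fin (m + 1)) ℝ) (hO : O * O.transpose = 1)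
    (t : Fin m → ℝ) (h0 : O 0 = vs t) (k : Fin m) :
    dvs t k = ∑ i : Fin m, ((nrm t)⁻¹ * O i.succ k.succ) • O i.succ := by
  rw [frame_expand O hO (dvs t k), Fin.sum_univ_succ, h0, dot_vs_dvs, zero_smul, zero_add]
  refine Finset.sum_congr rfl fun i _ => ?_
  rw [dot_dvs_of_orthogonal]
  rw [← h0, frame_dot O hO]
  simp

lemma abs_det_minor (O : Matrix (Fin (m + 1)) (Fin (m + 1)) ℝ) (hO : O * O.transpose = 1) :
    |(O.submatrix Fin.succ Fin.succ).det| = |O 0 0| := by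
  have hu : IsUnit O.det := by
    have := congrArg Matrix.det hO
    rw [Matrix.det_mul, Matrix.det_one] at this
    exact IsUnit.of_mul_eq_one _ this
  have hd : |O.det| = 1 := by
    have := congrArg Matrix.det hO
    rw [Matrix.det_mul, Matrix.det_one, Matrix.det_transpose] at this
    have h2 : |O.det| * |O.det| = 1 := by rw [← abs_mul, this, abs_one]
    nlinarith [abs_nonneg O.det]
  have h1 : O.adjugate = O.det • O.transpose := by
    have hinv : O⁻¹ = O.transpose := Matrix.inv_eq_right_inv hO
    rw [← hinv, Matrix.inv_def, smul_smul, Ring.mul_inverse_cancel _ hu, one_smul]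
  have h2 := Matrix.adjugate_fin_succ_eq_det_submatrix O 0 0
  rw [h1] at h2
  simp only [Matrix.smul_apply, Matrix.transpose_apply, smul_eq_mul, Fin.val_zero, add_zero,
    pow_zero, one_mul, Fin.succAbove_zero] at h2
  rw [← h2, abs_mul, hd, one_mul]

/-- Unit feature vector of the KSS kernel. -/
def ft (d : ℕ) (t : Fin m → ℝ) : Jx m d → ℝ := homE (vs t)

/-- Coordinate derivatives of the unit feature vector. -/
def dft (d : ℕ) (t : Fin m → ℝ) (k : Fin m) : Jx m d → ℝ := fderiv ℝ (ft d) t (Pi.single k 1)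

lemma ft_dot (s t : Fin m → ℝ) : ft d s ⬝ᵥ ft d t = (vs s ⬝ᵥ vs t) ^ d := homE_dot _ _

lemma ft_dot_self (t : Fin m → ℝ) : ft d t ⬝ᵥ ft d t = 1 := by rw [ft_dot, vs_dot_self, one_pow]

lemma contDiff_ft : ContDiff ℝ 2 (ft d : (Fin m → ℝ) → _) := contDiff_homE.comp contDiff_vs

lemma continuous_ft : Continuous (ft d : (Fin m → ℝ) → _) := contDiff_ft.continuous

lemma continuous_dft (k : Fin m) : Continuous fun t => dft d t k :=
  (contDiff_ft.continuous_fderiv (by norm_num)).clm_apply continuous_const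

lemma hasFDerivAt_ft (t : Fin m → ℝ) : HasFDerivAt (ft d) (fderiv ℝ (ft d) t) t :=
  (contDiff_ft.differentiable (by norm_num) t).hasFDerivAt

lemma fderiv_ft_apply (t h : Fin m → ℝ) : fderiv ℝ (ft d) t h = ∑ k, h k • dft d t k := by
  have : h = ∑ k, h k • (Pi.single k 1 : Fin m → ℝ) := by
    ext i; simp [Finset.sum_apply, Pi.single_apply]
  conv_lhs => rw [this]
  simp [dft]

lemma dft_eq_dhomE (t : Fin m → ℝ) (k : Fin m) : dft d t k = dhomE (vs t) (dvs t k) := by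
  have hv : HasFDerivAt vs (fderiv ℝ vs t) t :=
    (contDiff_vs.differentiable (by norm_num) t).hasFDerivAt
  have : HasFDerivAt (ft d) ((fderiv ℝ homE (vs t)).comp (fderiv ℝ vs t)) t :=
    (hasFDerivAt_homE (vs t)).comp t hv
  rw [dft, this.fderiv]; rfl

lemma dft_eq (O : Matrix (Fin (m + 1)) (Fin (m + 1)) ℝ) (hO : O * O.transpose = 1)
    (t : Fin m → ℝ) (h0 : O 0 = vs t) (k : Fin m) :
    dft d t k = ∑ i : Fin m, ((nrm t)⁻¹ * O i.succ k.succ) • dhomE (vs t) (O i.succ) := by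
  rw [dft_eq_dhomE, dvs_eq O hO t h0]
  simp [dhomE]

lemma abs_det_frame (O : Matrix (Fin (m + 1)) (Fin (m + 1)) ℝ) (hO : O * O.transpose = 1)
    (t : Fin m → ℝ) (h0 : O 0 = vs t) (W : Matrix (Fin m) (Fin m) ℝ) :
    |(Matrix.of fun ℓ k => ∑ i : Fin m, ((nrm t)⁻¹ * O i.succ k.succ) * W ℓ i).det|
      = (nrm t)⁻¹ ^ (m + 1) * |W.det| := by
  have : (Matrix.of fun ℓ k => ∑ i : Fin m, ((nrm t)⁻¹ * O i.succ k.succ) * W ℓ i)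
      = W * ((nrm t)⁻¹ • O.submatrix Fin.succ Fin.succ) := by
    ext ℓ k
    rw [Matrix.mul_apply]
    simp only [Matrix.of_apply, Matrix.smul_apply, Matrix.submatrix_apply, smul_eq_mul]
    exact Finset.sum_congr rfl fun i _ => by ring
  rw [this, Matrix.det_mul, Matrix.det_smul, abs_mul, abs_mul, abs_det_minor O hO, h0,
    vs_zero_coord, abs_of_pos (by have := nrm_pos t; positivity : 0 < (nrm t)⁻¹),
    abs_of_pos (by have := nrm_pos t; positivity : 0 < (nrm t)⁻¹ ^ Fintype.card (Fin m))]
  simp only [Fintype.card_fin]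
  ring

lemma exists_frame {p : ℕ} (w : Fin p → Fin (m + 1) → ℝ)
    (hw : ∀ i j, w i ⬝ᵥ w j = if i = j then 1 else 0) (σ : Fin p → Fin (m + 1))
    (hσ : Function.Injective σ) :
    ∃ O : Matrix (Fin (m + 1)) (Fin (m + 1)) ℝ, O * O.transpose = 1 ∧ ∀ i, O (σ i) = w i := by
  classical
  let w' : Fin (m + 1) → EuclideanSpace ℝ (Fin (m + 1)) :=
    fun k => WithLp.toLp 2 (Function.extend σ w 0 k)
  have hin : ∀ x y : Fin (m + 1) → ℝ, inner ℝ (WithLp.toLp 2 x) (WithLp.toLp 2 y) = x ⬝ᵥ y := by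
    intro x y
    simp [PiLp.inner_apply, dotProduct, mul_comm]
  have hon : Orthonormal ℝ ((Set.range σ).domRestrict w') := by
    rw [orthonormal_iff_ite]
    rintro ⟨x, i, rfl⟩ ⟨y, j, rfl⟩
    have key : inner ℝ (WithLp.toLp 2 (Function.extend σ w 0 (σ i)))
        (WithLp.toLp 2 (Function.extend σ w 0 (σ j))) = if i = j then 1 else 0 := by
      rw [hin, hσ.extend_apply, hσ.extend_apply, hw]
    refine Eq.trans key ?_
    by_cases h : i = j
    · subst h
      rw [if_pos rfl, if_pos rfl]
    · rw [if_neg h, if_neg fun h' => h (hσ (congrArg Subtype.val h'))]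
  obtain ⟨b, hb⟩ := hon.exists_orthonormalBasis_extension_of_card_eq (by simp)
  refine ⟨Matrix.of fun i => (b i).ofLp, ?_, fun i => ?_⟩
  · ext i j
    rw [Matrix.mul_apply, Matrix.one_apply]
    have := orthonormal_iff_ite.1 b.orthonormal i j
    rw [← this]
    simp [PiLp.inner_apply, mul_comm]
  · have := hb (σ i) ⟨i, rfl⟩
    ext k
    simp [this, w', hσ.extend_apply]
end

section

section Rows
variable {m : ℕ} {J : Type*} [Fintype J]

/-- Coefficients of the equation `ℓ`. -/
def row (ω : Fin m × J → ℝ) (ℓ : Fin m) : J → ℝ := fun j => ω (ℓ, j)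

/-- Coefficient vector supported on the equation `ℓ`. -/
def rowF (ℓ : Fin m) (p : J → ℝ) : Fin m × J → ℝ := fun i => if i.1 = ℓ then p i.2 else 0

lemma rowF_dot (ℓ : Fin m) (p : J → ℝ) (ω : Fin m × J → ℝ) : rowF ℓ p ⬝ᵥ ω = p ⬝ᵥ row ω ℓ := by
  simp [dotProduct, rowF, row, Fintype.sum_prod_type, Finset.sum_ite_irrel]

lemma row_rowF (ℓ ℓ' : Fin m) (p : J → ℝ) : row (rowF ℓ p) ℓ' = if ℓ' = ℓ then p else 0 := by
  ext j
  by_cases h : ℓ' = ℓ <;> simp [row, rowF, h]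

lemma rowF_dot_rowF (ℓ ℓ' : Fin m) (p q : J → ℝ) :
    rowF ℓ p ⬝ᵥ rowF ℓ' q = if ℓ = ℓ' then p ⬝ᵥ q else 0 := by
  rw [rowF_dot, row_rowF]
  split_ifs <;> simp

lemma rowF_add (ℓ : Fin m) (p q : J → ℝ) : rowF ℓ (p + q) = rowF ℓ p + rowF ℓ q := by
  ext i; by_cases h : i.1 = ℓ <;> simp [rowF, h]

lemma rowF_smul (ℓ : Fin m) (c : ℝ) (p : J → ℝ) : rowF ℓ (c • p) = c • rowF ℓ p := by
  ext i; by_cases h : i.1 = ℓ <;> simp [rowF, h]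

lemma continuous_rowF (ℓ : Fin m) : Continuous (rowF ℓ : (J → ℝ) → _) := by
  refine continuous_pi fun i => ?_
  by_cases h : i.1 = ℓ <;> simp [rowF, h] <;> fun_prop

lemma continuous_row (ℓ : Fin m) : Continuous fun ω : Fin m × J → ℝ => row ω ℓ :=
  continuous_pi fun _ => continuous_apply _

/-- A `C¹` map into the unit sphere, with its partial derivatives. -/
structure IsFeat (p : (Fin m → ℝ) → J → ℝ) (dp : (Fin m → ℝ) → Fin m → J → ℝ) : Prop where
  cont : Continuous p
  dcont : ∀ k, Continuous fun t => dp t k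
  deriv : ∀ t w, HasFDerivAt (fun t => p t ⬝ᵥ w) (dotCLM fun k => dp t k ⬝ᵥ w) t
  unit : ∀ t, p t ⬝ᵥ p t = 1
  orth : ∀ t k, p t ⬝ᵥ dp t k = 0

/-- Matrix of the values of the system on given features. -/
def detM (q : Fin m → J → ℝ) (ω : Fin m × J → ℝ) : Matrix (Fin m) (Fin m) ℝ :=
  Matrix.of fun ℓ k => q k ⬝ᵥ row ω ℓ

lemma detM_apply (q : Fin m → J → ℝ) (ω : Fin m × J → ℝ) (ℓ k : Fin m) :
    detM q ω ℓ k = q k ⬝ᵥ row ω ℓ := rfl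

lemma continuous_detM : Continuous fun x : (Fin m → J → ℝ) × (Fin m × J → ℝ) => detM x.1 x.2 := by
  unfold detM
  refine continuous_matrix fun ℓ k => ?_
  simp only [Matrix.of_apply]
  exact Continuous.dotProduct (by fun_prop) ((continuous_row ℓ).comp continuous_snd)

lemma gpdf_neg {κ : Type*} [Fintype κ] (u : κ → ℝ) : gpdf κ (-u) = gpdf κ u := by
  rw [gpdf_eq, gpdf_eq]
  simp [gaussianPDFReal]

theorem one_point {p : (Fin m → ℝ) → J → ℝ} {dp : (Fin m → ℝ) → Fin m → J → ℝ} (hp : IsFeat p dp)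
    {c : (Fin m → ℝ) → Fin m → ℝ} {dc : (Fin m → ℝ) → Matrix (Fin m) (Fin m) ℝ}
    (hdc : Continuous dc) (hc : ∀ t, HasFDerivAt c (matCLM (dc t)) t) {ε : ℝ} (hε : 0 < ε)
    {S : Set (Fin m → ℝ)} (hS : IsSigmaCompact S) :
    ∫⁻ ω, cnt {t ∈ S | ∀ ℓ, ε * (p t ⬝ᵥ row ω ℓ) + c t ℓ = 0} ∂(stdG (Fin m × J))
      = ∫⁻ t in S, ENNReal.ofReal (ε⁻¹ ^ m * gpdf (Fin m) (ε⁻¹ • c t)) *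
        ∫⁻ ω, ENNReal.ofReal |(ε • detM (dp t) ω + dc t).det| ∂(stdG (Fin m × J)) := by
  have hcc : Continuous c := continuous_iff_continuousAt.2 fun t => (hc t).continuousAt
  have hL : ∀ t, ∀ k : Fin m, ∑ i, (ε⁻¹ • (1 : Matrix (Fin m) (Fin m) ℝ)) k i • (ε • rowF i (p t))
      = rowF k (p t) := by
    intro t k
    rw [Finset.sum_eq_single k]
    · simp [smul_smul, hε.ne']
    · intro b _ hb; simp [hb.symm]
    · simp
  have := rice_palm' (κ := Fin m) (a := fun t ℓ => ε • rowF ℓ (p t)) (c := c)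
    (D := fun t ω => matCLM (ε • detM (dp t) ω + dc t))
    (continuous_pi fun ℓ => ((continuous_rowF ℓ).comp hp.cont).const_smul ε) hcc
    (fun t ω => by
      refine hasFDerivAt_pi'' fun ℓ => ?_
      have h1 := ((hp.deriv t (row ω ℓ)).const_mul ε).add ((hasFDerivAt_pi'.1 (hc t)) ℓ)
      refine (h1.congr_fderiv ?_).congr_of_eventuallyEq (Eventually.of_forall fun s => ?_)
      · ext h
        simp only [add_apply, smul_apply, dotCLM_apply, ContinuousLinearMap.comp_apply,
          matCLM_apply, Matrix.add_mulVec, Matrix.smul_mulVec, smul_eq_mul]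
        simp [detM, Matrix.mulVec, dotProduct_comm h]
      · simp [rowF_dot])
    (by
      refine continuous_matCLM.comp (Continuous.add (Continuous.const_smul ?_ ε)
        (hdc.comp continuous_fst))
      exact continuous_detM.comp (Continuous.prodMk
        ((continuous_pi fun k => hp.dcont k).comp continuous_fst) continuous_snd))
    hS (fun _ => ε⁻¹ • 1) (fun t _ => by simp [hε.ne'])
    (fun t _ k l => by
      rw [hL, hL, rowF_dot_rowF, hp.unit])
  convert! this using 1
  · refine lintegral_congr fun ω => ?_
    congr 1
    ext t
    simp [funext_iff, rowF_dot]
  · refine lintegral_congr fun t => ?_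
    congr 2
    · rw [Matrix.det_smul, Matrix.det_one, mul_one, Fintype.card_fin,
        abs_of_pos (by positivity), Matrix.smul_mulVec, Matrix.one_mulVec, smul_neg, gpdf_neg]
    · ext ω
      rw [det_matCLM]
      simp only [hL]
      congr 4
      refine congrArg (ε • ·) ?_
      ext ℓ k
      rw [detM_apply, detM_apply, ← rowF_dot, ← rowF_dot, dot_palmShift]
      simp [rowF_dot_rowF, dotProduct_comm _ (p t), hp.orth]

/-- Projection off two orthonormal vectors. -/
def proj2 (u g w : J → ℝ) : J → ℝ := w - (w ⬝ᵥ u) • u - (w ⬝ᵥ g) • g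

lemma proj2_dot_proj2 {u g : J → ℝ} (hu : u ⬝ᵥ u = 1) (hg : g ⬝ᵥ g = 1) (hug : u ⬝ᵥ g = 0)
    (w w' : J → ℝ) : proj2 u g w ⬝ᵥ proj2 u g w'
      = w ⬝ᵥ w' - (w ⬝ᵥ u) * (w' ⬝ᵥ u) - (w ⬝ᵥ g) * (w' ⬝ᵥ g) := by
  have hgu : g ⬝ᵥ u = 0 := by rw [dotProduct_comm, hug]
  simp only [proj2, sub_dotProduct, dotProduct_sub, smul_dotProduct, dotProduct_smul, hu, hg, hug,
    hgu, smul_eq_mul, dotProduct_comm u w', dotProduct_comm g w']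
  ring

/-- Normalised component of `q` orthogonal to `p`. -/
def ortho (p q : J → ℝ) : J → ℝ := (√(1 - (p ⬝ᵥ q) ^ 2))⁻¹ • (q - (p ⬝ᵥ q) • p)

lemma dot_ortho (p q w : J → ℝ) : w ⬝ᵥ ortho p q
    = (√(1 - (p ⬝ᵥ q) ^ 2))⁻¹ * (w ⬝ᵥ q - (p ⬝ᵥ q) * (w ⬝ᵥ p)) := by
  rw [ortho, dotProduct_smul, dotProduct_sub, dotProduct_smul, smul_eq_mul, smul_eq_mul]

lemma ortho_dot_self {p q : J → ℝ} (hp : p ⬝ᵥ p = 1) (hq : q ⬝ᵥ q = 1)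
    (h : (p ⬝ᵥ q) ^ 2 < 1) : ortho p q ⬝ᵥ ortho p q = 1 := by
  have h0 : 0 < √(1 - (p ⬝ᵥ q) ^ 2) := Real.sqrt_pos.2 (by linarith)
  have h1 : √(1 - (p ⬝ᵥ q) ^ 2) ^ 2 = 1 - (p ⬝ᵥ q) ^ 2 := Real.sq_sqrt (by linarith)
  rw [dot_ortho p q (ortho p q), dotProduct_comm (ortho p q) q, dotProduct_comm (ortho p q) p,
    dot_ortho, dot_ortho, hp, hq, dotProduct_comm q p]
  field_simp
  rw [h1]; ring

lemma dot_ortho_eq_zero {p q : J → ℝ} (hp : p ⬝ᵥ p = 1) : p ⬝ᵥ ortho p q = 0 := by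
  rw [dot_ortho, hp]; ring

theorem two_point {p q : (Fin m → ℝ) → J → ℝ} {dp dq : (Fin m → ℝ) → Fin m → J → ℝ}
    (hp : IsFeat p dp) (hq : IsFeat q dq)
    {S : Set (Fin m ⊕ Fin m → ℝ)} (hS : IsSigmaCompact S)
    (hlt : ∀ x ∈ S, (p (x ∘ Sum.inl) ⬝ᵥ q (x ∘ Sum.inr)) ^ 2 < 1) :
    ∫⁻ ω, cnt {x ∈ S | ∀ ℓ, p (x ∘ Sum.inl) ⬝ᵥ row ω ℓ = 0 ∧ q (x ∘ Sum.inr) ⬝ᵥ row ω ℓ = 0}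
      ∂(stdG (Fin m × J))
      = ∫⁻ x in S, ENNReal.ofReal ((√(1 - (p (x ∘ Sum.inl) ⬝ᵥ q (x ∘ Sum.inr)) ^ 2))⁻¹ ^ m
          * (√(2 * π))⁻¹ ^ (2 * m)) *
        ∫⁻ ω, ENNReal.ofReal
          (|(detM (fun k => proj2 (p (x ∘ Sum.inl)) (ortho (p (x ∘ Sum.inl)) (q (x ∘ Sum.inr)))
              (dp (x ∘ Sum.inl) k)) ω).det| *
           |(detM (fun k => proj2 (p (x ∘ Sum.inl)) (ortho (p (x ∘ Sum.inl)) (q (x ∘ Sum.inr)))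
              (dq (x ∘ Sum.inr) k)) ω).det|) ∂(stdG (Fin m × J)) := by
  set P : (Fin m ⊕ Fin m → ℝ) → J → ℝ := fun x => p (x ∘ Sum.inl) with hP
  set Q : (Fin m ⊕ Fin m → ℝ) → J → ℝ := fun x => q (x ∘ Sum.inr) with hQ
  have hl : Continuous fun x : Fin m ⊕ Fin m → ℝ => x ∘ Sum.inl :=
    continuous_pi fun _ => continuous_apply _
  have hr : Continuous fun x : Fin m ⊕ Fin m → ℝ => x ∘ Sum.inr :=
    continuous_pi fun _ => continuous_apply _
  set a : (Fin m ⊕ Fin m → ℝ) → Fin m ⊕ Fin m → Fin m × J → ℝ :=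
    fun x => Sum.elim (fun ℓ => rowF ℓ (P x)) (fun ℓ => rowF ℓ (Q x)) with ha
  set R : (Fin m ⊕ Fin m → ℝ) → Matrix (Fin m ⊕ Fin m) (Fin m ⊕ Fin m) ℝ := fun x =>
    Matrix.fromBlocks 1 0 ((-(√(1 - (P x ⬝ᵥ Q x) ^ 2))⁻¹ * (P x ⬝ᵥ Q x)) • 1)
      ((√(1 - (P x ⬝ᵥ Q x) ^ 2))⁻¹ • 1) with hRdef
  have hL : ∀ x, (fun k => ∑ i, R x k i • a x i)
      = Sum.elim (fun ℓ => rowF ℓ (P x)) (fun ℓ => rowF ℓ (ortho (P x) (Q x))) := by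
    intro x
    ext k : 1
    rw [Fintype.sum_sum_type]
    rcases k with k | k
    · simp only [hRdef, ha, Matrix.fromBlocks_apply₁₁, Matrix.fromBlocks_apply₁₂, Sum.elim_inl,
        Sum.elim_inr]
      simp [Matrix.one_apply]
    · simp only [hRdef, ha, Matrix.fromBlocks_apply₂₁, Matrix.fromBlocks_apply₂₂, Sum.elim_inl,
        Sum.elim_inr]
      simp only [Matrix.smul_apply, Matrix.one_apply, smul_eq_mul, mul_ite, mul_one, mul_zero,
        ite_smul, zero_smul, Finset.sum_ite_eq, Finset.mem_univ, if_true]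
      rw [ortho, rowF_smul, show Q x - (P x ⬝ᵥ Q x) • P x = Q x + (-(P x ⬝ᵥ Q x)) • P x by module,
        rowF_add, rowF_smul]
      module
  have hdet : ∀ x, |(R x).det| = (√(1 - (P x ⬝ᵥ Q x) ^ 2))⁻¹ ^ m := by
    intro x
    rw [hRdef, Matrix.det_fromBlocks_zero₁₂, Matrix.det_one, one_mul, Matrix.det_smul,
      Matrix.det_one, mul_one, Fintype.card_fin, abs_of_nonneg (by positivity)]
  have hpos : ∀ x ∈ S, 0 < √(1 - (P x ⬝ᵥ Q x) ^ 2) := fun x hx =>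
    Real.sqrt_pos.2 (by have := hlt x hx; linarith)
  have := rice_palm' (κ := Fin m ⊕ Fin m) (a := a) (c := 0)
    (D := fun x ω => matCLM (Matrix.fromBlocks (detM (dp (x ∘ Sum.inl)) ω) 0 0
      (detM (dq (x ∘ Sum.inr)) ω)))
    (continuous_pi fun k => by
      rcases k with ℓ | ℓ
      · exact (continuous_rowF ℓ).comp (hp.cont.comp hl)
      · exact (continuous_rowF ℓ).comp (hq.cont.comp hr)) continuous_const
    (fun x ω => by
      refine hasFDerivAt_pi'' fun k => ?_
      have hll : HasFDerivAt (fun x : Fin m ⊕ Fin m → ℝ => x ∘ Sum.inl)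
          (ContinuousLinearMap.pi fun i =>
            (ContinuousLinearMap.proj (Sum.inl i) : (Fin m ⊕ Fin m → ℝ) →L[ℝ] ℝ)) x :=
        hasFDerivAt_pi'' fun i => hasFDerivAt_apply _ _
      have hrr : HasFDerivAt (fun x : Fin m ⊕ Fin m → ℝ => x ∘ Sum.inr)
          (ContinuousLinearMap.pi fun i =>
            (ContinuousLinearMap.proj (Sum.inr i) : (Fin m ⊕ Fin m → ℝ) →L[ℝ] ℝ)) x :=
        hasFDerivAt_pi'' fun i => hasFDerivAt_apply _ _
      rcases k with ℓ | ℓ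
      · have h1 := (hp.deriv (x ∘ Sum.inl) (row ω ℓ)).comp x hll
        refine (h1.congr_fderiv ?_).congr_of_eventuallyEq (Eventually.of_forall fun s => ?_)
        · ext h
          simp only [ContinuousLinearMap.comp_apply, dotCLM_apply, matCLM_apply,
            ContinuousLinearMap.proj_apply, Matrix.fromBlocks_mulVec]
          simp only [Sum.elim_inl, Matrix.zero_mulVec, add_zero]
          rw [dotProduct_comm]; rfl
        · simp [ha, rowF_dot, hP]
      · have h1 := (hq.deriv (x ∘ Sum.inr) (row ω ℓ)).comp x hrr
        refine (h1.congr_fderiv ?_).congr_of_eventuallyEq (Eventually.of_forall fun s => ?_)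
        · ext h
          simp only [ContinuousLinearMap.comp_apply, dotCLM_apply, matCLM_apply,
            ContinuousLinearMap.proj_apply, Matrix.fromBlocks_mulVec]
          simp only [Sum.elim_inr, Matrix.zero_mulVec, zero_add]
          rw [dotProduct_comm]; rfl
        · simp [ha, rowF_dot, hQ])
    (by
      refine continuous_matCLM.comp (Continuous.matrix_fromBlocks ?_ continuous_const
        continuous_const ?_)
      · exact continuous_detM.comp (Continuous.prodMk
          ((continuous_pi fun k => (hp.dcont k).comp hl).comp continuous_fst) continuous_snd)
      · exact continuous_detM.comp (Continuous.prodMk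
          ((continuous_pi fun k => (hq.dcont k).comp hr).comp continuous_fst) continuous_snd))
    hS R (fun x hx => by
      rw [← abs_pos, hdet]
      have := hpos x hx
      positivity)
    (fun x hx k l => by
      have h1 : ∀ k, ∑ i, R x k i • a x i = _ := fun k => congrFun (hL x) k
      have e1 : P x ⬝ᵥ P x = 1 := hp.unit _
      have e2 : ortho (P x) (Q x) ⬝ᵥ ortho (P x) (Q x) = 1 :=
        ortho_dot_self e1 (hq.unit _) (hlt x hx)
      have e3 : P x ⬝ᵥ ortho (P x) (Q x) = 0 := dot_ortho_eq_zero e1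
      have e4 : ortho (P x) (Q x) ⬝ᵥ P x = 0 := by rw [dotProduct_comm, e3]
      rw [h1, h1]
      rcases k with k | k <;> rcases l with l | l <;> simp [rowF_dot_rowF, e1, e2, e3, e4])
  convert! this using 1
  · refine lintegral_congr fun ω => ?_
    congr 1
    ext x
    simp only [funext_iff, ha, Set.mem_ofPred_eq, Sum.forall, Sum.elim_inl, Sum.elim_inr, rowF_dot,
      Pi.zero_apply, add_zero, forall_and, hP, hQ]
  · refine lintegral_congr fun x => ?_
    congr 2
    · rw [hdet]
      simp [gpdf, two_mul, hP, hQ]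
    · ext ω
      rw [det_matCLM, Matrix.det_fromBlocks_zero₂₁, abs_mul, hL]
      have key : ∀ b : Fin m → J → ℝ, detM (fun k => proj2 (P x) (ortho (P x) (Q x)) (b k)) ω
          = detM b (palmShift (Sum.elim (fun ℓ => rowF ℓ (P x))
            (fun ℓ => rowF ℓ (ortho (P x) (Q x)))) ((R x).mulVec (-(0 : (Fin m ⊕ Fin m → ℝ) → Fin m ⊕ Fin m → ℝ) x)) ω) := by
        intro b
        ext ℓ k
        rw [detM_apply, detM_apply, ← rowF_dot _ (b k), dot_palmShift]
        rw [Fintype.sum_sum_type]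
        simp only [Sum.elim_inl, Sum.elim_inr, rowF_dot_rowF]
        simp only [rowF_dot]
        simp [proj2, sub_dotProduct]
        ring
      rw [key, key]

end Rows
end

section

section RowLaw
variable {m : ℕ} {J J' K : Type*} [Fintype J] [Fintype J'] [Fintype K]

lemma stdG_map_rowwise (a : K → J → ℝ) (b : K → J' → ℝ) (h : ∀ k l, a k ⬝ᵥ a l = b k ⬝ᵥ b l) :
    (stdG (Fin m × J)).map (fun ω (i : Fin m × K) => a i.2 ⬝ᵥ row ω i.1)
      = (stdG (Fin m × J')).map (fun ω (i : Fin m × K) => b i.2 ⬝ᵥ row ω i.1) := by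
  simp_rw [← rowF_dot]
  exact stdG_map_rows _ _ fun k l => by rw [rowF_dot_rowF, rowF_dot_rowF, h]

lemma measurable_rowwise (a : K → J → ℝ) :
    Measurable fun (ω : Fin m × J → ℝ) (i : Fin m × K) => a i.2 ⬝ᵥ row ω i.1 := by
  refine Continuous.measurable (continuous_pi fun i => ?_)
  exact Continuous.dotProduct continuous_const (continuous_row i.1)

lemma lintegral_rowwise (a : K → J → ℝ) (b : K → J' → ℝ) (h : ∀ k l, a k ⬝ᵥ a l = b k ⬝ᵥ b l)
    {H : (Fin m × K → ℝ) → ENNReal} (hH : Measurable H) :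
    ∫⁻ ω, H (fun i => a i.2 ⬝ᵥ row ω i.1) ∂(stdG (Fin m × J))
      = ∫⁻ ω, H (fun i => b i.2 ⬝ᵥ row ω i.1) ∂(stdG (Fin m × J')) := by
  rw [← lintegral_map hH (measurable_rowwise a), stdG_map_rowwise a b h,
    lintegral_map hH (measurable_rowwise b)]

lemma measurable_det_of {n : Type*} [Fintype n] [DecidableEq n] {X : Type*} [MeasurableSpace X]
    {M : X → Matrix n n ℝ} (h : ∀ i j, Measurable fun x => M x i j) :
    Measurable fun x => (M x).det := by
  simp_rw [Matrix.det_apply']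
  fun_prop

/-- Columns of the first matrix of the correlated pair. -/
def mA (i : Fin m) : Fin m ⊕ Fin m → ℝ := Pi.single (Sum.inl i) 1

/-- Columns of the second matrix of the correlated pair with correlations `c`. -/
def mB (c : Fin m → ℝ) (i : Fin m) : Fin m ⊕ Fin m → ℝ :=
  Sum.elim (Pi.single i (c i)) (Pi.single i (√(1 - c i ^ 2)))

lemma mA_dot_mA (i j : Fin m) : mA i ⬝ᵥ mA j = if i = j then 1 else 0 := by
  simp [mA, Pi.single_apply, eq_comm]

lemma mA_dot_mB (c : Fin m → ℝ) (i j : Fin m) : mA i ⬝ᵥ mB c j = if i = j then c i else 0 := by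
  simp only [mA, mB, single_dotProduct, one_mul, Sum.elim_inl, Pi.single_apply]
  split_ifs with h <;> simp [h]

lemma mB_dot_mB {c : Fin m → ℝ} (hc : ∀ i, |c i| ≤ 1) (i j : Fin m) :
    mB c i ⬝ᵥ mB c j = if i = j then 1 else 0 := by
  simp only [mB, sumElim_dotProduct_sumElim, single_dotProduct]
  split_ifs with h
  · subst h
    simp only [Pi.single_eq_same]
    have := (sq_le_one_iff_abs_le_one (c i)).2 (hc i)
    rw [← pow_two, ← pow_two, Real.sq_sqrt (by linarith)]; ring
  · simp [h]

/-- Mean of the product of absolute determinants of a correlated pair of Gaussian matrices. -/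
def Gl (c : Fin m → ℝ) : ENNReal :=
  ∫⁻ ω, ENNReal.ofReal (|(detM mA ω).det| * |(detM (mB c) ω).det|)
    ∂(stdG (Fin m × (Fin m ⊕ Fin m)))

lemma detM_smul (τ : Fin m → ℝ) (u : Fin m → J → ℝ) (ω : Fin m × J → ℝ) :
    (detM (fun i => τ i • u i) ω).det = (∏ i, τ i) * (detM u ω).det := by
  rw [← Matrix.det_mul_row]
  congr 1
  ext ℓ k
  simp [detM]

lemma measurable_detM_abs (u : Fin m → J → ℝ) :
    Measurable fun ω : Fin m × J → ℝ => |(detM u ω).det| := by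
  refine Measurable.abs (measurable_det_of fun i j => ?_)
  exact (Continuous.dotProduct continuous_const (continuous_row i)).measurable

lemma lintegral_pair_det {u w : Fin m → J → ℝ} {u' w' : Fin m → J' → ℝ}
    (h1 : ∀ i j, u i ⬝ᵥ u j = u' i ⬝ᵥ u' j) (h2 : ∀ i j, u i ⬝ᵥ w j = u' i ⬝ᵥ w' j)
    (h3 : ∀ i j, w i ⬝ᵥ w j = w' i ⬝ᵥ w' j) (f : ℝ → ℝ → ENNReal)
    (hf : Measurable (Function.uncurry f)) :
    ∫⁻ ω, f |(detM u ω).det| |(detM w ω).det| ∂(stdG (Fin m × J))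
      = ∫⁻ ω, f |(detM u' ω).det| |(detM w' ω).det| ∂(stdG (Fin m × J')) := by
  have hm : ∀ s : Fin m → Fin m ⊕ Fin m, Measurable fun x : Fin m × (Fin m ⊕ Fin m) → ℝ =>
      |(Matrix.of fun ℓ k => x (ℓ, s k)).det| := fun s =>
    (measurable_det_of fun i j => measurable_pi_apply _).abs
  exact lintegral_rowwise (K := Fin m ⊕ Fin m) (Sum.elim u w) (Sum.elim u' w')
    (by
      rintro (k | k) (l | l)
      · exact h1 k l
      · exact h2 k l
      · simp only [Sum.elim_inl, Sum.elim_inr]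
        rw [dotProduct_comm, h2, dotProduct_comm]
      · exact h3 k l)
    (H := fun x => f |(Matrix.of fun ℓ k => x (ℓ, Sum.inl k)).det|
      |(Matrix.of fun ℓ k => x (ℓ, Sum.inr k)).det|)
    (hf.comp ((hm Sum.inl).prodMk (hm Sum.inr)))

lemma pair_det_law {u w : Fin m → J → ℝ} {τ c : Fin m → ℝ} (hc : ∀ i, |c i| ≤ 1)
    (h1 : ∀ i j, u i ⬝ᵥ u j = if i = j then τ i ^ 2 else 0)
    (h2 : ∀ i j, u i ⬝ᵥ w j = if i = j then τ i ^ 2 * c i else 0)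
    (h3 : ∀ i j, w i ⬝ᵥ w j = if i = j then τ i ^ 2 else 0) :
    ∫⁻ ω, ENNReal.ofReal (|(detM u ω).det| * |(detM w ω).det|) ∂(stdG (Fin m × J))
      = ENNReal.ofReal (∏ i, τ i ^ 2) * Gl c := by
  have e := lintegral_pair_det (u := u) (w := w) (u' := fun i => τ i • mA i)
    (w' := fun i => τ i • mB c i)
    (fun i j => by
      rw [h1, smul_dotProduct, dotProduct_smul, mA_dot_mA]
      split_ifs with h
      · subst h; simp [pow_two]
      · simp)
    (fun i j => by
      rw [h2, smul_dotProduct, dotProduct_smul, mA_dot_mB]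
      split_ifs with h
      · subst h; simp [pow_two, mul_assoc]
      · simp)
    (fun i j => by
      rw [h3, smul_dotProduct, dotProduct_smul, mB_dot_mB hc]
      split_ifs with h
      · subst h; simp [pow_two]
      · simp)
    (fun x y => ENNReal.ofReal (x * y)) (by unfold Function.uncurry; fun_prop)
  rw [e, Gl, ← lintegral_const_mul' _ _ ENNReal.ofReal_ne_top]
  refine lintegral_congr fun ω => ?_
  rw [detM_smul, detM_smul, ← ENNReal.ofReal_mul (by positivity), abs_mul, abs_mul,
    Finset.prod_pow, ← sq_abs]
  ring_nf

end RowLaw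

section Lift
variable {m d : ℕ}

lemma isFeat_ft : IsFeat (ft d : (Fin m → ℝ) → _) (dft d) where
  cont := continuous_ft
  dcont := continuous_dft
  deriv t w := by
    refine (HasFDerivAt.dot_const (hasFDerivAt_ft t) w).congr_fderiv ?_
    ext h
    rw [ContinuousLinearMap.comp_apply, dotCLM_apply, dotCLM_apply, fderiv_ft_apply,
      sum_dotProduct]
    simp [dotProduct, Finset.mul_sum, mul_assoc]
  unit := ft_dot_self
  orth t k := by
    rw [dft_eq_dhomE, dotProduct_comm, ft, dhomE_dot_homE, dotProduct_comm (dvs t k), dot_vs_dvs, mul_zero]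

/-- Feature map of the mixture `a Y + b Y'` of two independent systems. -/
def liftF {J : Type*} (a b : ℝ) (p : J → ℝ) : J ⊕ J → ℝ := Sum.elim (a • p) (b • p)

lemma liftF_dot {J : Type*} [Fintype J] (a b a' b' : ℝ) (p q : J → ℝ) :
    liftF a b p ⬝ᵥ liftF a' b' q = (a * a' + b * b') * (p ⬝ᵥ q) := by
  simp only [liftF, sumElim_dotProduct_sumElim, smul_dotProduct, dotProduct_smul, smul_eq_mul]
  ring

lemma liftF_dot_elim {J : Type*} [Fintype J] (a b : ℝ) (p : J → ℝ) (w : J ⊕ J → ℝ) :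
    liftF a b p ⬝ᵥ w = p ⬝ᵥ (a • (w ∘ Sum.inl) + b • (w ∘ Sum.inr)) := by
  simp only [liftF, dotProduct, Fintype.sum_sum_type, Sum.elim_inl, Sum.elim_inr,
    Pi.smul_apply, Pi.add_apply, smul_eq_mul, Function.comp, ← Finset.sum_add_distrib]
  exact Finset.sum_congr rfl fun i _ => by ring

lemma continuous_liftF {J : Type*} [Fintype J] (a b : ℝ) :
    Continuous (liftF a b : (J → ℝ) → _) := by
  refine continuous_pi fun j => ?_
  rcases j with j | j <;> simp [liftF] <;> fun_prop

lemma IsFeat.lift {J : Type*} [Fintype J] {p : (Fin m → ℝ) → J → ℝ}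
    {dp : (Fin m → ℝ) → Fin m → J → ℝ} (h : IsFeat p dp) {a b : ℝ} (hab : a ^ 2 + b ^ 2 = 1) :
    IsFeat (fun t => liftF a b (p t)) (fun t k => liftF a b (dp t k)) where
  cont := (continuous_liftF a b).comp h.cont
  dcont k := (continuous_liftF a b).comp (h.dcont k)
  deriv t w := by
    simp_rw [liftF_dot_elim]
    exact h.deriv t _
  unit t := by rw [liftF_dot, h.unit]; linarith
  orth t k := by rw [liftF_dot, h.orth, mul_zero]

end Lift
end

section

section Pair
variable {m : ℕ}

lemma dot_sq_le {ι : Type*} [Fintype ι] (x y : ι → ℝ) : (x ⬝ᵥ y) ^ 2 ≤ (x ⬝ᵥ x) * (y ⬝ᵥ y) := by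
  have := Finset.sum_mul_sq_le_sq_mul_sq Finset.univ x y
  simpa [dotProduct, pow_two] using this

lemma vs_injective : Function.Injective (vs : (Fin m → ℝ) → _) := by
  intro s t h
  have h0 := congrFun h 0
  rw [vs_zero_coord, vs_zero_coord, inv_inj] at h0
  ext k
  have hk := congrFun h k.succ
  simp only [vs, Pi.smul_apply, xh_succ, smul_eq_mul, h0] at hk
  exact mul_left_cancel₀ (inv_ne_zero (nrm_pos t).ne') hk

lemma vs_dot_sq_lt_one {s t : Fin m → ℝ} (h : s ≠ t) : (vs s ⬝ᵥ vs t) ^ 2 < 1 := by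
  set c := vs s ⬝ᵥ vs t with hc
  have key : (vs s - c • vs t) ⬝ᵥ (vs s - c • vs t) = 1 - c ^ 2 := by
    simp only [sub_dotProduct, dotProduct_sub, smul_dotProduct, dotProduct_smul, vs_dot_self,
      dotProduct_comm (vs t) (vs s), ← hc, smul_eq_mul]
    ring
  by_contra hlt
  have h0 : (vs s - c • vs t) ⬝ᵥ (vs s - c • vs t) = 0 :=
    le_antisymm (by rw [key]; linarith) (dot_self_nonneg _)
  have h1 : vs s = c • vs t := sub_eq_zero.1 (dotProduct_self_eq_zero.1 h0)
  have hc2 : c ^ 2 = 1 := by linarith [key ▸ h0]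
  have hz := congrFun h1 0
  simp only [Pi.smul_apply, vs_zero_coord, smul_eq_mul] at hz
  have hs := inv_pos.2 (nrm_pos s)
  have ht := inv_pos.2 (nrm_pos t)
  have hcpos : 0 < c := by
    by_contra hn
    have := mul_nonneg (neg_nonneg.2 (not_lt.1 hn)) ht.le
    linarith
  have : c = 1 := by nlinarith
  exact h (vs_injective (by rw [h1, this, one_smul]))

/-- Correlation of two mixed systems. -/
def kA (d : ℕ) (r c : ℝ) : ℝ := r * c ^ d

/-- Squared correlation of value and gradient. -/
def kB (d : ℕ) (r c : ℝ) : ℝ := r ^ 2 * d * (c ^ (d - 1)) ^ 2 * (1 - c ^ 2)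

/-- Conditional variance of the radial derivative. -/
def kS (d : ℕ) (r c : ℝ) : ℝ := 1 - kB d r c / (1 - kA d r c ^ 2)

/-- Correlation of the radial derivatives. -/
def kD (d : ℕ) (r c : ℝ) : ℝ := r * (c ^ (d - 1) * c - (d - 1 : ℕ) * c ^ (d - 2) * (1 - c ^ 2))

/-- Conditional covariance of the radial derivatives. -/
def kK (d : ℕ) (r c : ℝ) : ℝ := kD d r c - kA d r c * kB d r c / (1 - kA d r c ^ 2)

/-- Correlation of the tangential derivatives. -/
def kE (d : ℕ) (r c : ℝ) : ℝ := r * c ^ (d - 1)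

/-- Conditional correlations of the derivatives. -/
def kC [NeZero m] (d : ℕ) (r c : ℝ) (i : Fin m) : ℝ :=
  if i = 0 then kK d r c / kS d r c else kE d r c

/-- The map `w ↦ proj2 u g (liftF a b w)`. -/
def projLift {J : Type*} [Fintype J] (u g : J ⊕ J → ℝ) (a b : ℝ) : (J → ℝ) →ₗ[ℝ] (J ⊕ J → ℝ) where
  toFun w := proj2 u g (liftF a b w)
  map_add' w w' := by
    have : liftF a b (w + w') = liftF a b w + liftF a b w' := by
      ext j; rcases j with j | j <;> simp [liftF, mul_add]
    simp only [this, proj2, add_dotProduct, add_smul]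
    abel
  map_smul' c w := by
    have : liftF a b (c • w) = c • liftF a b w := by
      ext j; rcases j with j | j <;> simp [liftF] <;> ring
    simp only [this, proj2, smul_dotProduct, smul_eq_mul, mul_smul, smul_sub, RingHom.id_apply]

lemma abs_det_projLift {d : ℕ} (u g : Jx m d ⊕ Jx m d → ℝ) (a b : ℝ)
    (O : Matrix (Fin (m + 1)) (Fin (m + 1)) ℝ) (hO : O * O.transpose = 1)
    (t : Fin m → ℝ) (h0 : O 0 = vs t) (ω : Fin m × (Jx m d ⊕ Jx m d) → ℝ) :
    |(detM (fun k => proj2 u g (liftF a b (dft d t k))) ω).det|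
      = (nrm t)⁻¹ ^ (m + 1) *
        |(detM (fun i : Fin m => proj2 u g (liftF a b (dhomE (vs t) (O i.succ)))) ω).det| := by
  rw [← abs_det_frame O hO t h0]
  congr 2
  ext ℓ k
  rw [Matrix.of_apply, detM_apply]
  have := map_sum (projLift u g a b)
    (fun i : Fin m => ((nrm t)⁻¹ * O i.succ k.succ) • (dhomE (vs t) (O i.succ) : Jx m d → ℝ))
    Finset.univ
  rw [← dft_eq O hO t h0 k] at this
  refine (congrArg (· ⬝ᵥ row ω ℓ) this).trans ?_
  simp only [sum_dotProduct, map_smul, smul_dotProduct, smul_eq_mul]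
  rfl

lemma exists_frames [NeZero m] {s t : Fin m → ℝ} (h : s ≠ t) :
    ∃ O O' : Matrix (Fin (m + 1)) (Fin (m + 1)) ℝ, O * O.transpose = 1 ∧ O' * O'.transpose = 1 ∧
      O 0 = vs s ∧ O' 0 = vs t ∧
      (∀ i : Fin m, O i.succ ⬝ᵥ vs t = if i = 0 then √(1 - (vs s ⬝ᵥ vs t) ^ 2) else 0) ∧
      (∀ i : Fin m, O' i.succ ⬝ᵥ vs s = if i = 0 then -√(1 - (vs s ⬝ᵥ vs t) ^ 2) else 0) ∧
      ∀ i j : Fin m, O i.succ ⬝ᵥ O' j.succ =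
        if i = j then (if i = 0 then vs s ⬝ᵥ vs t else 1) else 0 := by
  set c := vs s ⬝ᵥ vs t with hc
  have hlt := vs_dot_sq_lt_one h
  set σ := √(1 - c ^ 2) with hσ
  have hσ2 : σ ^ 2 = 1 - c ^ 2 := Real.sq_sqrt (by linarith)
  have hσp : 0 < σ := Real.sqrt_pos.2 (by linarith)
  set b : Fin (m + 1) → ℝ := σ⁻¹ • (vs t - c • vs s) with hb
  have hbs : vs s ⬝ᵥ b = 0 := by
    simp only [hb, dotProduct_smul, dotProduct_sub, vs_dot_self, ← hc, smul_eq_mul]; ring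
  have hbb : b ⬝ᵥ b = 1 := by
    simp only [hb, smul_dotProduct, dotProduct_smul, sub_dotProduct, dotProduct_sub, vs_dot_self,
      dotProduct_comm (vs t) (vs s), ← hc, smul_eq_mul]
    field_simp
    rw [hσ2]; ring
  have hvt : vs t = c • vs s + σ • b := by
    simp only [hb, smul_smul, mul_inv_cancel₀ hσp.ne', one_smul]; abel
  obtain ⟨O, hO, hOw⟩ := exists_frame ![vs s, b]
    (by
      intro i j
      fin_cases i <;> fin_cases j <;>
        simp [vs_dot_self, hbs, hbb, dotProduct_comm b (vs s)])
    ![0, (0 : Fin m).succ]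
    (by
      intro i j hij
      fin_cases i <;> fin_cases j
      · rfl
      · exact (Fin.succ_ne_zero (0 : Fin m) (show _ from hij).symm).elim
      · exact (Fin.succ_ne_zero (0 : Fin m) (show _ from hij)).elim
      · rfl)
  have h0 : O 0 = vs s := hOw 0
  have h1 : O (0 : Fin m).succ = b := hOw 1
  have hd := frame_dot O hO
  let O' : Matrix (Fin (m + 1)) (Fin (m + 1)) ℝ :=
    Matrix.of (Fin.cons (c • O 0 + σ • O (0 : Fin m).succ) fun i : Fin m =>
      if i = 0 then (-σ) • O 0 + c • O (0 : Fin m).succ else O i.succ)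
  have e0 : O' 0 = c • O 0 + σ • O (0 : Fin m).succ := rfl
  have e1 : ∀ i : Fin m, O' i.succ =
      if i = 0 then (-σ) • O 0 + c • O (0 : Fin m).succ else O i.succ := fun i => rfl
  have hs0 : ∀ i : Fin m, i.succ ≠ 0 := Fin.succ_ne_zero
  have hs1 : ∀ i : Fin m, (0 : Fin (m + 1)) ≠ i.succ := fun i => (Fin.succ_ne_zero i).symm
  have dot0s : ∀ i : Fin m, O 0 ⬝ᵥ O i.succ = 0 := fun i => by rw [hd, if_neg (hs1 i)]
  have dots0 : ∀ i : Fin m, O i.succ ⬝ᵥ O 0 = 0 := fun i => by rw [hd, if_neg (hs0 i)]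
  have dot00 : O 0 ⬝ᵥ O 0 = 1 := by rw [hd, if_pos rfl]
  have dotss : ∀ i j : Fin m, O i.succ ⬝ᵥ O j.succ = if i = j then 1 else 0 := fun i j => by
    rw [hd]; simp
  refine ⟨O, O', hO, ?_, h0, ?_, ?_, ?_, ?_⟩
  · ext i j
    rw [Matrix.mul_apply', Matrix.one_apply]
    change O' i ⬝ᵥ O' j = _
    refine Fin.cases ?_ (fun i => ?_) i <;> refine Fin.cases ?_ (fun j => ?_) j
    · simp only [e0, add_dotProduct, dotProduct_add, smul_dotProduct, dotProduct_smul, dot00,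
        dot0s, dots0, dotss, smul_eq_mul, if_true]
      linear_combination hσ2
    · rw [if_neg (hs1 j), e0, e1]
      split_ifs with hj
      · simp only [add_dotProduct, dotProduct_add, smul_dotProduct, dotProduct_smul, dot00,
          dot0s, dots0, dotss, smul_eq_mul, if_true]
        ring
      · simp [-Fin.succ_zero_eq_one, -Fin.succ_zero_eq_one', add_dotProduct, dot0s, dotss, Ne.symm hj]
    · rw [if_neg (hs0 i), e0, e1]
      split_ifs with hj
      · simp only [add_dotProduct, dotProduct_add, smul_dotProduct, dotProduct_smul, dot00,
          dot0s, dots0, dotss, smul_eq_mul, if_true]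
        ring
      · simp [-Fin.succ_zero_eq_one, -Fin.succ_zero_eq_one', dotProduct_add, dots0, dotss, hj]
    · rw [e1, e1]
      by_cases hi : i = 0 <;> by_cases hj : j = 0
      · simp only [hi, hj, add_dotProduct, dotProduct_add, smul_dotProduct, dotProduct_smul, dot00,
          dot0s, dots0, dotss, smul_eq_mul, if_true]
        linear_combination hσ2
      · simp [-Fin.succ_zero_eq_one, -Fin.succ_zero_eq_one', hi, hj, add_dotProduct, dot0s, dotss, Ne.symm hj]
      · simp [-Fin.succ_zero_eq_one, -Fin.succ_zero_eq_one', hi, hj, dotProduct_add, dots0, dotss]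
      · simp [-Fin.succ_zero_eq_one, -Fin.succ_zero_eq_one', hi, hj, dotss]
  · rw [e0, h0, h1, hvt]
  · intro i
    rw [hvt, ← h0, ← h1]
    simp only [dotProduct_add, dotProduct_smul, dots0, dotss, smul_eq_mul]
    split_ifs <;> simp
  · intro i
    rw [e1, ← h0]
    split_ifs with hi
    · simp [-Fin.succ_zero_eq_one, -Fin.succ_zero_eq_one', add_dotProduct, dots0, dot00]
    · exact dots0 i
  · intro i j
    rw [e1]
    by_cases hj : j = 0
    · subst hj
      by_cases hi : i = 0 <;> simp [-Fin.succ_zero_eq_one, -Fin.succ_zero_eq_one', hi, dotProduct_add, dots0, dotss]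
    · rw [if_neg hj, dotss]
      by_cases hij : i = j
      · subst hij; simp [-Fin.succ_zero_eq_one, -Fin.succ_zero_eq_one', hj]
      · simp [-Fin.succ_zero_eq_one, -Fin.succ_zero_eq_one', hij]

lemma kA_sq_lt_one {d : ℕ} (hd : d ≠ 0) {r c : ℝ} (hr : r ^ 2 ≤ 1) (hc : c ^ 2 < 1) :
    kA d r c ^ 2 < 1 := by
  have h1 : (c ^ 2) ^ d < 1 := pow_lt_one₀ (sq_nonneg c) hc hd
  have h0 : 0 ≤ (c ^ 2) ^ d := by positivity
  have : kA d r c ^ 2 = r ^ 2 * (c ^ 2) ^ d := by rw [kA, mul_pow, ← pow_mul, ← pow_mul, mul_comm 2]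
  rw [this]
  nlinarith [sq_nonneg r]

lemma mul_ite_zero_ite_zero [NeZero m] (i j : Fin m) (x y : ℝ) :
    (if i = 0 then x else 0) * (if j = 0 then y else 0)
      = if i = j then (if i = 0 then x * y else 0) else 0 := by
  by_cases hi : i = 0
  · subst hi
    by_cases hj : j = 0
    · subst hj; simp
    · simp [hj, Ne.symm hj]
  · simp [hi]

lemma pair_point [NeZero m] {d : ℕ} (hd : d ≠ 0) {r ρ : ℝ} (hr : r ^ 2 + ρ ^ 2 = 1)
    {s t : Fin m → ℝ} (h : s ≠ t) {c : ℝ} (hc : vs s ⬝ᵥ vs t = c)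
    {p q : Jx m d ⊕ Jx m d → ℝ} (hp : p = liftF 1 0 (ft d s)) (hq : q = liftF r ρ (ft d t)) :
    0 ≤ kS d r c ∧ (∀ i : Fin m, |kC d r c i| ≤ 1) ∧
    ∫⁻ ω, ENNReal.ofReal
          (|(detM (fun k => proj2 p (ortho p q) (liftF 1 0 (dft d s k))) ω).det| *
           |(detM (fun k => proj2 p (ortho p q) (liftF r ρ (dft d t k))) ω).det|)
           ∂(stdG (Fin m × (Jx m d ⊕ Jx m d)))
      = ENNReal.ofReal ((nrm s)⁻¹ ^ (m + 1) * (nrm t)⁻¹ ^ (m + 1) * (d ^ m * kS d r c)) *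
        Gl (kC d r c : Fin m → ℝ) := by
  obtain ⟨O, O', hO, hO', h0, h0', hOt, hOs, hOO⟩ := exists_frames h
  rw [hc] at hOt hOs hOO
  have hc1 : c ^ 2 < 1 := hc ▸ vs_dot_sq_lt_one h
  have hA1 : kA d r c ^ 2 < 1 := kA_sq_lt_one hd (by nlinarith [sq_nonneg ρ]) hc1
  set σ := √(1 - c ^ 2) with hσ
  have hσ2 : σ ^ 2 = 1 - c ^ 2 := Real.sq_sqrt (by linarith)
  have hpp : p ⬝ᵥ p = 1 := by rw [hp, liftF_dot, ft_dot_self]; ring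
  have hqq : q ⬝ᵥ q = 1 := by rw [hq, liftF_dot, ft_dot_self]; linarith
  have hpq : p ⬝ᵥ q = kA d r c := by rw [hp, hq, liftF_dot, ft_dot, hc, kA]; ring
  have hlt : (p ⬝ᵥ q) ^ 2 < 1 := by rw [hpq]; exact hA1
  have hg := ortho_dot_self hpp hqq hlt
  have hug : p ⬝ᵥ ortho p q = 0 := dot_ortho_eq_zero hpp
  set α : Fin m → Jx m d ⊕ Jx m d → ℝ := fun i => liftF 1 0 (dhomE (vs s) (O i.succ)) with hα
  set β : Fin m → Jx m d ⊕ Jx m d → ℝ := fun i => liftF r ρ (dhomE (vs t) (O' i.succ)) with hβ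
  have hfr := frame_dot O hO
  have hfr' := frame_dot O' hO'
  have Os : ∀ i : Fin m, O i.succ ⬝ᵥ vs s = 0 := fun i => by rw [← h0, hfr]; simp
  have Ot : ∀ i : Fin m, O' i.succ ⬝ᵥ vs t = 0 := fun i => by rw [← h0', hfr']; simp
  have hαp : ∀ i, α i ⬝ᵥ p = 0 := fun i => by
    simp only [hα, hp]; rw [liftF_dot, ft, dhomE_dot_homE, Os]; ring
  have hβq : ∀ i, β i ⬝ᵥ q = 0 := fun i => by
    simp only [hβ, hq]; rw [liftF_dot, ft, dhomE_dot_homE, Ot]; ring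
  set e : ℝ := r * (d * c ^ (d - 1) * σ) with he
  have hαq : ∀ i, α i ⬝ᵥ q = if i = 0 then e else 0 := fun i => by
    simp only [hα, hq]; rw [liftF_dot, ft, dhomE_dot_homE, hOt, hc]
    split_ifs <;> simp [he]
  have hβp : ∀ i, β i ⬝ᵥ p = if i = 0 then -e else 0 := fun i => by
    simp only [hβ, hp]; rw [liftF_dot, ft, dhomE_dot_homE, hOs, dotProduct_comm (vs t), hc]
    split_ifs <;> simp [he]
  have hαα : ∀ i j, α i ⬝ᵥ α j = if i = j then (d : ℝ) else 0 := fun i j => by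
    simp only [hα]
    rw [liftF_dot, dhomE_dot_dhomE, Os, hfr, vs_dot_self]
    simp
  have hββ : ∀ i j, β i ⬝ᵥ β j = if i = j then (d : ℝ) else 0 := fun i j => by
    simp only [hβ]
    rw [liftF_dot, dhomE_dot_dhomE, Ot, hfr', vs_dot_self, ← pow_two, ← pow_two, hr]
    simp
  have hαβ : ∀ i j, α i ⬝ᵥ β j =
      if i = j then (if i = 0 then d * kD d r c else d * kE d r c) else 0 := fun i j => by
    simp only [hα, hβ]
    rw [liftF_dot, dhomE_dot_dhomE, hOt, dotProduct_comm (vs s) (O' j.succ), hOs, hOO, hc, kD, kE]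
    by_cases hij : i = j
    · subst hij
      by_cases hi : i = 0
      · simp only [hi, if_true]; linear_combination (-(r * d * (d - 1 : ℕ) * c ^ (d - 2))) * hσ2
      · simp only [hi, if_true, if_false]; ring
    · rw [if_neg hij, if_neg hij]
      by_cases hi : i = 0
      · rw [if_neg (fun hj => hij (hi.trans hj.symm) : ¬ j = 0)]; ring
      · rw [if_neg hi]; ring
  set D := 1 - kA d r c ^ 2 with hD
  have hDp : 0 < D := by rw [hD]; linarith
  have hsq : ((√D)⁻¹) ^ 2 = D⁻¹ := by rw [inv_pow, Real.sq_sqrt hDp.le]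
  have hg' : ∀ w, w ⬝ᵥ ortho p q = (√D)⁻¹ * (w ⬝ᵥ q - kA d r c * (w ⬝ᵥ p)) := fun w => by
    rw [dot_ortho, hpq]
  have he2 : e ^ 2 = d * kB d r c := by
    rw [he, kB, ← hσ2]; ring
  set u : Fin m → Jx m d ⊕ Jx m d → ℝ := fun i => proj2 p (ortho p q) (α i) with hu
  set w : Fin m → Jx m d ⊕ Jx m d → ℝ := fun i => proj2 p (ortho p q) (β i) with hw
  have hαg : ∀ i, α i ⬝ᵥ ortho p q = if i = 0 then (√D)⁻¹ * e else 0 := fun i => by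
    rw [hg', hαp, hαq]; split_ifs <;> simp
  have hβg : ∀ i, β i ⬝ᵥ ortho p q = if i = 0 then (√D)⁻¹ * (kA d r c * e) else 0 := fun i => by
    rw [hg', hβp, hβq]; split_ifs <;> simp
  have hkS : kS d r c = 1 - kB d r c / D := rfl
  have hkK : kK d r c = kD d r c - kA d r c * kB d r c / D := rfl
  have huu : ∀ i j, u i ⬝ᵥ u j = if i = j then (if i = 0 then d * kS d r c else d) else 0 := by
    intro i j
    change proj2 _ _ _ ⬝ᵥ proj2 _ _ _ = _
    rw [proj2_dot_proj2 hpp hg hug, hαα, hαp, hαg, hαg, mul_ite_zero_ite_zero]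
    split_ifs
    · rw [hkS]; linear_combination (-e ^ 2) * hsq - D⁻¹ * he2
    · ring
    · ring
  have hww : ∀ i j, w i ⬝ᵥ w j = if i = j then (if i = 0 then d * kS d r c else d) else 0 := by
    intro i j
    change proj2 _ _ _ ⬝ᵥ proj2 _ _ _ = _
    rw [proj2_dot_proj2 hpp hg hug, hββ, hβp, hβp, hβg, hβg, mul_ite_zero_ite_zero,
      mul_ite_zero_ite_zero]
    split_ifs
    · rw [hkS]
      have : D⁻¹ * D = 1 := inv_mul_cancel₀ hDp.ne'
      have hA2 : kA d r c ^ 2 = 1 - D := by rw [hD]; ring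
      linear_combination (-kA d r c ^ 2 * e ^ 2) * hsq - D⁻¹ * e ^ 2 * hA2 + e ^ 2 * this - D⁻¹ * he2
    · ring
    · ring
  have huw : ∀ i j, u i ⬝ᵥ w j =
      if i = j then (if i = 0 then d * kK d r c else d * kE d r c) else 0 := by
    intro i j
    change proj2 _ _ _ ⬝ᵥ proj2 _ _ _ = _
    rw [proj2_dot_proj2 hpp hg hug, hαβ, hαp, hαg, hβg, mul_ite_zero_ite_zero]
    split_ifs
    · rw [hkK]; linear_combination (-e ^ 2 * kA d r c) * hsq - D⁻¹ * kA d r c * he2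
    · ring
    · ring
  have hdp : 0 < (d : ℝ) := by positivity
  have hS0 : 0 ≤ kS d r c := by
    have := dot_self_nonneg (u 0)
    rw [huu, if_pos rfl, if_pos rfl] at this
    exact nonneg_of_mul_nonneg_right this hdp
  have hK2 : kK d r c ^ 2 ≤ kS d r c ^ 2 := by
    have := dot_sq_le (u 0) (w 0)
    rw [huu, hww, huw, if_pos rfl, if_pos rfl, if_pos rfl, if_pos rfl, mul_pow] at this
    have h2 : (0 : ℝ) < d ^ 2 := by positivity
    exact le_of_mul_le_mul_left (by linarith) h2
  have hC : ∀ i : Fin m, |kC d r c i| ≤ 1 := by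
    intro i
    rw [kC]
    split_ifs with hi
    · rw [abs_div]
      exact div_le_one_of_le₀ (sq_le_sq.1 hK2) (abs_nonneg _)
    · have := dot_sq_le (u i) (w i)
      simp only [huu, hww, huw, if_true, if_neg hi, mul_pow] at this
      have h2 : (0 : ℝ) < d ^ 2 := by positivity
      rw [← sq_le_one_iff_abs_le_one]
      exact le_of_mul_le_mul_left (by linarith) h2
  refine ⟨hS0, hC, ?_⟩
  have hKS : kS d r c * (kK d r c / kS d r c) = kK d r c := by
    rcases eq_or_ne (kS d r c) 0 with h0 | h0
    · rw [h0] at hK2 ⊢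
      have : kK d r c = 0 := by
        have h3 := sq_nonneg (kK d r c)
        exact pow_eq_zero_iff two_ne_zero |>.1 (by linarith)
      rw [this]; simp
    · field_simp
  let τ : Fin m → ℝ := fun i => √(if i = 0 then d * kS d r c else d)
  have hτ : ∀ i, τ i ^ 2 = if i = 0 then d * kS d r c else d := fun i =>
    Real.sq_sqrt (by split_ifs <;> positivity)
  have key := pair_det_law (u := u) (w := w) (τ := τ) hC (fun i j => by rw [huu, hτ])
    (fun i j => by
      rw [huw, hτ, kC]
      by_cases hi : i = 0
      · simp only [hi, if_true]; rw [mul_assoc, hKS]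
      · simp only [hi, if_false])
    (fun i j => by rw [hww, hτ])
  have hprod : ∏ i, τ i ^ 2 = d ^ m * kS d r c := by
    simp_rw [hτ]
    have : ∀ i : Fin m, (if i = 0 then d * kS d r c else (d : ℝ))
        = d * (if i = 0 then kS d r c else 1) := fun i => by split_ifs <;> simp
    simp_rw [this]
    rw [Finset.prod_mul_distrib]
    simp
  rw [hprod] at key
  have hns := nrm_pos s
  have hnt := nrm_pos t
  rw [ENNReal.ofReal_mul (by positivity), mul_assoc, ← key,
    ← lintegral_const_mul' _ _ ENNReal.ofReal_ne_top]
  refine lintegral_congr fun ω => ?_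
  rw [abs_det_projLift _ _ _ _ O hO s h0, abs_det_projLift _ _ _ _ O' hO' t h0',
    ← ENNReal.ofReal_mul (by positivity), mul_mul_mul_comm]

end Pair
end

section

section DetBounds
variable {m : ℕ}

lemma abs_det_le_prod_norm (A : Fin m → Fin m → ℝ) :
    ‖(Matrix.of A).det‖ ≤ (m ! : ℝ) * ∏ i, ‖A i‖ := by
  rw [Matrix.det_apply']
  refine (norm_sum_le _ _).trans ?_
  have : ∀ σ : Equiv.Perm (Fin m), ‖((Equiv.Perm.sign σ : ℤ) : ℝ) * ∏ i, Matrix.of A (σ i) i‖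
      ≤ ∏ i, ‖A i‖ := by
    intro σ
    rw [norm_mul, norm_prod]
    have h1 : ‖((Equiv.Perm.sign σ : ℤ) : ℝ)‖ = 1 := by
      rcases Int.units_eq_one_or (Equiv.Perm.sign σ) with h | h <;> simp [h]
    rw [h1, one_mul, ← Equiv.prod_comp σ fun i => ‖A i‖]
    exact Finset.prod_le_prod (fun _ _ => norm_nonneg _) fun i _ => norm_le_pi_norm (A (σ i)) i
  refine (Finset.sum_le_sum fun σ _ => this σ).trans ?_
  rw [Finset.sum_const, Finset.card_univ, Fintype.card_perm, Fintype.card_fin, nsmul_eq_mul]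

lemma norm_le_of_entries {A : Fin m → Fin m → ℝ} {x : ℝ} (hx : 0 ≤ x) (h : ∀ i j, |A i j| ≤ x) :
    ‖A‖ ≤ x :=
  (pi_norm_le_iff_of_nonneg hx).2 fun i => (pi_norm_le_iff_of_nonneg hx).2 fun j => h i j

lemma abs_det_le_of_entries {A : Matrix (Fin m) (Fin m) ℝ} {x : ℝ} (hx : 0 ≤ x)
    (h : ∀ i j, |A i j| ≤ x) : |A.det| ≤ (m ! : ℝ) * x ^ m := by
  refine (abs_det_le_prod_norm A).trans ?_
  gcongr
  refine (Finset.prod_le_prod (fun _ _ => norm_nonneg _) fun i _ =>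
    (norm_le_pi_norm (A : Fin m → Fin m → ℝ) i).trans (norm_le_of_entries hx h)).trans ?_
  simp

lemma abs_det_sub_le {A B : Matrix (Fin m) (Fin m) ℝ} {x y : ℝ} (hx : 0 ≤ x) (hy : 0 ≤ y)
    (hA : ∀ i j, |A i j| ≤ x) (hB : ∀ i j, |B i j| ≤ x) (hAB : ∀ i j, |A i j - B i j| ≤ y) :
    |A.det - B.det| ≤ (m ! : ℝ) * m * x ^ (m - 1) * y := by
  let A' : Fin m → Fin m → ℝ := A
  let B' : Fin m → Fin m → ℝ := B
  have := MultilinearMap.norm_image_sub_le_of_bound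
    (Matrix.detRowAlternating (R := ℝ) (n := Fin m)).toMultilinearMap (C := (m ! : ℝ))
    (by positivity) (fun A => abs_det_le_prod_norm A) A' B'
  refine le_trans this ?_
  rw [Fintype.card_fin]
  have h1 : ‖A' - B'‖ ≤ y := norm_le_of_entries hy hAB
  have h2 : max ‖A'‖ ‖B'‖ ≤ x := max_le (norm_le_of_entries hx hA) (norm_le_of_entries hx hB)
  have h3 : 0 ≤ max ‖A'‖ ‖B'‖ := le_max_of_le_left (norm_nonneg _)
  gcongr

end DetBounds

section Moments

/-- Absolute moments of the standard normal law. -/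
def gmom (n : ℕ) : ENNReal := ∫⁻ x, ENNReal.ofReal (|x| ^ n) ∂(gaussianReal 0 1)

lemma gmom_lt_top (n : ℕ) : gmom n < ⊤ := by
  have h := (memLp_id_gaussianReal (μ := 0) (v := 1) (n : NNReal)).integrable_norm_pow'
  have h2 : Integrable (fun x : ℝ => |x| ^ n) (gaussianReal 0 1) := by simpa using h
  rw [gmom]
  exact h2.lintegral_lt_top

variable {J ι : Type*} [Fintype J] [Fintype ι]

lemma lintegral_abs_dot_pow (a : J → ℝ) (n : ℕ) :
    ∫⁻ ω, ENNReal.ofReal (|a ⬝ᵥ ω| ^ n) ∂(stdG J)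
      = ENNReal.ofReal (√(a ⬝ᵥ a) ^ n) * gmom n := by
  have h := stdG_map_rows (κ := Unit) (fun _ => a) (fun (_ : Unit) (_ : Unit) => √(a ⬝ᵥ a))
    (fun _ _ => by
      rw [← Real.mul_self_sqrt (dot_self_nonneg a)]; simp [dotProduct])
  have hm : Measurable fun x : Unit → ℝ => ENNReal.ofReal (|x ()| ^ n) := by fun_prop
  have m1 : Measurable fun (ω : J → ℝ) (_ : Unit) => a ⬝ᵥ ω :=
    measurable_pi_lambda _ fun _ =>
      (Continuous.dotProduct continuous_const continuous_id).measurable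
  have m2 : Measurable fun (ω : Unit → ℝ) (_ : Unit) => (fun _ : Unit => √(a ⬝ᵥ a)) ⬝ᵥ ω :=
    measurable_pi_lambda _ fun _ =>
      (Continuous.dotProduct continuous_const continuous_id).measurable
  have e := congrArg (fun μ => ∫⁻ x, ENNReal.ofReal (|x ()| ^ n) ∂μ) h
  rw [lintegral_map hm m1, lintegral_map hm m2] at e
  rw [e]
  have mp : MeasurePreserving (Function.eval ()) (stdG Unit) (gaussianReal 0 1) :=
    measurePreserving_eval (fun _ : Unit => gaussianReal 0 1) ()
  rw [gmom, ← lintegral_const_mul' _ _ ENNReal.ofReal_ne_top, ← mp.lintegral_comp (by fun_prop)]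
  refine lintegral_congr fun ω => ?_
  rw [← ENNReal.ofReal_mul (by positivity)]
  simp [dotProduct, abs_mul, mul_pow, abs_of_nonneg]

/-- Moment constants of sums of Gaussian linear forms. -/
def lmom (k n : ℕ) : ENNReal := ENNReal.ofReal ((k : ℝ) ^ n) * gmom n

lemma lmom_lt_top (k n : ℕ) : lmom k n < ⊤ :=
  ENNReal.mul_lt_top ENNReal.ofReal_lt_top (gmom_lt_top n)

lemma lin_moment (a : ι → J → ℝ) {D : ℝ} (hD : 0 ≤ D) (ha : ∀ i, a i ⬝ᵥ a i ≤ D ^ 2) (n : ℕ) :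
    ∫⁻ ω, ENNReal.ofReal ((∑ i, |a i ⬝ᵥ ω|) ^ n) ∂(stdG J)
      ≤ ENNReal.ofReal (D ^ n) * lmom (Fintype.card ι) n := by
  rcases n with _ | n
  · simp [lmom, gmom]
  have hpt : ∀ ω : J → ℝ, (∑ i, |a i ⬝ᵥ ω|) ^ (n + 1)
      ≤ (Fintype.card ι : ℝ) ^ n * ∑ i, |a i ⬝ᵥ ω| ^ (n + 1) := fun ω => by
    exact pow_sum_le_card_mul_sum_pow (s := Finset.univ) (fun i _ => abs_nonneg (a i ⬝ᵥ ω)) n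
  refine (lintegral_mono fun ω => ENNReal.ofReal_le_ofReal (hpt ω)).trans ?_
  simp_rw [ENNReal.ofReal_mul (show (0 : ℝ) ≤ (Fintype.card ι : ℝ) ^ n by positivity)]
  rw [lintegral_const_mul' _ _ ENNReal.ofReal_ne_top]
  have : ∀ ω : J → ℝ, ENNReal.ofReal (∑ i, |a i ⬝ᵥ ω| ^ (n + 1))
      = ∑ i, ENNReal.ofReal (|a i ⬝ᵥ ω| ^ (n + 1)) := fun ω =>
    ENNReal.ofReal_sum_of_nonneg fun i _ => by positivity
  simp_rw [this]
  rw [lintegral_finsetSum]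
  swap
  · intro i _
    have : Measurable fun ω : J → ℝ => a i ⬝ᵥ ω :=
      (Continuous.dotProduct continuous_const continuous_id).measurable
    fun_prop
  simp_rw [lintegral_abs_dot_pow]
  have h2 : ∑ i, ENNReal.ofReal (√(a i ⬝ᵥ a i) ^ (n + 1)) * gmom (n + 1)
      ≤ ∑ _i : ι, ENNReal.ofReal (D ^ (n + 1)) * gmom (n + 1) := by
    refine Finset.sum_le_sum fun i _ => ?_
    gcongr
    exact Real.sqrt_le_iff.2 ⟨hD, ha i⟩
  refine (mul_le_mul_right h2 _).trans (le_of_eq ?_)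
  rw [Finset.sum_const, Finset.card_univ, nsmul_eq_mul, lmom, pow_succ (Fintype.card ι : ℝ),
    ENNReal.ofReal_mul (by positivity), ENNReal.ofReal_natCast]
  ring

end Moments
end

section

section DetLaw
variable {m : ℕ} {J : Type*} [Fintype J]

/-- The square matrix with the given entries. -/
def Zm (ω : Fin m × Fin m → ℝ) : Matrix (Fin m) (Fin m) ℝ := fun ℓ k => ω (ℓ, k)

lemma continuous_Zm_det : Continuous fun ω : Fin m × Fin m → ℝ => (Zm ω).det := by
  refine Continuous.matrix_det ?_
  exact continuous_pi fun i => continuous_pi fun j => continuous_apply (i, j)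

lemma detM_single (ω : Fin m × Fin m → ℝ) :
    detM (fun k : Fin m => (Pi.single k 1 : Fin m → ℝ)) ω = Zm ω := by
  ext ℓ k
  simp [detM_apply, row, Zm]

lemma det_law {u : Fin m → J → ℝ} (h : ∀ i j, u i ⬝ᵥ u j = if i = j then 1 else 0)
    {f : ℝ → ENNReal} (hf : Measurable f) :
    ∫⁻ ω, f |(detM u ω).det| ∂(stdG (Fin m × J))
      = ∫⁻ ω, f |(Zm ω).det| ∂(stdG (Fin m × Fin m)) := by
  have h' : ∀ i j, u i ⬝ᵥ u j =
      (Pi.single i 1 : Fin m → ℝ) ⬝ᵥ (Pi.single j 1 : Fin m → ℝ) := fun i j => by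
    rw [h]; simp [Pi.single_apply, eq_comm]
  have := lintegral_pair_det h' h' h' (fun x _ => f x) (hf.comp measurable_fst)
  simpa only [detM_single] using this

/-- Absolute moments of the determinant of a Gaussian matrix. -/
def DP (m p : ℕ) : ENNReal :=
  ∫⁻ ω : Fin m × Fin m → ℝ, ENNReal.ofReal (|(Zm ω).det| ^ p) ∂(stdG (Fin m × Fin m))

lemma lintegral_abs_det_pow_lt_top {a : Fin m → Fin m → Fin m × J → ℝ} (p : ℕ) :
    ∫⁻ ω, ENNReal.ofReal (|(Matrix.of fun ℓ k => a ℓ k ⬝ᵥ ω).det| ^ p) ∂(stdG (Fin m × J)) < ⊤ := by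
  set D := ∑ i : Fin m × Fin m, √(a i.1 i.2 ⬝ᵥ a i.1 i.2) with hD
  have hb : ∀ ω, |(Matrix.of fun ℓ k => a ℓ k ⬝ᵥ ω).det| ^ p
      ≤ (m ! : ℝ) ^ p * (∑ i : Fin m × Fin m, |a i.1 i.2 ⬝ᵥ ω|) ^ (m * p) := fun ω => by
    rw [pow_mul, ← mul_pow]
    refine pow_le_pow_left₀ (abs_nonneg _) (abs_det_le_of_entries
      (Finset.sum_nonneg fun _ _ => abs_nonneg _) fun i j => ?_) _
    exact Finset.single_le_sum (f := fun i : Fin m × Fin m => |a i.1 i.2 ⬝ᵥ ω|)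
      (fun _ _ => abs_nonneg _) (Finset.mem_univ (i, j))
  refine (lintegral_mono fun ω => ENNReal.ofReal_le_ofReal (hb ω)).trans_lt ?_
  simp_rw [ENNReal.ofReal_mul (show (0 : ℝ) ≤ (m ! : ℝ) ^ p by positivity)]
  rw [lintegral_const_mul' _ _ ENNReal.ofReal_ne_top]
  refine ENNReal.mul_lt_top ENNReal.ofReal_lt_top ?_
  have hD0 : 0 ≤ D := Finset.sum_nonneg fun _ _ => Real.sqrt_nonneg _
  refine (lin_moment (fun i : Fin m × Fin m => a i.1 i.2) hD0 (fun i => ?_) _).trans_lt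
    (ENNReal.mul_lt_top ENNReal.ofReal_lt_top (lmom_lt_top _ _))
  rw [← Real.sqrt_le_left hD0]
  exact Finset.single_le_sum (f := fun i : Fin m × Fin m => √(a i.1 i.2 ⬝ᵥ a i.1 i.2))
    (fun _ _ => Real.sqrt_nonneg _) (Finset.mem_univ i)

lemma lintegral_detM_pow_lt_top (u : Fin m → J → ℝ) (p : ℕ) :
    ∫⁻ ω, ENNReal.ofReal (|(detM u ω).det| ^ p) ∂(stdG (Fin m × J)) < ⊤ := by
  have := lintegral_abs_det_pow_lt_top (a := fun ℓ k => rowF ℓ (u k)) p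
  simp_rw [rowF_dot] at this
  exact this

lemma DP_lt_top (m p : ℕ) : DP m p < ⊤ := by
  have := lintegral_detM_pow_lt_top (fun k : Fin m => (Pi.single k 1 : Fin m → ℝ)) p
  simp_rw [detM_single] at this
  exact this

lemma Zm_det_zero_null : (volume : Measure (Fin m × Fin m → ℝ)) {ω | (Zm ω).det = 0} = 0 := by
  set N : Set (Fin m × Fin m → ℝ) := {ω | (Zm ω).det = 0} with hN
  have hNm : MeasurableSet N := continuous_Zm_det.measurable (measurableSet_singleton 0)
  let I : Fin m × Fin m → ℝ := fun i => if i.1 = i.2 then 1 else 0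
  have hc : Continuous fun p : (Fin m × Fin m → ℝ) × ℝ => p.1 + p.2 • I := by fun_prop
  have hS : MeasurableSet {p : (Fin m × Fin m → ℝ) × ℝ | p.1 + p.2 • I ∈ N} := hc.measurable hNm
  have h1 : ((volume : Measure (Fin m × Fin m → ℝ)).prod (volume : Measure ℝ))
      {p : (Fin m × Fin m → ℝ) × ℝ | p.1 + p.2 • I ∈ N} = 0 := by
    rw [Measure.measure_prod_null hS]
    refine Eventually.of_forall fun ω => ?_
    refine Set.Countable.measure_zero (Set.Finite.countable ?_) _
    have : Prod.mk ω ⁻¹' {p : (Fin m × Fin m → ℝ) × ℝ | p.1 + p.2 • I ∈ N}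
        ⊆ {x | (Matrix.charpoly (-(Zm ω))).IsRoot x} := by
      intro x hx
      have e : Zm (ω + x • I) = Matrix.scalar (Fin m) x - -(Zm ω) := by
        ext i j
        by_cases hij : i = j <;> simp [Zm, I, hij, add_comm]
      have hx' : (Zm (ω + x • I)).det = 0 := hx
      rw [e] at hx'
      exact (Matrix.eval_charpoly _ _).trans hx'
    exact (Polynomial.finite_setOf_isRoot (Matrix.charpoly_monic _).ne_zero).subset this
  rw [← Measure.prod_swap, Measure.map_apply measurable_swap hS,
    Measure.measure_prod_null (measurable_swap hS)] at h1
  obtain ⟨x, hx⟩ := h1.exists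
  have h2 : Prod.mk x ⁻¹' (Prod.swap ⁻¹' {p : (Fin m × Fin m → ℝ) × ℝ | p.1 + p.2 • I ∈ N})
      = (fun ω => ω + x • I) ⁻¹' N := rfl
  have hx' : volume ((fun ω => ω + x • I) ⁻¹' N) = 0 := hx
  rwa [measure_preimage_add_right] at hx'

lemma Zm_det_ne_zero_ae : ∀ᵐ ω ∂(stdG (Fin m × Fin m)), (Zm ω).det ≠ 0 := by
  rw [stdG_eq_withDensity]
  refine (withDensity_absolutelyContinuous _ _).ae_le ?_
  have := measure_eq_zero_iff_ae_notMem.1 (Zm_det_zero_null (m := m))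
  filter_upwards [this] with ω h using h

lemma DP_pos (m p : ℕ) : 0 < DP m p := by
  rw [pos_iff_ne_zero]
  intro h0
  rw [DP, lintegral_eq_zero_iff
    (continuous_Zm_det.measurable.abs.pow_const p).ennreal_ofReal] at h0
  obtain ⟨ω, h1, h2⟩ := (h0.and (Zm_det_ne_zero_ae (m := m))).exists
  simp only [Pi.zero_apply, ENNReal.ofReal_eq_zero] at h1
  have : 0 < |(Zm ω).det| ^ p := by positivity
  linarith

lemma DP_zero : DP m 0 = 1 := by simp [DP]

/-- Mean absolute determinant of a Gaussian matrix. -/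
def Dm (m : ℕ) : ℝ := (DP m 1).toReal

lemma Dm_pos (m : ℕ) : 0 < Dm m := ENNReal.toReal_pos (DP_pos m 1).ne' (DP_lt_top m 1).ne

lemma ofReal_Dm (m : ℕ) : ENNReal.ofReal (Dm m) = DP m 1 := ENNReal.ofReal_toReal (DP_lt_top m 1).ne

end DetLaw
end

section

section GlFacts
variable {m : ℕ}

/-- The conditional matrix with common part `W` and independent part `U`. -/
def mixM (c : Fin m → ℝ) (W U : Fin m × Fin m → ℝ) : Matrix (Fin m) (Fin m) ℝ :=
  fun ℓ k => √(c k) * W (ℓ, k) + √(1 - c k) * U (ℓ, k)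

/-- Conditional mean absolute determinant given the common part. -/
def mixE (c : Fin m → ℝ) (W : Fin m × Fin m → ℝ) : ENNReal :=
  ∫⁻ U, ENNReal.ofReal |(mixM c W U).det| ∂(stdG (Fin m × Fin m))

lemma smul_single_dot_smul_single {P : Type*} [Fintype P] [DecidableEq P] (x y : ℝ) (i j : P) :
    (x • (Pi.single i 1 : P → ℝ)) ⬝ᵥ (y • (Pi.single j 1 : P → ℝ)) = if i = j then x * y else 0 := by
  by_cases h : i = j
  · subst h; simp [mul_comm]
  · simp [h]

lemma measurable_mixM (c : Fin m → ℝ) :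
    Measurable fun p : (Fin m × Fin m → ℝ) × (Fin m × Fin m → ℝ) =>
      ENNReal.ofReal |(mixM c p.1 p.2).det| := by
  refine (measurable_det_of fun i j => ?_).abs.ennreal_ofReal
  unfold mixM
  fun_prop

lemma measurable_mixE (c : Fin m → ℝ) : Measurable (mixE c) :=
  (measurable_mixM c).lintegral_prod_right'

lemma lintegral_mixE {c : Fin m → ℝ} (h0 : ∀ i, 0 ≤ c i) (h1 : ∀ i, c i ≤ 1) :
    ∫⁻ W, mixE c W ∂(stdG (Fin m × Fin m)) = DP m 1 := by
  unfold mixE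
  rw [← lintegral_prod _ (measurable_mixM c).aemeasurable]
  have h := stdG_map_prod_rows (ι := Fin m × Fin m) (κ := Fin m × Fin m) (ι' := Fin m × Fin m)
    (fun i : Fin m × Fin m => √(c i.2) • (Pi.single i 1 : Fin m × Fin m → ℝ))
    (fun i => √(1 - c i.2) • (Pi.single i 1 : Fin m × Fin m → ℝ))
    (fun i => Pi.single i 1) (fun k l => by
      by_cases hkl : k = l
      · subst hkl
        simp [Real.mul_self_sqrt, h0, h1]
      · simp [hkl])
  have hf : Measurable fun ω : Fin m × Fin m → ℝ => ENNReal.ofReal |(Zm ω).det| :=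
    continuous_Zm_det.measurable.abs.ennreal_ofReal
  have h2 := congrArg (fun μ => ∫⁻ ω, ENNReal.ofReal |(Zm ω).det| ∂μ) h
  rw [lintegral_map hf (by unfold dotProduct; fun_prop),
    lintegral_map hf (by unfold dotProduct; fun_prop)] at h2
  beta_reduce at h2
  simp only [DP, pow_one]
  convert! h2 using 4
  · congr 2
    ext ℓ k
    simp [mixM, Zm]
  · congr 2
    ext ℓ k
    simp [Zm]

lemma lintegral_mixE_sq {c : Fin m → ℝ} (h0 : ∀ i, 0 ≤ c i) (h1 : ∀ i, c i ≤ 1) :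
    ∫⁻ W, mixE c W ^ 2 ∂(stdG (Fin m × Fin m)) = Gl c := by
  have hm2 : Measurable fun p : (Fin m × Fin m → ℝ) × ((Fin m × Fin m ⊕ Fin m × Fin m) → ℝ) =>
      ENNReal.ofReal (|(mixM c p.1 (p.2 ∘ Sum.inl)).det| * |(mixM c p.1 (p.2 ∘ Sum.inr)).det|) := by
    refine (Measurable.mul (measurable_det_of fun i j => ?_).abs
      (measurable_det_of fun i j => ?_).abs).ennreal_ofReal
    all_goals
      unfold mixM
      simp only [Function.comp_apply]
      fun_prop
  have hW : ∀ W, mixE c W ^ 2 = ∫⁻ U, ENNReal.ofReal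
      (|(mixM c W (U ∘ Sum.inl)).det| * |(mixM c W (U ∘ Sum.inr)).det|)
        ∂(stdG (Fin m × Fin m ⊕ Fin m × Fin m)) := fun W => by
    have hs : Measurable fun U => ENNReal.ofReal |(mixM c W U).det| :=
      (measurable_mixM c).comp measurable_prodMk_left
    have := (stdG_sum_measurePreserving (ι := Fin m × Fin m) (κ := Fin m × Fin m)).lintegral_comp
      ((hs.comp measurable_fst).mul (hs.comp measurable_snd))
    rw [sq, mixE, ← lintegral_prod_mul hs.aemeasurable hs.aemeasurable]
    refine this.symm.trans ?_
    simp_rw [ENNReal.ofReal_mul (abs_nonneg _)]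
    rfl
  simp_rw [hW]
  rw [← lintegral_prod _ hm2.aemeasurable]
  have h := stdG_map_prod_rows (ι := Fin m × Fin m) (κ := Fin m × Fin m ⊕ Fin m × Fin m)
    (ι' := Fin m × (Fin m ⊕ Fin m)) (η := Fin m × Fin m ⊕ Fin m × Fin m)
    (Sum.elim (fun i => √(c i.2) • (Pi.single i 1 : Fin m × Fin m → ℝ))
      (fun i => √(c i.2) • (Pi.single i 1 : Fin m × Fin m → ℝ)))
    (Sum.elim (fun i => √(1 - c i.2) • Pi.single (Sum.inl i) (1 : ℝ))
      (fun i => √(1 - c i.2) • Pi.single (Sum.inr i) (1 : ℝ)))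
    (Sum.elim (fun i => rowF i.1 (mA i.2)) (fun i => rowF i.1 (mB c i.2))) (by
      have hc : ∀ i, |c i| ≤ 1 := fun i => abs_le.2 ⟨by linarith [h0 i], h1 i⟩
      have eI : ∀ (i j : Fin m × Fin m) (u v : Fin m ⊕ Fin m → ℝ) (x : ℝ),
          u ⬝ᵥ v = (if i.2 = j.2 then x else 0) →
          rowF i.1 u ⬝ᵥ rowF j.1 v = if i = j then x else 0 := fun i j u v x h => by
        rw [rowF_dot_rowF, h]; simp only [Prod.ext_iff, ite_and]
      rintro (i | i) (j | j)
      · simp only [Sum.elim_inl]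
        rw [eI i j _ _ _ (mA_dot_mA _ _), smul_single_dot_smul_single,
          smul_single_dot_smul_single]
        simp only [Sum.inl.injEq]
        split_ifs with hij
        · rw [hij, Real.mul_self_sqrt (h0 _), Real.mul_self_sqrt (by linarith [h1 j.2])]; ring
        · simp
      · simp only [Sum.elim_inl, Sum.elim_inr]
        rw [eI i j _ _ _ (mA_dot_mB _ _ _), smul_single_dot_smul_single,
          smul_single_dot_smul_single]
        simp only [reduceCtorEq, if_false]
        split_ifs with hij
        · rw [hij, Real.mul_self_sqrt (h0 _)]; ring
        · simp
      · simp only [Sum.elim_inl, Sum.elim_inr]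
        rw [dotProduct_comm (rowF _ _), eI j i _ _ _ (mA_dot_mB _ _ _),
          smul_single_dot_smul_single, smul_single_dot_smul_single]
        simp only [reduceCtorEq, if_false]
        by_cases hij : i = j
        · subst hij
          simp [Real.mul_self_sqrt, h0]
        · simp [hij, Ne.symm hij]
      · simp only [Sum.elim_inr]
        rw [eI i j _ _ _ (mB_dot_mB hc _ _), smul_single_dot_smul_single,
          smul_single_dot_smul_single]
        simp only [Sum.inr.injEq]
        split_ifs with hij
        · rw [hij, Real.mul_self_sqrt (h0 _), Real.mul_self_sqrt (by linarith [h1 j.2])]; ring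
        · simp)
  have hf : Measurable fun ω : (Fin m × Fin m ⊕ Fin m × Fin m) → ℝ =>
      ENNReal.ofReal (|(Zm (ω ∘ Sum.inl)).det| * |(Zm (ω ∘ Sum.inr)).det|) := by
    refine (Measurable.mul (measurable_det_of fun i j => ?_).abs
      (measurable_det_of fun i j => ?_).abs).ennreal_ofReal
    all_goals
      unfold Zm
      simp only [Function.comp_apply]
      fun_prop
  have h2 := congrArg (fun μ => ∫⁻ ω, ENNReal.ofReal (|(Zm (ω ∘ Sum.inl)).det| *
    |(Zm (ω ∘ Sum.inr)).det|) ∂μ) h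
  rw [lintegral_map hf (by unfold dotProduct; fun_prop),
    lintegral_map hf (by unfold dotProduct; fun_prop)] at h2
  rw [Gl]
  convert! h2 using 4
  · congr 2
    · congr 1
      ext ℓ k
      simp [mixM, Zm]
    · congr 1
      ext ℓ k
      simp [mixM, Zm]
  · congr 2
    · congr 1
      ext ℓ k
      simp [Zm, detM_apply, rowF_dot]
    · congr 1
      ext ℓ k
      simp [Zm, detM_apply, rowF_dot]

/-- The sum of the absolute values of the coordinates. -/
def l1 {ι : Type*} [Fintype ι] (ω : ι → ℝ) : ℝ := ∑ i, |ω i|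

lemma l1_nonneg {ι : Type*} [Fintype ι] (ω : ι → ℝ) : 0 ≤ l1 ω :=
  Finset.sum_nonneg fun _ _ => abs_nonneg _

lemma abs_le_l1 {ι : Type*} [Fintype ι] (ω : ι → ℝ) (i : ι) : |ω i| ≤ l1 ω :=
  Finset.single_le_sum (f := fun i => |ω i|) (fun _ _ => abs_nonneg _) (Finset.mem_univ i)

lemma abs_add_abs_le_l1 {ι : Type*} [Fintype ι] (ω : ι → ℝ) {i j : ι} (h : i ≠ j) :
    |ω i| + |ω j| ≤ l1 ω :=
  Finset.add_le_sum (f := fun i => |ω i|) (fun _ _ => abs_nonneg _) (Finset.mem_univ i)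
    (Finset.mem_univ j) h

lemma continuous_l1 {ι : Type*} [Fintype ι] : Continuous (l1 : (ι → ℝ) → ℝ) := by
  unfold l1; fun_prop

lemma integrable_l1_pow {ι : Type*} [Fintype ι] (n : ℕ) :
    Integrable (fun ω : ι → ℝ => l1 ω ^ n) (stdG ι) := by
  classical
  refine ⟨(continuous_l1.pow n).aestronglyMeasurable, ?_⟩
  rw [hasFiniteIntegral_iff_ofReal (Eventually.of_forall fun ω => pow_nonneg (l1_nonneg ω) n)]
  have := lin_moment (fun i : ι => (Pi.single i 1 : ι → ℝ)) zero_le_one (fun i => by simp) n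
  simp only [single_dotProduct, one_mul] at this
  exact this.trans_lt (ENNReal.mul_lt_top ENNReal.ofReal_lt_top (lmom_lt_top _ _))

lemma detM_mA_apply (ω : Fin m × (Fin m ⊕ Fin m) → ℝ) (ℓ k : Fin m) :
    detM mA ω ℓ k = ω (ℓ, Sum.inl k) := by
  simp [detM_apply, mA, row]

lemma detM_mB_apply (c : Fin m → ℝ) (ω : Fin m × (Fin m ⊕ Fin m) → ℝ) (ℓ k : Fin m) :
    detM (mB c) ω ℓ k = c k * ω (ℓ, Sum.inl k) + √(1 - c k ^ 2) * ω (ℓ, Sum.inr k) := by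
  rw [detM_apply, mB, dotProduct, Fintype.sum_sum_type]
  simp [row, Pi.single_apply]

lemma abs_detM_mB_le {c : Fin m → ℝ} (hc : ∀ i, |c i| ≤ 1) (ω : Fin m × (Fin m ⊕ Fin m) → ℝ)
    (ℓ k : Fin m) : |detM (mB c) ω ℓ k| ≤ l1 ω := by
  rw [detM_mB_apply]
  refine le_trans ?_ (abs_add_abs_le_l1 ω (i := (ℓ, Sum.inl k)) (j := (ℓ, Sum.inr k)) (by simp))
  refine (abs_add_le _ _).trans ?_
  rw [abs_mul, abs_mul]
  have h2 : |√(1 - c k ^ 2)| ≤ 1 := by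
    rw [abs_of_nonneg (Real.sqrt_nonneg _)]
    exact Real.sqrt_le_one.2 (by nlinarith [sq_nonneg (c k)])
  exact add_le_add (mul_le_of_le_one_left (abs_nonneg _) (hc k))
    (mul_le_of_le_one_left (abs_nonneg _) h2)

lemma abs_detM_mA_le (ω : Fin m × (Fin m ⊕ Fin m) → ℝ) (ℓ k : Fin m) :
    |detM mA ω ℓ k| ≤ l1 ω := by
  rw [detM_mA_apply]; exact abs_le_l1 _ _

/-- The integrand defining the mixed absolute determinant moment. -/
def gInt (c : Fin m → ℝ) (ω : Fin m × (Fin m ⊕ Fin m) → ℝ) : ℝ :=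
  |(detM mA ω).det| * |(detM (mB c) ω).det|

/-- The mixed absolute determinant moment. -/
def Gr (c : Fin m → ℝ) : ℝ := ∫ ω, gInt c ω ∂(stdG (Fin m × (Fin m ⊕ Fin m)))

lemma gInt_nonneg (c : Fin m → ℝ) (ω : Fin m × (Fin m ⊕ Fin m) → ℝ) : 0 ≤ gInt c ω :=
  mul_nonneg (abs_nonneg _) (abs_nonneg _)

lemma measurable_gInt (c : Fin m → ℝ) : Measurable (gInt c) :=
  (measurable_detM_abs _).mul (measurable_detM_abs _)

lemma gInt_le {c : Fin m → ℝ} (hc : ∀ i, |c i| ≤ 1) (ω : Fin m × (Fin m ⊕ Fin m) → ℝ) :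
    gInt c ω ≤ (m ! : ℝ) ^ 2 * l1 ω ^ (2 * m) := by
  have h1 := abs_det_le_of_entries (l1_nonneg ω) (abs_detM_mA_le ω)
  have h2 := abs_det_le_of_entries (l1_nonneg ω) (abs_detM_mB_le hc ω)
  calc gInt c ω ≤ (m ! * l1 ω ^ m) * (m ! * l1 ω ^ m) :=
        mul_le_mul h1 h2 (abs_nonneg _) (mul_nonneg (by positivity) (pow_nonneg (l1_nonneg ω) m))
    _ = _ := by ring

lemma integrable_gInt {c : Fin m → ℝ} (hc : ∀ i, |c i| ≤ 1) :
    Integrable (gInt c) (stdG (Fin m × (Fin m ⊕ Fin m))) :=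
  ((integrable_l1_pow (2 * m)).const_mul _).mono' (measurable_gInt c).aestronglyMeasurable
    (Eventually.of_forall fun ω => by
      rw [Real.norm_of_nonneg (gInt_nonneg c ω)]; exact gInt_le hc ω)

lemma ofReal_Gr {c : Fin m → ℝ} (hc : ∀ i, |c i| ≤ 1) : ENNReal.ofReal (Gr c) = Gl c := by
  rw [Gr, Gl, ofReal_integral_eq_lintegral_ofReal (integrable_gInt hc)
    (Eventually.of_forall (gInt_nonneg c))]
  rfl

lemma Gr_nonneg (c : Fin m → ℝ) : 0 ≤ Gr c := integral_nonneg (gInt_nonneg c)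

lemma exists_Gr_le (m : ℕ) : ∃ C : ℝ, 0 < C ∧ ∀ c : Fin m → ℝ, (∀ i, |c i| ≤ 1) → Gr c ≤ C := by
  refine ⟨(m ! : ℝ) ^ 2 * (∫ ω, l1 ω ^ (2 * m) ∂(stdG (Fin m × (Fin m ⊕ Fin m)))) + 1, ?_, ?_⟩
  · have : 0 ≤ ∫ ω, l1 ω ^ (2 * m) ∂(stdG (Fin m × (Fin m ⊕ Fin m))) :=
      integral_nonneg fun ω => pow_nonneg (l1_nonneg ω) _
    positivity
  · intro c hc
    rw [← integral_const_mul]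
    have := integral_mono (integrable_gInt hc) ((integrable_l1_pow (2 * m)).const_mul _)
      (gInt_le hc)
    exact this.trans (by linarith)

lemma Gr_neg {c c' : Fin m → ℝ} (hc : ∀ i, |c i| ≤ 1) (h : ∀ i, c' i = c i ∨ c' i = -c i) :
    Gr c' = Gr c := by
  have hc' : ∀ i, |c' i| ≤ 1 := fun i => by rcases h i with e | e <;> simp [e, hc]
  have hs : ∀ i, ∃ s : ℝ, s * s = 1 ∧ c' i = s * c i := fun i => by
    rcases h i with e | e
    · exact ⟨1, by simp, by simp [e]⟩
    · exact ⟨-1, by simp, by simp [e]⟩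
  choose s hs hsc using hs
  have e := lintegral_pair_det (u := fun i => mA i) (w := fun i => s i • mB c i) (u' := mA)
    (w' := mB c') (fun i j => rfl)
    (fun i j => by
      rw [dotProduct_smul, mA_dot_mB, mA_dot_mB]
      split_ifs with hij
      · rw [hij, hsc, smul_eq_mul]
      · simp)
    (fun i j => by
      rw [dotProduct_smul, smul_dotProduct, mB_dot_mB hc, mB_dot_mB hc']
      split_ifs with hij
      · rw [hij]; simp [hs]
      · simp)
    (fun x y => ENNReal.ofReal (x * y)) (by
      show Measurable fun p : ℝ × ℝ => ENNReal.ofReal (p.1 * p.2)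
      fun_prop)
  simp only [detM_smul] at e
  have hp : |∏ i, s i| = 1 := by
    rw [Finset.abs_prod]
    refine Finset.prod_eq_one fun i _ => ?_
    have := hs i
    rcases mul_self_eq_one_iff.1 this with h | h <;> simp [h]
  simp only [abs_mul, hp, one_mul] at e
  have e' : Gl c = Gl c' := e
  rw [← ofReal_Gr hc, ← ofReal_Gr hc', ENNReal.ofReal_eq_ofReal_iff (Gr_nonneg _) (Gr_nonneg _)] at e'
  exact e'.symm

lemma continuousOn_Gr : ContinuousOn (Gr : (Fin m → ℝ) → ℝ) {c | ∀ i, |c i| ≤ 1} := by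
  refine continuousOn_of_dominated (bound := fun ω => (m ! : ℝ) ^ 2 * l1 ω ^ (2 * m))
    (fun c _ => (measurable_gInt c).aestronglyMeasurable) (fun c hc => ?_)
    ((integrable_l1_pow _).const_mul _) ?_
  · refine Eventually.of_forall fun ω => ?_
    rw [Real.norm_of_nonneg (gInt_nonneg c ω)]
    exact gInt_le hc ω
  · refine Eventually.of_forall fun ω => Continuous.continuousOn ?_
    unfold gInt
    refine continuous_const.mul (Continuous.abs (Continuous.matrix_det ?_))
    refine continuous_matrix fun i j => ?_
    simp_rw [detM_mB_apply]
    fun_prop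

lemma abs_sqrt_sub_one_le {x : ℝ} (hx : |x| ≤ 1) : |√(1 - x ^ 2) - 1| ≤ |x| := by
  have h1 : x ^ 2 ≤ |x| := by
    rw [← sq_abs]; nlinarith [abs_nonneg x]
  have h2 : x ^ 2 ≤ 1 := by linarith
  have h3 := Real.sq_sqrt (show 0 ≤ 1 - x ^ 2 by linarith)
  have h4 := Real.sqrt_nonneg (1 - x ^ 2)
  have h5 : √(1 - x ^ 2) ≤ 1 := Real.sqrt_le_one.2 (by nlinarith [sq_nonneg x])
  rw [abs_sub_comm, abs_of_nonneg (by linarith)]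
  nlinarith

lemma exists_abs_Gr_sub_le (m : ℕ) : ∃ C : ℝ, 0 < C ∧ ∀ (c : Fin m → ℝ) (δ : ℝ), δ ≤ 1 →
    (∀ i, |c i| ≤ δ) → 0 ≤ δ → |Gr c - Gr (0 : Fin m → ℝ)| ≤ C * δ := by
  set I := ∫ ω, l1 ω ^ m * (l1 ω ^ (m - 1) * l1 ω) ∂(stdG (Fin m × (Fin m ⊕ Fin m))) with hI
  have hI0 : 0 ≤ I := integral_nonneg fun ω => by have := l1_nonneg ω; positivity
  refine ⟨(m ! : ℝ) * (m ! * m) * I + 1, by positivity, fun c δ hδ hc h0 => ?_⟩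
  have hc1 : ∀ i, |c i| ≤ 1 := fun i => (hc i).trans hδ
  have hz : ∀ i, |(0 : Fin m → ℝ) i| ≤ 1 := fun i => by simp
  have key : ∀ ω, |gInt c ω - gInt 0 ω|
      ≤ ((m ! : ℝ) * (m ! * m) * δ) * (l1 ω ^ m * (l1 ω ^ (m - 1) * l1 ω)) := fun ω => by
    have hl := l1_nonneg ω
    have h1 := abs_det_le_of_entries hl (abs_detM_mA_le ω)
    have h2 := abs_det_sub_le (y := δ * l1 ω) hl (by positivity) (abs_detM_mB_le hc1 ω)
      (abs_detM_mB_le hz ω) (fun i j => by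
        rw [detM_mB_apply, detM_mB_apply]
        simp only [Pi.zero_apply, zero_mul, zero_add]
        have e : c j * ω (i, Sum.inl j) + √(1 - c j ^ 2) * ω (i, Sum.inr j)
            - √(1 - 0 ^ 2) * ω (i, Sum.inr j)
            = c j * ω (i, Sum.inl j) + (√(1 - c j ^ 2) - 1) * ω (i, Sum.inr j) := by
          simp; ring
        rw [e]
        refine (abs_add_le _ _).trans ?_
        rw [abs_mul, abs_mul]
        have := abs_add_abs_le_l1 ω (i := (i, Sum.inl j)) (j := (i, Sum.inr j)) (by simp)
        have h4 := (abs_sqrt_sub_one_le (hc1 j)).trans (hc j)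
        calc _ ≤ δ * |ω (i, Sum.inl j)| + δ * |ω (i, Sum.inr j)| :=
              add_le_add (mul_le_mul_of_nonneg_right (hc j) (abs_nonneg _))
                (mul_le_mul_of_nonneg_right h4 (abs_nonneg _))
          _ ≤ _ := by nlinarith)
    rw [gInt, gInt, ← mul_sub, abs_mul, abs_abs]
    calc _ ≤ (m ! * l1 ω ^ m) * ((m ! : ℝ) * m * l1 ω ^ (m - 1) * (δ * l1 ω)) :=
          mul_le_mul h1 ((abs_abs_sub_abs_le _ _).trans h2) (abs_nonneg _) (by positivity)
      _ = _ := by ring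
  have hint : Integrable (fun ω : Fin m × (Fin m ⊕ Fin m) → ℝ =>
      l1 ω ^ m * (l1 ω ^ (m - 1) * l1 ω)) (stdG _) := by
    simp_rw [← pow_succ, ← pow_add]
    exact integrable_l1_pow _
  rw [Gr, Gr, ← integral_sub (integrable_gInt hc1) (integrable_gInt hz)]
  refine (abs_integral_le_integral_abs).trans ((integral_mono
    ((integrable_gInt hc1).sub (integrable_gInt hz)).abs (hint.const_mul _) key).trans ?_)
  rw [integral_const_mul, ← hI]
  nlinarith

end GlFacts
end

section

section GlStrict
variable {m : ℕ}

lemma mixE_lt_top_ae {c : Fin m → ℝ} (h0 : ∀ i, 0 ≤ c i) (h1 : ∀ i, c i ≤ 1) :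
    ∀ᵐ W ∂(stdG (Fin m × Fin m)), mixE c W < ⊤ :=
  ae_lt_top (measurable_mixE c) (by rw [lintegral_mixE h0 h1]; exact (DP_lt_top m 1).ne)

lemma integral_mixE {c : Fin m → ℝ} (h0 : ∀ i, 0 ≤ c i) (h1 : ∀ i, c i ≤ 1) :
    ∫ W, (mixE c W).toReal ∂(stdG (Fin m × Fin m)) = Dm m := by
  rw [integral_toReal (measurable_mixE c).aemeasurable (mixE_lt_top_ae h0 h1),
    lintegral_mixE h0 h1, Dm]

lemma integral_mixE_sq {c : Fin m → ℝ} (h0 : ∀ i, 0 ≤ c i) (h1 : ∀ i, c i ≤ 1) :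
    ∫ W, (mixE c W).toReal ^ 2 ∂(stdG (Fin m × Fin m)) = Gr c := by
  have hc : ∀ i, |c i| ≤ 1 := fun i => abs_le.2 ⟨by linarith [h0 i], h1 i⟩
  have : ∀ W, (mixE c W).toReal ^ 2 = (mixE c W ^ 2).toReal := fun W => by simp
  simp_rw [this]
  rw [integral_toReal ((measurable_mixE c).pow_const 2).aemeasurable, lintegral_mixE_sq h0 h1,
    ← ofReal_Gr hc, ENNReal.toReal_ofReal (Gr_nonneg c)]
  filter_upwards [mixE_lt_top_ae h0 h1] with W hW
  exact ENNReal.pow_lt_top hW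

lemma integrable_mixE {c : Fin m → ℝ} (h0 : ∀ i, 0 ≤ c i) (h1 : ∀ i, c i ≤ 1) :
    Integrable (fun W => (mixE c W).toReal) (stdG (Fin m × Fin m)) :=
  integrable_toReal_of_lintegral_ne_top (measurable_mixE c).aemeasurable
    (by rw [lintegral_mixE h0 h1]; exact (DP_lt_top m 1).ne)

lemma integrable_mixE_sq {c : Fin m → ℝ} (h0 : ∀ i, 0 ≤ c i) (h1 : ∀ i, c i ≤ 1) :
    Integrable (fun W => (mixE c W).toReal ^ 2) (stdG (Fin m × Fin m)) := by
  have hc : ∀ i, |c i| ≤ 1 := fun i => abs_le.2 ⟨by linarith [h0 i], h1 i⟩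
  have : ∀ W, (mixE c W).toReal ^ 2 = (mixE c W ^ 2).toReal := fun W => by simp
  simp_rw [this]
  exact integrable_toReal_of_lintegral_ne_top ((measurable_mixE c).pow_const 2).aemeasurable
    (by rw [lintegral_mixE_sq h0 h1, ← ofReal_Gr hc]; exact ENNReal.ofReal_ne_top)

lemma integral_mixE_sub_sq {c : Fin m → ℝ} (h0 : ∀ i, 0 ≤ c i) (h1 : ∀ i, c i ≤ 1) :
    ∫ W, ((mixE c W).toReal - Dm m) ^ 2 ∂(stdG (Fin m × Fin m)) = Gr c - Dm m ^ 2 := by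
  have e : ∀ W, ((mixE c W).toReal - Dm m) ^ 2
      = (mixE c W).toReal ^ 2 - (2 * Dm m) * (mixE c W).toReal + Dm m ^ 2 := fun W => by ring
  simp_rw [e]
  have hs : Integrable (fun W => (mixE c W).toReal ^ 2 - (2 * Dm m) * (mixE c W).toReal)
      (stdG (Fin m × Fin m)) :=
    (integrable_mixE_sq h0 h1).sub ((integrable_mixE h0 h1).const_mul _)
  rw [integral_add hs (integrable_const _), integral_sub (integrable_mixE_sq h0 h1)
    ((integrable_mixE h0 h1).const_mul _), integral_const_mul, integral_mixE h0 h1,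
    integral_mixE_sq h0 h1]
  simp
  ring

lemma Gr_abs {c : Fin m → ℝ} (hc : ∀ i, |c i| ≤ 1) : Gr (fun i => |c i|) = Gr c :=
  Gr_neg hc fun i => abs_choice (c i)

lemma sq_Dm_le_Gr {c : Fin m → ℝ} (hc : ∀ i, |c i| ≤ 1) : Dm m ^ 2 ≤ Gr c := by
  rw [← Gr_abs hc]
  have := integral_mixE_sub_sq (c := fun i => |c i|) (fun i => abs_nonneg _) hc
  have h : 0 ≤ ∫ W, ((mixE (fun i => |c i|) W).toReal - Dm m) ^ 2 ∂(stdG (Fin m × Fin m)) :=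
    integral_nonneg fun _ => sq_nonneg _
  linarith

lemma Gr_zero : Gr (0 : Fin m → ℝ) = Dm m ^ 2 := by
  have := integral_mixE_sub_sq (c := (0 : Fin m → ℝ)) (fun i => le_rfl) (fun i => zero_le_one)
  have h : ∀ W, mixE (0 : Fin m → ℝ) W = DP m 1 := fun W => by
    have e : ∀ U, mixM (0 : Fin m → ℝ) W U = Zm U := fun U => by
      ext ℓ k
      simp [mixM, Zm]
    simp only [mixE, DP, pow_one, e]
  simp_rw [h] at this
  simp [Dm] at this ⊢
  linarith

lemma ae_stdG_dense {ι : Type*} [Fintype ι] {p : (ι → ℝ) → Prop} (h : ∀ᵐ ω ∂(stdG ι), p ω) :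
    Dense {ω | p ω} := by
  have h2 : ∀ᵐ ω ∂(volume : Measure (ι → ℝ)), p ω := by
    rw [stdG_eq_withDensity] at h
    refine (withDensity_absolutelyContinuous' (measurable_gpdf).ennreal_ofReal.aemeasurable
      (Eventually.of_forall fun u => ?_)).ae_le h
    simpa using gpdf_pos u
  exact Measure.dense_of_ae h2

lemma sq_Dm_lt_Gr (hm : m ≠ 0) {c : Fin m → ℝ} (hc : ∀ i, |c i| ≤ 1) (hz : ∀ i, c i ≠ 0) :
    Dm m ^ 2 < Gr c := by
  refine lt_of_le_of_ne (sq_Dm_le_Gr hc) fun heq => ?_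
  rw [← Gr_abs hc] at heq
  set e : Fin m → ℝ := fun i => |c i| with he
  have h0 : ∀ i, 0 ≤ e i := fun i => abs_nonneg _
  have h1 : ∀ i, e i ≤ 1 := hc
  have hv := integral_mixE_sub_sq h0 h1
  rw [heq, sub_self, integral_eq_zero_iff_of_nonneg (fun _ => sq_nonneg _)] at hv
  swap
  · have e' : ∀ W, ((mixE e W).toReal - Dm m) ^ 2
      = (mixE e W).toReal ^ 2 - (2 * Dm m) * (mixE e W).toReal + Dm m ^ 2 := fun W => by ring
    simp_rw [e']
    exact ((integrable_mixE_sq h0 h1).sub ((integrable_mixE h0 h1).const_mul _)).add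
      (integrable_const _)
  have hae : ∀ᵐ W ∂(stdG (Fin m × Fin m)), mixE e W = DP m 1 := by
    filter_upwards [hv, mixE_lt_top_ae h0 h1] with W hW ht
    have : (mixE e W).toReal = Dm m := by
      have := pow_eq_zero_iff (two_ne_zero) |>.1 hW
      linarith
    rw [← ofReal_Dm, ← this, ENNReal.ofReal_toReal ht.ne]
  have hd := ae_stdG_dense hae
  let I : Fin m × Fin m → ℝ := fun i => if i.1 = i.2 then 1 else 0
  have hW : ∀ n : ℕ, ∃ W, mixE e W = DP m 1 ∧ dist (((n : ℝ) + 1) • I) W < 1 := fun n => by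
    obtain ⟨W, h1, h2⟩ := Metric.dense_iff.1 hd (((n : ℝ) + 1) • I) 1 one_pos
    exact ⟨W, h2, by rw [_root_.dist_comm]; exact h1⟩
  choose W hW1 hW2 using hW
  have hlim : ∀ i, Tendsto (fun n : ℕ => ((n : ℝ) + 1)⁻¹ * W n i) atTop (nhds (I i)) := fun i => by
    rw [tendsto_iff_dist_tendsto_zero]
    refine squeeze_zero (fun _ => dist_nonneg) (fun n => ?_) tendsto_one_div_add_atTop_nhds_zero_nat
    have h3 : dist ((((n : ℝ) + 1) • I) i) (W n i) < 1 :=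
      (dist_le_pi_dist _ _ i).trans_lt (hW2 n)
    have hn : (0 : ℝ) < n + 1 := by positivity
    have : ((n : ℝ) + 1)⁻¹ * W n i - I i = ((n : ℝ) + 1)⁻¹ * (W n i - (((n : ℝ) + 1) • I) i) := by
      simp only [Pi.smul_apply, smul_eq_mul]; field_simp
    rw [Real.dist_eq, this, abs_mul, abs_of_pos (inv_pos.2 hn), one_div]
    rw [_root_.dist_comm, Real.dist_eq] at h3
    exact mul_le_of_le_one_right (inv_pos.2 hn).le h3.le
  have hfat := lintegral_liminf_le (u := (atTop : Filter ℕ)) (μ := stdG (Fin m × Fin m))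
    (f := fun (n : ℕ) U => ENNReal.ofReal |((((n : ℝ) + 1)⁻¹) • (mixM e (W n) U)).det|)
    (fun n => (measurable_det_of fun i j => by
      simp only [Matrix.smul_apply, mixM]; fun_prop).abs.ennreal_ofReal)
  have hL : ∀ U, liminf (fun n : ℕ => ENNReal.ofReal |((((n : ℝ) + 1)⁻¹) • (mixM e (W n) U)).det|)
      atTop = ENNReal.ofReal (∏ i, √(e i)) := fun U => by
    refine Tendsto.liminf_eq ?_
    have hdiag : ∏ i, √(e i) = |(Matrix.diagonal fun i => √(e i)).det| := by
      rw [Matrix.det_diagonal, abs_of_nonneg (Finset.prod_nonneg fun _ _ => Real.sqrt_nonneg _)]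
    rw [hdiag]
    refine ENNReal.tendsto_ofReal (Tendsto.abs ?_)
    refine ((Continuous.matrix_det continuous_id).tendsto _).comp ?_
    refine tendsto_pi_nhds.2 fun i => tendsto_pi_nhds.2 fun j => ?_
    simp only [Matrix.smul_apply, mixM, smul_eq_mul]
    have h5 := ((hlim (i, j)).const_mul √(e j)).add
      ((tendsto_one_div_add_atTop_nhds_zero_nat (𝕜 := ℝ)).mul_const (√(1 - e j) * U (i, j)))
    convert! h5 using 2
    · ring
    · by_cases hij : i = j <;> simp [I, hij]
  simp_rw [hL] at hfat
  have hR : ∀ n : ℕ, ∫⁻ U, ENNReal.ofReal |((((n : ℝ) + 1)⁻¹) • (mixM e (W n) U)).det|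
      ∂(stdG (Fin m × Fin m)) = ENNReal.ofReal ((((n : ℝ) + 1)⁻¹) ^ m) * DP m 1 := fun n => by
    rw [← hW1 n, mixE, ← lintegral_const_mul' _ _ ENNReal.ofReal_ne_top]
    refine lintegral_congr fun U => ?_
    have hn : (0 : ℝ) ≤ ((n : ℝ) + 1)⁻¹ := by positivity
    rw [Matrix.det_smul, abs_mul, abs_of_nonneg (by positivity), Fintype.card_fin,
      ENNReal.ofReal_mul (by positivity)]
  simp_rw [hR] at hfat
  have hT : Tendsto (fun n : ℕ => ENNReal.ofReal ((((n : ℝ) + 1)⁻¹) ^ m) * DP m 1) atTop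
      (nhds 0) := by
    have h6 : Tendsto (fun n : ℕ => (((n : ℝ) + 1)⁻¹) ^ m) atTop (nhds 0) := by
      have := (tendsto_one_div_add_atTop_nhds_zero_nat (𝕜 := ℝ)).pow m
      simpa [hm] using this
    have h7 := ENNReal.Tendsto.mul_const (ENNReal.tendsto_ofReal h6)
      (Or.inr (DP_lt_top m 1).ne) (b := DP m 1)
    simpa using h7
  rw [hT.liminf_eq] at hfat
  simp only [lintegral_const, measure_univ, mul_one, nonpos_iff_eq_zero,
    ENNReal.ofReal_eq_zero] at hfat
  have : 0 < ∏ i, √(e i) := Finset.prod_pos fun i _ => Real.sqrt_pos.2 (abs_pos.2 (hz i))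
  linarith

end GlStrict
end

section

lemma lintegral_comp_mulVec {ι : Type*} [Fintype ι] [DecidableEq ι] {M : Matrix ι ι ℝ}
    (hM : M.det ≠ 0) {f : (ι → ℝ) → ENNReal} (hf : Measurable f) :
    ∫⁻ x, f (M.mulVec x) = ENNReal.ofReal |M.det|⁻¹ * ∫⁻ x, f x := by
  have h := Real.map_matrix_volume_pi_eq_smul_volume_pi hM
  have hm : Measurable (Matrix.toLin' M) :=
    (LinearMap.continuous_of_finiteDimensional _).measurable
  have e := lintegral_map (μ := volume) hf hm
  rw [h, lintegral_smul_measure] at e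
  rw [← abs_inv, ← smul_eq_mul]
  exact e.symm

lemma lintegral_gpdf (ι : Type*) [Fintype ι] : ∫⁻ u : ι → ℝ, ENNReal.ofReal (gpdf ι u) = 1 := by
  have : stdG ι Set.univ = 1 := measure_univ
  rwa [stdG_eq_withDensity, withDensity_apply _ MeasurableSet.univ, setLIntegral_univ] at this

lemma lintegral_stdG {ι : Type*} [Fintype ι] {f : (ι → ℝ) → ENNReal} (hf : Measurable f) :
    ∫⁻ u, f u ∂(stdG ι) = ∫⁻ u, ENNReal.ofReal (gpdf ι u) * f u := by
  rw [stdG_eq_withDensity, lintegral_withDensity_eq_lintegral_mul _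
    measurable_gpdf.ennreal_ofReal hf]
  rfl

section Moment
variable {m : ℕ}

lemma lintegral_det_pow_gpdf_axis (n p : ℕ) (τ : ℝ) :
    ∫⁻ ω : Fin (n + 1) × Fin (n + 1) → ℝ, ENNReal.ofReal (|(Zm ω).det| ^ p *
      gpdf (Fin (n + 1)) (fun ℓ => τ * ω (ℓ, 0))) ∂(stdG _)
      = ENNReal.ofReal ((√(2 * π))⁻¹ ^ (n + 1) * (√(1 + τ ^ 2))⁻¹ ^ (n + 1 + p)) * DP (n + 1) p := by
  set σ := √(1 + τ ^ 2) with hσ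
  have hσ0 : 0 < σ := Real.sqrt_pos.2 (by positivity)
  have hσ2 : σ ^ 2 = 1 + τ ^ 2 := Real.sq_sqrt (by positivity)
  set dg : Fin (n + 1) × Fin (n + 1) → ℝ := fun i => if i.2 = 0 then σ else 1 with hdg
  have hdet : (Matrix.diagonal dg).det = σ ^ (n + 1) := by
    rw [Matrix.det_diagonal, Fintype.prod_prod_type]
    simp [hdg, Finset.prod_ite_eq']
  have hZ : ∀ ω, (Zm ((Matrix.diagonal dg).mulVec ω)).det = σ * (Zm ω).det := fun ω => by
    have h1 := Matrix.det_mul_row (fun k : Fin (n + 1) => if k = 0 then σ else 1) (Zm ω)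
    rw [show (∏ i : Fin (n + 1), if i = 0 then σ else 1) = σ by simp] at h1
    rw [← h1]
    congr 1
    ext ℓ k
    simp [Zm, Matrix.mulVec_diagonal, hdg]
  have hg : ∀ ω : Fin (n + 1) × Fin (n + 1) → ℝ, gpdf _ ω * gpdf (Fin (n + 1)) (fun ℓ => τ * ω (ℓ, 0))
      = (√(2 * π))⁻¹ ^ (n + 1) * gpdf _ ((Matrix.diagonal dg).mulVec ω) := fun ω => by
    simp only [gpdf, Fintype.card_fin]
    have e : (Matrix.diagonal dg).mulVec ω ⬝ᵥ (Matrix.diagonal dg).mulVec ω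
        = ω ⬝ᵥ ω + (fun ℓ => τ * ω (ℓ, 0)) ⬝ᵥ (fun ℓ : Fin (n + 1) => τ * ω (ℓ, 0)) := by
      simp only [dotProduct, Matrix.mulVec_diagonal, Fintype.sum_prod_type, hdg,
        ← Finset.sum_add_distrib]
      refine Finset.sum_congr rfl fun ℓ _ => ?_
      rw [Fin.sum_univ_succ, Fin.sum_univ_succ]
      simp only [if_true, Fin.succ_ne_zero, if_false, one_mul]
      linear_combination (ω (ℓ, 0)) ^ 2 * hσ2
    rw [e, neg_add, add_div, Real.exp_add]
    ring
  have hfm : Measurable fun ω : Fin (n + 1) × Fin (n + 1) → ℝ =>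
      ENNReal.ofReal (gpdf _ ω) * ENNReal.ofReal (|(Zm ω).det| ^ p) :=
    measurable_gpdf.ennreal_ofReal.mul (continuous_Zm_det.measurable.abs.pow_const p).ennreal_ofReal
  rw [lintegral_stdG]
  swap
  · refine ((continuous_Zm_det.measurable.abs.pow_const p).mul
      (measurable_gpdf.comp ?_)).ennreal_ofReal
    fun_prop
  have e2 : ∀ ω : Fin (n + 1) × Fin (n + 1) → ℝ, ENNReal.ofReal (gpdf _ ω) *
      ENNReal.ofReal (|(Zm ω).det| ^ p * gpdf (Fin (n + 1)) (fun ℓ => τ * ω (ℓ, 0)))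
      = ENNReal.ofReal ((√(2 * π))⁻¹ ^ (n + 1) * σ⁻¹ ^ p) *
        (ENNReal.ofReal (gpdf _ ((Matrix.diagonal dg).mulVec ω)) *
          ENNReal.ofReal (|(Zm ((Matrix.diagonal dg).mulVec ω)).det| ^ p)) := fun ω => by
    rw [← ENNReal.ofReal_mul (gpdf_pos _).le, ← ENNReal.ofReal_mul (gpdf_pos _).le,
      ← ENNReal.ofReal_mul (by positivity), hZ, abs_mul, abs_of_pos hσ0]
    congr 1
    have : σ⁻¹ ^ p * σ ^ p = 1 := by rw [← mul_pow, inv_mul_cancel₀ hσ0.ne', one_pow]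
    linear_combination (|(Zm ω).det| ^ p) * hg ω - ((√(2 * π))⁻¹ ^ (n + 1) *
      gpdf _ ((Matrix.diagonal dg).mulVec ω) * |(Zm ω).det| ^ p) * this
  simp_rw [e2]
  rw [lintegral_const_mul' _ _ ENNReal.ofReal_ne_top,
    lintegral_comp_mulVec (by rw [hdet]; positivity) hfm, ← lintegral_stdG
      (continuous_Zm_det.measurable.abs.pow_const p).ennreal_ofReal, ← DP, ← mul_assoc,
    ← ENNReal.ofReal_mul (by positivity), hdet, abs_of_pos (by positivity)]
  congr 2
  rw [← inv_pow σ (n + 1), pow_add σ⁻¹ (n + 1) p]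
  ring

lemma lintegral_det_pow_gpdf (hm : m ≠ 0) (p : ℕ) (t : Fin m → ℝ) :
    ∫⁻ ω : Fin m × Fin m → ℝ, ENNReal.ofReal (|(Zm ω).det| ^ p *
      gpdf (Fin m) ((Zm ω).mulVec t)) ∂(stdG _)
      = ENNReal.ofReal ((√(2 * π))⁻¹ ^ m * (nrm t)⁻¹ ^ (m + p)) * DP m p := by
  obtain ⟨n, rfl⟩ : ∃ n, m = n + 1 := ⟨m - 1, by omega⟩
  obtain ⟨O, hO, τ, hτ⟩ : ∃ O : Matrix (Fin (n + 1)) (Fin (n + 1)) ℝ, O * O.transpose = 1 ∧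
      ∃ τ : ℝ, t = τ • O 0 := by
    by_cases ht : t = 0
    · exact ⟨1, by simp, 0, by simp [ht]⟩
    · have hp : 0 < t ⬝ᵥ t := by
        have := dot_self_nonneg t
        refine lt_of_le_of_ne this fun h => ht ?_
        exact dotProduct_self_eq_zero.1 h.symm
      have hs : 0 < √(t ⬝ᵥ t) := Real.sqrt_pos.2 hp
      obtain ⟨O, hO, h0⟩ := exists_frame (p := 1) (fun _ => (√(t ⬝ᵥ t))⁻¹ • t) (fun i j => by
        rw [if_pos (Subsingleton.elim _ _), smul_dotProduct, dotProduct_smul, smul_eq_mul,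
          smul_eq_mul]
        nth_rewrite 3 [← Real.mul_self_sqrt hp.le]
        field_simp) (fun _ => 0) (fun i j _ => Subsingleton.elim _ _)
      refine ⟨O, hO, √(t ⬝ᵥ t), ?_⟩
      rw [h0 0, smul_smul, mul_inv_cancel₀ hs.ne', one_smul]
  have hOO : ∀ i j, O i ⬝ᵥ O j = if i = j then 1 else 0 := fun i j => by
    have := congrFun (congrFun hO i) j
    rw [Matrix.mul_apply, Matrix.one_apply] at this
    exact this
  have hdO : |O.det| = 1 := by
    have := congrArg Matrix.det hO
    rw [Matrix.det_mul, Matrix.det_transpose, Matrix.det_one] at this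
    rcases mul_self_eq_one_iff.1 this with h | h <;> simp [h]
  have htt : t ⬝ᵥ t = τ ^ 2 := by
    rw [hτ, smul_dotProduct, dotProduct_smul, hOO]; simp [sq]
  have key := lintegral_rowwise (m := n + 1) (K := Fin (n + 1) ⊕ Unit)
    (Sum.elim (fun k => O k) (fun _ => t))
    (Sum.elim (fun k => (Pi.single k 1 : Fin (n + 1) → ℝ)) (fun _ => τ • Pi.single 0 1))
    (by
      rintro (k | k) (l | l)
      · simp [hOO, Pi.single_apply, eq_comm]
      · simp only [Sum.elim_inl, Sum.elim_inr]
        rw [hτ, dotProduct_smul, hOO, dotProduct_smul]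
        simp [Pi.single_apply, eq_comm]
      · simp only [Sum.elim_inl, Sum.elim_inr]
        rw [hτ, smul_dotProduct, hOO, smul_dotProduct]
        simp [Pi.single_apply, eq_comm]
      · simp only [Sum.elim_inr]
        rw [htt, smul_dotProduct, dotProduct_smul]
        simp [sq])
    (H := fun x => ENNReal.ofReal (|(Matrix.of fun ℓ k => x (ℓ, Sum.inl k)).det| ^ p *
      gpdf (Fin (n + 1)) (fun ℓ => x (ℓ, Sum.inr ())))) (by
        refine (((measurable_det_of fun i j => ?_).abs.pow_const p).mul
          (measurable_gpdf.comp ?_)).ennreal_ofReal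
        · simp only [Matrix.of_apply]; fun_prop
        · fun_prop)
  rw [nrm, htt, ← lintegral_det_pow_gpdf_axis n p τ]
  refine Eq.trans (lintegral_congr fun ω => ?_) (key.trans (lintegral_congr fun ω => ?_))
  · have h1 : (Matrix.of fun ℓ k => O k ⬝ᵥ row ω ℓ : Matrix (Fin (n + 1)) (Fin (n + 1)) ℝ)
        = Zm ω * O.transpose := by
      ext ℓ k
      simp [Matrix.mul_apply, Zm, dotProduct, row, mul_comm]
    have h2 : (Zm ω).mulVec t = fun ℓ => t ⬝ᵥ row ω ℓ := by
      ext ℓ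
      simp [Matrix.mulVec, Zm, dotProduct, row, mul_comm]
    simp only [Sum.elim_inl, Sum.elim_inr]
    rw [h1, Matrix.det_mul, Matrix.det_transpose, abs_mul, hdO, mul_one, h2]
  · have h1 : (Matrix.of fun ℓ k => (Pi.single k 1 : Fin (n + 1) → ℝ) ⬝ᵥ row ω ℓ :
        Matrix (Fin (n + 1)) (Fin (n + 1)) ℝ) = Zm ω := by
      ext ℓ k
      simp [Zm, row]
    simp only [Sum.elim_inl, Sum.elim_inr]
    rw [h1]
    simp [row]

/-- The area formula for a linear system: inverse moments of the spherical norm. -/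
lemma det_moment_identity (hm : m ≠ 0) (p : ℕ) :
    (∫⁻ t : Fin m → ℝ, ENNReal.ofReal ((√(2 * π))⁻¹ ^ m * (nrm t)⁻¹ ^ (m + (p + 1)))) * DP m (p + 1)
      = DP m p := by
  have hM : Measurable fun x : (Fin m → ℝ) × (Fin m × Fin m → ℝ) =>
      ENNReal.ofReal (|(Zm x.2).det| ^ (p + 1) * gpdf (Fin m) ((Zm x.2).mulVec x.1)) := by
    refine (((continuous_Zm_det.comp continuous_snd).measurable.abs.pow_const _).mul
      (measurable_gpdf.comp ?_)).ennreal_ofReal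
    unfold Matrix.mulVec dotProduct Zm
    fun_prop
  rw [← lintegral_mul_const' _ _ (DP_lt_top m _).ne]
  simp_rw [← lintegral_det_pow_gpdf hm (p + 1)]
  rw [lintegral_lintegral_swap hM.aemeasurable, DP]
  refine lintegral_congr_ae ?_
  filter_upwards [Zm_det_ne_zero_ae (m := m)] with ω hω
  simp_rw [ENNReal.ofReal_mul (show 0 ≤ |(Zm ω).det| ^ (p + 1) by positivity)]
  rw [lintegral_const_mul' _ _ ENNReal.ofReal_ne_top,
    lintegral_comp_mulVec hω (f := fun x => ENNReal.ofReal (gpdf (Fin m) x))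
      measurable_gpdf.ennreal_ofReal, lintegral_gpdf, mul_one,
    ← ENNReal.ofReal_mul (by positivity)]
  congr 1
  have : |(Zm ω).det| ≠ 0 := by positivity
  field_simp
  ring

end Moment
end

section

section Rot
variable {m : ℕ}

/-- Density of the root distribution. -/
def rho (t : Fin m → ℝ) : ℝ := (√(2 * π))⁻¹ ^ m * Dm m * (nrm t)⁻¹ ^ (m + 1)

lemma rho_pos (t : Fin m → ℝ) : 0 < rho t := by
  have := nrm_pos t
  have := Dm_pos m
  unfold rho
  positivity

lemma continuous_nrm : Continuous (nrm : (Fin m → ℝ) → ℝ) := contDiff_nrm.continuous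

lemma continuous_rho : Continuous (rho : (Fin m → ℝ) → ℝ) := by
  unfold rho
  exact continuous_const.mul ((continuous_nrm.inv₀ fun t => (nrm_pos t).ne').pow _)

lemma lintegral_rho (hm : m ≠ 0) : ∫⁻ t : Fin m → ℝ, ENNReal.ofReal (rho t) = 1 := by
  have h := det_moment_identity hm 0
  rw [DP_zero, zero_add, ← ofReal_Dm, ← lintegral_mul_const' _ _ ENNReal.ofReal_ne_top] at h
  rw [← h]
  refine lintegral_congr fun t => ?_
  have := nrm_pos t
  rw [← ENNReal.ofReal_mul (by positivity), rho]
  congr 1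
  ring

lemma lintegral_eq_abs_mul_comp_mul {a : ℝ} (ha : a ≠ 0) {f : ℝ → ENNReal} (hf : Measurable f) :
    ∫⁻ x, f x = ENNReal.ofReal |a| * ∫⁻ x, f (a * x) := by
  conv_lhs => rw [← Real.smul_map_volume_mul_left ha]
  rw [lintegral_smul_measure, lintegral_map hf (measurable_const_mul a), smul_eq_mul]

lemma lintegral_eq_abs_pow_mul_comp_smul {x : ℝ} (hx : x ≠ 0) {f : (Fin m → ℝ) → ENNReal}
    (hf : Measurable f) : ∫⁻ u, f u = ENNReal.ofReal (|x| ^ m) * ∫⁻ t, f (x • t) := by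
  have h := lintegral_comp_mulVec (M := x • (1 : Matrix (Fin m) (Fin m) ℝ))
    (by rw [Matrix.det_smul]; simp [hx]) hf
  simp only [Matrix.det_smul, Matrix.det_one, mul_one, Fintype.card_fin, Matrix.smul_mulVec,
    Matrix.one_mulVec, abs_pow] at h
  have hx' : 0 < |x| ^ m := by positivity
  rw [h, ← mul_assoc, ← ENNReal.ofReal_mul (by positivity), mul_inv_cancel₀ hx'.ne',
    ENNReal.ofReal_one, one_mul]

lemma measurable_xh : Measurable (xh : (Fin m → ℝ) → Fin (m + 1) → ℝ) := by
  refine measurable_pi_iff.2 fun i => ?_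
  refine Fin.cases ?_ (fun k => ?_) i
  · simp
  · simpa using measurable_pi_apply k

lemma lintegral_stdG_homogeneous_aux {H : (Fin (m + 1) → ℝ) → ENNReal} (hH : Measurable H)
    (hs : ∀ x : ℝ, x ≠ 0 → ∀ g, H (x • g) = H g) :
    ∫⁻ g, H g ∂(stdG (Fin (m + 1))) = (∫⁻ x : ℝ, ENNReal.ofReal (|x| ^ m *
      ((√(2 * π))⁻¹ ^ (m + 1) * Real.exp (-x ^ 2 / 2)))) *
      ∫⁻ t : Fin m → ℝ, ENNReal.ofReal ((nrm t)⁻¹ ^ (m + 1)) * H (xh t) := by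
  have hHx : Measurable fun t : Fin m → ℝ => H (xh t) := hH.comp measurable_xh
  have hF : Measurable fun g : Fin (m + 1) → ℝ => ENNReal.ofReal (gpdf _ g) * H g :=
    measurable_gpdf.ennreal_ofReal.mul hH
  rw [lintegral_stdG hH]
  have h1 := ((volume_preserving_piFinSuccAbove (fun _ : Fin (m + 1) => ℝ) 0).symm
    ).lintegral_comp hF
  have hc : ∀ p : ℝ × (Fin m → ℝ), (MeasurableEquiv.piFinSuccAbove (fun _ => ℝ) 0).symm p
      = Fin.cons p.1 p.2 := fun p => by
    show (Fin.insertNth 0 p.1 p.2 : Fin (m + 1) → ℝ) = Fin.cons p.1 p.2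
    rw [Fin.insertNth_zero]
    rfl
  simp only [hc] at h1
  have hcm : Measurable fun p : ℝ × (Fin m → ℝ) => (Fin.cons p.1 p.2 : Fin (m + 1) → ℝ) := by
    refine measurable_pi_iff.2 fun i => ?_
    refine Fin.cases ?_ (fun k => ?_) i
    · simpa using measurable_fst
    · simpa [Function.comp_def] using (measurable_pi_apply k).comp measurable_snd
  rw [← h1, show (volume : Measure (ℝ × (Fin m → ℝ))) = volume.prod volume from rfl,
    lintegral_prod _ (show Measurable fun p : ℝ × (Fin m → ℝ) =>
      ENNReal.ofReal (gpdf _ (Fin.cons p.1 p.2 : Fin (m + 1) → ℝ)) * H (Fin.cons p.1 p.2)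
      from hF.comp hcm).aemeasurable]
  have hFc : Measurable fun p : ℝ × (Fin m → ℝ) =>
    ENNReal.ofReal (gpdf (Fin (m + 1)) (Fin.cons p.1 p.2 : Fin (m + 1) → ℝ)) *
      H (Fin.cons p.1 p.2) := hF.comp hcm
  set φx : ℝ → ENNReal := fun x => ENNReal.ofReal (|x| ^ m *
      ((√(2 * π))⁻¹ ^ (m + 1) * Real.exp (-x ^ 2 / 2))) with hφx
  have hφm : Measurable φx := by rw [hφx]; fun_prop
  have h2 : ∀ᵐ x : ℝ, ∫⁻ u : Fin m → ℝ, ENNReal.ofReal (gpdf _ (Fin.cons x u : Fin (m + 1) → ℝ)) *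
      H (Fin.cons x u) = ∫⁻ t : Fin m → ℝ, φx (nrm t * x) * ENNReal.ofReal ((nrm t)⁻¹ ^ m) *
        H (xh t) := by
    have : ∀ᵐ x : ℝ, x ≠ 0 := by simp [ae_iff]
    filter_upwards [this] with x hx
    have hFx : Measurable fun u : Fin m → ℝ =>
        ENNReal.ofReal (gpdf (Fin (m + 1)) (Fin.cons x u : Fin (m + 1) → ℝ)) *
          H (Fin.cons x u) := by
      have := hFc.comp (measurable_prodMk_left (x := x))
      exact this
    rw [lintegral_eq_abs_pow_mul_comp_smul hx hFx,
      ← lintegral_const_mul' _ _ ENNReal.ofReal_ne_top]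
    refine lintegral_congr fun t => ?_
    have e : (Fin.cons x (x • t) : Fin (m + 1) → ℝ) = x • xh t := by
      funext i
      refine Fin.cases ?_ (fun k => ?_) i <;> simp
    have hn := nrm_pos t
    rw [e, hs x hx, ← mul_assoc, ← ENNReal.ofReal_mul (by positivity), hφx,
      ← ENNReal.ofReal_mul (by positivity)]
    congr 2
    rw [gpdf, smul_dotProduct, dotProduct_smul, xh_dot, ← nrm_sq, abs_mul, abs_of_pos hn,
      Fintype.card_fin, smul_eq_mul, smul_eq_mul, mul_pow, inv_pow]
    have h5 : nrm t ^ m ≠ 0 := by positivity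
    field_simp
    rw [one_div, inv_pow, mul_inv_cancel₀ h5]
  rw [lintegral_congr_ae h2, lintegral_lintegral_swap]
  swap
  · refine Measurable.aemeasurable ?_
    refine ((hφm.comp ?_).mul ?_).mul (hHx.comp measurable_snd)
    · exact (continuous_nrm.measurable.comp measurable_snd).mul measurable_fst
    · exact (((continuous_nrm.measurable.comp measurable_snd).inv).pow_const _).ennreal_ofReal
  rw [← lintegral_const_mul _ (by
    exact ((continuous_nrm.measurable.inv).pow_const _).ennreal_ofReal.mul hHx)]
  refine lintegral_congr fun t => ?_
  have hn := nrm_pos t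
  simp_rw [mul_assoc]
  rw [lintegral_mul_const _ (show Measurable fun x => φx (nrm t * x) from
    hφm.comp (measurable_const_mul _)),
    lintegral_eq_abs_mul_comp_mul hn.ne' hφm, abs_of_pos hn]
  have : ENNReal.ofReal ((nrm t)⁻¹ ^ m) = ENNReal.ofReal (nrm t) *
      ENNReal.ofReal ((nrm t)⁻¹ ^ (m + 1)) := by
    rw [← ENNReal.ofReal_mul hn.le, _root_.pow_succ', ← mul_assoc, mul_inv_cancel₀ hn.ne', one_mul]
  rw [this]
  ring

lemma lintegral_stdG_homogeneous (hm : m ≠ 0) {H : (Fin (m + 1) → ℝ) → ENNReal} (hH : Measurable H)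
    (hs : ∀ x : ℝ, x ≠ 0 → ∀ g, H (x • g) = H g) :
    ∫⁻ g, H g ∂(stdG (Fin (m + 1))) = ∫⁻ t : Fin m → ℝ, ENNReal.ofReal (rho t) * H (xh t) := by
  have hk : (0 : ℝ) ≤ (√(2 * π))⁻¹ ^ m * Dm m := by have := Dm_pos m; positivity
  have hn : ∀ t : Fin m → ℝ, ENNReal.ofReal (rho t) = ENNReal.ofReal ((√(2 * π))⁻¹ ^ m * Dm m) *
      ENNReal.ofReal ((nrm t)⁻¹ ^ (m + 1)) := fun t => by rw [← ENNReal.ofReal_mul hk, rho]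
  have h1 := lintegral_stdG_homogeneous_aux (m := m) (H := fun _ => 1) measurable_const
    (fun _ _ _ => rfl)
  have h2 := lintegral_rho hm
  simp_rw [hn] at h2 ⊢
  simp only [lintegral_const, measure_univ, mul_one] at h1
  rw [lintegral_const_mul' _ _ ENNReal.ofReal_ne_top] at h2
  simp_rw [mul_assoc]
  rw [lintegral_const_mul' _ _ ENNReal.ofReal_ne_top, lintegral_stdG_homogeneous_aux hH hs]
  congr 1
  set X := ∫⁻ t : Fin m → ℝ, ENNReal.ofReal ((nrm t)⁻¹ ^ (m + 1)) with hX
  have hX0 : X ≠ 0 := by rintro h; rw [h] at h2; simp at h2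
  have hX1 : X ≠ ⊤ := by
    rintro h
    rw [h] at h1
    rcases eq_or_ne (∫⁻ x : ℝ, ENNReal.ofReal (|x| ^ m *
      ((√(2 * π))⁻¹ ^ (m + 1) * Real.exp (-x ^ 2 / 2)))) 0 with h3 | h3
    · rw [h3] at h1; simp at h1
    · rw [ENNReal.mul_top h3] at h1; simp at h1
  exact (ENNReal.mul_left_inj hX0 hX1).1 (h1.symm.trans h2.symm)

/-- Rotation invariance of the root distribution. -/
lemma lintegral_rho_vs_dot (hm : m ≠ 0) (s : Fin m → ℝ) {h : ℝ → ENNReal} (hh : Measurable h) :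
    ∫⁻ t : Fin m → ℝ, ENNReal.ofReal (rho t) * h |vs s ⬝ᵥ vs t|
      = ∫⁻ t : Fin m → ℝ, ENNReal.ofReal (rho t) * h (nrm t)⁻¹ := by
  have key : ∀ a : Fin (m + 1) → ℝ,
      ∫⁻ g, h (|a ⬝ᵥ g| / √(g ⬝ᵥ g)) ∂(stdG (Fin (m + 1)))
        = ∫⁻ t : Fin m → ℝ, ENNReal.ofReal (rho t) * h (|a ⬝ᵥ vs t|) := fun a => by
    rw [lintegral_stdG_homogeneous hm]
    · refine lintegral_congr fun t => ?_
      congr 2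
      rw [xh_dot, vs, dotProduct_smul, smul_eq_mul, abs_mul, abs_inv, abs_of_pos (nrm_pos t), nrm]
      field_simp
    · refine hh.comp ?_
      unfold dotProduct
      fun_prop
    · intro x hx g
      congr 1
      rw [dotProduct_smul, smul_dotProduct, dotProduct_smul, smul_eq_mul, smul_eq_mul, smul_eq_mul,
        ← mul_assoc, Real.sqrt_mul (mul_self_nonneg x), Real.sqrt_mul_self_eq_abs, abs_mul,
        mul_div_mul_left _ _ (abs_pos.2 hx).ne']
  have h0 : ∀ t : Fin m → ℝ, (nrm t)⁻¹ = |(Pi.single 0 1 : Fin (m + 1) → ℝ) ⬝ᵥ vs t| := fun t => by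
    rw [single_one_dotProduct, vs_zero_coord, abs_of_pos (inv_pos.2 (nrm_pos t))]
  simp_rw [h0]
  rw [← key, ← key]
  obtain ⟨O, hO, h1⟩ := exists_frame (p := 1) (fun _ => vs s) (fun i j => by
    rw [if_pos (Subsingleton.elim _ _), vs_dot_self]) (fun _ => 0)
    (fun i j _ => Subsingleton.elim _ _)
  have hOO : ∀ i j, O i ⬝ᵥ O j = if i = j then 1 else 0 := fun i j => by
    have := congrFun (congrFun hO i) j
    rw [Matrix.mul_apply, Matrix.one_apply] at this
    exact this
  have hlaw := stdG_map_rows (fun i => O i) (fun i => (Pi.single i 1 : Fin (m + 1) → ℝ))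
    (fun k l => by rw [hOO]; simp [Pi.single_apply, eq_comm])
  have hHm : Measurable fun g : Fin (m + 1) → ℝ => h (|g 0| / √(g ⬝ᵥ g)) := by
    refine hh.comp ?_
    unfold dotProduct
    fun_prop
  have e := congrArg (fun μ => ∫⁻ g, h (|g 0| / √(g ⬝ᵥ g)) ∂μ) hlaw
  beta_reduce at e
  rw [lintegral_map hHm (by unfold dotProduct; fun_prop),
    lintegral_map hHm (by unfold dotProduct; fun_prop)] at e
  have hn : ∀ g, (fun i => O i ⬝ᵥ g) ⬝ᵥ (fun i => O i ⬝ᵥ g) = g ⬝ᵥ g := fun g => by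
    have h2 : (fun i => O i ⬝ᵥ g) = O.mulVec g := rfl
    rw [h2, Matrix.dotProduct_mulVec, Matrix.vecMul_mulVec, mul_eq_one_comm.1 hO,
      Matrix.vecMul_one]
  have hs : ∀ g : Fin (m + 1) → ℝ, (fun i => (Pi.single i 1 : Fin (m + 1) → ℝ) ⬝ᵥ g) = g :=
    fun g => by ext i; simp
  simp_rw [hn, hs] at e
  rw [h1 0] at e
  exact e

end Rot
end

section

section TwoPoint
variable {m d : ℕ}

/-- Number of zeros of the system in `S`. -/
def Nz (d : ℕ) (S : Set (Fin m → ℝ)) (ω : Fin m × Jx m d → ℝ) : ENNReal :=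
  cnt {t ∈ S | ∀ ℓ, ft d t ⬝ᵥ row ω ℓ = 0}

lemma continuous_ft_dot_row :
    Continuous fun x : (Fin m × Jx m d → ℝ) × (Fin m → ℝ) => fun ℓ => ft d x.2 ⬝ᵥ row x.1 ℓ :=
  continuous_pi fun ℓ => (continuous_ft.comp continuous_snd).dotProduct
    ((continuous_row ℓ).comp continuous_fst)

lemma measurable_Nz {S : Set (Fin m → ℝ)} (hS : IsSigmaCompact S) :
    Measurable (Nz d S : (Fin m × Jx m d → ℝ) → ENNReal) := by
  convert! measurable_cnt_zeros
    (F := fun (ω : Fin m × Jx m d → ℝ) (t : Fin m → ℝ) ℓ => ft d t ⬝ᵥ row ω ℓ)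
    continuous_ft_dot_row 0 hS using 1
  funext ω
  simp only [Nz, funext_iff, Pi.zero_apply]

lemma abs_det_dft (O : Matrix (Fin (m + 1)) (Fin (m + 1)) ℝ) (hO : O * O.transpose = 1)
    (t : Fin m → ℝ) (h0 : O 0 = vs t) (ω : Fin m × Jx m d → ℝ) :
    |(detM (dft d t) ω).det|
      = (nrm t)⁻¹ ^ (m + 1) * |(detM (fun i : Fin m => dhomE (vs t) (O i.succ)) ω).det| := by
  rw [← abs_det_frame O hO t h0]
  congr 2
  ext ℓ k
  rw [Matrix.of_apply, detM_apply, dft_eq O hO t h0 k]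
  simp only [sum_dotProduct, smul_dotProduct, smul_eq_mul]
  rfl

lemma lintegral_abs_det_dft (hd : d ≠ 0) (t : Fin m → ℝ) :
    ∫⁻ ω, ENNReal.ofReal |(detM (dft d t) ω).det| ∂(stdG (Fin m × Jx m d))
      = ENNReal.ofReal ((nrm t)⁻¹ ^ (m + 1) * √d ^ m * Dm m) := by
  obtain ⟨O, hO, h1⟩ := exists_frame (p := 1) (fun _ => vs t) (fun i j => by
    rw [if_pos (Subsingleton.elim _ _), vs_dot_self]) (fun _ => 0)
    (fun i j _ => Subsingleton.elim _ _)
  have h0 : O 0 = vs t := h1 0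
  have hfr := frame_dot O hO
  have Os : ∀ i : Fin m, O i.succ ⬝ᵥ vs t = 0 := fun i => by rw [← h0, hfr]; simp
  have hd0 : (0 : ℝ) < d := by positivity
  have hu : ∀ i j : Fin m, ((√d)⁻¹ • dhomE (vs t) (O i.succ) : Jx m d → ℝ) ⬝ᵥ
      ((√d)⁻¹ • dhomE (vs t) (O j.succ)) = if i = j then 1 else 0 := fun i j => by
    rw [smul_dotProduct, dotProduct_smul, dhomE_dot_dhomE, Os, hfr, vs_dot_self, smul_eq_mul,
      smul_eq_mul, ← mul_assoc, ← pow_two, inv_pow, Real.sq_sqrt hd0.le]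
    by_cases h : i = j
    · simp [h, hd0.ne']
    · simp [h]
  have key := det_law hu (f := ENNReal.ofReal) ENNReal.measurable_ofReal
  have hn := nrm_pos t
  have hsd : 0 < √(d : ℝ) := Real.sqrt_pos.2 hd0
  have e : ∀ ω : Fin m × Jx m d → ℝ, |(detM (dft d t) ω).det| = (nrm t)⁻¹ ^ (m + 1) * √d ^ m *
      |(detM (fun i : Fin m => (√d)⁻¹ • dhomE (vs t) (O i.succ)) ω).det| := fun ω => by
    rw [abs_det_dft O hO t h0, detM_smul (fun _ => (√d)⁻¹), abs_mul, Finset.prod_const,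
      Finset.card_univ, Fintype.card_fin, abs_of_pos (pow_pos (inv_pos.2 hsd) m), inv_pow (√(d : ℝ)) m,
      mul_assoc, mul_inv_cancel_left₀ (pow_pos hsd m).ne']
  simp_rw [e]
  rw [ENNReal.ofReal_mul (by positivity), ofReal_Dm]
  simp_rw [fun x => ENNReal.ofReal_mul (p := (nrm t)⁻¹ ^ (m + 1) * √d ^ m) (q := x)
    (by positivity)]
  rw [lintegral_const_mul' _ _ ENNReal.ofReal_ne_top, key, DP]
  simp

theorem lintegral_Nz (hd : d ≠ 0) {S : Set (Fin m → ℝ)} (hS : IsSigmaCompact S) :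
    ∫⁻ ω, Nz d S ω ∂(stdG (Fin m × Jx m d))
      = ENNReal.ofReal (√d ^ m) * ∫⁻ t in S, ENNReal.ofReal (rho t) := by
  have h := one_point (isFeat_ft (m := m) (d := d)) (c := fun _ => 0) (dc := fun _ => 0)
    continuous_const (fun t => by
      have : matCLM (0 : Matrix (Fin m) (Fin m) ℝ) = 0 := by
        ext v; simp [matCLM]
      rw [this]
      exact hasFDerivAt_const _ _) one_pos hS
  simp only [one_mul, Pi.zero_apply, add_zero, one_smul, smul_zero, inv_one, one_pow] at h
  rw [← lintegral_const_mul' _ _ ENNReal.ofReal_ne_top]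
  refine h.trans (lintegral_congr fun t => ?_)
  have hD := Dm_pos m
  have hn := nrm_pos t
  rw [lintegral_abs_det_dft hd, ← ENNReal.ofReal_mul (gpdf_pos _).le,
    ← ENNReal.ofReal_mul (by positivity), gpdf, rho, zero_dotProduct, Fintype.card_fin]
  congr 1
  simp
  ring

lemma stdG_rot_measurePreserving {ι : Type*} [Fintype ι] {r ρ : ℝ} (h : r ^ 2 + ρ ^ 2 = 1) :
    MeasurePreserving (fun p : (ι → ℝ) × (ι → ℝ) => r • p.1 + ρ • p.2)
      ((stdG ι).prod (stdG ι)) (stdG ι) := by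
  classical
  refine ⟨by fun_prop, ?_⟩
  have := stdG_map_prod_rows (fun i : ι => r • (Pi.single i 1 : ι → ℝ))
    (fun i : ι => ρ • (Pi.single i 1 : ι → ℝ)) (fun i : ι => (Pi.single i 1 : ι → ℝ))
    (fun k l => by
      simp only [smul_dotProduct, dotProduct_smul, smul_eq_mul]
      linear_combination (Pi.single k 1 ⬝ᵥ (Pi.single l 1 : ι → ℝ)) * h)
  simp only [smul_dotProduct, single_one_dotProduct, smul_eq_mul] at this
  exact this.trans Measure.map_id

/-- Two independent coefficient vectors as one. -/
def pairUp {K J : Type*} (p : (K × J → ℝ) × (K × J → ℝ)) (i : K × (J ⊕ J)) : ℝ :=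
  Sum.elim (fun j => p.1 (i.1, j)) (fun j => p.2 (i.1, j)) i.2

lemma pairUp_measurePreserving {K J : Type*} [Fintype K] [Fintype J] :
    MeasurePreserving (pairUp : (K × J → ℝ) × (K × J → ℝ) → _)
      ((stdG (K × J)).prod (stdG (K × J))) (stdG (K × (J ⊕ J))) := by
  classical
  have hm : Measurable (pairUp : (K × J → ℝ) × (K × J → ℝ) → _) := by
    refine measurable_pi_iff.2 ?_
    rintro ⟨k, j | j⟩
    · exact (measurable_pi_apply (k, j)).comp measurable_fst
    · exact (measurable_pi_apply (k, j)).comp measurable_snd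
  refine ⟨hm, ?_⟩
  have := stdG_map_prod_rows (η := K × (J ⊕ J))
    (fun i => Sum.elim (fun j => (Pi.single (i.1, j) 1 : K × J → ℝ)) (fun _ => 0) i.2)
    (fun i => Sum.elim (fun _ => 0) (fun j => (Pi.single (i.1, j) 1 : K × J → ℝ)) i.2)
    (fun i => (Pi.single i 1 : K × (J ⊕ J) → ℝ)) (by
      rintro ⟨k, j | j⟩ ⟨l, i | i⟩ <;>
        simp [Pi.single_apply])
  rw [show (fun (ω : K × (J ⊕ J) → ℝ) i => (Pi.single i 1 : K × (J ⊕ J) → ℝ) ⬝ᵥ ω) = id from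
    funext fun ω => funext fun i => single_one_dotProduct _ _, Measure.map_id] at this
  rw [← this]
  congr 1
  funext p i
  rcases i with ⟨k, j | j⟩ <;> simp [pairUp]

variable [NeZero m]

/-- Two-point function of the zeros with respect to their intensity. -/
def kk (m : ℕ) [NeZero m] (d : ℕ) (r c : ℝ) : ℝ :=
  (√(1 - kA d r c ^ 2))⁻¹ ^ m * kS d r c * Gr (kC d r c : Fin m → ℝ) / Dm m ^ 2

lemma measurable_Gr : Measurable (Gr : (Fin m → ℝ) → ℝ) := by
  have : Continuous (Function.uncurry (gInt : (Fin m → ℝ) → _)) := by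
    unfold gInt Function.uncurry
    refine Continuous.mul ?_ (Continuous.abs (Continuous.matrix_det ?_))
    · exact Continuous.abs (Continuous.matrix_det
        (continuous_detM.comp (continuous_const.prodMk continuous_snd)))
    · refine continuous_matrix fun i j => ?_
      simp_rw [detM_mB_apply]
      fun_prop
  exact (this.stronglyMeasurable.integral_prod_right (ν := stdG _)).measurable

lemma measurable_kk (d : ℕ) (r : ℝ) : Measurable (kk m d r) := by
  have hA : Measurable (kA d r) := by unfold kA; fun_prop
  have hB : Measurable (kB d r) := by unfold kB; fun_prop
  have hS : Measurable (kS d r) := by unfold kS; fun_prop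
  have hD : Measurable (kD d r) := by unfold kD; fun_prop
  have hK : Measurable (kK d r) := by unfold kK; fun_prop
  have hE : Measurable (kE d r) := by unfold kE; fun_prop
  have hC : Measurable fun c => (kC d r c : Fin m → ℝ) := by
    refine measurable_pi_iff.2 fun i => ?_
    unfold kC
    split_ifs
    · exact hK.div hS
    · exact hE
  have := measurable_Gr.comp hC
  unfold kk
  exact ((((hA.pow_const 2).const_sub 1).sqrt.inv.pow_const m).mul hS).mul this |>.div_const _

lemma cnt_prod {S T : Set (Fin m → ℝ)} :
    cnt {x : Fin m ⊕ Fin m → ℝ | x ∘ Sum.inl ∈ S ∧ x ∘ Sum.inr ∈ T} = cnt S * cnt T := by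
  have h : (Equiv.sumPiEquivProdPi fun _ : Fin m ⊕ Fin m => ℝ) ''
      {x : Fin m ⊕ Fin m → ℝ | x ∘ Sum.inl ∈ S ∧ x ∘ Sum.inr ∈ T} = S ×ˢ T := by
    rw [Equiv.image_eq_preimage_symm]
    rfl
  have h2 := (Equiv.injective (Equiv.sumPiEquivProdPi fun _ : Fin m ⊕ Fin m => ℝ)).encard_image
    {x : Fin m ⊕ Fin m → ℝ | x ∘ Sum.inl ∈ S ∧ x ∘ Sum.inr ∈ T}
  rw [cnt, ← h2, h, Set.encard_prod, cnt, cnt, ENat.toENNReal_mul]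

lemma cnt_sq {S : Set (Fin m → ℝ)} :
    cnt S ^ 2 = cnt S + cnt {x : Fin m ⊕ Fin m → ℝ | x ∘ Sum.inl ∈ S ∧ x ∘ Sum.inr ∈ S ∧
      x ∘ Sum.inl ≠ x ∘ Sum.inr} := by
  have h : cnt {x : Fin m ⊕ Fin m → ℝ | x ∘ Sum.inl ∈ S ∧ x ∘ Sum.inr ∈ S ∧
      x ∘ Sum.inl = x ∘ Sum.inr} = cnt S := by
    have hi : Function.Injective fun t : Fin m → ℝ => (Sum.elim t t : Fin m ⊕ Fin m → ℝ) :=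
      fun s t h => funext fun i => congrFun h (Sum.inl i)
    rw [cnt, cnt, ← hi.encard_image]
    congr 2
    ext x
    constructor
    · rintro ⟨h1, -, h3⟩
      refine ⟨x ∘ Sum.inl, h1, ?_⟩
      show Sum.elim (x ∘ Sum.inl) (x ∘ Sum.inl) = x
      nth_rw 2 [h3]
      exact Sum.elim_comp_inl_inr x
    · rintro ⟨t, ht, rfl⟩
      exact ⟨ht, ht, rfl⟩
  rw [pow_two, ← cnt_prod]
  nth_rw 1 [← h]
  rw [← cnt_union]
  · congr 1
    ext x
    simp only [Set.mem_union, Set.mem_ofPred_eq]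
    tauto
  · rw [Set.disjoint_left]
    rintro x ⟨-, -, h1⟩ ⟨-, -, h2⟩
    exact h2 h1

/-- Pairs of distinct zeros of two correlated systems. -/
def pairSet (d : ℕ) (B B' : Set (Fin m → ℝ)) (ω ω' : Fin m × Jx m d → ℝ) :
    Set (Fin m ⊕ Fin m → ℝ) :=
  {x | x ∘ Sum.inl ∈ {t ∈ B | ∀ ℓ, ft d t ⬝ᵥ row ω ℓ = 0} ∧
    x ∘ Sum.inr ∈ {t ∈ B' | ∀ ℓ, ft d t ⬝ᵥ row ω' ℓ = 0} ∧ x ∘ Sum.inl ≠ x ∘ Sum.inr}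

lemma isSigmaCompact_offDiag {B B' : Set (Fin m → ℝ)} (hB : IsSigmaCompact B)
    (hB' : IsSigmaCompact B') : IsSigmaCompact {x : Fin m ⊕ Fin m → ℝ |
      x ∘ Sum.inl ∈ B ∧ x ∘ Sum.inr ∈ B' ∧ x ∘ Sum.inl ≠ x ∘ Sum.inr} := by
  have h1 : Continuous fun p : (Fin m → ℝ) × (Fin m → ℝ) =>
      (Sum.elim p.1 p.2 : Fin m ⊕ Fin m → ℝ) := by
    refine continuous_pi ?_
    rintro (i | i)
    · exact (continuous_apply i).comp continuous_fst
    · exact (continuous_apply i).comp continuous_snd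
  have h0 : IsSigmaCompact (B ×ˢ B') := by
    obtain ⟨K, hK, rfl⟩ := hB
    obtain ⟨K', hK', rfl⟩ := hB'
    rw [show (⋃ n, K n) ×ˢ (⋃ n, K' n) = ⋃ x : ℕ × ℕ, K x.1 ×ˢ K' x.2 by ext; simp]
    exact isSigmaCompact_iUnion_of_isCompact _ fun x => (hK x.1).prod (hK' x.2)
  have h2 := h0.image h1
  have ho : IsOpen {x : Fin m ⊕ Fin m → ℝ | x ∘ Sum.inl ≠ x ∘ Sum.inr} :=
    isOpen_ne_fun (by fun_prop) (by fun_prop)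
  convert! h2.inter_isOpen ho using 1
  ext x
  constructor
  · rintro ⟨ha, hb, hc⟩
    exact ⟨⟨(x ∘ Sum.inl, x ∘ Sum.inr), ⟨ha, hb⟩, Sum.elim_comp_inl_inr x⟩, hc⟩
  · rintro ⟨⟨p, ⟨ha, hb⟩, rfl⟩, hc⟩
    exact ⟨ha, hb, hc⟩

lemma kk_nonneg (hd : d ≠ 0) {r : ℝ} (hr : r ^ 2 ≤ 1) {s t : Fin m → ℝ} (h : s ≠ t) :
    0 ≤ kS d r (vs s ⬝ᵥ vs t) ∧ (∀ i : Fin m, |kC d r (vs s ⬝ᵥ vs t) i| ≤ 1) ∧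
      0 ≤ kk m d r (vs s ⬝ᵥ vs t) := by
  obtain ⟨h1, h2, -⟩ := pair_point hd (r := r) (ρ := √(1 - r ^ 2))
    (by rw [Real.sq_sqrt (by linarith)]; ring) h rfl rfl rfl
  have h3 := Gr_nonneg (kC d r (vs s ⬝ᵥ vs t) : Fin m → ℝ)
  refine ⟨h1, h2, ?_⟩
  unfold kk
  positivity

theorem lintegral_cnt_pairSet (hd : d ≠ 0) {r ρ : ℝ} (hr : r ^ 2 + ρ ^ 2 = 1)
    {B B' : Set (Fin m → ℝ)} (hB : IsSigmaCompact B) (hB' : IsSigmaCompact B') :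
    ∫⁻ p, cnt (pairSet d B B' p.1 (r • p.1 + ρ • p.2))
        ∂((stdG (Fin m × Jx m d)).prod (stdG (Fin m × Jx m d)))
      = ENNReal.ofReal (d ^ m) * ∫⁻ s in B, ∫⁻ t in B',
          ENNReal.ofReal (kk m d r (vs s ⬝ᵥ vs t) * rho s * rho t) := by
  set S : Set (Fin m ⊕ Fin m → ℝ) :=
    {x | x ∘ Sum.inl ∈ B ∧ x ∘ Sum.inr ∈ B' ∧ x ∘ Sum.inl ≠ x ∘ Sum.inr} with hS
  have hSc : IsSigmaCompact S := isSigmaCompact_offDiag hB hB'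
  have hF := (isFeat_ft (m := m) (d := d))
  have hp := hF.lift (a := 1) (b := 0) (by norm_num)
  have hq := hF.lift hr
  have hr1 : r ^ 2 ≤ 1 := by nlinarith [sq_nonneg ρ]
  have hlt : ∀ x ∈ S, (liftF 1 0 (ft d (x ∘ Sum.inl)) ⬝ᵥ liftF r ρ (ft d (x ∘ Sum.inr))) ^ 2
      < 1 := fun x hx => by
    have := kA_sq_lt_one hd hr1 (vs_dot_sq_lt_one hx.2.2)
    rw [liftF_dot, ft_dot]
    simpa [kA] using this
  have key := two_point hp hq hSc hlt
  have hcm : Measurable fun ω : Fin m × (Jx m d ⊕ Jx m d) → ℝ =>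
      cnt {x ∈ S | ∀ ℓ, liftF 1 0 (ft d (x ∘ Sum.inl)) ⬝ᵥ row ω ℓ = 0 ∧
        liftF r ρ (ft d (x ∘ Sum.inr)) ⬝ᵥ row ω ℓ = 0} := by
    convert! measurable_cnt_zeros (F := fun (ω : Fin m × (Jx m d ⊕ Jx m d) → ℝ)
        (x : Fin m ⊕ Fin m → ℝ) (ℓ : Fin m) =>
        (liftF 1 0 (ft d (x ∘ Sum.inl)) ⬝ᵥ row ω ℓ, liftF r ρ (ft d (x ∘ Sum.inr)) ⬝ᵥ row ω ℓ))
      ?_ 0 hSc using 1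
    · funext ω
      simp only [funext_iff, Prod.ext_iff, Pi.zero_apply, Prod.fst_zero, Prod.snd_zero]
    · refine continuous_pi fun ℓ => ?_
      have hx : ∀ e : Fin m → Fin m ⊕ Fin m, Continuous fun x : (Fin m × (Jx m d ⊕ Jx m d) → ℝ) ×
        (Fin m ⊕ Fin m → ℝ) => x.2 ∘ e := fun e => by fun_prop
      have hrow := (continuous_row (J := Jx m d ⊕ Jx m d) ℓ).comp
        (continuous_fst (X := Fin m × (Jx m d ⊕ Jx m d) → ℝ) (Y := Fin m ⊕ Fin m → ℝ))
      exact ((hp.cont.comp (hx Sum.inl)).dotProduct hrow).prodMk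
        ((hq.cont.comp (hx Sum.inr)).dotProduct hrow)
  have h1 := pairUp_measurePreserving.lintegral_comp hcm
  have hset : ∀ p : (Fin m × Jx m d → ℝ) × (Fin m × Jx m d → ℝ),
      {x ∈ S | ∀ ℓ, liftF 1 0 (ft d (x ∘ Sum.inl)) ⬝ᵥ row (pairUp p) ℓ = 0 ∧
        liftF r ρ (ft d (x ∘ Sum.inr)) ⬝ᵥ row (pairUp p) ℓ = 0}
        = pairSet d B B' p.1 (r • p.1 + ρ • p.2) := fun p => by
    ext x
    have e1 : ∀ ℓ, row (pairUp p) ℓ ∘ Sum.inl = row p.1 ℓ := fun ℓ => rfl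
    have e2 : ∀ ℓ, row (pairUp p) ℓ ∘ Sum.inr = row p.2 ℓ := fun ℓ => rfl
    have e3 : ∀ ℓ, row (r • p.1 + ρ • p.2) ℓ = r • row p.1 ℓ + ρ • row p.2 ℓ := fun ℓ => rfl
    simp only [pairSet, Set.mem_ofPred_eq, liftF_dot_elim, e1, e2, e3, hS, one_smul, zero_smul,
      add_zero, forall_and]
    tauto
  simp only [hset] at h1
  rw [h1, key]
  have hmeas : Measurable fun p : (Fin m → ℝ) × (Fin m → ℝ) =>
      ENNReal.ofReal (kk m d r (vs p.1 ⬝ᵥ vs p.2) * rho p.1 * rho p.2) := by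
    have hv : Continuous (vs : (Fin m → ℝ) → _) := contDiff_vs.continuous
    have : Measurable fun p : (Fin m → ℝ) × (Fin m → ℝ) => vs p.1 ⬝ᵥ vs p.2 :=
      ((hv.comp continuous_fst).dotProduct (hv.comp continuous_snd)).measurable
    exact ((((measurable_kk d r).comp this).mul
      (continuous_rho.measurable.comp measurable_fst)).mul
      (continuous_rho.measurable.comp measurable_snd)).ennreal_ofReal
  obtain ⟨hSm⟩ : Nonempty (MeasurableSet S) := by
    obtain ⟨K, hK, h⟩ := hSc
    exact ⟨h ▸ MeasurableSet.iUnion fun n => (hK n).measurableSet⟩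
  have hcongr : ∫⁻ x in S, ENNReal.ofReal (d ^ m) * ENNReal.ofReal
      (kk m d r (vs (x ∘ Sum.inl) ⬝ᵥ vs (x ∘ Sum.inr)) * rho (x ∘ Sum.inl) * rho (x ∘ Sum.inr))
      = ENNReal.ofReal (d ^ m) * ∫⁻ s in B, ∫⁻ t in B',
          ENNReal.ofReal (kk m d r (vs s ⬝ᵥ vs t) * rho s * rho t) := by
    rw [lintegral_const_mul' _ _ ENNReal.ofReal_ne_top]
    congr 1
    have hmp := volume_measurePreserving_sumPiEquivProdPi (fun _ : Fin m ⊕ Fin m => ℝ)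
    have hBm : MeasurableSet {p : (Fin m → ℝ) × (Fin m → ℝ) | p.1 ≠ p.2} :=
      (isOpen_ne_fun continuous_fst continuous_snd).measurableSet
    have hms : ∀ {C : Set (Fin m → ℝ)}, IsSigmaCompact C → MeasurableSet C := fun ⟨K, hK, h⟩ =>
      h ▸ MeasurableSet.iUnion fun n => (hK n).measurableSet
    have hnull : (volume : Measure ((Fin m → ℝ) × (Fin m → ℝ))) {p | p.1 ≠ p.2}ᶜ = 0 := by
      rw [show (volume : Measure ((Fin m → ℝ) × (Fin m → ℝ))) = volume.prod volume from rfl,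
        Measure.measure_prod_null hBm.compl]
      refine Eventually.of_forall fun s => ?_
      have : Prod.mk s ⁻¹' {p : (Fin m → ℝ) × (Fin m → ℝ) | p.1 ≠ p.2}ᶜ = {s} := by
        ext t; simp [eq_comm]
      show volume (Prod.mk s ⁻¹' {p : (Fin m → ℝ) × (Fin m → ℝ) | p.1 ≠ p.2}ᶜ) = 0
      rw [this]
      simp
    have hBB : S = (MeasurableEquiv.sumPiEquivProdPi (fun _ : Fin m ⊕ Fin m => ℝ)) ⁻¹'
        ((B ×ˢ B') ∩ {p | p.1 ≠ p.2}) := by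
      ext x
      simp only [hS, Set.mem_preimage, Set.mem_inter_iff, Set.mem_prod, and_assoc]
      rfl
    have h2 := hmp.setLIntegral_comp_preimage (((hms hB).prod (hms hB')).inter hBm) hmeas
    rw [← hBB] at h2
    refine h2.trans ?_
    rw [setLIntegral_congr (inter_ae_eq_left_of_ae_eq_univ (ae_eq_univ.2 hnull)),
      show (volume : Measure ((Fin m → ℝ) × (Fin m → ℝ))) = volume.prod volume from rfl,
      ← Measure.prod_restrict, lintegral_prod _ hmeas.aemeasurable]
  rw [← hcongr]
  refine setLIntegral_congr_fun hSm fun x hx => ?_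
  obtain ⟨-, hC, h3⟩ := pair_point hd hr hx.2.2 rfl rfl rfl
  have h5 := (kk_nonneg hd hr1 hx.2.2).1
  have h6 := nrm_pos (x ∘ Sum.inl)
  have h7 := nrm_pos (x ∘ Sum.inr)
  have h8 := Dm_pos m
  rw [h3, ← ofReal_Gr hC, ← ENNReal.ofReal_mul (by positivity),
    ← ENNReal.ofReal_mul (by positivity), ← ENNReal.ofReal_mul (by positivity)]
  congr 1
  rw [liftF_dot, ft_dot, kk, rho, rho, kA]
  simp only [one_mul, zero_mul, add_zero]
  field_simp
  ring

end TwoPoint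
end

section

section Second
variable {m d : ℕ} [NeZero m]

lemma IsSigmaCompact.measurableSet' {C : Set (Fin m → ℝ)} (h : IsSigmaCompact C) :
    MeasurableSet C := by
  obtain ⟨K, hK, rfl⟩ := h
  exact MeasurableSet.iUnion fun n => (hK n).measurableSet

lemma kk_abs (hd : 2 ≤ d) {r : ℝ} (hr : r ^ 2 ≤ 1) {s t : Fin m → ℝ} (h : s ≠ t) :
    kk m d r |vs s ⬝ᵥ vs t| = kk m d r (vs s ⬝ᵥ vs t) := by
  obtain ⟨-, h2, -⟩ := kk_nonneg (by omega : d ≠ 0) hr h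
  revert h2
  generalize vs s ⬝ᵥ vs t = c
  intro h2
  rcases abs_cases c with ⟨h, -⟩ | ⟨h, -⟩
  · rw [h]
  rw [h]
  have hA : kA d r (-c) ^ 2 = kA d r c ^ 2 := by simp only [kA]; rw [mul_pow, mul_pow, ← pow_mul,
    ← pow_mul, Even.neg_pow ⟨d, by ring⟩]
  have hB : kB d r (-c) = kB d r c := by
    simp only [kB]; rw [← pow_mul, ← pow_mul, Even.neg_pow ⟨d - 1, by ring⟩, neg_sq]
  have hS : kS d r (-c) = kS d r c := by rw [kS, kS, hA, hB]
  obtain ⟨n, rfl⟩ : ∃ n, d = n + 2 := ⟨d - 2, by omega⟩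
  have hC : ∀ i : Fin m, kC (n + 2) r (-c) i = kC (n + 2) r c i ∨
      kC (n + 2) r (-c) i = -kC (n + 2) r c i := by
    intro i
    simp only [kC, kK, hA, hB, hS, kD, kE, kA]
    simp only [show n + 2 - 1 = n + 1 by omega, show n + 2 - 2 = n by omega]
    rcases neg_one_pow_eq_or ℝ n with h | h
    all_goals
      rw [neg_pow c (n + 2), neg_pow c (n + 1), neg_pow c n, pow_add (-1 : ℝ) n 2,
        pow_add (-1 : ℝ) n 1, h]
      split_ifs
      · first
        | (left; ring1)
        | (right; ring1)
      · first
        | (left; ring1)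
        | (right; ring1)
  rw [kk, kk, hA, hS, Gr_neg h2 hC]

/-- Mass of the two-point function. -/
def Mk (m : ℕ) [NeZero m] (h : ℝ → ℝ) : ENNReal :=
  ∫⁻ t : Fin m → ℝ, ENNReal.ofReal (rho t) * ENNReal.ofReal (h (nrm t)⁻¹)

lemma lintegral_kk_rho (hd : 2 ≤ d) {r : ℝ} (hr : r ^ 2 ≤ 1) {g : ℝ → ℝ} (hg : Measurable g)
    (s : Fin m → ℝ) :
    ∫⁻ t, ENNReal.ofReal (rho t) * ENNReal.ofReal (g (kk m d r (vs s ⬝ᵥ vs t)))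
      = Mk m fun c => g (kk m d r c) := by
  rw [Mk, ← lintegral_rho_vs_dot (NeZero.ne m) s (h := fun c => ENNReal.ofReal (g (kk m d r c)))
    (hg.comp (measurable_kk d r)).ennreal_ofReal]
  refine lintegral_congr_ae ?_
  filter_upwards [(Set.finite_singleton s).measure_zero volume |> compl_mem_ae_iff.2] with t ht
  rw [kk_abs hd hr (fun h => ht h.symm)]

/-- Mass of the root distribution. -/
def muB (S : Set (Fin m → ℝ)) : ENNReal := ∫⁻ t in S, ENNReal.ofReal (rho t)

lemma lintegral_Nz_mul_ge (hd : 2 ≤ d) {r ρ : ℝ} (hr : r ^ 2 + ρ ^ 2 = 1) :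
    ENNReal.ofReal (d ^ m) * Mk m (kk m d r) ≤
      ∫⁻ p, Nz d Set.univ p.1 * Nz d Set.univ (r • p.1 + ρ • p.2)
        ∂((stdG (Fin m × Jx m d)).prod (stdG (Fin m × Jx m d))) := by
  have h0 := isSigmaCompact_univ (X := Fin m → ℝ)
  have h1 := lintegral_cnt_pairSet (by omega : d ≠ 0) hr h0 h0
  refine le_trans (le_of_eq ?_) (h1.ge.trans (lintegral_mono fun p => ?_))
  · congr 1
    simp only [Measure.restrict_univ]
    have hr1 : r ^ 2 ≤ 1 := by nlinarith [sq_nonneg ρ]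
    have : ∀ s : Fin m → ℝ, ∫⁻ t : Fin m → ℝ, ENNReal.ofReal
        (kk m d r (vs s ⬝ᵥ vs t) * rho s * rho t)
        = ENNReal.ofReal (rho s) * Mk m (kk m d r) := fun s => by
      have h5 : ∫⁻ t : Fin m → ℝ, ENNReal.ofReal (rho t) * ENNReal.ofReal (kk m d r (vs s ⬝ᵥ vs t))
        = Mk m (kk m d r) := lintegral_kk_rho (g := id) hd hr1 measurable_id s
      rw [← h5, ← lintegral_const_mul' _ _ ENNReal.ofReal_ne_top]
      refine lintegral_congr fun t => ?_
      have h1 := (rho_pos s).le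
      have h2 := (rho_pos t).le
      rw [← ENNReal.ofReal_mul h2, ← ENNReal.ofReal_mul h1]
      congr 1
      ring
    simp_rw [this]
    rw [lintegral_mul_const _ continuous_rho.measurable.ennreal_ofReal, lintegral_rho (NeZero.ne m),
      one_mul]
  · rw [Nz, Nz, ← cnt_prod]
    exact cnt_mono fun x hx => ⟨hx.1, hx.2.1⟩

lemma lintegral_Nz_sq_eq (hd : 2 ≤ d) {B : Set (Fin m → ℝ)} (hB : IsSigmaCompact B) :
    ∫⁻ ω, Nz d B ω ^ 2 ∂(stdG (Fin m × Jx m d)) = ENNReal.ofReal (√d ^ m) * muB B +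
      ENNReal.ofReal (d ^ m) * ∫⁻ s in B, ENNReal.ofReal (rho s) *
        ∫⁻ t in B, ENNReal.ofReal (rho t) * ENNReal.ofReal (kk m d 1 (vs s ⬝ᵥ vs t)) := by
  have h1 := lintegral_cnt_pairSet (by omega : d ≠ 0) (r := 1) (ρ := 0) (by norm_num) hB hB
  simp only [one_smul, zero_smul, add_zero] at h1
  have h2 : ∀ ω : Fin m × Jx m d → ℝ, Nz d B ω ^ 2 = Nz d B ω + cnt (pairSet d B B ω ω) :=
    fun ω => cnt_sq
  simp_rw [h2]
  rw [lintegral_add_left (measurable_Nz hB), lintegral_Nz (by omega) hB]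
  congr 1
  have h3 := (measurePreserving_fst (μ := stdG (Fin m × Jx m d)) (ν := stdG (Fin m × Jx m d)))
  have h4 : Measurable fun ω : Fin m × Jx m d → ℝ => cnt (pairSet d B B ω ω) := by
    convert! measurable_cnt_zeros (F := fun (ω : Fin m × Jx m d → ℝ)
        (x : Fin m ⊕ Fin m → ℝ) (ℓ : Fin m) =>
        (ft d (x ∘ Sum.inl) ⬝ᵥ row ω ℓ, ft d (x ∘ Sum.inr) ⬝ᵥ row ω ℓ))
      ?_ 0 (isSigmaCompact_offDiag hB hB) using 1
    · funext ω
      congr 1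
      ext x
      simp only [pairSet, funext_iff, Prod.ext_iff, Pi.zero_apply, Prod.fst_zero, Prod.snd_zero,
        Set.mem_ofPred_eq, forall_and]
      tauto
    · refine continuous_pi fun ℓ => ?_
      have hx : ∀ e : Fin m → Fin m ⊕ Fin m, Continuous fun x : (Fin m × Jx m d → ℝ) ×
        (Fin m ⊕ Fin m → ℝ) => x.2 ∘ e := fun e => by fun_prop
      have hrow := (continuous_row (J := Jx m d) ℓ).comp
        (continuous_fst (X := Fin m × Jx m d → ℝ) (Y := Fin m ⊕ Fin m → ℝ))
      exact ((continuous_ft.comp (hx Sum.inl)).dotProduct hrow).prodMk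
        ((continuous_ft.comp (hx Sum.inr)).dotProduct hrow)
  rw [← h3.lintegral_comp h4, h1]
  congr 1
  refine lintegral_congr fun s => ?_
  rw [← lintegral_const_mul' _ _ ENNReal.ofReal_ne_top]
  refine lintegral_congr fun t => ?_
  have h1 := (rho_pos s).le
  have h2 := (rho_pos t).le
  rw [← ENNReal.ofReal_mul h2, ← ENNReal.ofReal_mul h1]
  congr 1
  ring

lemma lintegral_Nz_sq_le (hd : 2 ≤ d) {B : Set (Fin m → ℝ)} (hB : IsSigmaCompact B) :
    ∫⁻ ω, Nz d B ω ^ 2 ∂(stdG (Fin m × Jx m d)) ≤ ENNReal.ofReal (√d ^ m) * muB B +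
      ENNReal.ofReal (d ^ m) * (muB B * (muB B + Mk m fun c => |kk m d 1 c - 1|)) := by
  rw [lintegral_Nz_sq_eq hd hB]
  gcongr
  rw [muB, ← lintegral_mul_const _ continuous_rho.measurable.ennreal_ofReal]
  refine lintegral_mono fun s => ?_
  simp only
  gcongr
  rw [← lintegral_kk_rho (g := fun x => |x - 1|) hd (r := 1) (by norm_num) (by fun_prop) s]
  refine le_trans ?_ (add_le_add le_rfl (setLIntegral_le_lintegral B _))
  rw [← lintegral_add_left continuous_rho.measurable.ennreal_ofReal]
  refine lintegral_mono fun t => ?_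
  simp only
  nth_rw 2 [← mul_one (ENNReal.ofReal (rho t))]
  rw [← mul_add, ← ENNReal.ofReal_one, ← ENNReal.ofReal_add zero_le_one (abs_nonneg _)]
  gcongr
  linarith [le_abs_self (kk m d 1 (vs s ⬝ᵥ vs t) - 1)]

lemma lintegral_Nz_univ_sq (hd : 2 ≤ d) :
    ∫⁻ ω, Nz d Set.univ ω ^ 2 ∂(stdG (Fin m × Jx m d)) = ENNReal.ofReal (√d ^ m) +
      ENNReal.ofReal (d ^ m) * Mk m (kk m d 1) := by
  rw [lintegral_Nz_sq_eq hd isSigmaCompact_univ]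
  simp only [Measure.restrict_univ, muB]
  have h := fun s : Fin m → ℝ =>
    lintegral_kk_rho (g := id) hd (r := 1) (by norm_num) measurable_id s
  simp only [id] at h
  simp_rw [h]
  rw [lintegral_mul_const _ continuous_rho.measurable.ennreal_ofReal, lintegral_rho (NeZero.ne m),
    one_mul, mul_one]

end Second
end

section

section SecondReal
variable {m d : ℕ} [NeZero m]

/-- Number of zeros in `S` as a real number. -/
def nz (d : ℕ) (S : Set (Fin m → ℝ)) (ω : Fin m × Jx m d → ℝ) : ℝ := (Nz d S ω).toReal

/-- Renormalized integrated covariance. -/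
def Ik (m : ℕ) [NeZero m] (d : ℕ) (r : ℝ) : ℝ :=
  √d ^ m * ∫ t : Fin m → ℝ, (kk m d r (nrm t)⁻¹ - 1) * rho t

/-- Renormalized integrated absolute covariance. -/
def Jk (m : ℕ) [NeZero m] (d : ℕ) : ℝ :=
  √d ^ m * ∫ t : Fin m → ℝ, |kk m d 1 (nrm t)⁻¹ - 1| * rho t

def IntK (m : ℕ) [NeZero m] (d : ℕ) (r : ℝ) : Prop :=
  Integrable fun t : Fin m → ℝ => (kk m d r (nrm t)⁻¹ - 1) * rho t

lemma integrable_rho : Integrable (rho : (Fin m → ℝ) → ℝ) :=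
  ⟨continuous_rho.aestronglyMeasurable, by
    rw [hasFiniteIntegral_iff_ofReal (Eventually.of_forall fun t => (rho_pos t).le),
      lintegral_rho (NeZero.ne m)]
    exact ENNReal.one_lt_top⟩

lemma integral_rho : ∫ t : Fin m → ℝ, rho t = 1 := by
  rw [integral_eq_lintegral_of_nonneg_ae (Eventually.of_forall fun t => (rho_pos t).le)
    continuous_rho.aestronglyMeasurable, lintegral_rho (NeZero.ne m), ENNReal.toReal_one]

lemma vs_zero_dot (t : Fin m → ℝ) : vs 0 ⬝ᵥ vs t = (nrm t)⁻¹ := by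
  rw [vs_dot]; simp [nrm]

lemma ae_ne (s : Fin m → ℝ) : ∀ᵐ t : Fin m → ℝ, t ≠ s := by
  filter_upwards [(Set.finite_singleton s).measure_zero volume |> compl_mem_ae_iff.2] with t ht h
  exact ht h

lemma kk_nrm_nonneg (hd : d ≠ 0) {r : ℝ} (hr : r ^ 2 ≤ 1) {t : Fin m → ℝ} (ht : t ≠ 0) :
    0 ≤ kk m d r (nrm t)⁻¹ := by
  rw [← vs_zero_dot]
  exact (kk_nonneg hd hr ht.symm).2.2

lemma Mk_kk (hd : d ≠ 0) {r : ℝ} (hr : r ^ 2 ≤ 1) (hi : IntK m d r) :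
    Mk m (kk m d r) = ENNReal.ofReal (1 + Ik m d r / √d ^ m) := by
  have hd0 : 0 < √(d : ℝ) := Real.sqrt_pos.2 (by positivity)
  have h1 : Integrable fun t : Fin m → ℝ => rho t * kk m d r (nrm t)⁻¹ := by
    refine (hi.add integrable_rho).congr (Eventually.of_forall fun t => ?_)
    simp only [Pi.add_apply]
    ring
  have h2 : 1 + Ik m d r / √d ^ m = ∫ t : Fin m → ℝ, rho t * kk m d r (nrm t)⁻¹ := by
    have h3 := integral_add integrable_rho hi
    rw [integral_rho] at h3
    rw [Ik, mul_div_cancel_left₀ _ (by positivity), ← h3]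
    congr 1
    ext t
    ring
  rw [h2, ofReal_integral_eq_lintegral_ofReal h1 (by
    filter_upwards [ae_ne (0 : Fin m → ℝ)] with t ht
    exact mul_nonneg (rho_pos t).le (kk_nrm_nonneg hd hr ht)), Mk]
  simp_rw [ENNReal.ofReal_mul (rho_pos _).le]

lemma Mk_abs (hd : d ≠ 0) (hi : IntK m d 1) :
    Mk m (fun c => |kk m d 1 c - 1|) = ENNReal.ofReal (Jk m d / √d ^ m) := by
  have hd0 : 0 < √(d : ℝ) := Real.sqrt_pos.2 (by positivity)
  have h1 : Integrable fun t : Fin m → ℝ => |kk m d 1 (nrm t)⁻¹ - 1| * rho t := by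
    refine hi.abs.congr (Eventually.of_forall fun t => ?_)
    simp only
    rw [abs_mul, abs_of_pos (rho_pos t)]
  rw [Jk, mul_div_cancel_left₀ _ (by positivity), ofReal_integral_eq_lintegral_ofReal h1
    (Eventually.of_forall fun t => mul_nonneg (abs_nonneg _) (rho_pos t).le), Mk]
  simp_rw [ENNReal.ofReal_mul (abs_nonneg _), mul_comm]

lemma Jk_nonneg : 0 ≤ Jk m d :=
  mul_nonneg (by positivity) (integral_nonneg fun t => mul_nonneg (abs_nonneg _) (rho_pos t).le)

lemma muB_le_one (B : Set (Fin m → ℝ)) : muB B ≤ 1 :=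
  (setLIntegral_le_lintegral B _).trans (lintegral_rho (NeZero.ne m)).le

lemma ofReal_muB (B : Set (Fin m → ℝ)) : ENNReal.ofReal (muB B).toReal = muB B :=
  ENNReal.ofReal_toReal ((muB_le_one B).trans_lt ENNReal.one_lt_top).ne

lemma Nz_lt_top_ae (hd : d ≠ 0) {B : Set (Fin m → ℝ)} (hB : IsSigmaCompact B) :
    ∀ᵐ ω ∂(stdG (Fin m × Jx m d)), Nz d B ω < ⊤ := by
  refine ae_lt_top (measurable_Nz hB) ?_
  rw [lintegral_Nz hd hB]
  exact ENNReal.mul_ne_top ENNReal.ofReal_ne_top ((muB_le_one B).trans_lt ENNReal.one_lt_top).ne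

lemma measurable_nz {B : Set (Fin m → ℝ)} (hB : IsSigmaCompact B) :
    Measurable (nz d B : (Fin m × Jx m d → ℝ) → ℝ) := (measurable_Nz hB).ennreal_toReal

lemma nz_nonneg (B : Set (Fin m → ℝ)) (ω : Fin m × Jx m d → ℝ) : 0 ≤ nz d B ω :=
  ENNReal.toReal_nonneg

lemma lintegral_nz_pow (hd : d ≠ 0) {B : Set (Fin m → ℝ)} (hB : IsSigmaCompact B) (k : ℕ) :
    ∫⁻ ω, ENNReal.ofReal (nz d B ω ^ k) ∂(stdG (Fin m × Jx m d))
      = ∫⁻ ω, Nz d B ω ^ k ∂(stdG (Fin m × Jx m d)) := by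
  refine lintegral_congr_ae ?_
  filter_upwards [Nz_lt_top_ae hd hB] with ω hω
  rw [ENNReal.ofReal_pow (nz_nonneg _ _), nz, ENNReal.ofReal_toReal hω.ne]

lemma integral_nz (hd : d ≠ 0) {B : Set (Fin m → ℝ)} (hB : IsSigmaCompact B) :
    ∫ ω, nz d B ω ∂(stdG (Fin m × Jx m d)) = √d ^ m * (muB B).toReal := by
  have := lintegral_nz_pow hd hB 1
  simp only [pow_one] at this
  rw [integral_eq_lintegral_of_nonneg_ae (Eventually.of_forall fun t => nz_nonneg _ _)
    (measurable_nz hB).aestronglyMeasurable, this, lintegral_Nz hd hB, ENNReal.toReal_mul,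
    ENNReal.toReal_ofReal (by positivity), muB]

lemma lintegral_Nz_sq_le' (hd : 2 ≤ d) (hi : IntK m d 1) {B : Set (Fin m → ℝ)}
    (hB : IsSigmaCompact B) :
    ∫⁻ ω, Nz d B ω ^ 2 ∂(stdG (Fin m × Jx m d)) ≤
      ENNReal.ofReal (√d ^ m * (muB B).toReal * (1 + Jk m d) + (√d ^ m * (muB B).toReal) ^ 2) := by
  have hd0 : 0 < √(d : ℝ) := Real.sqrt_pos.2 (by positivity)
  have hJ := Jk_nonneg (m := m) (d := d)
  refine (lintegral_Nz_sq_le hd hB).trans (le_of_eq ?_)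
  rw [Mk_abs (by omega) hi, ← ofReal_muB B]
  have h0 : 0 ≤ (muB B).toReal := ENNReal.toReal_nonneg
  rw [ENNReal.toReal_ofReal h0, ← ENNReal.ofReal_mul (by positivity),
    ← ENNReal.ofReal_add h0 (by positivity),
    ← ENNReal.ofReal_mul h0, ← ENNReal.ofReal_mul (by positivity), ← ENNReal.ofReal_add
    (by positivity) (by positivity)]
  congr 1
  have : (d : ℝ) ^ m = √d ^ m * √d ^ m := by
    rw [← mul_pow, Real.mul_self_sqrt (by positivity)]
  rw [this]
  field_simp
  ring

lemma memLp_nz (hd : 2 ≤ d) (hi : IntK m d 1) {B : Set (Fin m → ℝ)} (hB : IsSigmaCompact B) :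
    MemLp (nz d B) 2 (stdG (Fin m × Jx m d)) := by
  rw [memLp_two_iff_integrable_sq (measurable_nz hB).aestronglyMeasurable]
  refine ⟨((measurable_nz hB).pow_const 2).aestronglyMeasurable, ?_⟩
  rw [hasFiniteIntegral_iff_ofReal (Eventually.of_forall fun t => sq_nonneg _),
    lintegral_nz_pow (by omega) hB]
  exact (lintegral_Nz_sq_le' hd hi hB).trans_lt ENNReal.ofReal_lt_top

lemma integral_sub_sq {Ω : Type*} [MeasurableSpace Ω] {μ : Measure Ω} [IsProbabilityMeasure μ]
    {X : Ω → ℝ} (hX : MemLp X 2 μ) {c : ℝ} (hc : ∫ ω, X ω ∂μ = c) :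
    ∫ ω, (X ω - c) ^ 2 ∂μ = (∫ ω, X ω ^ 2 ∂μ) - c ^ 2 := by
  have h1 := hX.integrable one_le_two
  have h2 := hX.integrable_sq
  have h3 : Integrable (fun ω => 2 * c * X ω) μ := h1.const_mul _
  have h4 : Integrable (fun ω => X ω ^ 2 - 2 * c * X ω) μ := h2.sub h3
  have : ∀ ω, (X ω - c) ^ 2 = X ω ^ 2 - 2 * c * X ω + c ^ 2 := fun ω => by ring
  simp_rw [this]
  rw [integral_add h4 (integrable_const _), integral_sub h2 h3, integral_const_mul, hc, integral_const, probReal_univ,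
    one_smul]
  ring

lemma integral_nz_sq (hd : d ≠ 0) {B : Set (Fin m → ℝ)} (hB : IsSigmaCompact B) :
    ∫ ω, nz d B ω ^ 2 ∂(stdG (Fin m × Jx m d))
      = (∫⁻ ω, Nz d B ω ^ 2 ∂(stdG (Fin m × Jx m d))).toReal := by
  rw [integral_eq_lintegral_of_nonneg_ae (Eventually.of_forall fun t => sq_nonneg _)
    ((measurable_nz hB).pow_const 2).aestronglyMeasurable, lintegral_nz_pow hd hB]

lemma var_nz_le (hd : 2 ≤ d) (hi : IntK m d 1) {B : Set (Fin m → ℝ)} (hB : IsSigmaCompact B) :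
    ∫ ω, (nz d B ω - √d ^ m * (muB B).toReal) ^ 2 ∂(stdG (Fin m × Jx m d))
      ≤ √d ^ m * (muB B).toReal * (1 + Jk m d) := by
  have hJ := Jk_nonneg (m := m) (d := d)
  rw [integral_sub_sq (memLp_nz hd hi hB) (integral_nz (by omega) hB),
    integral_nz_sq (by omega) hB, sub_le_iff_le_add]
  exact ENNReal.toReal_le_of_le_ofReal (by positivity) (lintegral_Nz_sq_le' hd hi hB)

lemma muB_univ : muB (Set.univ : Set (Fin m → ℝ)) = 1 := by
  rw [muB, Measure.restrict_univ, lintegral_rho (NeZero.ne m)]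

lemma integral_nz_univ_sq (hd : 2 ≤ d) (hi : IntK m d 1) (h0 : 0 ≤ 1 + Ik m d 1 / √d ^ m) :
    ∫ ω, nz d Set.univ ω ^ 2 ∂(stdG (Fin m × Jx m d))
      = √d ^ m * (1 + Ik m d 1) + d ^ m := by
  have hd0 : 0 < √(d : ℝ) := Real.sqrt_pos.2 (by positivity)
  have : (d : ℝ) ^ m = √d ^ m * √d ^ m := by
    rw [← mul_pow, Real.mul_self_sqrt (by positivity)]
  rw [integral_nz_sq (by omega) isSigmaCompact_univ, lintegral_Nz_univ_sq hd,
    Mk_kk (by omega) (by norm_num) hi, ← ENNReal.ofReal_mul (by positivity),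
    ← ENNReal.ofReal_add (by positivity) (by positivity), ENNReal.toReal_ofReal (by positivity),
    this]
  field_simp
  ring

lemma one_add_Ik_nonneg (hd : d ≠ 0) {r : ℝ} (hr : r ^ 2 ≤ 1) (hi : IntK m d r) :
    0 ≤ 1 + Ik m d r / √d ^ m := by
  have hd0 : 0 < √(d : ℝ) := Real.sqrt_pos.2 (by positivity)
  have h3 := integral_add integrable_rho hi
  rw [integral_rho] at h3
  rw [Ik, mul_div_cancel_left₀ _ (by positivity), ← h3]
  refine integral_nonneg_of_ae ?_
  filter_upwards [ae_ne (0 : Fin m → ℝ)] with t ht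
  have := mul_nonneg (kk_nrm_nonneg hd hr ht) (rho_pos t).le
  simp only [Pi.zero_apply]
  linarith

lemma var_nz_univ (hd : 2 ≤ d) (hi : IntK m d 1) :
    ∫ ω, (nz d Set.univ ω - √d ^ m) ^ 2 ∂(stdG (Fin m × Jx m d)) = √d ^ m * (1 + Ik m d 1) := by
  have : (d : ℝ) ^ m = √d ^ m * √d ^ m := by
    rw [← mul_pow, Real.mul_self_sqrt (by positivity)]
  rw [integral_sub_sq (memLp_nz hd hi isSigmaCompact_univ)
    (by rw [integral_nz (by omega) isSigmaCompact_univ, muB_univ]; simp),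
    integral_nz_univ_sq hd hi (one_add_Ik_nonneg (by omega) (by norm_num) hi), this]
  ring

lemma integral_nz_sub_sq_le (hd : 2 ≤ d) (hi : IntK m d 1) {r ρ : ℝ} (hr : r ^ 2 + ρ ^ 2 = 1)
    (hir : IntK m d r) :
    ∫ p, (nz d Set.univ p.1 - nz d Set.univ (r • p.1 + ρ • p.2)) ^ 2
        ∂((stdG (Fin m × Jx m d)).prod (stdG (Fin m × Jx m d)))
      ≤ 2 * √d ^ m * (1 + Ik m d 1 - Ik m d r) := by
  have hd0 : 0 < √(d : ℝ) := Real.sqrt_pos.2 (by positivity)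
  have hu := isSigmaCompact_univ (X := Fin m → ℝ)
  have hr1 : r ^ 2 ≤ 1 := by nlinarith [sq_nonneg ρ]
  have hm1 := measurePreserving_fst (μ := stdG (Fin m × Jx m d)) (ν := stdG (Fin m × Jx m d))
  have hm2 := stdG_rot_measurePreserving (ι := Fin m × Jx m d) hr
  have hX := memLp_nz hd hi hu
  have hX1 := hX.comp_measurePreserving hm1
  have hX2 := hX.comp_measurePreserving hm2
  have hX12 : Integrable (fun p => nz d Set.univ p.1 * nz d Set.univ (r • p.1 + ρ • p.2))
    ((stdG (Fin m × Jx m d)).prod (stdG (Fin m × Jx m d))) := hX1.integrable_mul hX2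
  have hX11 : Integrable (fun p => nz d Set.univ p.1 ^ 2)
    ((stdG (Fin m × Jx m d)).prod (stdG (Fin m × Jx m d))) := hX1.integrable_sq
  have hX22 : Integrable (fun p => nz d Set.univ (r • p.1 + ρ • p.2) ^ 2)
    ((stdG (Fin m × Jx m d)).prod (stdG (Fin m × Jx m d))) := hX2.integrable_sq
  have hXs : Integrable (fun p => nz d Set.univ p.1 ^ 2 + nz d Set.univ (r • p.1 + ρ • p.2) ^ 2)
    ((stdG (Fin m × Jx m d)).prod (stdG (Fin m × Jx m d))) := hX11.add hX22
  have e1 : ∫ p, (nz d Set.univ p.1) ^ 2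
        ∂((stdG (Fin m × Jx m d)).prod (stdG (Fin m × Jx m d)))
      = √d ^ m * (1 + Ik m d 1) + d ^ m := by
    rw [← integral_nz_univ_sq hd hi (one_add_Ik_nonneg (by omega) (by norm_num) hi), ← hm1.map_eq,
      integral_map hm1.aemeasurable ((measurable_nz hu).pow_const 2).aestronglyMeasurable, hm1.map_eq]
  have e2 : ∫ p, (nz d Set.univ (r • p.1 + ρ • p.2)) ^ 2
        ∂((stdG (Fin m × Jx m d)).prod (stdG (Fin m × Jx m d)))
      = √d ^ m * (1 + Ik m d 1) + d ^ m := by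
    rw [← integral_nz_univ_sq hd hi (one_add_Ik_nonneg (by omega) (by norm_num) hi), ← hm2.map_eq,
      integral_map hm2.aemeasurable ((measurable_nz hu).pow_const 2).aestronglyMeasurable, hm2.map_eq]
  have e3 : √d ^ m * Ik m d r + d ^ m ≤
      ∫ p, nz d Set.univ p.1 * nz d Set.univ (r • p.1 + ρ • p.2)
        ∂((stdG (Fin m × Jx m d)).prod (stdG (Fin m × Jx m d))) := by
    have h3 := lintegral_Nz_mul_ge (m := m) hd hr
    have h4 : ∫⁻ p, Nz d Set.univ p.1 * Nz d Set.univ (r • p.1 + ρ • p.2)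
        ∂((stdG (Fin m × Jx m d)).prod (stdG (Fin m × Jx m d)))
        = ∫⁻ p, ENNReal.ofReal (nz d Set.univ p.1 * nz d Set.univ (r • p.1 + ρ • p.2))
        ∂((stdG (Fin m × Jx m d)).prod (stdG (Fin m × Jx m d))) := by
      have hN := Nz_lt_top_ae (m := m) (by omega : d ≠ 0) hu
      refine lintegral_congr_ae ?_
      filter_upwards [hm1.quasiMeasurePreserving.ae hN, hm2.quasiMeasurePreserving.ae hN]
        with p h1 h2
      rw [ENNReal.ofReal_mul (nz_nonneg _ _), nz, nz, ENNReal.ofReal_toReal h1.ne,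
        ENNReal.ofReal_toReal h2.ne]
    rw [h4, Mk_kk (by omega) hr1 hir, ← ENNReal.ofReal_mul (by positivity),
      ← ofReal_integral_eq_lintegral_ofReal hX12
        (Eventually.of_forall fun p => mul_nonneg (nz_nonneg _ _) (nz_nonneg _ _)),
      ENNReal.ofReal_le_ofReal_iff (integral_nonneg
        fun p => mul_nonneg (nz_nonneg _ _) (nz_nonneg _ _))] at h3
    refine le_trans (le_of_eq ?_) h3
    have : (d : ℝ) ^ m = √d ^ m * √d ^ m := by
      rw [← mul_pow, Real.mul_self_sqrt (by positivity)]
    rw [this]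
    field_simp
    ring
  have e4 : ∀ p : (Fin m × Jx m d → ℝ) × (Fin m × Jx m d → ℝ),
      (nz d Set.univ p.1 - nz d Set.univ (r • p.1 + ρ • p.2)) ^ 2
      = (nz d Set.univ p.1 ^ 2 + nz d Set.univ (r • p.1 + ρ • p.2) ^ 2)
        - 2 * (nz d Set.univ p.1 * nz d Set.univ (r • p.1 + ρ • p.2)) := fun p => by ring
  simp_rw [e4]
  rw [integral_sub hXs (hX12.const_mul 2), integral_add hX11 hX22,
    integral_const_mul, e1, e2]
  linarith

end SecondReal
end

section

section Asymptotics
variable {m d : ℕ} [NeZero m]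

def wS (A x : ℝ) : ℝ := 1 - x * A ^ 2 / (1 - A ^ 2)

def wK (A x δ : ℝ) : ℝ := A * (1 - δ * x) - A * (x * A ^ 2) / (1 - A ^ 2)

def wC (A x δ E : ℝ) (i : Fin m) : ℝ := if i = 0 then wK A x δ / wS A x else E

/-- Two-point function in terms of the correlation and the rescaled squared distance. -/
def wW (m : ℕ) [NeZero m] (A x δ E : ℝ) : ℝ :=
  (√(1 - A ^ 2))⁻¹ ^ m * wS A x * Gr (wC A x δ E : Fin m → ℝ) / Dm m ^ 2

/-- Cosine of the angle between the projections of `0` and of a rescaled point. -/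
def cz (d : ℕ) (z : Fin m → ℝ) : ℝ := (nrm ((√d)⁻¹ • z))⁻¹

lemma cz_pos (z : Fin m → ℝ) : 0 < cz d z := inv_pos.2 (nrm_pos _)

lemma cz_sq (z : Fin m → ℝ) : cz d z ^ 2 = (1 + z ⬝ᵥ z / d)⁻¹ := by
  rw [cz, inv_pow, nrm_sq, smul_dotProduct, dotProduct_smul, smul_eq_mul, smul_eq_mul, ← mul_assoc,
    ← mul_inv, Real.mul_self_sqrt (by positivity), inv_mul_eq_div]

lemma kk_eq_wW (hd : 2 ≤ d) (r : ℝ) (z : Fin m → ℝ) :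
    kS d r (cz d z) = wS (r * cz d z ^ d) (z ⬝ᵥ z) ∧
    (kC d r (cz d z) : Fin m → ℝ) =
      wC (r * cz d z ^ d) (z ⬝ᵥ z) ((d - 1) / d) (r * cz d z ^ (d - 1)) ∧
    kk m d r (cz d z) =
      wW m (r * cz d z ^ d) (z ⬝ᵥ z) ((d - 1) / d) (r * cz d z ^ (d - 1)) := by
  have hc := cz_sq (d := d) z
  have hc0 := cz_pos (d := d) z
  have hx := dot_self_nonneg z
  set c := cz d z
  have hd0 : (0 : ℝ) < d := by positivity
  have h1 : (d : ℝ) * (1 - c ^ 2) = z ⬝ᵥ z * c ^ 2 := by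
    rw [hc]
    field_simp
    ring
  obtain ⟨n, rfl⟩ : ∃ n, d = n + 2 := ⟨d - 2, by omega⟩
  have hB : kB (n + 2) r c = z ⬝ᵥ z * (r * c ^ (n + 2)) ^ 2 := by
    rw [kB, show n + 2 - 1 = n + 1 by omega]
    linear_combination (r ^ 2 * (c ^ (n + 1)) ^ 2) * h1
  have hD : kD (n + 2) r c = r * c ^ (n + 2) * (1 - ((n + 2 : ℕ) - 1) / (n + 2 : ℕ) * z ⬝ᵥ z) := by
    rw [kD, show n + 2 - 1 = n + 1 by omega, show n + 2 - 2 = n by omega]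
    push_cast at h1 hd0 ⊢
    have h2 : (1 - c ^ 2) = z ⬝ᵥ z * c ^ 2 / (n + 2) := by field_simp; linarith
    rw [h2]
    field_simp
    ring
  have hS : kS (n + 2) r c = wS (r * c ^ (n + 2)) (z ⬝ᵥ z) := by rw [kS, wS, hB, kA]
  have hC : (kC (n + 2) r c : Fin m → ℝ) = wC (r * c ^ (n + 2)) (z ⬝ᵥ z)
      (((n + 2 : ℕ) - 1) / (n + 2 : ℕ)) (r * c ^ (n + 2 - 1)) := by
    funext i
    rw [kC, wC, kK, wK, hS, hD, hB, kA, kE]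
  exact ⟨hS, hC, by rw [kk, wW, hS, hC, kA]⟩

lemma wC_mem (hd : 2 ≤ d) {r : ℝ} (hr : r ^ 2 ≤ 1) {z : Fin m → ℝ} (hz : z ≠ 0) :
    0 ≤ wS (r * cz d z ^ d) (z ⬝ᵥ z) ∧ (∀ i : Fin m,
      |wC (r * cz d z ^ d) (z ⬝ᵥ z) ((d - 1) / d) (r * cz d z ^ (d - 1)) i| ≤ 1) := by
  have hd0 : 0 < √(d : ℝ) := Real.sqrt_pos.2 (by positivity)
  have h := kk_nonneg (by omega : d ≠ 0) hr (s := 0) (t := (√d)⁻¹ • z)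
    (by rw [ne_comm, smul_ne_zero_iff]; exact ⟨by positivity, hz⟩)
  rw [vs_zero_dot] at h
  obtain ⟨h1, h2, -⟩ := kk_eq_wW hd r z
  rw [← h1, ← h2]
  exact ⟨h.1, h.2.1⟩

lemma dot_self_pos {z : Fin m → ℝ} (hz : z ≠ 0) : 0 < z ⬝ᵥ z :=
  (dot_self_nonneg z).lt_of_ne' fun h => hz (dotProduct_self_eq_zero.1 h)

lemma tendsto_wS {ι : Type*} {l : Filter ι} {A x : ι → ℝ} {A₀ x₀ : ℝ} (hA : Tendsto A l (nhds A₀))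
    (hx : Tendsto x l (nhds x₀)) (h1 : A₀ ^ 2 < 1) :
    Tendsto (fun n => wS (A n) (x n)) l (nhds (wS A₀ x₀)) := by
  unfold wS
  exact tendsto_const_nhds.sub ((hx.mul (hA.pow 2)).div (tendsto_const_nhds.sub (hA.pow 2))
    (by linarith))

lemma tendsto_wC {ι : Type*} {l : Filter ι} {A x δ E : ι → ℝ} {A₀ x₀ δ₀ E₀ : ℝ}
    (hA : Tendsto A l (nhds A₀)) (hx : Tendsto x l (nhds x₀)) (hδ : Tendsto δ l (nhds δ₀))
    (hE : Tendsto E l (nhds E₀)) (h1 : A₀ ^ 2 < 1) (h2 : wS A₀ x₀ ≠ 0) :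
    Tendsto (fun n => (wC (A n) (x n) (δ n) (E n) : Fin m → ℝ)) l (nhds (wC A₀ x₀ δ₀ E₀)) := by
  rw [tendsto_pi_nhds]
  intro i
  simp only [wC]
  split_ifs
  · refine Tendsto.div ?_ (tendsto_wS hA hx h1) h2
    unfold wK
    exact (hA.mul (tendsto_const_nhds.sub (hδ.mul hx))).sub ((hA.mul (hx.mul (hA.pow 2))).div
      (tendsto_const_nhds.sub (hA.pow 2)) (by linarith))
  · exact hE

lemma isClosed_cube : IsClosed {c : Fin m → ℝ | ∀ i, |c i| ≤ 1} := by
  simp only [Set.ofPred_forall]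
  exact isClosed_iInter fun i => isClosed_le (by fun_prop) continuous_const

lemma tendsto_Gr {ι : Type*} {l : Filter ι} [l.NeBot] {c : ι → Fin m → ℝ} {c₀ : Fin m → ℝ}
    (hc : Tendsto c l (nhds c₀)) (h : ∀ᶠ n in l, ∀ i, |c n i| ≤ 1) :
    (∀ i, |c₀ i| ≤ 1) ∧ Tendsto (fun n => Gr (c n)) l (nhds (Gr c₀)) := by
  have h0 : c₀ ∈ {c : Fin m → ℝ | ∀ i, |c i| ≤ 1} := isClosed_cube.mem_of_tendsto hc h
  exact ⟨h0, (continuousOn_Gr c₀ h0).tendsto.comp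
    (tendsto_nhdsWithin_iff.2 ⟨hc, h⟩)⟩

lemma tendsto_wW {ι : Type*} {l : Filter ι} [l.NeBot] {A x δ E : ι → ℝ} {A₀ x₀ δ₀ E₀ : ℝ}
    (hA : Tendsto A l (nhds A₀)) (hx : Tendsto x l (nhds x₀)) (hδ : Tendsto δ l (nhds δ₀))
    (hE : Tendsto E l (nhds E₀)) (h1 : A₀ ^ 2 < 1) (h2 : wS A₀ x₀ ≠ 0)
    (h : ∀ᶠ n in l, ∀ i : Fin m, |wC (A n) (x n) (δ n) (E n) i| ≤ 1) :
    (∀ i : Fin m, |wC A₀ x₀ δ₀ E₀ i| ≤ 1) ∧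
    Tendsto (fun n => wW m (A n) (x n) (δ n) (E n)) l (nhds (wW m A₀ x₀ δ₀ E₀)) := by
  obtain ⟨h3, h4⟩ := tendsto_Gr (tendsto_wC hA hx hδ hE h1 h2) h
  refine ⟨h3, ?_⟩
  unfold wW
  refine ((Tendsto.mul (Tendsto.pow (Tendsto.inv₀ ?_ ?_) m) (tendsto_wS hA hx h1)).mul h4).div_const _
  · exact (tendsto_const_nhds.sub (hA.pow 2)).sqrt
  · exact (Real.sqrt_pos.2 (by linarith)).ne'

/-- Limiting correlation. -/
def uI (r x : ℝ) : ℝ := r * Real.exp (-x / 2)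

/-- Limiting two-point function. -/
def kI (m : ℕ) [NeZero m] (r x : ℝ) : ℝ := wW m (uI r x) x 1 (uI r x)

lemma uI_sq (r x : ℝ) : uI r x ^ 2 = r ^ 2 * Real.exp (-x) := by
  rw [uI, mul_pow, ← Real.exp_nat_mul]
  congr 2
  push_cast
  ring

lemma uI_sq_mul_le {r x : ℝ} (hr : r ^ 2 ≤ 1) (hx : 0 ≤ x) : uI r x ^ 2 * (1 + x + x ^ 2 / 2) ≤ 1 := by
  rw [uI_sq, Real.exp_neg]
  have h1 := Real.quadratic_le_exp_of_nonneg hx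
  have h2 : (Real.exp x)⁻¹ * (1 + x + x ^ 2 / 2) ≤ 1 := by
    rw [inv_mul_le_iff₀ (Real.exp_pos x), mul_one]
    exact h1
  rw [mul_assoc]
  exact mul_le_one₀ hr (by positivity) h2

lemma uI_sq_lt_one {r x : ℝ} (hr : r ^ 2 ≤ 1) (hx : 0 < x) : uI r x ^ 2 < 1 := by
  have := uI_sq_mul_le hr hx.le
  nlinarith [sq_nonneg (uI r x), sq_nonneg x, mul_pos hx hx]

lemma wS_uI_pos {r x : ℝ} (hr : r ^ 2 ≤ 1) (hx : 0 < x) : 0 < wS (uI r x) x := by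
  have h1 := uI_sq_mul_le hr hx.le
  have h2 := uI_sq_lt_one hr hx
  rw [wS, sub_pos, div_lt_one (by linarith)]
  rcases (sq_nonneg (uI r x)).eq_or_lt with h | h
  · rw [← h]; norm_num
  · nlinarith [mul_pos h (mul_pos hx hx)]

lemma tendsto_cz (z : Fin m → ℝ) :
    Tendsto (fun d : ℕ => cz d z) atTop (nhds 1) ∧
    Tendsto (fun d : ℕ => cz d z ^ d) atTop (nhds (Real.exp (-(z ⬝ᵥ z) / 2))) := by
  have h0 : ∀ d : ℕ, cz d z = √((1 + z ⬝ᵥ z / d)⁻¹) := fun d => by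
    rw [← cz_sq, Real.sqrt_sq (cz_pos z).le]
  constructor
  · simp_rw [h0]
    have h1 : Tendsto (fun d : ℕ => 1 + z ⬝ᵥ z / d) atTop (nhds (1 + 0)) :=
      tendsto_const_nhds.add (tendsto_const_div_atTop_nhds_zero_nat _)
    rw [add_zero] at h1
    simpa using (h1.inv₀ one_ne_zero).sqrt
  · have h1 : ∀ d : ℕ, cz d z ^ d = √(((1 + z ⬝ᵥ z / d) ^ d)⁻¹) := fun d => by
      rw [← inv_pow, ← cz_sq, ← pow_mul, mul_comm 2 d, pow_mul,
        Real.sqrt_sq (pow_nonneg (cz_pos z).le _)]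
    simp_rw [h1]
    have h2 := ((Real.tendsto_one_add_div_pow_exp (z ⬝ᵥ z)).inv₀ (Real.exp_ne_zero _)).sqrt
    convert! h2 using 2
    rw [← Real.exp_neg, Real.sqrt_eq_rpow, ← Real.exp_mul]
    congr 1
    ring

lemma tendsto_kk {r : ℝ} (hr : r ^ 2 ≤ 1) {z : Fin m → ℝ} (hz : z ≠ 0) :
    (∀ i : Fin m, |wC (uI r (z ⬝ᵥ z)) (z ⬝ᵥ z) 1 (uI r (z ⬝ᵥ z)) i| ≤ 1) ∧
    Tendsto (fun d : ℕ => kk m d r (cz d z)) atTop (nhds (kI m r (z ⬝ᵥ z))) := by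
  obtain ⟨h1, h2⟩ := tendsto_cz z
  have hx := dot_self_pos hz
  have hδ : Tendsto (fun d : ℕ => ((d : ℝ) - 1) / d) atTop (nhds 1) := by
    have h3 : Tendsto (fun d : ℕ => 1 - (d : ℝ)⁻¹) atTop (nhds (1 - 0)) :=
      tendsto_const_nhds.sub tendsto_inv_atTop_nhds_zero_nat
    rw [sub_zero] at h3
    refine h3.congr' ?_
    filter_upwards [eventually_ge_atTop 1] with d hd
    field_simp
  have hE : Tendsto (fun d : ℕ => r * cz d z ^ (d - 1)) atTop (nhds (uI r (z ⬝ᵥ z))) := by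
    have h3 := (h2.div h1 one_ne_zero).const_mul r
    rw [div_one] at h3
    refine h3.congr' ?_
    filter_upwards [eventually_ge_atTop 1] with d hd
    obtain ⟨n, rfl⟩ : ∃ n, d = n + 1 := ⟨d - 1, by omega⟩
    have := (cz_pos (d := n + 1) z).ne'
    simp only [Pi.div_apply]
    rw [pow_succ, mul_div_cancel_right₀ _ this, Nat.add_sub_cancel]
  have := tendsto_wW (m := m) (h2.const_mul r) (tendsto_const_nhds (x := z ⬝ᵥ z)) hδ hE
    (uI_sq_lt_one hr hx) (wS_uI_pos hr hx).ne' (by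
      filter_upwards [eventually_ge_atTop 2] with d hd
      exact (wC_mem hd hr hz).2)
  refine ⟨this.1, this.2.congr' ?_⟩
  filter_upwards [eventually_ge_atTop 2] with d hd
  exact ((kk_eq_wW hd r z).2.2).symm

end Asymptotics
end

section

section Domination
variable {m d : ℕ} [NeZero m]

lemma pow_sub_one_le {y : ℝ} (hy1 : 1 ≤ y) (m : ℕ) : y ^ m - 1 ≤ m * y ^ m * (y - 1) := by
  have hy0 : 0 < y := by linarith
  have h4 := one_add_mul_le_pow (a := y⁻¹ - 1) (by
    have : 0 ≤ y⁻¹ := by positivity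
    linarith) m
  rw [add_sub_cancel, inv_pow] at h4
  have h5 : 0 < y ^ m := by positivity
  have h6 := mul_le_mul_of_nonneg_right h4 h5.le
  rw [inv_mul_cancel₀ h5.ne'] at h6
  have h7 : -(y - 1) ≤ y⁻¹ - 1 := by
    have : y * y⁻¹ = 1 := mul_inv_cancel₀ (by positivity)
    nlinarith [inv_nonneg.2 hy0.le]
  have h8 : m * (-(y - 1)) * y ^ m ≤ (m : ℝ) * (y⁻¹ - 1) * y ^ m := by gcongr
  linarith

lemma abs_inv_sqrt_pow_sub_one_le {A : ℝ} (hA : 0 ≤ A) (ha1 : A ^ 2 ≤ 4 / 9) (m : ℕ) :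
    |(√(1 - A ^ 2))⁻¹ ^ m - 1| ≤ 2 * m * 2 ^ m * A := by
  set y := (√(1 - A ^ 2))⁻¹ with hy
  have ha0 := sq_nonneg A
  have hA1 : A ≤ 1 := by nlinarith
  have hy2 : y ^ 2 = (1 - A ^ 2)⁻¹ := by rw [hy, inv_pow, Real.sq_sqrt (by linarith)]
  have hy0 : 0 ≤ y := by positivity
  have hyle : y ^ 2 ≤ 1 + 2 * A ^ 2 := by
    rw [hy2, inv_le_iff_one_le_mul₀ (by linarith)]
    nlinarith
  have hyge : 1 ≤ y ^ 2 := by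
    rw [hy2, le_inv_comm₀ one_pos (by linarith), inv_one]
    linarith
  have hy1 : 1 ≤ y := by nlinarith
  have hyA : y ≤ 1 + 2 * A := by nlinarith
  have hy3 : y ≤ 2 := by nlinarith
  clear_value y
  rw [abs_of_nonneg (by linarith [one_le_pow₀ hy1 (n := m)])]
  have h3 := pow_sub_one_le hy1 m
  have h9 : y ^ m ≤ 2 ^ m := pow_le_pow_left₀ hy0 hy3 m
  calc y ^ m - 1 ≤ m * y ^ m * (y - 1) := h3
    _ ≤ m * 2 ^ m * (2 * A) := by
        gcongr
        linarith
    _ = _ := by ring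

lemma abs_wW_sub_one_le (m : ℕ) [NeZero m] : ∃ C : ℝ, 0 < C ∧ ∀ A x δ E : ℝ, 0 ≤ A → 1 ≤ x →
    A ^ 2 * (1 + x + x ^ 2 / 4) ≤ 1 → 0 ≤ δ → δ ≤ 1 → |E| ≤ A * (1 + x) →
    (∀ i : Fin m, |wC A x δ E i| ≤ 1) → |wW m A x δ E - 1| ≤ C * (A * (1 + x)) := by
  obtain ⟨C₁, hC₁, h₁⟩ := exists_Gr_le m
  obtain ⟨C₂, hC₂, h₂⟩ := exists_abs_Gr_sub_le m
  have hD := Dm_pos m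
  refine ⟨2 * m * 2 ^ m * (C₁ / Dm m ^ 2) + 2 * (C₁ / Dm m ^ 2) + 10 * C₂ / Dm m ^ 2,
    by positivity, fun A x δ E hA hx hAx hδ0 hδ1 hE hc => ?_⟩
  set a := A ^ 2 with ha
  have ha0 : 0 ≤ a := sq_nonneg A
  have ha1 : a ≤ 4 / 9 := by
    nlinarith [mul_nonneg ha0 (by linarith : 0 ≤ x - 1), mul_nonneg ha0 (by nlinarith : 0 ≤ x ^ 2 - 1)]
  have hA1 : A ≤ 1 := by nlinarith
  have hxa : x * a / (1 - a) ≤ 4 / 5 := by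
    rw [div_le_iff₀ (by linarith)]
    nlinarith [mul_nonneg ha0 (sq_nonneg (x - 2)), mul_nonneg ha0 (by linarith : 0 ≤ x)]
  have hxa0 : 0 ≤ x * a / (1 - a) := div_nonneg (by positivity) (by linarith)
  have hxa2 : x * a / (1 - a) ≤ 2 * (A * (1 + x)) := by
    rw [div_le_iff₀ (by linarith)]
    have : a ≤ A := by nlinarith
    nlinarith [mul_nonneg hA (by linarith : 0 ≤ 1 + x), mul_le_mul_of_nonneg_left this
      (by linarith : 0 ≤ x), mul_nonneg (mul_nonneg hA (by linarith : 0 ≤ 1 + x))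
      (by linarith : 0 ≤ 4 / 9 - a)]
  have hS0 : 1 / 5 ≤ wS A x := by unfold wS; linarith
  have hS1 : wS A x ≤ 1 := by unfold wS; linarith
  have hS2 : |wS A x - 1| ≤ 2 * (A * (1 + x)) := by
    rw [show wS A x - 1 = -(x * a / (1 - a)) by unfold wS; ring, abs_neg, abs_of_nonneg hxa0]
    exact hxa2
  have hs0 : 0 ≤ A * (1 + x) := by positivity
  have hcs : ∀ i : Fin m, |wC A x δ E i| ≤ 10 * (A * (1 + x)) := by
    intro i
    unfold wC
    split_ifs
    · rw [abs_div, abs_of_pos (by linarith : 0 < wS A x), div_le_iff₀ (by linarith)]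
      have hk : |wK A x δ| ≤ 2 * (A * (1 + x)) := by
        have h3 : wK A x δ = A * (1 - δ * x - x * a / (1 - a)) := by unfold wK; ring
        have h4 : 0 ≤ δ * x := by positivity
        have h5 : δ * x ≤ x := by nlinarith
        rw [h3, abs_mul, abs_of_nonneg hA]
        have : |1 - δ * x - x * a / (1 - a)| ≤ 2 * (1 + x) := by
          rw [abs_le]; constructor <;> linarith
        nlinarith
      nlinarith
    · linarith
  have hGu := h₁ _ hc
  have hG0 := Gr_nonneg (wC A x δ E : Fin m → ℝ)
  have hG : |Gr (wC A x δ E : Fin m → ℝ) - Dm m ^ 2| ≤ C₂ * (10 * (A * (1 + x))) := by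
    have h3 := h₂ (wC A x δ E) (min 1 (10 * (A * (1 + x)))) (min_le_left _ _)
      (fun i => le_min (hc i) (hcs i)) (le_min zero_le_one (by positivity))
    rw [Gr_zero] at h3
    exact h3.trans (mul_le_mul_of_nonneg_left (min_le_right _ _) hC₂.le)
  set G := Gr (wC A x δ E : Fin m → ℝ)
  set D := Dm m ^ 2 with hDdef
  have hD2 : 0 < D := by positivity
  have hP : |(√(1 - a))⁻¹ ^ m - 1| ≤ 2 * m * 2 ^ m * (A * (1 + x)) := by
    refine (abs_inv_sqrt_pow_sub_one_le hA ha1 m).trans ?_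
    gcongr
    exact le_mul_of_one_le_right hA (by linarith)
  set y := (√(1 - a))⁻¹ with hy
  have hg : |G / D - 1| ≤ 10 * C₂ / D * (A * (1 + x)) := by
    rw [show G / D - 1 = (G - D) / D by field_simp, abs_div, abs_of_pos hD2, div_le_iff₀ hD2]
    refine hG.trans (le_of_eq ?_)
    field_simp
  have hgu : G / D ≤ C₁ / D := by gcongr
  have hg0 : 0 ≤ G / D := by positivity
  have hW : wW m A x δ E - 1 = (y ^ m - 1) * (wS A x * (G / D)) + (wS A x - 1) * (G / D)
      + (G / D - 1) := by
    unfold wW; ring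
  rw [hW]
  refine (abs_add_le _ _).trans ?_
  rw [add_mul, add_mul]
  refine add_le_add ((abs_add_le _ _).trans (add_le_add ?_ ?_)) hg
  · rw [abs_mul, abs_of_nonneg (mul_nonneg (by linarith : 0 ≤ wS A x) hg0)]
    have : wS A x * (G / D) ≤ C₁ / D := by nlinarith
    calc _ ≤ 2 * m * 2 ^ m * (A * (1 + x)) * (C₁ / D) :=
          mul_le_mul hP this (mul_nonneg (by linarith) hg0) (by positivity)
      _ = _ := by ring
  · rw [abs_mul, abs_of_nonneg hg0]
    calc _ ≤ 2 * (A * (1 + x)) * (C₁ / D) := mul_le_mul hS2 hgu hg0 (by positivity)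
      _ = _ := by ring

lemma wW_near_le (m : ℕ) [NeZero m] : ∃ C : ℝ, 0 < C ∧ ∀ A x δ E : ℝ, 0 < x → x ≤ 1 →
    A ^ 2 * (1 + x) ≤ 1 → 1 - x ^ 2 ≤ A ^ 2 * (1 + x) →
    0 ≤ wS A x → (∀ i : Fin m, |wC A x δ E i| ≤ 1) → wW m A x δ E ≤ C * (√x)⁻¹ ^ (m - 1) := by
  obtain ⟨C₁, hC₁, h₁⟩ := exists_Gr_le m
  have hD := Dm_pos m
  refine ⟨√2 ^ m * 2 * C₁ / Dm m ^ 2, by positivity, fun A x δ E hx hx1 hA hA' hS hc => ?_⟩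
  have ha0 := sq_nonneg A
  have h2 : x / 2 ≤ 1 - A ^ 2 := by nlinarith
  have h3 : wS A x ≤ 2 * x := by
    rw [wS, sub_le_comm, le_div_iff₀ (by linarith)]
    nlinarith
  have h4 : (√(1 - A ^ 2))⁻¹ ^ m ≤ √2 ^ m * (√x)⁻¹ ^ m := by
    rw [← mul_pow]
    refine pow_le_pow_left₀ (by positivity) ?_ m
    rw [show √2 * (√x)⁻¹ = (√(x / 2))⁻¹ by
      rw [Real.sqrt_div hx.le, inv_div, div_eq_mul_inv]]
    exact inv_anti₀ (Real.sqrt_pos.2 (by positivity)) (Real.sqrt_le_sqrt h2)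
  have h5 : x * (√x)⁻¹ ^ m ≤ (√x)⁻¹ ^ (m - 1) := by
    obtain ⟨n, hn⟩ : ∃ n, m = n + 1 := ⟨m - 1, by have := NeZero.ne m; omega⟩
    rw [hn, Nat.add_sub_cancel, _root_.pow_succ]
    have h6 : x * (√x)⁻¹ = √x := by
      rw [← div_eq_mul_inv, Real.div_sqrt]
    have h7 : √x ≤ 1 := Real.sqrt_le_one.2 hx1
    calc x * ((√x)⁻¹ ^ n * (√x)⁻¹) = (√x)⁻¹ ^ n * √x := by linear_combination (√x)⁻¹ ^ n * h6
      _ ≤ _ := mul_le_of_le_one_right (by positivity) h7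
  unfold wW
  calc _ ≤ √2 ^ m * (√x)⁻¹ ^ m * (2 * x) * C₁ / Dm m ^ 2 := by
        have := h₁ _ hc
        have := Gr_nonneg (wC A x δ E : Fin m → ℝ)
        gcongr
    _ = √2 ^ m * 2 * C₁ / Dm m ^ 2 * (x * (√x)⁻¹ ^ m) := by ring
    _ ≤ _ := by gcongr

lemma wW_le_of_lt_one (m : ℕ) [NeZero m] {r : ℝ} (hr : r ^ 2 < 1) :
    ∃ C : ℝ, 0 < C ∧ ∀ A x δ E : ℝ, 0 < x → A ^ 2 ≤ r ^ 2 →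
    0 ≤ wS A x → (∀ i : Fin m, |wC A x δ E i| ≤ 1) → wW m A x δ E ≤ C := by
  obtain ⟨C₁, hC₁, h₁⟩ := exists_Gr_le m
  have hD := Dm_pos m
  have hr' : 0 < √(1 - r ^ 2) := Real.sqrt_pos.2 (by linarith)
  refine ⟨(√(1 - r ^ 2))⁻¹ ^ m * 1 * C₁ / Dm m ^ 2, by positivity, fun A x δ E hx hA hS hc => ?_⟩
  have h3 : wS A x ≤ 1 := by
    rw [wS, sub_le_self_iff]
    exact div_nonneg (by positivity) (by linarith)
  have h4 : (√(1 - A ^ 2))⁻¹ ≤ (√(1 - r ^ 2))⁻¹ := inv_anti₀ hr' (Real.sqrt_le_sqrt (by linarith))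
  have := h₁ _ hc
  have := Gr_nonneg (wC A x δ E : Fin m → ℝ)
  unfold wW
  gcongr

lemma one_add_div_pow_le {n : ℕ} (hn : n ≠ 0) (hd : n ≤ d) {x : ℝ} (hx : 0 ≤ x) :
    (1 + x / n) ^ n ≤ (1 + x / d) ^ d := by
  have hn0 : (0 : ℝ) < n := by positivity
  have hd0 : (0 : ℝ) < d := by have : 0 < d := by omega
                               positivity
  have h := one_add_mul_self_le_rpow_one_add (s := x / d) (by
    have : 0 ≤ x / d := by positivity
    linarith) (p := (d : ℝ) / n) (by rw [le_div_iff₀ hn0, one_mul]; exact_mod_cast hd)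
  calc (1 + x / n) ^ n = (1 + d / n * (x / d)) ^ n := by congr 2; field_simp
    _ ≤ ((1 + x / d) ^ ((d : ℝ) / n)) ^ n := pow_le_pow_left₀ (by positivity) h n
    _ = _ := by
      rw [← Real.rpow_natCast, ← Real.rpow_mul (by positivity), div_mul_cancel₀ _ hn0.ne',
        Real.rpow_natCast]

/-- Integrable majorant, independent of `d`. -/
def dom (z : Fin m → ℝ) : ℝ :=
  rho z + Set.indicator {z | z ⬝ᵥ z ≤ 1} (fun z => (√(z ⬝ᵥ z))⁻¹ ^ (m - 1)) z

lemma norm_le_sqrt_dot (z : Fin m → ℝ) : ‖z‖ ≤ √(z ⬝ᵥ z) := by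
  rw [pi_norm_le_iff_of_nonneg (Real.sqrt_nonneg _)]
  intro i
  rw [Real.norm_eq_abs]
  refine Real.abs_le_sqrt ?_
  rw [dotProduct, sq]
  exact Finset.single_le_sum (f := fun i => z i * z i) (fun i _ => mul_self_nonneg _)
    (Finset.mem_univ i)

lemma continuous_dot_self : Continuous fun z : Fin m → ℝ => z ⬝ᵥ z :=
  continuous_id.dotProduct continuous_id

lemma integrable_dom : Integrable (dom : (Fin m → ℝ) → ℝ) := by
  have : Nontrivial (Fin m → ℝ) := by
    have : Nonempty (Fin m) := ⟨0⟩
    infer_instance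
  refine integrable_rho.add ?_
  have h : Integrable (fun z : Fin m → ℝ =>
      (Set.indicator (Set.Iic 1) (fun y : ℝ => y⁻¹ ^ (m - 1)) ‖z‖)) := by
    rw [integrable_fun_norm_addHaar, Module.finrank_fin_fun]
    have h1 : IntegrableOn (fun _ : ℝ => (1 : ℝ)) (Set.Ioc 0 1) :=
      integrableOn_const (by simp)
    rw [← integrable_indicator_iff measurableSet_Ioc] at h1
    refine (h1.integrableOn (s := Set.Ioi 0)).congr_fun (fun y hy => ?_) measurableSet_Ioi
    have hy : (0 : ℝ) < y := hy
    by_cases hy1 : y ≤ 1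
    · simp [Set.indicator, hy, hy1, hy.ne']
    · simp [Set.indicator, hy1]
  refine h.mono ((((continuous_dot_self.measurable.sqrt).inv.pow_const _).indicator
    (measurableSet_le continuous_dot_self.measurable measurable_const)).aestronglyMeasurable) ?_
  filter_upwards [ae_ne 0] with z hz
  have hz' : 0 < ‖z‖ := norm_pos_iff.2 hz
  have h1 := norm_le_sqrt_dot z
  by_cases hx : z ⬝ᵥ z ≤ 1
  · rw [Set.indicator_of_mem (by exact hx), Set.indicator_of_mem (by
      exact h1.trans (Real.sqrt_le_one.2 hx)), Real.norm_of_nonneg (by positivity),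
      Real.norm_of_nonneg (by positivity)]
    exact pow_le_pow_left₀ (by positivity) (inv_anti₀ hz' h1) _
  · rw [Set.indicator_of_notMem (by exact hx), norm_zero]
    exact norm_nonneg _

lemma rho_le_rho_zero (z : Fin m → ℝ) : rho z ≤ rho (0 : Fin m → ℝ) := by
  have h := Dm_pos m
  have h1 : 1 ≤ nrm z := Real.one_le_sqrt.2 (by linarith [dot_self_nonneg z])
  have h2 : nrm (0 : Fin m → ℝ) = 1 := by simp [nrm]
  unfold rho
  rw [h2]
  gcongr

end Domination
end

section

section DominatedLimit
variable {m d : ℕ} [NeZero m]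

lemma inv_cz_pow_sq (z : Fin m → ℝ) : (cz d z ^ d) ^ 2 = ((1 + z ⬝ᵥ z / d) ^ d)⁻¹ := by
  rw [← pow_mul, mul_comm, pow_mul, cz_sq, inv_pow]

lemma cz_pow_mul_le (hd : m + 3 ≤ d) (z : Fin m → ℝ) :
    cz d z ^ d * (1 + z ⬝ᵥ z) ≤ (m + 3 : ℝ) ^ (m + 3) * (nrm z)⁻¹ ^ (m + 1) := by
  have hx := dot_self_nonneg z
  have hn := nrm_pos z
  have hc := cz_pos (d := d) z
  have h := one_add_div_pow_le (n := m + 3) (by omega) hd hx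
  push_cast at h
  have h0 : ((nrm z)⁻¹ ^ (m + 1)) ^ 2 = (1 + z ⬝ᵥ z)⁻¹ ^ (m + 1) := by
    rw [← pow_mul, mul_comm, pow_mul, inv_pow _ 2, nrm_sq]
  rw [← pow_le_pow_iff_left₀ (by positivity) (by positivity) two_ne_zero, mul_pow, inv_cz_pow_sq,
    mul_pow, h0, inv_mul_le_iff₀ (by positivity)]
  have h1 : (1 + z ⬝ᵥ z) ^ (m + 3) ≤ (m + 3) ^ (m + 3) * (1 + z ⬝ᵥ z / d) ^ d := by
    refine le_trans ?_ (mul_le_mul_of_nonneg_left h (by positivity))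
    rw [← mul_pow]
    refine pow_le_pow_left₀ (by positivity) ?_ _
    field_simp
    linarith
  have h2 : 1 ≤ ((m : ℝ) + 3) ^ (m + 3) := one_le_pow₀ (by linarith [(m : ℕ).cast_nonneg (α := ℝ)])
  have h3 : (1 + z ⬝ᵥ z) ^ 2 = (1 + z ⬝ᵥ z) ^ (m + 3) * (1 + z ⬝ᵥ z)⁻¹ ^ (m + 1) := by
    rw [show m + 3 = 2 + (m + 1) by ring, pow_add, mul_assoc, ← mul_pow, mul_inv_cancel₀ (by positivity),
      one_pow, mul_one]
  rw [h3, ← mul_assoc]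
  refine mul_le_mul_of_nonneg_right (h1.trans ?_) (by positivity)
  rw [mul_comm]
  refine mul_le_mul_of_nonneg_left ?_ (by positivity)
  nlinarith

lemma exists_kk_far (m : ℕ) [NeZero m] : ∃ C : ℝ, 0 < C ∧ ∀ d : ℕ, m + 3 ≤ d → ∀ r : ℝ, 0 ≤ r →
    r ≤ 1 → ∀ z : Fin m → ℝ, 1 ≤ z ⬝ᵥ z → |kk m d r (cz d z) - 1| ≤ C * rho z := by
  obtain ⟨C, hC, h⟩ := abs_wW_sub_one_le m
  have hD := Dm_pos m
  have hp : 0 < (√(2 * π))⁻¹ ^ m * Dm m := by positivity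
  refine ⟨C * ((m + 3 : ℝ) ^ (m + 3) / ((√(2 * π))⁻¹ ^ m * Dm m)), by positivity,
    fun d hd r hr0 hr1 z hx => ?_⟩
  have hz : z ≠ 0 := by rintro rfl; simp at hx; linarith
  have hr2 : r ^ 2 ≤ 1 := by nlinarith
  have hc := cz_pos (d := d) z
  have hn := nrm_pos z
  have hd2 : (2 : ℝ) ≤ d := by exact_mod_cast (by omega : 2 ≤ d)
  rw [(kk_eq_wW (by omega) r z).2.2]
  refine (h _ _ _ _ (by positivity) hx ?_ (div_nonneg (by linarith) (by linarith))
    (by rw [div_le_one (by linarith)]; linarith) ?_ (wC_mem (by omega) hr2 hz).2).trans ?_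
  · have h1 := one_add_div_pow_le (n := 2) (d := d) (by omega) (by omega) (x := z ⬝ᵥ z) (by linarith)
    push_cast at h1
    rw [mul_pow, inv_cz_pow_sq, mul_assoc]
    refine mul_le_one₀ hr2 (by positivity) ?_
    rw [inv_mul_le_iff₀ (by positivity)]
    linarith
  · have hcz := cz_sq (d := d) z
    have h1 : 1 ≤ cz d z * (1 + z ⬝ᵥ z) := by
      refine (one_le_sq_iff₀ (by positivity)).1 ?_
      rw [mul_pow, hcz, ← div_eq_inv_mul, one_le_div (by positivity)]
      have : z ⬝ᵥ z / d ≤ z ⬝ᵥ z := div_le_self (by linarith) (by linarith)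
      nlinarith
    rw [abs_of_nonneg (by positivity), mul_assoc]
    refine mul_le_mul_of_nonneg_left ?_ hr0
    obtain ⟨n, rfl⟩ : ∃ n, d = n + 1 := ⟨d - 1, by omega⟩
    rw [Nat.add_sub_cancel, _root_.pow_succ, mul_assoc]
    exact le_mul_of_one_le_right (by positivity) h1
  · rw [mul_assoc C]
    refine mul_le_mul_of_nonneg_left ?_ hC.le
    calc r * cz d z ^ d * (1 + z ⬝ᵥ z) ≤ 1 * cz d z ^ d * (1 + z ⬝ᵥ z) := by gcongr
      _ ≤ (m + 3 : ℝ) ^ (m + 3) * (nrm z)⁻¹ ^ (m + 1) := by rw [one_mul]; exact cz_pow_mul_le hd z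
      _ = _ := by unfold rho; field_simp

lemma exists_le_rho (m : ℕ) : ∃ C : ℝ, 0 < C ∧ ∀ z : Fin m → ℝ, z ⬝ᵥ z ≤ 1 → 1 ≤ C * rho z := by
  have hD := Dm_pos m
  have hp : 0 < (√(2 * π))⁻¹ ^ m * Dm m := by positivity
  refine ⟨√2 ^ (m + 1) / ((√(2 * π))⁻¹ ^ m * Dm m), by positivity, fun z hz => ?_⟩
  have hn := nrm_pos z
  have h : nrm z ≤ √2 := Real.sqrt_le_sqrt (by linarith)
  calc (1 : ℝ) = √2 ^ (m + 1) * (√2)⁻¹ ^ (m + 1) := by rw [← mul_pow, mul_inv_cancel₀ (by positivity), one_pow]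
    _ ≤ √2 ^ (m + 1) * (nrm z)⁻¹ ^ (m + 1) := by gcongr
    _ = _ := by unfold rho; field_simp

lemma kk_cz_nonneg (hd : 2 ≤ d) {r : ℝ} (hr : r ^ 2 ≤ 1) {z : Fin m → ℝ} (hz : z ≠ 0) :
    0 ≤ kk m d r (cz d z) := by
  have := (wC_mem hd hr hz).1
  have := Gr_nonneg (wC (r * cz d z ^ d) (z ⬝ᵥ z) ((d - 1) / d) (r * cz d z ^ (d - 1)) : Fin m → ℝ)
  rw [(kk_eq_wW hd r z).2.2, wW]
  positivity

lemma exists_kk_lower (m : ℕ) [NeZero m] : ∃ C : ℝ, 0 < C ∧ ∀ d : ℕ, m + 3 ≤ d → ∀ r : ℝ, 0 ≤ r →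
    r ≤ 1 → ∀ z : Fin m → ℝ, z ≠ 0 → -(C * rho z) ≤ kk m d r (cz d z) - 1 := by
  obtain ⟨C₁, h₁, h₁'⟩ := exists_kk_far m
  obtain ⟨C₂, h₂, h₂'⟩ := exists_le_rho m
  refine ⟨C₁ + C₂, by positivity, fun d hd r hr0 hr1 z hz => ?_⟩
  have := rho_pos z
  rcases le_total 1 (z ⬝ᵥ z) with hx | hx
  · have := (abs_le.1 (h₁' d hd r hr0 hr1 z hx)).1
    nlinarith
  · have := h₂' z hx
    have := kk_cz_nonneg (d := d) (r := r) (by omega) (by nlinarith) hz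
    nlinarith

lemma exists_kk_bound (m : ℕ) [NeZero m] {r : ℝ} (hr0 : 0 ≤ r) (hr1 : r ≤ 1) :
    ∃ C : ℝ, 0 < C ∧ ∀ d : ℕ, m + 3 ≤ d → ∀ z : Fin m → ℝ, z ≠ 0 →
    |kk m d r (cz d z) - 1| ≤ C * dom z := by
  obtain ⟨C₁, h₁, h₁'⟩ := exists_kk_far m
  have hr2 : r ^ 2 ≤ 1 := by nlinarith
  obtain ⟨C₂, h₂, h₂'⟩ : ∃ C : ℝ, 0 < C ∧ ∀ d : ℕ, m + 3 ≤ d → ∀ z : Fin m → ℝ, z ≠ 0 →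
      z ⬝ᵥ z ≤ 1 → kk m d r (cz d z) ≤ C * (√(z ⬝ᵥ z))⁻¹ ^ (m - 1) := by
    rcases eq_or_lt_of_le hr1 with rfl | hr
    · obtain ⟨C, hC, h⟩ := wW_near_le m
      refine ⟨C, hC, fun d hd z hz hx => ?_⟩
      have hx0 := dot_self_pos hz
      have hd2 : (2 : ℝ) ≤ d := by exact_mod_cast (by omega : 2 ≤ d)
      rw [(kk_eq_wW (by omega) 1 z).2.2]
      refine h _ _ _ _ hx0 hx ?_ ?_ (wC_mem (by omega) hr2 hz).1 (wC_mem (by omega) hr2 hz).2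
      · have h1 := one_add_div_pow_le (n := 1) (d := d) (by omega) (by omega) hx0.le
        push_cast at h1
        rw [one_mul, inv_cz_pow_sq, inv_mul_le_iff₀ (by positivity)]
        linarith
      · have h1 : (1 + z ⬝ᵥ z / d) ^ d ≤ Real.exp (z ⬝ᵥ z) := by
          have h2 := pow_le_pow_left₀ (by positivity) (Real.add_one_le_exp (z ⬝ᵥ z / d)) d
          rwa [← Real.exp_nat_mul, mul_div_cancel₀ _ (by positivity), add_comm] at h2
        have h2 : 1 - z ⬝ᵥ z ≤ ((1 + z ⬝ᵥ z / d) ^ d)⁻¹ := by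
          have := Real.add_one_le_exp (-(z ⬝ᵥ z))
          rw [Real.exp_neg] at this
          have := inv_anti₀ (by positivity) h1
          linarith
        rw [one_mul, inv_cz_pow_sq]
        nlinarith
    · obtain ⟨C, hC, h⟩ := wW_le_of_lt_one m (r := r) (by nlinarith)
      refine ⟨C, hC, fun d hd z hz hx => ?_⟩
      have hx0 := dot_self_pos hz
      rw [(kk_eq_wW (by omega) r z).2.2]
      refine (h _ _ _ _ hx0 ?_ (wC_mem (by omega) hr2 hz).1 (wC_mem (by omega) hr2 hz).2).trans
        (le_mul_of_one_le_right hC.le (one_le_pow₀ ?_))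
      · rw [mul_pow, inv_cz_pow_sq]
        exact mul_le_of_le_one_right (sq_nonneg r) (inv_le_one_of_one_le₀ (one_le_pow₀ (by
          have : 0 ≤ z ⬝ᵥ z / d := by positivity
          linarith)))
      · exact (one_le_inv₀ (Real.sqrt_pos.2 hx0)).2 (Real.sqrt_le_one.2 hx)
  refine ⟨C₁ + (C₂ + 1), by positivity, fun d hd z hz => ?_⟩
  have hρ := rho_pos z
  have hx0 := dot_self_pos hz
  by_cases hx : z ⬝ᵥ z ≤ 1
  · have h3 := kk_cz_nonneg (d := d) (by omega) hr2 hz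
    have h4 := h₂' d hd z hz hx
    have h5 : 1 ≤ (√(z ⬝ᵥ z))⁻¹ ^ (m - 1) :=
      one_le_pow₀ ((one_le_inv₀ (Real.sqrt_pos.2 hx0)).2 (Real.sqrt_le_one.2 hx))
    rw [dom, Set.indicator_of_mem (by exact hx)]
    rw [abs_le]
    constructor <;> nlinarith
  · rw [dom, Set.indicator_of_notMem (by exact hx), add_zero]
    have := h₁' d hd r hr0 hr1 z (by linarith)
    nlinarith

/-- Limit of `Ik`. -/
def II (m : ℕ) [NeZero m] (r : ℝ) : ℝ :=
  ∫ z : Fin m → ℝ, (kI m r (z ⬝ᵥ z) - 1) * rho (0 : Fin m → ℝ)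

lemma rescale_kk (hd : d ≠ 0) (g : ℝ → ℝ) :
    (Integrable (fun t : Fin m → ℝ => g (nrm t)⁻¹ * rho t) ↔
      Integrable (fun z : Fin m → ℝ => g (cz d z) * rho ((√d)⁻¹ • z))) ∧
    √d ^ m * ∫ t : Fin m → ℝ, g (nrm t)⁻¹ * rho t =
      ∫ z : Fin m → ℝ, g (cz d z) * rho ((√d)⁻¹ • z) := by
  have hd0 : 0 < √(d : ℝ) := Real.sqrt_pos.2 (by positivity)
  refine ⟨(integrable_comp_smul_iff volume (fun t : Fin m → ℝ => g (nrm t)⁻¹ * rho t)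
    (inv_ne_zero hd0.ne')).symm, ?_⟩
  have h := Measure.integral_comp_smul (μ := volume) (fun t : Fin m → ℝ => g (nrm t)⁻¹ * rho t)
    (√d)⁻¹
  rw [Module.finrank_fin_fun, inv_pow, inv_inv, abs_of_pos (by positivity), smul_eq_mul] at h
  exact h.symm

lemma measurable_cz (d : ℕ) : Measurable (cz d : (Fin m → ℝ) → ℝ) :=
  (continuous_nrm.comp (continuous_const_smul _)).measurable.inv

lemma measurable_rescaled (d : ℕ) (r : ℝ) : Measurable fun z : Fin m → ℝ =>
    (kk m d r (cz d z) - 1) * rho ((√d)⁻¹ • z) :=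
  (((measurable_kk d r).comp (measurable_cz d)).sub_const 1).mul
    (continuous_rho.comp (continuous_const_smul _)).measurable

lemma norm_rescaled_le {r C : ℝ}
    (h : ∀ d : ℕ, m + 3 ≤ d → ∀ z : Fin m → ℝ, z ≠ 0 → |kk m d r (cz d z) - 1| ≤ C * dom z)
    (hd : m + 3 ≤ d) :
    ∀ᵐ z : Fin m → ℝ, ‖(kk m d r (cz d z) - 1) * rho ((√d)⁻¹ • z)‖
      ≤ C * dom z * rho (0 : Fin m → ℝ) := by
  filter_upwards [ae_ne 0] with z hz
  rw [Real.norm_eq_abs, abs_mul, abs_of_pos (rho_pos _)]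
  exact mul_le_mul (h d hd z hz) (rho_le_rho_zero _) (rho_pos _).le
    ((abs_nonneg _).trans (h d hd z hz))

lemma intK_of_le {r : ℝ} (hr0 : 0 ≤ r) (hr1 : r ≤ 1) (hd : m + 3 ≤ d) : IntK m d r := by
  obtain ⟨C, hC, h⟩ := exists_kk_bound m hr0 hr1
  refine ((rescale_kk (d := d) (by omega) fun c => kk m d r c - 1).1).2 ?_
  exact ((integrable_dom.const_mul C).mul_const _).mono' (measurable_rescaled d r).aestronglyMeasurable
    (norm_rescaled_le h hd)

lemma exists_Jk_le (m : ℕ) [NeZero m] : ∃ C : ℝ, 0 < C ∧ ∀ d : ℕ, m + 3 ≤ d → Jk m d ≤ C := by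
  obtain ⟨C, hC, h⟩ := exists_kk_bound m zero_le_one le_rfl
  have h0 : 0 ≤ ∫ z : Fin m → ℝ, C * dom z * rho (0 : Fin m → ℝ) := integral_nonneg_of_ae (by
    filter_upwards [ae_ne 0] with z hz
    exact mul_nonneg ((abs_nonneg _).trans (h (m + 3) le_rfl z hz)) (rho_pos _).le)
  refine ⟨(∫ z : Fin m → ℝ, C * dom z * rho (0 : Fin m → ℝ)) + 1, by positivity, fun d hd => ?_⟩
  rw [Jk, (rescale_kk (d := d) (by omega) fun c => |kk m d 1 c - 1|).2]
  refine (integral_mono_of_nonneg (Eventually.of_forall fun z => ?_)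
    ((integrable_dom.const_mul C).mul_const _) ?_).trans (by linarith)
  · exact mul_nonneg (abs_nonneg _) (rho_pos _).le
  · filter_upwards [norm_rescaled_le h hd] with z hz
    rwa [Real.norm_eq_abs, abs_mul, abs_of_pos (rho_pos _)] at hz

lemma tendsto_Ik {r : ℝ} (hr0 : 0 ≤ r) (hr1 : r ≤ 1) :
    Tendsto (fun d : ℕ => Ik m d r) atTop (nhds (II m r)) := by
  obtain ⟨C, hC, h⟩ := exists_kk_bound m hr0 hr1
  have h1 : Tendsto (fun d : ℕ => ∫ z : Fin m → ℝ, (kk m d r (cz d z) - 1) * rho ((√d)⁻¹ • z))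
      atTop (nhds (II m r)) := by
    refine tendsto_integral_filter_of_dominated_convergence
      (fun z => C * dom z * rho (0 : Fin m → ℝ))
      (Eventually.of_forall fun d => (measurable_rescaled d r).aestronglyMeasurable) ?_
      ((integrable_dom.const_mul C).mul_const _) ?_
    · filter_upwards [eventually_ge_atTop (m + 3)] with d hd using norm_rescaled_le h hd
    · filter_upwards [ae_ne 0] with z hz
      refine ((tendsto_kk (by nlinarith) hz).2.sub_const 1).mul ?_
      have h2 : Tendsto (fun d : ℕ => (√(d : ℝ))⁻¹) atTop (nhds 0) :=
        tendsto_inv_atTop_zero.comp (Real.tendsto_sqrt_atTop.comp tendsto_natCast_atTop_atTop)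
      have h3 : Tendsto (fun d : ℕ => (√(d : ℝ))⁻¹ • z) atTop (nhds ((0 : ℝ) • z)) :=
        h2.smul_const z
      rw [zero_smul] at h3
      exact (continuous_rho.tendsto 0).comp h3
  refine h1.congr' ?_
  filter_upwards [eventually_ge_atTop 1] with d hd
  exact ((rescale_kk (by omega) fun c => kk m d r c - 1).2).symm

lemma abs_kI_sub_one_le {r : ℝ} (hr0 : 0 ≤ r) (hr1 : r ≤ 1) :
    ∃ C : ℝ, 0 < C ∧ ∀ z : Fin m → ℝ, z ≠ 0 → |kI m r (z ⬝ᵥ z) - 1| ≤ C * dom z := by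
  obtain ⟨C, hC, h⟩ := exists_kk_bound m hr0 hr1
  refine ⟨C, hC, fun z hz => ?_⟩
  refine le_of_tendsto ((tendsto_kk (by nlinarith) hz).2.sub_const 1).abs ?_
  filter_upwards [eventually_ge_atTop (m + 3)] with d hd using h d hd z hz

lemma exists_kI_lower (m : ℕ) [NeZero m] : ∃ C : ℝ, 0 < C ∧ ∀ r : ℝ, 0 ≤ r →
    r ≤ 1 → ∀ z : Fin m → ℝ, z ≠ 0 → -(C * rho z) ≤ kI m r (z ⬝ᵥ z) - 1 := by
  obtain ⟨C, hC, h⟩ := exists_kk_lower m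
  refine ⟨C, hC, fun r hr0 hr1 z hz => ?_⟩
  refine ge_of_tendsto ((tendsto_kk (by nlinarith) hz).2.sub_const 1) ?_
  filter_upwards [eventually_ge_atTop (m + 3)] with d hd using h d hd r hr0 hr1 z hz

end DominatedLimit
end

section

section Positivity
variable {m : ℕ} [NeZero m]

lemma integrable_exp_half : Integrable fun z : Fin m → ℝ => Real.exp (-(z ⬝ᵥ z) / 2) := by
  have h : Integrable (gpdf (Fin m)) := by
    refine ⟨continuous_gpdf.aestronglyMeasurable, ?_⟩
    rw [hasFiniteIntegral_iff_ofReal (Eventually.of_forall fun t => (gpdf_pos t).le)]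
    have h1 : (stdG (Fin m)) Set.univ = 1 := measure_univ
    rw [stdG_eq_withDensity, withDensity_apply _ MeasurableSet.univ, Measure.restrict_univ] at h1
    rw [h1]
    exact ENNReal.one_lt_top
  refine (h.const_mul ((√(2 * π)) ^ m)).congr (Eventually.of_forall fun z => ?_)
  have : 0 < √(2 * π) := by positivity
  simp only [gpdf, Fintype.card_fin]
  rw [← mul_assoc, ← mul_pow, mul_inv_cancel₀ this.ne', one_pow, one_mul]

/-- Auxiliary radial potential. -/
def phiR (m : ℕ) (r : ℝ) (z : Fin m → ℝ) : ℝ := (1 - uI r (z ⬝ᵥ z) ^ 2) ^ (-(m : ℝ) / 2) - 1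

lemma inv_sqrt_pow_eq {y : ℝ} (hy : 0 < y) (m : ℕ) : (√y)⁻¹ ^ m = y ^ (-(m : ℝ) / 2) := by
  rw [Real.sqrt_eq_rpow, ← Real.rpow_neg hy.le, ← Real.rpow_natCast, ← Real.rpow_mul hy.le]
  congr 1
  ring

lemma uI_sq_le {r : ℝ} (z : Fin m → ℝ) : uI r (z ⬝ᵥ z) ^ 2 ≤ r ^ 2 := by
  rw [uI_sq]
  exact mul_le_of_le_one_right (sq_nonneg r) (Real.exp_le_one_iff.2 (by linarith [dot_self_nonneg z]))

lemma hasLineDerivAt_phiR {r : ℝ} (hr : r ^ 2 < 1) (z : Fin m → ℝ) (i : Fin m) :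
    HasLineDerivAt ℝ (phiR m r) (-(m * z i * uI r (z ⬝ᵥ z) ^ 2 / (1 - uI r (z ⬝ᵥ z) ^ 2) *
      (1 - uI r (z ⬝ᵥ z) ^ 2) ^ (-(m : ℝ) / 2))) z (Pi.single i 1) := by
  unfold HasLineDerivAt phiR
  have h0 : ∀ t : ℝ, (z + t • Pi.single i 1) ⬝ᵥ (z + t • Pi.single i 1)
      = z ⬝ᵥ z + 2 * t * z i + t ^ 2 := by
    intro t
    simp [add_dotProduct, dotProduct_add]
    ring
  simp_rw [h0, uI_sq]
  have hlt : 0 < 1 - r ^ 2 * Real.exp (-(z ⬝ᵥ z)) := by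
    have := uI_sq_le (r := r) z
    rw [uI_sq] at this
    linarith
  have h1 : HasDerivAt (fun t : ℝ => 1 - r ^ 2 * Real.exp (-(z ⬝ᵥ z + 2 * t * z i + t ^ 2)))
      (2 * z i * (r ^ 2 * Real.exp (-(z ⬝ᵥ z)))) 0 := by
    have h2 : HasDerivAt (fun t : ℝ => -(z ⬝ᵥ z + 2 * t * z i + t ^ 2)) (-(2 * z i)) 0 := by
      have h3 := ((((hasDerivAt_id (0 : ℝ)).const_mul 2).mul_const (z i)).const_add (z ⬝ᵥ z)).add
        ((hasDerivAt_id (0 : ℝ)).pow 2)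
      convert! h3.neg using 1
      simp
    convert! (h2.exp.const_mul (r ^ 2)).const_sub 1 using 1
    simp
    ring
  have h4 := (h1.rpow_const (p := -(m : ℝ) / 2) (Or.inl (by simpa using hlt.ne'))).sub_const 1
  convert! h4 using 1
  simp only [mul_zero, zero_mul, add_zero, ne_eq, OfNat.ofNat_ne_zero, not_false_eq_true, zero_pow]
  rw [Real.rpow_sub_one hlt.ne']
  ring

lemma one_add_mul_exp_le {x : ℝ} : (1 + x) * Real.exp (-x) ≤ 2 * Real.exp (-x / 2) := by
  have h := Real.add_one_le_exp (x / 2)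
  have h1 : Real.exp (-x / 2) = Real.exp (x / 2) * Real.exp (-x) := by
    rw [← Real.exp_add]; congr 1; ring
  rw [h1, ← mul_assoc]
  exact mul_le_mul_of_nonneg_right (by linarith) (Real.exp_pos _).le

lemma exists_phiR_le (m : ℕ) [NeZero m] {r : ℝ} (hr : r ^ 2 < 1) : ∃ C : ℝ, 0 < C ∧ ∀ z : Fin m → ℝ,
    0 ≤ phiR m r z ∧ phiR m r z ≤ C * Real.exp (-(z ⬝ᵥ z)) ∧
    0 ≤ uI r (z ⬝ᵥ z) ^ 2 / (1 - uI r (z ⬝ᵥ z) ^ 2) * (1 - uI r (z ⬝ᵥ z) ^ 2) ^ (-(m : ℝ) / 2) ∧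
    uI r (z ⬝ᵥ z) ^ 2 / (1 - uI r (z ⬝ᵥ z) ^ 2) * (1 - uI r (z ⬝ᵥ z) ^ 2) ^ (-(m : ℝ) / 2)
      ≤ C * Real.exp (-(z ⬝ᵥ z)) := by
  have hr' : 0 < √(1 - r ^ 2) := Real.sqrt_pos.2 (by linarith)
  set Y := (√(1 - r ^ 2))⁻¹ with hY
  have hYY : Y ^ 2 = (1 - r ^ 2)⁻¹ := by rw [hY, inv_pow, Real.sq_sqrt (by linarith)]
  have hY0 : 0 < Y := by positivity
  refine ⟨(m + 1) * Y ^ m * Y ^ 2, by positivity, fun z => ?_⟩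
  have ha := uI_sq_le (r := r) z
  have ha0 := sq_nonneg (uI r (z ⬝ᵥ z))
  have hae : uI r (z ⬝ᵥ z) ^ 2 ≤ Real.exp (-(z ⬝ᵥ z)) := by
    rw [uI_sq]
    exact mul_le_of_le_one_left (Real.exp_pos _).le hr.le
  unfold phiR
  set a := uI r (z ⬝ᵥ z) ^ 2
  rw [← inv_sqrt_pow_eq (by linarith)]
  set y := (√(1 - a))⁻¹ with hy
  have hy0 : 0 < y := inv_pos.2 (Real.sqrt_pos.2 (by linarith))
  have hyY : y ≤ Y := inv_anti₀ hr' (Real.sqrt_le_sqrt (by linarith))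
  have hy2 : y ^ 2 = (1 - a)⁻¹ := by rw [hy, inv_pow, Real.sq_sqrt (by linarith)]
  have hy1 : 1 ≤ y := (one_le_inv₀ (Real.sqrt_pos.2 (by linarith))).2 (Real.sqrt_le_one.2 (by linarith))
  have hym : y ^ m ≤ Y ^ m := pow_le_pow_left₀ hy0.le hyY m
  have hq : a / (1 - a) ≤ Y ^ 2 * Real.exp (-(z ⬝ᵥ z)) := by
    rw [div_eq_inv_mul, ← hy2]
    gcongr
  have hq0 : 0 ≤ a / (1 - a) := div_nonneg ha0 (by linarith)
  have hm0 : (0 : ℝ) ≤ m := by positivity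
  refine ⟨by linarith [one_le_pow₀ hy1 (n := m)], ?_, by positivity, ?_⟩
  · have h3 := pow_sub_one_le hy1 m
    have h4 : y - 1 ≤ a / (1 - a) := by
      have : a / (1 - a) = y ^ 2 - 1 := by
        rw [hy2]
        have : 1 - a ≠ 0 := by linarith
        field_simp
        ring
      nlinarith
    calc y ^ m - 1 ≤ m * y ^ m * (y - 1) := h3
      _ ≤ m * Y ^ m * (Y ^ 2 * Real.exp (-(z ⬝ᵥ z))) := by
          gcongr
          linarith
      _ ≤ (m + 1) * Y ^ m * (Y ^ 2 * Real.exp (-(z ⬝ᵥ z))) := by gcongr; linarith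
      _ = _ := by ring
  · calc a / (1 - a) * y ^ m ≤ Y ^ 2 * Real.exp (-(z ⬝ᵥ z)) * Y ^ m := by gcongr
      _ = 1 * Y ^ m * Y ^ 2 * Real.exp (-(z ⬝ᵥ z)) := by ring
      _ ≤ _ := by gcongr; linarith

lemma continuous_uI_dot (r : ℝ) : Continuous fun z : Fin m → ℝ => uI r (z ⬝ᵥ z) := by
  have := continuous_dot_self (m := m)
  unfold uI
  fun_prop

lemma abs_apply_le (z : Fin m → ℝ) (i : Fin m) : |z i| ≤ 1 + z ⬝ᵥ z ∧ z i ^ 2 ≤ z ⬝ᵥ z := by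
  have h : z i ^ 2 ≤ z ⬝ᵥ z := by
    rw [dotProduct, sq]
    exact Finset.single_le_sum (f := fun i => z i * z i) (fun i _ => mul_self_nonneg _)
      (Finset.mem_univ i)
  refine ⟨?_, h⟩
  nlinarith [sq_abs (z i), sq_nonneg (|z i| - 1), abs_nonneg (z i)]

lemma integral_phiR_identity (hm : m ≠ 0) {r : ℝ} (hr : r ^ 2 < 1) :
    Integrable (fun z : Fin m → ℝ => (√(1 - uI r (z ⬝ᵥ z) ^ 2))⁻¹ ^ m *
      wS (uI r (z ⬝ᵥ z)) (z ⬝ᵥ z) - 1) ∧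
    ∫ z : Fin m → ℝ, ((√(1 - uI r (z ⬝ᵥ z) ^ 2))⁻¹ ^ m * wS (uI r (z ⬝ᵥ z)) (z ⬝ᵥ z) - 1) = 0 := by
  obtain ⟨C, hC, h⟩ := exists_phiR_le m hr
  have hpos : ∀ z : Fin m → ℝ, 0 < 1 - uI r (z ⬝ᵥ z) ^ 2 := fun z => by
    linarith [uI_sq_le (r := r) z]
  have hcΦ : Continuous (phiR m r) :=
    ((continuous_const.sub ((continuous_uI_dot r).pow 2)).rpow_const
      fun z => Or.inl (hpos z).ne').sub continuous_const
  have hdom := (integrable_exp_half (m := m)).const_mul (2 * C)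
  have hd : ∀ z : Fin m → ℝ, C * ((1 + z ⬝ᵥ z) * Real.exp (-(z ⬝ᵥ z)))
      ≤ 2 * C * Real.exp (-(z ⬝ᵥ z) / 2) := fun z => by
    nlinarith [one_add_mul_exp_le (x := z ⬝ᵥ z)]
  have he : ∀ z : Fin m → ℝ, 0 < Real.exp (-(z ⬝ᵥ z)) := fun z => Real.exp_pos _
  have hΦ : Integrable (phiR m r) := hdom.mono' hcΦ.aestronglyMeasurable
    (Eventually.of_forall fun z => by
      rw [Real.norm_of_nonneg (h z).1]
      refine (h z).2.1.trans (le_trans ?_ (hd z))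
      gcongr
      nlinarith [he z, dot_self_nonneg z])
  set g' : Fin m → (Fin m → ℝ) → ℝ := fun i z =>
    -(m * z i * uI r (z ⬝ᵥ z) ^ 2 / (1 - uI r (z ⬝ᵥ z) ^ 2) *
      (1 - uI r (z ⬝ᵥ z) ^ 2) ^ (-(m : ℝ) / 2)) with hg'
  have hcg' : ∀ i, Continuous (g' i) := fun i =>
    (((continuous_const.mul (continuous_apply i)).mul ((continuous_uI_dot r).pow 2)).div
      (continuous_const.sub ((continuous_uI_dot r).pow 2)) (fun z => (hpos z).ne')).mul
      ((continuous_const.sub ((continuous_uI_dot r).pow 2)).rpow_const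
      fun z => Or.inl (hpos z).ne') |>.neg
  have h1 : ∀ i : Fin m, Integrable (fun z : Fin m → ℝ => z i * phiR m r z) := fun i =>
    hdom.mono' ((continuous_apply i).mul hcΦ).aestronglyMeasurable
      (Eventually.of_forall fun z => by
        rw [norm_mul, Real.norm_of_nonneg (h z).1, Real.norm_eq_abs]
        refine le_trans ?_ (hd z)
        calc _ ≤ (1 + z ⬝ᵥ z) * (C * Real.exp (-(z ⬝ᵥ z))) :=
              mul_le_mul (abs_apply_le z i).1 (h z).2.1 (h z).1 (by linarith [dot_self_nonneg z])
          _ = _ := by ring)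
  have h2 : ∀ i : Fin m, Integrable (fun z : Fin m → ℝ => z i * g' i z) := fun i =>
    (hdom.const_mul m).mono' ((continuous_apply i).mul (hcg' i)).aestronglyMeasurable
      (Eventually.of_forall fun z => by
        have h3 : z i * g' i z = -(m * (z i ^ 2 * (uI r (z ⬝ᵥ z) ^ 2 / (1 - uI r (z ⬝ᵥ z) ^ 2) *
          (1 - uI r (z ⬝ᵥ z) ^ 2) ^ (-(m : ℝ) / 2)))) := by simp only [hg']; ring
        rw [h3, norm_neg, Real.norm_of_nonneg (mul_nonneg (by positivity)
          (mul_nonneg (sq_nonneg _) (h z).2.2.1))]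
        refine mul_le_mul_of_nonneg_left (le_trans ?_ (hd z)) (by positivity)
        calc _ ≤ (1 + z ⬝ᵥ z) * (C * Real.exp (-(z ⬝ᵥ z))) :=
              mul_le_mul (by linarith [(abs_apply_le z i).2]) (h z).2.2.2 (h z).2.2.1
                (by linarith [dot_self_nonneg z])
          _ = _ := by ring)
  have h3 : ∀ i : Fin m, ∫ z : Fin m → ℝ, z i * g' i z = -∫ z, phiR m r z := fun i => by
    have h4 := integral_bilinear_hasLineDerivAt_right_eq_neg_left_of_integrable (μ := volume)
      (f := fun z : Fin m → ℝ => z i) (f' := fun _ => (1 : ℝ)) (g := phiR m r) (g' := g' i)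
      (v := Pi.single i 1) (B := ContinuousLinearMap.mul ℝ ℝ) (by simpa using hΦ)
      (by simpa using h2 i) (by simpa using h1 i) (fun z _ => by
        have h5 := (hasDerivAt_id (0 : ℝ)).const_add (z i)
        unfold HasLineDerivAt
        convert! h5 using 1
        funext t
        simp)
      (fun z _ => hasLineDerivAt_phiR hr z i)
    simpa using h4
  have h5 : ∀ z : Fin m → ℝ, (√(1 - uI r (z ⬝ᵥ z) ^ 2))⁻¹ ^ m * wS (uI r (z ⬝ᵥ z)) (z ⬝ᵥ z) - 1
      = phiR m r z + (m : ℝ)⁻¹ * ∑ i, z i * g' i z := by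
    intro z
    have hs : ∑ i, z i * g' i z = -(m * (z ⬝ᵥ z) * (uI r (z ⬝ᵥ z) ^ 2 /
        (1 - uI r (z ⬝ᵥ z) ^ 2) * (1 - uI r (z ⬝ᵥ z) ^ 2) ^ (-(m : ℝ) / 2))) := by
      simp only [hg']
      generalize hq : uI r (z ⬝ᵥ z) = q
      calc _ = ∑ i, z i * z i * -(m * (q ^ 2 / (1 - q ^ 2) * (1 - q ^ 2) ^ (-(m : ℝ) / 2))) :=
            Finset.sum_congr rfl fun i _ => by ring
        _ = _ := by
            rw [← Finset.sum_mul]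
            change (z ⬝ᵥ z) * _ = _
            ring
    rw [hs, phiR, inv_sqrt_pow_eq (hpos z), wS]
    have := (hpos z).ne'
    have hm0 : (m : ℝ) ≠ 0 := by exact_mod_cast hm
    field_simp
    ring
  have hsum : Integrable (fun z : Fin m → ℝ => (m : ℝ)⁻¹ * ∑ i, z i * g' i z) :=
    (integrable_finset_sum _ fun i _ => h2 i).const_mul _
  simp_rw [h5]
  refine ⟨hΦ.add hsum, ?_⟩
  rw [integral_add hΦ hsum, integral_const_mul, integral_finset_sum _ fun i _ => h2 i]
  simp_rw [h3]
  rw [Finset.sum_const, Finset.card_univ, Fintype.card_fin, nsmul_eq_mul]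
  have hm0 : (m : ℝ) ≠ 0 := by exact_mod_cast hm
  field_simp
  ring

end Positivity
end

section

section Liminf
variable {m : ℕ} [NeZero m]

lemma measurable_wW {α : Type*} [MeasurableSpace α] {A x E : α → ℝ} (hA : Measurable A)
    (hx : Measurable x) (hE : Measurable E) (δ : ℝ) :
    Measurable fun a => wW m (A a) (x a) δ (E a) := by
  have h : Measurable fun a => (wC (A a) (x a) δ (E a) : Fin m → ℝ) := by
    refine measurable_pi_lambda _ fun i => ?_
    unfold wC wK wS
    split_ifs
    · fun_prop
    · exact hE
  have h1 := measurable_Gr.comp h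
  unfold wW wS
  exact ((((measurable_const.sub (hA.pow_const 2)).sqrt.inv.pow_const m).mul
    (by fun_prop)).mul h1).div_const _

lemma measurable_kI (r : ℝ) : Measurable fun z : Fin m → ℝ => kI m r (z ⬝ᵥ z) :=
  measurable_wW (continuous_uI_dot r).measurable continuous_dot_self.measurable
    (continuous_uI_dot r).measurable 1

lemma integrable_kI_sub_one {r : ℝ} (hr0 : 0 ≤ r) (hr1 : r ≤ 1) :
    Integrable fun z : Fin m → ℝ => kI m r (z ⬝ᵥ z) - 1 := by
  obtain ⟨C, hC, h⟩ := abs_kI_sub_one_le (m := m) hr0 hr1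
  refine (integrable_dom.const_mul C).mono' ((measurable_kI r).sub_const 1).aestronglyMeasurable ?_
  filter_upwards [ae_ne (0 : Fin m → ℝ)] with z hz
  exact h z hz

lemma II_pos {r : ℝ} (hr0 : 0 < r) (hr1 : r < 1) : 0 < II m r := by
  have hr2 : r ^ 2 < 1 := by nlinarith
  obtain ⟨h1, h2⟩ := integral_phiR_identity (NeZero.ne m) hr2
  have h3 := integrable_kI_sub_one (m := m) hr0.le hr1.le
  have hD := Dm_pos m
  have hkey : ∀ z : Fin m → ℝ, z ≠ 0 →
      kI m r (z ⬝ᵥ z) - 1 - ((√(1 - uI r (z ⬝ᵥ z) ^ 2))⁻¹ ^ m *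
        wS (uI r (z ⬝ᵥ z)) (z ⬝ᵥ z) - 1) = (√(1 - uI r (z ⬝ᵥ z) ^ 2))⁻¹ ^ m *
        wS (uI r (z ⬝ᵥ z)) (z ⬝ᵥ z) *
        ((Gr (wC (uI r (z ⬝ᵥ z)) (z ⬝ᵥ z) 1 (uI r (z ⬝ᵥ z)) : Fin m → ℝ) - Dm m ^ 2) / Dm m ^ 2) ∧
      0 < (√(1 - uI r (z ⬝ᵥ z) ^ 2))⁻¹ ^ m * wS (uI r (z ⬝ᵥ z)) (z ⬝ᵥ z) := by
    intro z hz
    have hx := dot_self_pos hz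
    have ha := uI_sq_lt_one hr2.le hx
    refine ⟨?_, mul_pos (pow_pos (inv_pos.2 (Real.sqrt_pos.2 (by linarith))) _)
      (wS_uI_pos hr2.le hx)⟩
    rw [kI, wW, sub_div, div_self (by positivity)]
    ring
  have hpos : 0 < ∫ z : Fin m → ℝ, (kI m r (z ⬝ᵥ z) - 1 -
      ((√(1 - uI r (z ⬝ᵥ z) ^ 2))⁻¹ ^ m * wS (uI r (z ⬝ᵥ z)) (z ⬝ᵥ z) - 1)) := by
    refine (integral_pos_iff_support_of_nonneg_ae ?_ (h3.sub h1)).2 ?_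
    rotate_left
    · have hU : IsOpen {z : Fin m → ℝ | 1 < z ⬝ᵥ z} :=
        isOpen_lt continuous_const continuous_dot_self
      have hne : {z : Fin m → ℝ | 1 < z ⬝ᵥ z}.Nonempty := ⟨Pi.single 0 2, by
        rw [Set.mem_ofPred_eq, single_dotProduct, Pi.single_eq_same]; norm_num⟩
      refine lt_of_lt_of_le (hU.measure_pos volume hne) (measure_mono fun z hz => ?_)
      rw [Set.mem_ofPred_eq] at hz
      have hz0 : z ≠ 0 := by rintro rfl; simp at hz; linarith
      rw [Function.mem_support, Pi.sub_apply, (hkey z hz0).1]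
      have hx := dot_self_pos hz0
      have ha := uI_sq_lt_one hr2.le hx
      have hu : 0 < uI r (z ⬝ᵥ z) := mul_pos hr0 (Real.exp_pos _)
      refine (mul_pos (hkey z hz0).2 (div_pos (sub_pos.2 ?_) (by positivity))).ne'
      refine sq_Dm_lt_Gr (NeZero.ne m) (tendsto_kk hr2.le hz0).1 fun i => ?_
      unfold wC
      split_ifs
      · refine div_ne_zero (ne_of_lt ?_) (wS_uI_pos hr2.le hx).ne'
        unfold wK
        have : 0 < uI r (z ⬝ᵥ z) * (z ⬝ᵥ z * uI r (z ⬝ᵥ z) ^ 2) / (1 - uI r (z ⬝ᵥ z) ^ 2) :=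
          div_pos (by positivity) (by linarith)
        nlinarith
      · exact hu.ne'
    · filter_upwards [ae_ne (0 : Fin m → ℝ)] with z hz
      show (0 : ℝ) ≤ _
      rw [Pi.sub_apply, (hkey z hz).1]
      exact mul_nonneg (hkey z hz).2.le (div_nonneg
        (sub_nonneg.2 (sq_Dm_le_Gr (tendsto_kk hr2.le hz).1)) (by positivity))
  rw [integral_sub h3 h1, h2, sub_zero] at hpos
  rw [II, integral_mul_const]
  exact mul_pos hpos (rho_pos _)

lemma lintegral_limit_peak :
    ∫⁻ t : Fin m → ℝ, ENNReal.ofReal ((nrm t)⁻¹ ^ (m + 2) * Gr (fun _ : Fin m => 1) / Dm m ^ 2)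
      = ENNReal.ofReal (rho (0 : Fin m → ℝ))⁻¹ := by
  have hB : (mB (fun _ : Fin m => (1 : ℝ))) = mA := by
    funext i
    unfold mB mA
    ext j
    rcases j with j | j <;> simp [Pi.single_apply]
  have hG : ENNReal.ofReal (Gr (fun _ : Fin m => (1 : ℝ))) = DP m 2 := by
    rw [ofReal_Gr (by simp), Gl, hB, DP]
    have := det_law (u := (mA : Fin m → Fin m ⊕ Fin m → ℝ)) (fun i j => by
      simp [mA, Pi.single_apply, eq_comm]) (f := fun x => ENNReal.ofReal (x ^ 2)) (by fun_prop)
    simpa only [sq] using this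
  have hD := Dm_pos m
  have hP : 0 < (√(2 * π))⁻¹ ^ m := by positivity
  have h := det_moment_identity (NeZero.ne m) 1
  rw [← hG, ← ofReal_Dm] at h
  have hG0 := Gr_nonneg (fun _ : Fin m => (1 : ℝ))
  have hn : Measurable fun t : Fin m → ℝ =>
      ENNReal.ofReal ((√(2 * π))⁻¹ ^ m * (nrm t)⁻¹ ^ (m + (1 + 1))) := by
    have := (continuous_nrm (m := m)).measurable
    fun_prop
  calc _ = ∫⁻ t : Fin m → ℝ, ENNReal.ofReal ((√(2 * π))⁻¹ ^ m * (nrm t)⁻¹ ^ (m + (1 + 1))) *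
        (ENNReal.ofReal (Gr (fun _ : Fin m => (1 : ℝ))) *
          ENNReal.ofReal (((√(2 * π))⁻¹ ^ m * Dm m ^ 2)⁻¹)) := by
        refine lintegral_congr fun t => ?_
        have hn := nrm_pos t
        rw [← ENNReal.ofReal_mul hG0, ← ENNReal.ofReal_mul (by positivity)]
        congr 1
        field_simp
    _ = _ := by
        rw [lintegral_mul_const _ hn, ← mul_assoc, h, ← ENNReal.ofReal_mul hD.le]
        congr 1
        simp only [rho, nrm, zero_dotProduct, add_zero, Real.sqrt_one, inv_one, one_pow, mul_one]
        field_simp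

lemma tendsto_kI_peak {e : ℕ → ℝ} (he : ∀ n, 0 < e n) (he1 : ∀ n, e n < 1)
    (h0 : Tendsto e atTop (nhds 0)) {y : Fin m → ℝ} (hy : y ≠ 0) :
    Tendsto (fun n => e n ^ m * kI m (√(1 - e n ^ 2)) ((e n • y) ⬝ᵥ (e n • y))) atTop
      (nhds ((nrm y)⁻¹ ^ (m + 2) * Gr (fun _ : Fin m => 1) / Dm m ^ 2)) := by
  set x := y ⬝ᵥ y with hx
  have hx0 : 0 < x := dot_self_pos hy
  have hxx : ∀ n, (e n • y) ⬝ᵥ (e n • y) = e n ^ 2 * x := fun n => by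
    rw [smul_dotProduct, dotProduct_smul, smul_eq_mul, smul_eq_mul, hx]; ring
  have hr2 : ∀ n, √(1 - e n ^ 2) ^ 2 = 1 - e n ^ 2 := fun n =>
    Real.sq_sqrt (by nlinarith [he n, he1 n])
  have hr1 : ∀ n, √(1 - e n ^ 2) ^ 2 ≤ 1 := fun n => by rw [hr2]; nlinarith [he n]
  set A : ℕ → ℝ := fun n => uI (√(1 - e n ^ 2)) (e n ^ 2 * x) with hA
  have hA2 : ∀ n, A n ^ 2 = (1 - e n ^ 2) * Real.exp (-(e n ^ 2 * x)) := fun n => by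
    rw [hA, uI_sq, hr2]
  have hs0 : Tendsto (fun n => e n ^ 2) atTop (nhds 0) := by simpa using h0.pow 2
  have hAt : Tendsto A atTop (nhds 1) := by
    have hc : Continuous fun s : ℝ => uI (√(1 - s)) (s * x) := by unfold uI; fun_prop
    have h1 := (hc.tendsto 0).comp hs0
    have h2 : uI (√(1 - 0)) (0 * x) = 1 := by simp [uI]
    rwa [h2] at h1
  set B : ℕ → ℝ := fun n => (1 - A n ^ 2) / e n ^ 2 with hB
  have hBt : Tendsto B atTop (nhds (1 + x)) := by
    have hd : HasDerivAt (fun s : ℝ => (1 - s) * Real.exp (-(s * x))) (-(1 + x)) 0 := by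
      have h1 := ((hasDerivAt_id (0 : ℝ)).const_sub 1).mul
        (((hasDerivAt_id (0 : ℝ)).mul_const x).neg.exp)
      convert! h1 using 1
      simp
      ring
    have h2 := (hasDerivAt_iff_tendsto_slope_zero.1 hd).comp (tendsto_nhdsWithin_iff.2
      ⟨hs0, Eventually.of_forall fun n => (pow_pos (he n) 2).ne'⟩)
    have h3 := h2.neg
    rw [neg_neg] at h3
    refine h3.congr fun n => ?_
    simp only [Function.comp, hB, hA2, zero_add, sub_zero, zero_mul, neg_zero, Real.exp_zero,
      smul_eq_mul, mul_one]
    have := (he n).ne'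
    field_simp
    ring
  have hx1 : 0 < 1 + x := by linarith
  have hBe : ∀ n, 1 - A n ^ 2 = e n ^ 2 * B n := fun n => by
    have := (he n).ne'
    simp only [hB]
    field_simp
  have hAlt : ∀ n, A n ^ 2 < 1 := fun n => uI_sq_lt_one (hr1 n) (by have := he n; positivity)
  have hBpos : ∀ n, 0 < B n := fun n => div_pos (by linarith [hAlt n]) (by have := he n; positivity)
  have hfrac : ∀ n (q : ℝ), e n ^ 2 * x * q / (1 - A n ^ 2) = x * q / B n := fun n q => by
    have := (he n).ne'
    have := (hBpos n).ne'
    rw [hBe]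
    field_simp
  have hSt : Tendsto (fun n => wS (A n) (e n ^ 2 * x)) atTop (nhds ((1 + x)⁻¹)) := by
    have h1 : Tendsto (fun n => 1 - x * A n ^ 2 / B n) atTop (nhds (1 - x * 1 ^ 2 / (1 + x))) :=
      tendsto_const_nhds.sub (((hAt.pow 2).const_mul x).div hBt hx1.ne')
    have h2 : 1 - x * 1 ^ 2 / (1 + x) = (1 + x)⁻¹ := by field_simp; ring
    rw [h2] at h1
    exact h1.congr fun n => by rw [wS, hfrac]
  have hKt : Tendsto (fun n => wK (A n) (e n ^ 2 * x) 1) atTop (nhds ((1 + x)⁻¹)) := by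
    have h1 : Tendsto (fun n => A n * (1 - 1 * (e n ^ 2 * x)) - A n * (x * A n ^ 2 / B n)) atTop
        (nhds (1 * (1 - 1 * (0 * x)) - 1 * (x * 1 ^ 2 / (1 + x)))) :=
      (hAt.mul (tendsto_const_nhds.sub ((hs0.mul_const x).const_mul 1))).sub
        (hAt.mul (((hAt.pow 2).const_mul x).div hBt hx1.ne'))
    have h2 : 1 * (1 - 1 * (0 * x)) - 1 * (x * 1 ^ 2 / (1 + x)) = (1 + x)⁻¹ := by field_simp; ring
    rw [h2] at h1
    exact h1.congr fun n => by rw [wK, mul_div_assoc (A n), hfrac]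
  have hCt : Tendsto (fun n => (wC (A n) (e n ^ 2 * x) 1 (A n) : Fin m → ℝ)) atTop
      (nhds (fun _ => 1)) := by
    refine tendsto_pi_nhds.2 fun i => ?_
    unfold wC
    split_ifs
    · have := hKt.div hSt (inv_pos.2 hx1).ne'
      rwa [div_self (inv_pos.2 hx1).ne'] at this
    · exact hAt
  have hGt := (tendsto_Gr hCt (Eventually.of_forall fun n => by
    have := (tendsto_kk (hr1 n) (smul_ne_zero (he n).ne' hy)).1
    rwa [hxx] at this)).2
  have hsq : Tendsto (fun n => (√(B n))⁻¹ ^ m) atTop (nhds ((√(1 + x))⁻¹ ^ m)) :=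
    (((Real.continuous_sqrt.tendsto _).comp hBt).inv₀ (Real.sqrt_pos.2 hx1).ne').pow m
  have hfin := ((hsq.mul hSt).mul hGt).div_const (Dm m ^ 2)
  have hn : nrm y = √(1 + x) := rfl
  have hl : (√(1 + x))⁻¹ ^ m * (1 + x)⁻¹ = (nrm y)⁻¹ ^ (m + 2) := by
    rw [hn, pow_add, inv_pow (√(1 + x)) 2, Real.sq_sqrt hx1.le]
  rw [hl] at hfin
  refine hfin.congr fun n => ?_
  have := (he n).ne'
  rw [hxx]
  show _ = e n ^ m * ((√(1 - A n ^ 2))⁻¹ ^ m * wS (A n) (e n ^ 2 * x) *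
    Gr (wC (A n) (e n ^ 2 * x) 1 (A n)) / Dm m ^ 2)
  rw [hBe n, Real.sqrt_mul (by positivity), Real.sqrt_sq (he n).le, mul_inv, mul_pow (e n)⁻¹]
  have h1 : e n ^ m * (e n)⁻¹ ^ m = 1 := by rw [← mul_pow, mul_inv_cancel₀ this, one_pow]
  linear_combination (-((√(B n))⁻¹ ^ m * wS (A n) (e n ^ 2 * x) *
    Gr (wC (A n) (e n ^ 2 * x) 1 (A n) : Fin m → ℝ) / Dm m ^ 2)) * h1

lemma exists_II_gt (m : ℕ) [NeZero m] {η : ℝ} (hη : 0 < η) :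
    ∃ r : ℝ, 0 ≤ r ∧ r < 1 ∧ 1 + II m 1 - η < II m r := by
  obtain ⟨C₁, hC₁, hl⟩ := exists_kI_lower m
  obtain ⟨C₂, hC₂, h2⟩ := exists_le_rho m
  set C := max C₁ C₂ with hC
  have hρ : ∀ z : Fin m → ℝ, 0 < rho z := rho_pos
  have hlow : ∀ r : ℝ, 0 ≤ r → r ≤ 1 → ∀ z : Fin m → ℝ, z ≠ 0 →
      0 ≤ kI m r (z ⬝ᵥ z) - 1 + C * rho z := fun r h0 h1 z hz => by
    have := hl r h0 h1 z hz
    have := mul_le_mul_of_nonneg_right (le_max_left C₁ C₂) (hρ z).le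
    linarith
  have hone : ∀ z : Fin m → ℝ, z ⬝ᵥ z ≤ 1 → 1 ≤ C * rho z := fun z hz =>
    (h2 z hz).trans (mul_le_mul_of_nonneg_right (le_max_right C₁ C₂) (hρ z).le)
  set e : ℕ → ℝ := fun n => ((n : ℝ) + 2)⁻¹ with he
  have he0 : ∀ n, 0 < e n := fun n => by positivity
  have he1 : ∀ n, e n < 1 := fun n => inv_lt_one_of_one_lt₀ (by linarith [n.cast_nonneg (α := ℝ)])
  have het : Tendsto e atTop (nhds 0) :=
    tendsto_inv_atTop_zero.comp (tendsto_natCast_atTop_atTop.atTop_add tendsto_const_nhds)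
  set r : ℕ → ℝ := fun n => √(1 - e n ^ 2) with hr
  have hr0 : ∀ n, 0 ≤ r n := fun n => Real.sqrt_nonneg _
  have hr1 : ∀ n, r n < 1 := fun n => by
    rw [hr, Real.sqrt_lt' one_pos]
    nlinarith [he0 n]
  have hrt : Tendsto r atTop (nhds 1) := by
    have := ((het.pow 2).const_sub 1).sqrt
    simpa using this
  have hrho := integrable_rho (m := m)
  have hg : ∀ q : ℝ, 0 ≤ q → q ≤ 1 →
      Integrable (fun z : Fin m → ℝ => kI m q (z ⬝ᵥ z) - 1 + C * rho z) ∧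
      ∫ z : Fin m → ℝ, (kI m q (z ⬝ᵥ z) - 1 + C * rho z) =
        (∫ z : Fin m → ℝ, (kI m q (z ⬝ᵥ z) - 1)) + C := fun q h0 h1 => by
    have h3 := integrable_kI_sub_one (m := m) h0 h1
    refine ⟨h3.add (hrho.const_mul C), ?_⟩
    rw [integral_add h3 (hrho.const_mul C), integral_const_mul, integral_rho, mul_one]
  have hge : ∀ q : ℝ, 0 ≤ q → q ≤ 1 →
      ∫⁻ z : Fin m → ℝ, ENNReal.ofReal (kI m q (z ⬝ᵥ z) - 1 + C * rho z) =
        ENNReal.ofReal ((∫ z : Fin m → ℝ, (kI m q (z ⬝ᵥ z) - 1)) + C) := fun q h0 h1 => by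
    rw [← (hg q h0 h1).2, ofReal_integral_eq_lintegral_ofReal (hg q h0 h1).1]
    filter_upwards [ae_ne (0 : Fin m → ℝ)] with z hz
    exact hlow q h0 h1 z hz
  have hmk : ∀ q : ℝ, Measurable fun z : Fin m → ℝ => ENNReal.ofReal (kI m q (z ⬝ᵥ z)) := fun q =>
    (measurable_kI q).ennreal_ofReal
  have hmg : ∀ q : ℝ, Measurable fun z : Fin m → ℝ =>
      ENNReal.ofReal (kI m q (z ⬝ᵥ z) - 1 + C * rho z) := fun q =>
    (((measurable_kI q).sub_const 1).add (continuous_rho.measurable.const_mul C)).ennreal_ofReal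
  have hms : ∀ c : ℝ, MeasurableSet {z : Fin m → ℝ | z ⬝ᵥ z < c} := fun c =>
    (isOpen_lt continuous_dot_self continuous_const).measurableSet
  set F : ℕ → (Fin m → ℝ) → ENNReal := fun n z =>
    ENNReal.ofReal (e n ^ m) * {z : Fin m → ℝ | z ⬝ᵥ z < e n}.indicator
      (fun z => ENNReal.ofReal (kI m (r n) (z ⬝ᵥ z))) (e n • z) +
    {z : Fin m → ℝ | z ⬝ᵥ z < e n}ᶜ.indicator
      (fun z => ENNReal.ofReal (kI m (r n) (z ⬝ᵥ z) - 1 + C * rho z)) z with hF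
  have hFm : ∀ n, Measurable (F n) := fun n =>
    ((((hmk (r n)).indicator (hms _)).comp (measurable_const_smul (e n))).const_mul _).add
      ((hmg (r n)).indicator (hms _).compl)
  have hFle : ∀ n, ∫⁻ z, F n z ≤ ENNReal.ofReal ((∫ z : Fin m → ℝ, (kI m (r n) (z ⬝ᵥ z) - 1)) + C) := by
    intro n
    rw [← hge _ (hr0 n) (hr1 n).le]
    simp only [hF]
    rw [lintegral_add_right _ ((hmg (r n)).indicator (hms _).compl), lintegral_const_mul' _ _
      ENNReal.ofReal_ne_top]
    have h3 := lintegral_eq_abs_pow_mul_comp_smul (m := m) (he0 n).ne'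
      ((hmk (r n)).indicator (hms (e n)))
    rw [abs_of_pos (he0 n)] at h3
    rw [← h3, lintegral_indicator (hms _), lintegral_indicator (hms _).compl]
    refine le_trans (add_le_add_left (setLIntegral_mono (hmg _) fun z hz =>
      ENNReal.ofReal_le_ofReal ?_) _) (lintegral_add_compl _ (hms (e n))).le
    rw [Set.mem_ofPred_eq] at hz
    linarith [hone z (hz.le.trans (he1 n).le)]
  set L : ℝ := (rho (0 : Fin m → ℝ))⁻¹ + ((∫ z : Fin m → ℝ, (kI m 1 (z ⬝ᵥ z) - 1)) + C) with hL
  have hnn : 0 ≤ (∫ z : Fin m → ℝ, (kI m 1 (z ⬝ᵥ z) - 1)) + C := by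
    rw [← (hg 1 zero_le_one le_rfl).2]
    refine integral_nonneg_of_ae ?_
    filter_upwards [ae_ne (0 : Fin m → ℝ)] with z hz
    exact hlow 1 zero_le_one le_rfl z hz
  have hlim : ENNReal.ofReal L ≤ liminf (fun n => ∫⁻ z, F n z) atTop := by
    rw [hL, ENNReal.ofReal_add (inv_pos.2 (hρ 0)).le hnn, ← lintegral_limit_peak,
      ← hge 1 zero_le_one le_rfl, ← lintegral_add_right _ (hmg 1)]
    refine le_trans (lintegral_mono_ae ?_) (lintegral_liminf_le (u := (atTop : Filter ℕ)) hFm)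
    filter_upwards [ae_ne (0 : Fin m → ℝ)] with y hy
    have hy0 := dot_self_pos hy
    refine le_of_eq (Tendsto.liminf_eq ?_).symm
    have hev1 : ∀ᶠ n in atTop, e n * (y ⬝ᵥ y) < 1 := by
      have := het.mul_const (y ⬝ᵥ y)
      rw [zero_mul] at this
      exact this.eventually_lt_const one_pos
    have hev2 : ∀ᶠ n in atTop, e n < y ⬝ᵥ y := het.eventually_lt_const hy0
    have hk := (tendsto_wW (m := m) (A := fun n => uI (r n) (y ⬝ᵥ y)) (x := fun _ => y ⬝ᵥ y)
      (δ := fun _ => 1) (E := fun n => uI (r n) (y ⬝ᵥ y)) (A₀ := uI 1 (y ⬝ᵥ y)) (x₀ := y ⬝ᵥ y)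
      (δ₀ := 1) (E₀ := uI 1 (y ⬝ᵥ y)) (hrt.mul_const _) tendsto_const_nhds tendsto_const_nhds
      (hrt.mul_const _) (uI_sq_lt_one (by norm_num) hy0) (wS_uI_pos (by norm_num) hy0).ne'
      (Eventually.of_forall fun n => (tendsto_kk (by nlinarith [hr0 n, hr1 n]) hy).1)).2
    have h4 := (ENNReal.tendsto_ofReal (tendsto_kI_peak he0 he1 het hy)).add
      (ENNReal.tendsto_ofReal ((hk.sub_const 1).add_const (C * rho y)))
    refine h4.congr' ?_
    filter_upwards [hev1, hev2] with n h5 h6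
    have h7 : (e n • y) ∈ {z : Fin m → ℝ | z ⬝ᵥ z < e n} := by
      rw [Set.mem_ofPred_eq, smul_dotProduct, dotProduct_smul, smul_eq_mul, smul_eq_mul]
      nlinarith [he0 n]
    have h8 : y ∈ {z : Fin m → ℝ | z ⬝ᵥ z < e n}ᶜ := by
      rw [Set.mem_compl_iff, Set.mem_ofPred_eq]
      linarith
    simp only [hF]
    rw [Set.indicator_of_mem h7, Set.indicator_of_mem h8, ← ENNReal.ofReal_mul (pow_pos (he0 n) m).le]
    rfl
  have hLpos : 0 < L := add_pos_of_pos_of_nonneg (inv_pos.2 (hρ 0)) hnn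
  have hη' : 0 < η / rho (0 : Fin m → ℝ) := div_pos hη (hρ 0)
  have hlt : ENNReal.ofReal (L - η / rho (0 : Fin m → ℝ)) < liminf (fun n => ∫⁻ z, F n z) atTop :=
    lt_of_lt_of_le ((ENNReal.ofReal_lt_ofReal_iff hLpos).2 (by linarith)) hlim
  obtain ⟨n, hn⟩ := (eventually_lt_of_lt_liminf hlt).exists
  have h9 := (ENNReal.ofReal_lt_ofReal_iff'.1 (hn.trans_le (hFle n))).1
  refine ⟨r n, hr0 n, hr1 n, ?_⟩
  rw [II, II, integral_mul_const, integral_mul_const]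
  have h10 : L - η / rho (0 : Fin m → ℝ) - C < ∫ z : Fin m → ℝ, (kI m (r n) (z ⬝ᵥ z) - 1) := by
    linarith
  have h11 := mul_lt_mul_of_pos_right h10 (hρ 0)
  have h12 : (L - η / rho (0 : Fin m → ℝ) - C) * rho (0 : Fin m → ℝ) =
      1 + (∫ z : Fin m → ℝ, (kI m 1 (z ⬝ᵥ z) - 1)) * rho (0 : Fin m → ℝ) - η := by
    have := (hρ 0).ne'
    rw [hL]
    field_simp
    ring
  linarith

lemma II_le {r : ℝ} (hr0 : 0 ≤ r) (hr1 : r ≤ 1) : II m r ≤ 1 + II m 1 := by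
  refine le_of_tendsto_of_tendsto (tendsto_Ik hr0 hr1)
    ((tendsto_Ik zero_le_one le_rfl).const_add 1) ?_
  filter_upwards [eventually_ge_atTop (m + 3)] with d hd
  have h := integral_nz_sub_sq_le (by omega) (intK_of_le (m := m) zero_le_one le_rfl hd)
    (r := r) (ρ := √(1 - r ^ 2)) (by rw [Real.sq_sqrt (by nlinarith)]; ring)
    (intK_of_le hr0 hr1 hd)
  have h0 := (integral_nonneg fun p => sq_nonneg _).trans h
  have hd0 : 0 < √(d : ℝ) := Real.sqrt_pos.2 (by exact_mod_cast (by omega : 0 < d))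
  have h1 := nonneg_of_mul_nonneg_right h0 (by positivity)
  linarith

lemma one_add_II_pos (m : ℕ) [NeZero m] : 0 < 1 + II m 1 :=
  (II_pos (by norm_num : (0 : ℝ) < 1 / 2) (by norm_num)).trans_le
    (II_le (by norm_num) (by norm_num))

end Liminf
end

section

variable {m d : ℕ}

lemma monoE_sq (v a : Fin (m + 1) → ℝ) (l : ℝ) (j : Jx m d) :
    monoE (fun i => Real.exp (l * a i) * v i ^ 2) j
      = Real.exp (l * (∑ k, a (Fin.succ k) * (j.1 k : ℕ) + a 0 * j.deg0)) * monoE v j ^ 2 := by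
  simp only [monoE, mul_pow, Finset.prod_mul_distrib, ← Finset.prod_pow]
  rw [mul_add, Real.exp_add, Finset.mul_sum, Real.exp_sum]
  simp only [← Real.exp_nat_mul]
  have e1 : ∀ k : Fin m, ((j.1 k : ℕ) : ℝ) * (l * a k.succ) = l * (a k.succ * (j.1 k : ℕ)) :=
    fun k => by ring
  simp only [e1, ← pow_mul]
  rw [show (j.deg0 : ℝ) * (l * a 0) = l * (a 0 * j.deg0) by ring]
  simp only [mul_comm 2 (_ : ℕ)]
  ring

/-- Chernoff bound for the squared monomials on the sphere. -/
lemma homE_tail (v a : Fin (m + 1) → ℝ) (hv : v ⬝ᵥ v = 1) {l M : ℝ} (hl : 0 ≤ l)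
    (ha : ∀ i, |l * a i| ≤ 1) (hM : ∀ i, (a i) ^ 2 ≤ M) :
    ∑ j : Jx m d, (if 0 ≤ ∑ k, a (Fin.succ k) * (j.1 k : ℕ) + a 0 * j.deg0 then homE v j ^ 2 else 0)
      ≤ Real.exp (d * (l * ∑ i, a i * v i ^ 2 + l ^ 2 * M)) := by
  have h1 : ∀ j : Jx m d,
      (if 0 ≤ ∑ k, a (Fin.succ k) * (j.1 k : ℕ) + a 0 * j.deg0 then homE v j ^ 2 else 0)
        ≤ mw j * monoE (fun i => Real.exp (l * a i) * v i ^ 2) j := by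
    intro j
    have hp := mul_nonneg (mw_pos j).le (sq_nonneg (monoE v j))
    rw [monoE_sq, mul_left_comm]
    split_ifs with h
    · rw [homE, mul_pow, Real.sq_sqrt (mw_pos j).le]
      exact le_mul_of_one_le_left hp (Real.one_le_exp (mul_nonneg hl h))
    · exact mul_nonneg (Real.exp_pos _).le hp
  refine (Finset.sum_le_sum fun j _ => h1 j).trans ?_
  rw [sum_mw_mul_monoE, Real.exp_nat_mul]
  refine pow_le_pow_left₀ (Finset.sum_nonneg fun i _ =>
    mul_nonneg (Real.exp_pos _).le (sq_nonneg _)) ?_ d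
  have hv' : ∑ i, v i ^ 2 = 1 := by rw [← hv]; simp [dotProduct, sq]
  have h2 : ∀ i, Real.exp (l * a i) * v i ^ 2 ≤ v i ^ 2 + l * (a i * v i ^ 2)
      + l ^ 2 * M * v i ^ 2 := by
    intro i
    have h3 := (abs_le.1 (Real.abs_exp_sub_one_sub_id_le (ha i))).2
    have h4 := mul_le_mul_of_nonneg_left (hM i) (sq_nonneg l)
    have h5 : Real.exp (l * a i) ≤ 1 + l * a i + l ^ 2 * M := by nlinarith
    nlinarith [mul_le_mul_of_nonneg_right h5 (sq_nonneg (v i))]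
  refine (Finset.sum_le_sum fun i _ => h2 i).trans ?_
  rw [Finset.sum_add_distrib, Finset.sum_add_distrib, ← Finset.mul_sum, ← Finset.mul_sum, hv',
    mul_one, add_assoc, add_comm]
  exact Real.add_one_le_exp _

lemma sum_single_tail (v : Fin (m + 1) → ℝ) (k : Fin m) (s c : ℝ) (x : Fin (m + 1) → ℝ) :
    ∑ i, (Fin.cons (-(s * c)) (Pi.single k s) : Fin (m + 1) → ℝ) i * x i
      = s * (x k.succ - c * x 0) := by
  rw [Fin.sum_univ_succ]
  simp [Pi.single_apply]
  ring

lemma ft_tail (t : Fin m → ℝ) (k : Fin m) {s c R : ℝ} (hs : s ^ 2 = 1) (hc : 0 ≤ c) (hR : 1 ≤ R)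
    (hcR : c ≤ R) (hd : R ^ 2 ≤ d) (hd0 : 0 < d) :
    ∑ j : Jx m d, (if 0 ≤ s * ((j.1 k : ℕ) - c * j.deg0) then ft d t j ^ 2 else 0)
      ≤ Real.exp (√d * (s * (t k ^ 2 - c)) / (1 + t ⬝ᵥ t) + R ^ 2) := by
  have hd1 : (0 : ℝ) < d := by exact_mod_cast hd0
  have hq : 0 < √(d : ℝ) := Real.sqrt_pos.2 hd1
  have hRq : R ≤ √(d : ℝ) := Real.le_sqrt_of_sq_le hd
  have hsa : |s| = 1 := by rw [← Real.sqrt_sq_eq_abs, hs, Real.sqrt_one]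
  have ha : ∀ i, |(Fin.cons (-(s * c)) (Pi.single k s) : Fin (m + 1) → ℝ) i| ≤ R := by
    intro i
    refine Fin.cases ?_ (fun i => ?_) i
    · simpa [abs_mul, hsa, abs_of_nonneg hc] using hcR
    · by_cases hi : i = k
      · subst hi; simpa [hsa] using hR
      · simpa [hi] using zero_le_one.trans hR
  have h := homE_tail (d := d) (vs t) (Fin.cons (-(s * c)) (Pi.single k s)) (vs_dot_self t)
    (l := (√(d : ℝ))⁻¹) (M := R ^ 2) (by positivity)
    (fun i => by
      rw [abs_mul, abs_of_pos (inv_pos.2 hq), inv_mul_le_iff₀ hq, mul_one]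
      exact (ha i).trans hRq)
    (fun i => by rw [← sq_abs]; exact pow_le_pow_left₀ (abs_nonneg _) (ha i) 2)
  rw [sum_single_tail (vs t) k s c fun i => vs t i ^ 2] at h
  have e1 : ∀ j : Jx m d, ∑ k', (Fin.cons (-(s * c)) (Pi.single k s) : Fin (m + 1) → ℝ) k'.succ *
      (j.1 k' : ℕ) + (Fin.cons (-(s * c)) (Pi.single k s) : Fin (m + 1) → ℝ) 0 * j.deg0
      = s * ((j.1 k : ℕ) - c * j.deg0) := by
    intro j
    simp [Pi.single_apply]
    ring
  simp only [e1] at h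
  refine h.trans (Real.exp_le_exp.2 (le_of_eq ?_))
  have hn : (nrm t)⁻¹ ^ 2 = (1 + t ⬝ᵥ t)⁻¹ := by rw [inv_pow, nrm_sq]
  simp only [vs, Pi.smul_apply, xh_succ, xh_zero, smul_eq_mul, mul_pow, hn]
  have e2 : (d : ℝ) * (√(d : ℝ))⁻¹ = √d := by
    rw [mul_inv_eq_iff_eq_mul₀ hq.ne', Real.mul_self_sqrt hd1.le]
  have e3 : (d : ℝ) * (√(d : ℝ))⁻¹ ^ 2 = 1 := by rw [inv_pow, Real.sq_sqrt hd1.le]; field_simp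
  rw [mul_add, ← mul_assoc, e2, ← mul_assoc (d : ℝ) (_ ^ 2), e3, one_pow]
  ring

lemma ft_apply_update (t : Fin m → ℝ) (k : Fin m) (j : Jx m d) (x : ℝ) :
    ft d (Function.update t k x) j
      = (√(mw j) * ∏ i ∈ Finset.univ.erase k, t i ^ (j.1 i : ℕ)) * x ^ (j.1 k : ℕ)
        * (nrm (Function.update t k x))⁻¹ ^ d := by
  have hj := j.2
  have hdd : (nrm (Function.update t k x))⁻¹ ^ d
      = (nrm (Function.update t k x))⁻¹ ^ ((∑ i, (j.1 i : ℕ)) + j.deg0) := by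
    congr 1; unfold Jx.deg0; omega
  rw [ft, homE, monoE]
  simp only [vs, Pi.smul_apply, xh_succ, xh_zero, smul_eq_mul, mul_pow, Finset.prod_mul_distrib,
    Finset.prod_pow_eq_pow_sum, mul_one]
  rw [hdd]
  rw [← Finset.mul_prod_erase Finset.univ (fun i => Function.update t k x i ^ (j.1 i : ℕ))
    (Finset.mem_univ k), Finset.prod_congr rfl fun i hi => by
      rw [Function.update_of_ne (Finset.ne_of_mem_erase hi)], Function.update_self, pow_add]
  ring

lemma dft_apply (t : Fin m → ℝ) (k : Fin m) (hk : t k ≠ 0) (j : Jx m d) :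
    dft d t k j = ((j.1 k : ℕ) / t k - d * t k / (1 + t ⬝ᵥ t)) * ft d t j := by
  have h1 : HasDerivAt (fun x => ft d (Function.update t k x) j) (dft d t k j) (t k) := by
    have h2 : HasFDerivAt (fun s => ft d s j)
        ((ContinuousLinearMap.proj j).comp (fderiv ℝ (ft d) t)) (Function.update t k (t k)) := by
      rw [Function.update_eq_self]
      exact (hasFDerivAt_pi'.1 (hasFDerivAt_ft t)) j
    exact h2.comp_hasDerivAt (t k) (hasDerivAt_update t k (t k))
  set A : ℝ := 1 + t ⬝ᵥ t - t k ^ 2 with hA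
  have hAx : ∀ x, 1 + Function.update t k x ⬝ᵥ Function.update t k x = A + x ^ 2 := by
    intro x
    have e1 : ∀ s : Fin m → ℝ, s ⬝ᵥ s = s k * s k + ∑ i ∈ Finset.univ.erase k, s i * s i :=
      fun s => (Finset.add_sum_erase _ (fun i => s i * s i) (Finset.mem_univ k)).symm
    rw [hA, e1 t, e1 (Function.update t k x), Function.update_self,
      Finset.sum_congr rfl fun i hi => by
        rw [Function.update_of_ne (Finset.ne_of_mem_erase hi)]]
    ring
  have hn : nrm t ≠ 0 := (nrm_pos t).ne'
  have h3 : HasDerivAt (fun x => nrm (Function.update t k x)) (t k / nrm t) (t k) := by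
    have h4 : HasDerivAt (fun x => √(A + x ^ 2)) (2 * t k / (2 * √(A + t k ^ 2))) (t k) := by
      refine HasDerivAt.sqrt ?_ ?_
      · simpa using (hasDerivAt_pow 2 (t k)).const_add A
      · have := one_add_dot_pos t
        rw [hA]; linarith
    have e : √(A + t k ^ 2) = nrm t := by rw [nrm, hA]; congr 1; ring
    rw [e, mul_div_mul_left _ _ two_ne_zero] at h4
    refine h4.congr_of_eventuallyEq (Eventually.of_forall fun x => ?_)
    simp only [nrm, hAx]
  have h5 := (((hasDerivAt_pow (j.1 k : ℕ) (t k)).const_mul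
    (√(mw j) * ∏ i ∈ Finset.univ.erase k, t i ^ (j.1 i : ℕ))).mul
    ((h3.fun_inv (by rw [Function.update_eq_self]; exact hn)).fun_pow d))
  have h6 := h1.unique (h5.congr_of_eventuallyEq (Eventually.of_forall fun x =>
    ft_apply_update t k j x))
  have h7 := ft_apply_update t k j (t k)
  rw [Function.update_eq_self] at h7
  rw [h6, h7]
  simp only [Function.update_eq_self]
  rw [← nrm_sq]
  have e1 : ∀ n : ℕ, (n : ℝ) * t k ^ (n - 1) = n / t k * t k ^ n := by
    intro n; cases n <;> simp [_root_.pow_succ]; field_simp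
  have e2 : (d : ℝ) * (nrm t)⁻¹ ^ (d - 1) = d * nrm t * (nrm t)⁻¹ ^ d := by
    cases d <;> simp [_root_.pow_succ]; field_simp
  rw [e1, e2]
  field_simp
  ring

lemma dft_sq_le (t : Fin m → ℝ) (k : Fin m) {K : ℝ} (hK : 0 < K) (hk : K⁻¹ ≤ |t k|)
    (j : Jx m d) : dft d t k j ^ 2 ≤ (d * (K + 1)) ^ 2 * ft d t j ^ 2 := by
  have : NeZero m := ⟨fun h => (h ▸ k).elim0⟩
  have hk0 : t k ≠ 0 := fun h => by
    rw [h, abs_zero] at hk; exact absurd (inv_pos.2 hK) (not_lt.2 hk)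
  rw [dft_apply t k hk0, mul_pow]
  refine mul_le_mul_of_nonneg_right ?_ (sq_nonneg _)
  refine sq_le_sq' ?_ ?_ <;>
  · have hj : ((j.1 k : ℕ) : ℝ) ≤ d := by exact_mod_cast Nat.lt_succ_iff.1 (j.1 k).2
    have h1 : |((j.1 k : ℕ) : ℝ) / t k| ≤ d * K := by
      rw [abs_div, Nat.abs_cast, div_eq_mul_inv]
      exact mul_le_mul hj (inv_le_of_inv_le₀ hK hk) (by positivity) (by positivity)
    have h2 : |(d : ℝ) * t k / (1 + t ⬝ᵥ t)| ≤ d := by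
      rw [abs_div, abs_mul, Nat.abs_cast, abs_of_pos (one_add_dot_pos t),
        div_le_iff₀ (one_add_dot_pos t)]
      exact mul_le_mul_of_nonneg_left (abs_apply_le t k).1 (by positivity)
    have := abs_le.1 h1
    have := abs_le.1 h2
    linarith

/-- Multi-indices whose homogeneous ratios lie in a box. -/
def cell (lo hi : Fin m → ℝ) : Set (Jx m d) :=
  {j | ∀ k, lo k ^ 2 * j.deg0 ≤ (j.1 k : ℕ) ∧ ((j.1 k : ℕ) : ℝ) < hi k ^ 2 * j.deg0}

/-- Size of the features off the central cell. -/
def tau (m d : ℕ) (K g : ℝ) : ℝ :=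
  2 * m * (K + 1) ^ 2 * d * Real.exp (K ^ 4 - √d * (g * K⁻¹ / (1 + m * K ^ 2)))

lemma ft_tail_le (t : Fin m → ℝ) (k : Fin m) {s c K g : ℝ} (hs : s ^ 2 = 1) (hc : 0 ≤ c)
    (hK : 1 ≤ K) (hg : 0 ≤ g) (hcK : c ≤ K ^ 2) (hd : K ^ 4 ≤ d) (hd0 : 0 < d)
    (htK : ∀ k, |t k| ≤ K) (h : s * (t k ^ 2 - c) ≤ -(g * K⁻¹)) :
    ∑ j : Jx m d, (if 0 ≤ s * ((j.1 k : ℕ) - c * j.deg0) then ft d t j ^ 2 else 0)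
      ≤ Real.exp (K ^ 4 - √d * (g * K⁻¹ / (1 + m * K ^ 2))) := by
  refine (ft_tail t k hs hc (R := K ^ 2) (by nlinarith) hcK (by nlinarith) hd0).trans
    (Real.exp_le_exp.2 ?_)
  have h1 : 1 + t ⬝ᵥ t ≤ 1 + m * K ^ 2 := by
    have : t ⬝ᵥ t ≤ ∑ _k : Fin m, K ^ 2 := Finset.sum_le_sum fun i _ => by
      have := abs_le.1 (htK i); nlinarith
    simpa using this
  have h2 : √(d : ℝ) * (s * (t k ^ 2 - c)) / (1 + t ⬝ᵥ t)
      ≤ -(√d * (g * K⁻¹ / (1 + m * K ^ 2))) := by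
    have hp := one_add_dot_pos t
    have hx : 0 ≤ g * K⁻¹ := by positivity
    rw [mul_div_assoc, ← mul_neg, ← neg_div]
    refine mul_le_mul_of_nonneg_left ?_ (Real.sqrt_nonneg _)
    refine (div_le_div_of_nonneg_right h hp.le).trans ?_
    rw [neg_div, neg_div, neg_le_neg_iff]
    exact div_le_div_of_nonneg_left hx hp h1
  nlinarith

lemma sum_compl_cell_le (t lo hi : Fin m → ℝ) {K g : ℝ} (hK : 1 ≤ K) (hg : 0 ≤ g)
    (hd : K ^ 4 ≤ d) (hd0 : 0 < d) (hlo : ∀ k, 0 ≤ lo k) (hhi : ∀ k, hi k ≤ K)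
    (ht : ∀ k, K⁻¹ ≤ |t k|) (htl : ∀ k, lo k + g ≤ |t k|) (hth : ∀ k, |t k| + g ≤ hi k) :
    ∑ j : Jx m d, (cell lo hi)ᶜ.indicator (ft d t) j ^ 2
      ≤ 2 * m * Real.exp (K ^ 4 - √d * (g * K⁻¹ / (1 + m * K ^ 2))) := by
  classical
  have htK : ∀ k, |t k| ≤ K := fun k => by linarith [hth k, hhi k]
  have hK0 : 0 < K⁻¹ := by positivity
  have h1 : ∀ j : Jx m d, (cell lo hi)ᶜ.indicator (ft d t) j ^ 2 ≤ ∑ k,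
      ((if 0 ≤ (-1) * (((j.1 k : ℕ) : ℝ) - lo k ^ 2 * j.deg0) then ft d t j ^ 2 else 0) +
      (if 0 ≤ 1 * (((j.1 k : ℕ) : ℝ) - hi k ^ 2 * j.deg0) then ft d t j ^ 2 else 0)) := by
    intro j
    have hnn : ∀ k ∈ Finset.univ, 0 ≤
      ((if 0 ≤ (-1) * (((j.1 k : ℕ) : ℝ) - lo k ^ 2 * j.deg0) then ft d t j ^ 2 else 0) +
      (if 0 ≤ 1 * (((j.1 k : ℕ) : ℝ) - hi k ^ 2 * j.deg0) then ft d t j ^ 2 else 0)) := by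
      intro k _; positivity
    by_cases hj : j ∈ cell lo hi
    · rw [Set.indicator_of_notMem (by simpa using hj)]
      simpa using Finset.sum_nonneg hnn
    · rw [Set.indicator_of_mem (by simpa using hj)]
      obtain ⟨k, hk⟩ := not_forall.1 hj
      refine le_trans ?_ (Finset.single_le_sum hnn (Finset.mem_univ k))
      by_cases h2 : lo k ^ 2 * j.deg0 ≤ ((j.1 k : ℕ) : ℝ)
      · rw [if_pos (show 0 ≤ 1 * (((j.1 k : ℕ) : ℝ) - hi k ^ 2 * j.deg0) by
          linarith [not_lt.1 fun h => hk ⟨h2, h⟩])]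
        exact le_add_of_nonneg_left (by positivity)
      · rw [if_pos (show 0 ≤ (-1) * (((j.1 k : ℕ) : ℝ) - lo k ^ 2 * j.deg0) by linarith)]
        exact le_add_of_nonneg_right (by positivity)
  refine (Finset.sum_le_sum fun j _ => h1 j).trans ?_
  rw [Finset.sum_comm]
  refine (Finset.sum_le_card_nsmul _ _
    (2 * Real.exp (K ^ 4 - √d * (g * K⁻¹ / (1 + m * K ^ 2)))) fun k _ => ?_).trans
    (le_of_eq (by simp; ring))
  rw [Finset.sum_add_distrib, two_mul]
  have ht2 := sq_abs (t k)
  have hl2 : lo k ≤ K := by linarith [htl k, htK k]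
  have hh0 : 0 ≤ hi k := by linarith [hth k, abs_nonneg (t k)]
  refine add_le_add (ft_tail_le t k (by norm_num) (sq_nonneg _) hK hg
    (pow_le_pow_left₀ (hlo k) hl2 2) hd hd0 htK ?_)
    (ft_tail_le t k (by norm_num) (sq_nonneg _) hK hg (pow_le_pow_left₀ hh0 (hhi k) 2) hd hd0 htK ?_)
  · have h3 : g * K⁻¹ ≤ (|t k| - lo k) * (|t k| + lo k) :=
      mul_le_mul (by linarith [htl k]) (by linarith [ht k, hlo k]) hK0.le (by linarith [htl k])
    rw [← ht2]; linarith
  · have h3 : g * K⁻¹ ≤ (hi k - |t k|) * (hi k + |t k|) :=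
      mul_le_mul (by linarith [hth k]) (by linarith [ht k]) hK0.le (by linarith [hth k])
    rw [← ht2]; linarith

lemma indicator_dot_self {J : Type*} [Fintype J] (C : Set J) (p : J → ℝ) :
    C.indicator p ⬝ᵥ C.indicator p = ∑ j, C.indicator p j ^ 2 := by simp [dotProduct, sq]

lemma off_cell_le (t lo hi : Fin m → ℝ) {K g : ℝ} (hK : 1 ≤ K) (hg : 0 ≤ g)
    (hd : K ^ 4 ≤ d) (hd0 : 0 < d) (hlo : ∀ k, 0 ≤ lo k) (hhi : ∀ k, hi k ≤ K)
    (ht : ∀ k, K⁻¹ ≤ |t k|) (htl : ∀ k, lo k + g ≤ |t k|) (hth : ∀ k, |t k| + g ≤ hi k) :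
    (cell lo hi)ᶜ.indicator (ft d t) ⬝ᵥ (cell lo hi)ᶜ.indicator (ft d t) ≤ tau m d K g ∧
    ∀ k, (cell lo hi)ᶜ.indicator (dft d t k) ⬝ᵥ (cell lo hi)ᶜ.indicator (dft d t k)
      ≤ d * tau m d K g := by
  have h := sum_compl_cell_le t lo hi hK hg hd hd0 hlo hhi ht htl hth
  have hd1 : (1 : ℝ) ≤ d := by exact_mod_cast hd0
  simp only [indicator_dot_self]
  refine ⟨h.trans ?_, fun k => ?_⟩
  · unfold tau
    refine mul_le_mul_of_nonneg_right ?_ (Real.exp_pos _).le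
    have h1 : (1 : ℝ) ≤ (K + 1) ^ 2 * d := by nlinarith
    nlinarith [mul_le_mul_of_nonneg_left h1 (by positivity : (0 : ℝ) ≤ 2 * m)]
  · calc _ ≤ ∑ j, (d * (K + 1)) ^ 2 * (cell lo hi)ᶜ.indicator (ft d t) j ^ 2 := by
          refine Finset.sum_le_sum fun j _ => ?_
          by_cases hj : j ∈ (cell lo hi)ᶜ
          · rw [Set.indicator_of_mem hj, Set.indicator_of_mem hj]
            exact dft_sq_le t k (by linarith) (ht k) j
          · rw [Set.indicator_of_notMem hj, Set.indicator_of_notMem hj]; simp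
      _ ≤ _ := by
          rw [← Finset.mul_sum]
          refine (mul_le_mul_of_nonneg_left h (sq_nonneg _)).trans (le_of_eq ?_)
          unfold tau; ring
end

section

variable {m d : ℕ}

lemma dft_dot_self_le (t : Fin m → ℝ) (k : Fin m) : dft d t k ⬝ᵥ dft d t k ≤ d := by
  have h0 : dvs t k ⬝ᵥ vs t = 0 := by rw [dotProduct_comm, dot_vs_dvs]
  rw [dft_eq_dhomE, dhomE_dot_dhomE, vs_dot_self, one_pow, dot_vs_dvs, h0]
  have h1 := dot_dvs_of_orthogonal t k _ h0
  have h2 : dvs t k k.succ ^ 2 ≤ dvs t k ⬝ᵥ dvs t k := by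
    rw [sq]
    exact Finset.single_le_sum (f := fun i => dvs t k i * dvs t k i)
      (fun i _ => mul_self_nonneg _) (Finset.mem_univ _)
  have h3 : (nrm t)⁻¹ ^ 2 ≤ 1 := by
    rw [inv_pow, nrm_sq]
    exact inv_le_one_of_one_le₀ (by linarith [dot_self_nonneg t])
  have h4 : dvs t k ⬝ᵥ dvs t k ≤ 1 := by
    set x := dvs t k ⬝ᵥ dvs t k
    have : x ^ 2 ≤ 1 * x := by
      rw [h1, mul_pow, ← h1]
      exact mul_le_mul h3 h2 (sq_nonneg _) zero_le_one
    nlinarith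
  nlinarith [(Nat.cast_nonneg d : (0 : ℝ) ≤ d)]

/-- Integrand of the smoothed root density. -/
def Psi {J : Type*} [Fintype J] (r ρ : ℝ) (p : J → ℝ) (dp : Fin m → J → ℝ)
    (ω w : Fin m × J → ℝ) : ℝ :=
  ρ⁻¹ ^ m * gpdf (Fin m) (fun ℓ => ρ⁻¹ * r * (p ⬝ᵥ row ω ℓ)) * |(detM dp (r • ω + ρ • w)).det|

/-- Sum of the absolute values of the coordinates along a family of features. -/
def absum {J ι : Type*} [Fintype J] [Fintype ι] (a : ι → J → ℝ) (ω : Fin m × J → ℝ) : ℝ :=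
  ∑ i : ι × Fin m, |rowF i.2 (a i.1) ⬝ᵥ ω|

section
variable {J ι : Type*} [Fintype J] [Fintype ι]

lemma le_absum (a : ι → J → ℝ) (ω : Fin m × J → ℝ) (i : ι) (ℓ : Fin m) :
    |a i ⬝ᵥ row ω ℓ| ≤ absum a ω := by
  rw [← rowF_dot]
  exact Finset.single_le_sum (f := fun i : ι × Fin m => |rowF i.2 (a i.1) ⬝ᵥ ω|)
    (fun _ _ => abs_nonneg _) (Finset.mem_univ (i, ℓ))

lemma absum_nonneg (a : ι → J → ℝ) (ω : Fin m × J → ℝ) : 0 ≤ absum a ω :=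
  Finset.sum_nonneg fun _ _ => abs_nonneg _

lemma absum_moment (a : ι → J → ℝ) (ha : ∀ i, a i ⬝ᵥ a i ≤ 1) (n : ℕ) :
    ∫⁻ ω, ENNReal.ofReal (absum a ω ^ n) ∂(stdG (Fin m × J))
      ≤ lmom (Fintype.card (ι × Fin m)) n := by
  have h := lin_moment (fun i : ι × Fin m => rowF i.2 (a i.1)) zero_le_one
    (fun i => by rw [rowF_dot_rowF, if_pos rfl, one_pow]; exact ha i.1) n
  simpa [absum] using h

lemma abs_exp_neg_sub_exp_neg_le {x y : ℝ} (hx : 0 ≤ x) (hy : 0 ≤ y) :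
    |Real.exp (-x) - Real.exp (-y)| ≤ |x - y| := by
  wlog h : Real.exp (-y) ≤ Real.exp (-x) generalizing x y
  · rw [abs_sub_comm, abs_sub_comm x]; exact this hy hx (le_of_not_ge h)
  rw [abs_of_nonneg (sub_nonneg.2 h)]
  clear h
  have h := Real.add_one_le_exp (-(y - x))
  have h2 : Real.exp (-y) = Real.exp (-x) * Real.exp (-(y - x)) := by
    rw [← Real.exp_add]; congr 1; ring
  have h3 := mul_le_mul_of_nonneg_left h (Real.exp_pos (-x)).le
  have h4 : Real.exp (-x) ≤ 1 := Real.exp_le_one_iff.2 (by linarith)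
  have h5 := Real.exp_pos (-x)
  have h6 := le_abs_self (x - y)
  have h7 := neg_abs_le (x - y)
  nlinarith [abs_nonneg (x - y)]

lemma abs_gpdf_sub_le (u v : Fin m → ℝ) : |gpdf (Fin m) u - gpdf (Fin m) v|
    ≤ ∑ ℓ, |u ℓ - v ℓ| * (|u ℓ| + |v ℓ|) := by
  have hc0 : (0 : ℝ) ≤ (√(2 * π))⁻¹ ^ Fintype.card (Fin m) := by positivity
  have hc1 : (√(2 * π))⁻¹ ^ Fintype.card (Fin m) ≤ 1 := by
    refine pow_le_one₀ (by positivity) (inv_le_one_of_one_le₀ ?_)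
    rw [Real.one_le_sqrt]
    nlinarith [Real.pi_gt_three]
  have hu := dot_self_nonneg u
  have hv := dot_self_nonneg v
  have h2 : |u ⬝ᵥ u / 2 - v ⬝ᵥ v / 2| ≤ ∑ ℓ, |u ℓ - v ℓ| * (|u ℓ| + |v ℓ|) := by
    have e : u ⬝ᵥ u / 2 - v ⬝ᵥ v / 2 = ∑ ℓ, (u ℓ - v ℓ) * (u ℓ + v ℓ) / 2 := by
      simp only [dotProduct, Finset.sum_div, ← Finset.sum_sub_distrib]
      exact Finset.sum_congr rfl fun ℓ _ => by ring
    rw [e]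
    refine (Finset.abs_sum_le_sum_abs _ _).trans (Finset.sum_le_sum fun ℓ _ => ?_)
    rw [abs_div, abs_mul, abs_two]
    have := mul_le_mul_of_nonneg_left (abs_add_le (u ℓ) (v ℓ)) (abs_nonneg (u ℓ - v ℓ))
    have : 0 ≤ |u ℓ - v ℓ| * |u ℓ + v ℓ| := by positivity
    linarith
  rw [gpdf, gpdf, ← mul_sub, abs_mul, abs_of_nonneg hc0, neg_div, neg_div]
  refine (mul_le_of_le_one_left (abs_nonneg _) hc1).trans (le_trans ?_ h2)
  exact abs_exp_neg_sub_exp_neg_le (by positivity) (by positivity)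

lemma gpdf_le_one (u : Fin m → ℝ) : gpdf (Fin m) u ≤ 1 := by
  refine (gpdf_le u).trans (pow_le_one₀ (by positivity) (inv_le_one_of_one_le₀ ?_))
  rw [Real.one_le_sqrt]
  nlinarith [Real.pi_gt_three]

lemma Psi_nonneg {r ρ : ℝ} (hρ : 0 < ρ) (p : J → ℝ) (dp : Fin m → J → ℝ) (ω w : Fin m × J → ℝ) :
    0 ≤ Psi r ρ p dp ω w :=
  mul_nonneg (mul_nonneg (by positivity) (gpdf_pos _).le) (abs_nonneg _)

lemma Psi_le {r ρ : ℝ} (hρ : 0 < ρ) (p : J → ℝ) (dp : Fin m → J → ℝ) (ω w : Fin m × J → ℝ) :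
    Psi r ρ p dp ω w ≤ ρ⁻¹ ^ m * m ! * absum dp (r • ω + ρ • w) ^ m := by
  rw [Psi, mul_assoc (ρ⁻¹ ^ m) (m ! : ℝ)]
  refine mul_le_mul ?_ (abs_det_le_of_entries (absum_nonneg _ _) fun i j => ?_) (abs_nonneg _)
    (by positivity)
  · exact mul_le_of_le_one_right (by positivity) (gpdf_le_one _)
  · rw [detM_apply]; exact le_absum _ _ _ _

/-- A pair of features together with their rescaled difference. -/
def trip (τ : ℝ) (p p' : ι → J → ℝ) : Fin 3 × ι → J → ℝ :=
  fun i => ![p i.2, p' i.2, τ⁻¹ • (p i.2 - p' i.2)] i.1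

lemma trip_le {τ : ℝ} (hτ : 0 < τ) (p p' : ι → J → ℝ) (ω : Fin m × J → ℝ) (i : ι) (ℓ : Fin m) :
    |p i ⬝ᵥ row ω ℓ| ≤ absum (trip τ p p') ω ∧ |p' i ⬝ᵥ row ω ℓ| ≤ absum (trip τ p p') ω ∧
    |p i ⬝ᵥ row ω ℓ - p' i ⬝ᵥ row ω ℓ| ≤ τ * absum (trip τ p p') ω := by
  refine ⟨le_absum (trip τ p p') ω (0, i) ℓ, le_absum (trip τ p p') ω (1, i) ℓ, ?_⟩
  have h := le_absum (trip τ p p') ω (2, i) ℓ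
  have e : trip τ p p' (2, i) = τ⁻¹ • (p i - p' i) := rfl
  rw [e, smul_dotProduct, sub_dotProduct, smul_eq_mul, abs_mul, abs_of_pos (inv_pos.2 hτ),
    inv_mul_le_iff₀ hτ] at h
  exact h

lemma trip_dot {τ : ℝ} (hτ : 0 < τ) {p p' : ι → J → ℝ} (h1 : ∀ i, p i ⬝ᵥ p i ≤ 1)
    (h2 : ∀ i, p' i ⬝ᵥ p' i ≤ 1) (h3 : ∀ i, (p i - p' i) ⬝ᵥ (p i - p' i) ≤ τ ^ 2)
    (i : Fin 3 × ι) : trip τ p p' i ⬝ᵥ trip τ p p' i ≤ 1 := by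
  obtain ⟨s, i⟩ := i
  fin_cases s
  · exact h1 i
  · exact h2 i
  · show (τ⁻¹ • (p i - p' i)) ⬝ᵥ (τ⁻¹ • (p i - p' i)) ≤ 1
    rw [smul_dotProduct, dotProduct_smul, smul_eq_mul, smul_eq_mul, ← mul_assoc, ← mul_inv,
      ← sq, inv_mul_le_iff₀ (by positivity), mul_one]
    exact h3 i

lemma abs_Psi_sub_le {r ρ τ : ℝ} (hr0 : 0 ≤ r) (hr1 : r ≤ 1) (hρ : 0 < ρ) (hτ : 0 < τ)
    (p p' : J → ℝ) (q q' : Fin m → J → ℝ) (ω w : Fin m × J → ℝ) :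
    |Psi r ρ p q ω w - Psi r ρ p' q' ω w| ≤ τ * (ρ⁻¹ ^ m * m ! * m *
      ((2 * ρ⁻¹ ^ 2 * absum (trip τ (fun _ : Unit => p) fun _ => p') ω ^ 2 + 1)
        * absum (trip τ q q') (r • ω + ρ • w) ^ m)) := by
  rcases Nat.eq_zero_or_pos m with rfl | hm
  · simp [Psi, gpdf]
  set X := absum (trip τ (fun _ : Unit => p) fun _ => p') ω with hX
  set W := absum (trip τ q q') (r • ω + ρ • w) with hW
  have hX0 : 0 ≤ X := absum_nonneg _ _
  have hW0 : 0 ≤ W := absum_nonneg _ _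
  have hx := fun ℓ => trip_le hτ (fun _ : Unit => p) (fun _ => p') ω () ℓ
  have hw := trip_le hτ q q' (r • ω + ρ • w)
  set u : Fin m → ℝ := fun ℓ => ρ⁻¹ * r * (p ⬝ᵥ row ω ℓ) with hu
  set u' : Fin m → ℝ := fun ℓ => ρ⁻¹ * r * (p' ⬝ᵥ row ω ℓ) with hu'
  have hκ : |ρ⁻¹ * r| ≤ ρ⁻¹ := by
    rw [abs_of_nonneg (by positivity)]; exact mul_le_of_le_one_right (by positivity) hr1
  have hg : |gpdf (Fin m) u - gpdf (Fin m) u'| ≤ m * (2 * ρ⁻¹ ^ 2 * X ^ 2) * τ := by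
    refine (abs_gpdf_sub_le u u').trans ((Finset.sum_le_card_nsmul _ _
      (ρ⁻¹ * (τ * X) * (ρ⁻¹ * X + ρ⁻¹ * X)) fun ℓ _ => ?_).trans (le_of_eq (by simp; ring)))
    obtain ⟨a, b, c⟩ := hx ℓ
    refine mul_le_mul ?_ (add_le_add ?_ ?_) (by positivity) (by positivity)
    · rw [hu, hu', ← mul_sub, abs_mul]
      exact mul_le_mul hκ c (abs_nonneg _) (by positivity)
    · rw [hu, abs_mul]; exact mul_le_mul hκ a (abs_nonneg _) (by positivity)
    · rw [hu', abs_mul]; exact mul_le_mul hκ b (abs_nonneg _) (by positivity)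
  have hd1 : |(detM q (r • ω + ρ • w)).det| ≤ m ! * W ^ m :=
    abs_det_le_of_entries hW0 fun i j => (hw j i).1
  have hd2 : |(detM q (r • ω + ρ • w)).det - (detM q' (r • ω + ρ • w)).det|
      ≤ m ! * m * W ^ m * τ := by
    have := abs_det_sub_le hW0 (mul_nonneg hτ.le hW0) (A := detM q (r • ω + ρ • w))
      (B := detM q' (r • ω + ρ • w)) (fun i j => (hw j i).1) (fun i j => (hw j i).2.1)
      fun i j => (hw j i).2.2
    refine this.trans (le_of_eq ?_)
    obtain ⟨n, rfl⟩ := Nat.exists_eq_succ_of_ne_zero hm.ne'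
    simp only [Nat.succ_eq_add_one, Nat.add_sub_cancel]
    ring
  have hd3 := (abs_abs_sub_abs_le _ _).trans hd2
  have e : Psi r ρ p q ω w - Psi r ρ p' q' ω w = ρ⁻¹ ^ m * ((gpdf (Fin m) u - gpdf (Fin m) u') *
      |(detM q (r • ω + ρ • w)).det| + gpdf (Fin m) u' *
      (|(detM q (r • ω + ρ • w)).det| - |(detM q' (r • ω + ρ • w)).det|)) := by
    simp only [Psi]; ring
  rw [e, abs_mul, abs_of_nonneg (by positivity)]
  have h1 := mul_le_mul hg hd1 (abs_nonneg _) (by positivity)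
  have h2 := mul_le_mul (gpdf_le_one u') hd3 (abs_nonneg _) zero_le_one
  have h3 := abs_add_le ((gpdf (Fin m) u - gpdf (Fin m) u') * |(detM q (r • ω + ρ • w)).det|)
    (gpdf (Fin m) u' *
      (|(detM q (r • ω + ρ • w)).det| - |(detM q' (r • ω + ρ • w)).det|))
  rw [abs_mul, abs_abs, abs_mul, abs_of_pos (gpdf_pos u')] at h3
  refine (mul_le_mul_of_nonneg_left (h3.trans (add_le_add h1 h2)) (by positivity)).trans
    (le_of_eq (by ring))

/-- Bound of the moments of the normalised density integrand. -/
def psiC (m : ℕ) (ρ : ℝ) (n : ℕ) : ENNReal :=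
  ENNReal.ofReal ((ρ⁻¹ ^ m * m !) ^ n) * lmom (m * m) (m * n)

lemma psiC_lt_top (m : ℕ) (ρ : ℝ) (n : ℕ) : psiC m ρ n < ⊤ :=
  ENNReal.mul_lt_top ENNReal.ofReal_lt_top (lmom_lt_top _ _)

lemma measurable_absum (a : ι → J → ℝ) : Measurable (absum a : (Fin m × J → ℝ) → ℝ) := by
  unfold absum dotProduct
  fun_prop

lemma Psi_moment {r ρ : ℝ} (hρ : 0 < ρ) (h : r ^ 2 + ρ ^ 2 = 1) (p : J → ℝ) {q : Fin m → J → ℝ}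
    (hq : ∀ i, q i ⬝ᵥ q i ≤ 1) (n : ℕ) :
    ∫⁻ x, ENNReal.ofReal (Psi r ρ p q x.1 x.2 ^ n) ∂((stdG (Fin m × J)).prod (stdG _))
      ≤ psiC m ρ n := by
  calc _ ≤ ∫⁻ x : (Fin m × J → ℝ) × (Fin m × J → ℝ), ENNReal.ofReal ((ρ⁻¹ ^ m * m !) ^ n) *
        ENNReal.ofReal (absum q (r • x.1 + ρ • x.2) ^ (m * n))
          ∂((stdG (Fin m × J)).prod (stdG _)) := by
        refine lintegral_mono fun x => ?_
        rw [← ENNReal.ofReal_mul (by positivity), pow_mul, ← mul_pow]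
        exact ENNReal.ofReal_le_ofReal
          (pow_le_pow_left₀ (Psi_nonneg hρ _ _ _ _) (Psi_le hρ _ _ _ _) n)
    _ ≤ _ := by
        rw [lintegral_const_mul' _ _ ENNReal.ofReal_ne_top,
          (stdG_rot_measurePreserving h).lintegral_comp
            (f := fun ω => ENNReal.ofReal (absum q ω ^ (m * n)))
            ((measurable_absum q).pow_const _).ennreal_ofReal]
        exact mul_le_mul' le_rfl (by simpa using absum_moment q hq (m * n))

/-- Bound of the second moment of the truncation error of the density integrand. -/
def dPsiC (m : ℕ) (ρ : ℝ) : ENNReal :=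
  ENNReal.ofReal ((ρ⁻¹ ^ m * m ! * m) ^ 2) *
    (ENNReal.ofReal (8 * (2 * ρ⁻¹ ^ 2) ^ 4) * lmom (3 * m) 8 + 8 + lmom (3 * m * m) (4 * m))

lemma dPsiC_lt_top (m : ℕ) (ρ : ℝ) : dPsiC m ρ < ⊤ := by
  refine ENNReal.mul_lt_top ENNReal.ofReal_lt_top (ENNReal.add_lt_top.2
    ⟨ENNReal.add_lt_top.2 ⟨ENNReal.mul_lt_top ENNReal.ofReal_lt_top (lmom_lt_top _ _), ?_⟩,
      lmom_lt_top _ _⟩)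
  exact ENNReal.ofNat_lt_top

lemma Psi_sub_moment {r ρ τ : ℝ} (hr0 : 0 ≤ r) (hr1 : r ≤ 1) (hρ : 0 < ρ)
    (h : r ^ 2 + ρ ^ 2 = 1) (hτ : 0 < τ) {p p' : J → ℝ} {q q' : Fin m → J → ℝ}
    (hp : p ⬝ᵥ p ≤ 1) (hp' : p' ⬝ᵥ p' ≤ 1) (hpp : (p - p') ⬝ᵥ (p - p') ≤ τ ^ 2)
    (hq : ∀ i, q i ⬝ᵥ q i ≤ 1) (hq' : ∀ i, q' i ⬝ᵥ q' i ≤ 1)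
    (hqq : ∀ i, (q i - q' i) ⬝ᵥ (q i - q' i) ≤ τ ^ 2) :
    ∫⁻ x, ENNReal.ofReal ((Psi r ρ p q x.1 x.2 - Psi r ρ p' q' x.1 x.2) ^ 2)
      ∂((stdG (Fin m × J)).prod (stdG _)) ≤ ENNReal.ofReal (τ ^ 2) * dPsiC m ρ := by
  set X := fun ω : Fin m × J → ℝ => absum (trip τ (fun _ : Unit => p) fun _ => p') ω with hX
  set W := fun ω : Fin m × J → ℝ => absum (trip τ q q') ω with hW
  have hXm : Measurable X := measurable_absum _
  have hWm : Measurable W := measurable_absum _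
  have hX0 : ∀ ω, 0 ≤ X ω := fun ω => absum_nonneg _ _
  have hW0 : ∀ ω, 0 ≤ W ω := fun ω => absum_nonneg _ _
  set A : ℝ := 8 * (2 * ρ⁻¹ ^ 2) ^ 4
  set B : ℝ := (ρ⁻¹ ^ m * m ! * m) ^ 2
  have hpt : ∀ x : (Fin m × J → ℝ) × (Fin m × J → ℝ),
      ENNReal.ofReal ((Psi r ρ p q x.1 x.2 - Psi r ρ p' q' x.1 x.2) ^ 2)
      ≤ ENNReal.ofReal (τ ^ 2) * (ENNReal.ofReal B * (ENNReal.ofReal A * ENNReal.ofReal (X x.1 ^ 8)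
        + 8 + ENNReal.ofReal (W (r • x.1 + ρ • x.2) ^ (4 * m)))) := by
    intro x
    have e8 : (8 : ENNReal) = ENNReal.ofReal 8 := by simp
    have hx8 := pow_nonneg (hX0 x.1) 8
    have hw4 := pow_nonneg (hW0 (r • x.1 + ρ • x.2)) (4 * m)
    rw [e8, ← ENNReal.ofReal_mul (by positivity), ← ENNReal.ofReal_add (by positivity) (by simp),
      ← ENNReal.ofReal_add (by positivity) hw4, ← ENNReal.ofReal_mul (by positivity),
      ← ENNReal.ofReal_mul (by positivity)]
    refine ENNReal.ofReal_le_ofReal ?_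
    have h1 := abs_Psi_sub_le hr0 hr1 hρ hτ p p' q q' x.1 x.2
    rw [← sq_abs]
    refine (pow_le_pow_left₀ (abs_nonneg _) h1 2).trans ?_
    rw [mul_pow, mul_pow]
    refine mul_le_mul_of_nonneg_left (mul_le_mul_of_nonneg_left ?_ (by positivity)) (by positivity)
    change ((2 * ρ⁻¹ ^ 2 * X x.1 ^ 2 + 1) * W (r • x.1 + ρ • x.2) ^ m) ^ 2 ≤ _
    set a : ℝ := 2 * ρ⁻¹ ^ 2
    have e1 : A * X x.1 ^ 8 = 8 * (a * X x.1 ^ 2) ^ 4 := by simp only [A]; ring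
    have e2 : W (r • x.1 + ρ • x.2) ^ (4 * m) = (W (r • x.1 + ρ • x.2) ^ m) ^ 4 := by
      rw [← pow_mul, mul_comm]
    rw [e1, e2]
    generalize a * X x.1 ^ 2 = y
    generalize W (r • x.1 + ρ • x.2) ^ m = z
    nlinarith [sq_nonneg ((y + 1) ^ 2 - z ^ 2), sq_nonneg (y ^ 2 - 1), sq_nonneg (y - 1),
      sq_nonneg ((y - 1) * (y + 1)), sq_nonneg ((y - 1) ^ 2), sq_nonneg (z ^ 2),
      sq_nonneg (y ^ 2)]
  refine (lintegral_mono hpt).trans ?_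
  have hm1 : Measurable fun x : (Fin m × J → ℝ) × (Fin m × J → ℝ) =>
      ENNReal.ofReal (X x.1 ^ 8) := by fun_prop
  rw [lintegral_const_mul' _ _ ENNReal.ofReal_ne_top, lintegral_const_mul' _ _ ENNReal.ofReal_ne_top,
    lintegral_add_left ((hm1.const_mul _).add_const _), lintegral_add_left (hm1.const_mul _),
    lintegral_const_mul' _ _ ENNReal.ofReal_ne_top,
    measurePreserving_fst.lintegral_comp (f := fun ω => ENNReal.ofReal (X ω ^ 8)) (by fun_prop),
    (stdG_rot_measurePreserving h).lintegral_comp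
      (f := fun ω => ENNReal.ofReal (W ω ^ (4 * m))) (by fun_prop)]
  have hX8 := absum_moment (trip τ (fun _ : Unit => p) fun _ => p')
    (trip_dot hτ (fun _ => hp) (fun _ => hp') fun _ => hpp) 8 (m := m)
  have hW4 := absum_moment (trip τ q q') (trip_dot hτ hq hq' hqq) (4 * m) (m := m)
  simp only [Fintype.card_prod, Fintype.card_fin, Fintype.card_unit, mul_one] at hX8 hW4
  rw [dPsiC]
  gcongr
  simp

lemma Psi_smul {s : ℝ} (hs : 0 ≤ s) (r ρ : ℝ) (p : J → ℝ) (q : Fin m → J → ℝ)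
    (ω w : Fin m × J → ℝ) : Psi r ρ p (fun k => s • q k) ω w = s ^ m * Psi r ρ p q ω w := by
  have : detM (fun k => s • q k) (r • ω + ρ • w) = s • detM q (r • ω + ρ • w) := by
    ext i j
    rw [detM_apply, Matrix.smul_apply, detM_apply, smul_dotProduct]
  rw [Psi, this, Matrix.det_smul, abs_mul, abs_of_nonneg (pow_nonneg hs _), Fintype.card_fin, Psi]
  ring

end
end

section

/-- Coefficient configurations. -/
abbrev Cf (m d : ℕ) := Fin m × Jx m d → ℝ

/-- The standard Gaussian law of the coefficients. -/
abbrev Gs (m d : ℕ) : Measure (Cf m d) := stdG (Fin m × Jx m d)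

lemma lintegral_pow_le {E : Type*} [MeasurableSpace E] (ν : Measure E) {f : E → ENNReal}
    (hf : AEMeasurable f ν) (n : ℕ) :
    (∫⁻ e, f e ∂ν) ^ (n + 1) ≤ ν Set.univ ^ n * ∫⁻ e, f e ^ (n + 1) ∂ν := by
  rcases Nat.eq_zero_or_pos n with rfl | hn
  · simp
  have hp : (1 : ℝ) < n + 1 := by simpa using hn
  have hpq := Real.HolderConjugate.conjExponent hp
  have h := ENNReal.lintegral_mul_le_Lp_mul_Lq ν hpq hf (aemeasurable_const (b := (1 : ENNReal)))
  simp only [Pi.mul_apply, mul_one, ENNReal.one_rpow, lintegral_const, one_mul] at h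
  have h2 := ENNReal.rpow_le_rpow h (by positivity : (0 : ℝ) ≤ n + 1)
  rw [ENNReal.mul_rpow_of_nonneg _ _ (by positivity), ← ENNReal.rpow_mul, ← ENNReal.rpow_mul] at h2
  have hn0 : (n : ℝ) ≠ 0 := by exact_mod_cast hn.ne'
  have e1 : 1 / ((n : ℝ) + 1) * (n + 1) = 1 := by field_simp
  have e2 : 1 / Real.conjExponent ((n : ℝ) + 1) * (n + 1) = n := by
    rw [Real.conjExponent]; field_simp; simp
  rw [e1, e2, ENNReal.rpow_one] at h2
  have e3 : ∀ x : ENNReal, x ^ ((n : ℝ) + 1) = x ^ (n + 1) := fun x => by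
    rw [← ENNReal.rpow_natCast]; push_cast; rfl
  simp only [e3, ENNReal.rpow_natCast] at h2
  rwa [mul_comm] at h2

lemma moment_integral_le {Ω E : Type*} [MeasurableSpace Ω] [MeasurableSpace E] (μ : Measure Ω)
    (ν : Measure E) [IsFiniteMeasure ν] {G : Ω → E → ℝ}
    (hG : Measurable (Function.uncurry G)) (n : ℕ) :
    ∫⁻ ω, ENNReal.ofReal (|∫ e, G ω e ∂ν| ^ (n + 1)) ∂μ
      ≤ ν Set.univ ^ n * ∫⁻ ω, ∫⁻ e, ENNReal.ofReal (|G ω e| ^ (n + 1)) ∂ν ∂μ := by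
  rw [← lintegral_const_mul' _ _ (ENNReal.pow_ne_top (measure_ne_top _ _))]
  refine lintegral_mono fun ω => ?_
  have hm : Measurable fun e => ENNReal.ofReal |G ω e| :=
    (measurable_norm.comp (hG.comp measurable_prodMk_left)).ennreal_ofReal
  have h1 : ENNReal.ofReal |∫ e, G ω e ∂ν| ≤ ∫⁻ e, ENNReal.ofReal |G ω e| ∂ν := by
    simp only [← Real.norm_eq_abs, ofReal_norm]
    exact enorm_integral_le_lintegral_enorm _
  rw [ENNReal.ofReal_pow (abs_nonneg _)]
  refine (pow_le_pow_left₀ zero_le h1 _).trans ((lintegral_pow_le ν hm.aemeasurable n).trans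
    (le_of_eq ?_))
  simp_rw [ENNReal.ofReal_pow (abs_nonneg _)]

variable {m d : ℕ}

/-- `Psi` along the features masked by `C`. -/
def mPsi (r ρ : ℝ) (C : Set (Jx m d)) (ω : Cf m d) (e : (Fin m → ℝ) × Cf m d) : ℝ :=
  Psi r ρ (C.indicator (ft d e.1)) (fun k => C.indicator (dft d e.1 k)) ω e.2

/-- Conditional mean of the number of roots in `T` seen through the coefficients in `C`. -/
def blk (r ρ : ℝ) (T : Set (Fin m → ℝ)) (C : Set (Jx m d)) (ω : Cf m d) : ℝ :=
  ∫ e, mPsi r ρ C ω e ∂((volume.restrict T).prod (Gs m d))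

lemma measurable_mPsi (r ρ : ℝ) (C : Set (Jx m d)) :
    Measurable (Function.uncurry (mPsi r ρ C)) := by
  have hi : ∀ {p : (Fin m → ℝ) → Jx m d → ℝ}, Measurable p →
      Measurable fun t => C.indicator (p t) := by
    intro p hp
    refine measurable_pi_lambda _ fun j => ?_
    by_cases hj : j ∈ C
    · simp only [Set.indicator_of_mem hj]; fun_prop
    · simp only [Set.indicator_of_notMem hj]; fun_prop
  have hft := hi (continuous_ft (d := d)).measurable
  have hdf : Measurable fun t k => C.indicator (dft d t k) :=
    measurable_pi_lambda _ fun k => hi (continuous_dft k).measurable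
  have h1 : Measurable fun x : Cf m d × (Fin m → ℝ) × Cf m d => C.indicator (ft d x.2.1) :=
    hft.comp (measurable_fst.comp measurable_snd)
  have h2 : Measurable fun x : Cf m d × (Fin m → ℝ) × Cf m d =>
      ((fun k => C.indicator (dft d x.2.1 k), r • x.1 + ρ • x.2.2) :
        (Fin m → Jx m d → ℝ) × Cf m d) :=
    (hdf.comp (measurable_fst.comp measurable_snd)).prodMk (by fun_prop)
  have h3 : Measurable fun x : Cf m d × (Fin m → ℝ) × Cf m d =>
      gpdf (Fin m) (fun ℓ => ρ⁻¹ * r * (C.indicator (ft d x.2.1) ⬝ᵥ row x.1 ℓ)) := by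
    refine measurable_gpdf.comp (measurable_pi_lambda _ fun ℓ => ?_)
    unfold dotProduct row
    fun_prop
  have h4 : Measurable fun x : (Fin m → Jx m d → ℝ) × Cf m d => |(detM x.1 x.2).det| :=
    continuous_detM.matrix_det.abs.measurable
  have h5 := h4.comp h2
  have h6 := (h3.const_mul (ρ⁻¹ ^ m)).mul h5
  exact h6

lemma measurable_mPsi_right (r ρ : ℝ) (C : Set (Jx m d)) (ω : Cf m d) :
    Measurable (mPsi r ρ C ω) := (measurable_mPsi r ρ C).of_uncurry_left

lemma mPsi_nonneg {r ρ : ℝ} (hρ : 0 < ρ) (C : Set (Jx m d)) (ω : Cf m d)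
    (e : (Fin m → ℝ) × Cf m d) : 0 ≤ mPsi r ρ C ω e := Psi_nonneg hρ _ _ _ _

lemma measurable_blk (r ρ : ℝ) (T : Set (Fin m → ℝ)) (C : Set (Jx m d)) :
    Measurable (blk r ρ T C) :=
  (measurable_mPsi r ρ C).stronglyMeasurable.integral_prod_right.measurable

lemma blk_indicator (r ρ : ℝ) (T : Set (Fin m → ℝ)) (C : Set (Jx m d))
    (ω : Cf m d) : blk r ρ T C ((Prod.snd ⁻¹' C).indicator ω) = blk r ρ T C ω := by
  have h : ∀ (p : Jx m d → ℝ) ℓ, C.indicator p ⬝ᵥ row ((Prod.snd ⁻¹' C).indicator ω) ℓ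
      = C.indicator p ⬝ᵥ row ω ℓ := by
    intro p ℓ
    refine Finset.sum_congr rfl fun j _ => ?_
    by_cases hj : j ∈ C <;> simp [row, hj]
  have hrow : ∀ (x w : Cf m d) ℓ, row (r • x + ρ • w) ℓ = r • row x ℓ + ρ • row w ℓ :=
    fun _ _ _ => rfl
  refine integral_congr_ae (Eventually.of_forall fun e => ?_)
  have hd : detM (fun k => C.indicator (dft d e.1 k)) (r • (Prod.snd ⁻¹' C).indicator ω + ρ • e.2)
      = detM (fun k => C.indicator (dft d e.1 k)) (r • ω + ρ • e.2) := by
    ext ℓ k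
    simp only [detM_apply, hrow, dotProduct_add, dotProduct_smul, h]
  simp only [mPsi, Psi, h, hd]

lemma indicator_dot_le {J : Type*} [Fintype J] (C : Set J) (p : J → ℝ) :
    C.indicator p ⬝ᵥ C.indicator p ≤ p ⬝ᵥ p := by
  refine Finset.sum_le_sum fun j _ => ?_
  by_cases hj : j ∈ C
  · simp [hj]
  · simp [hj, mul_self_nonneg]

/-- Interchange of the order of integration for pointwise moment bounds. -/
lemma lintegral_block_le {T : Set (Fin m → ℝ)} (hT : MeasurableSet T)
    {H : Cf m d → (Fin m → ℝ) × Cf m d → ENNReal} (hH : Measurable (Function.uncurry H))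
    {B : ENNReal} (hB : ∀ t ∈ T, ∫⁻ x, H x.1 (t, x.2) ∂((Gs m d).prod (Gs m d)) ≤ B) :
    ∫⁻ ω, ∫⁻ e, H ω e ∂((volume.restrict T).prod (Gs m d)) ∂(Gs m d) ≤ B * volume T := by
  have h1 : ∀ ω, ∫⁻ e, H ω e ∂((volume.restrict T).prod (Gs m d))
      = ∫⁻ t in T, ∫⁻ w, H ω (t, w) ∂(Gs m d) := fun ω =>
    lintegral_prod _ (hH.comp measurable_prodMk_left).aemeasurable
  simp_rw [h1]
  rw [lintegral_lintegral_swap (Measurable.lintegral_prod_right' (hH.comp (by fun_prop :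
    Measurable fun x : (Cf m d × (Fin m → ℝ)) × Cf m d => (x.1.1, (x.1.2, x.2))))).aemeasurable]
  refine (setLIntegral_mono' hT (g := fun _ => B) fun t ht => ?_).trans (by simp)
  refine le_trans (le_of_eq ?_) (hB t ht)
  exact (lintegral_prod _ (hH.comp (by fun_prop : Measurable fun x : Cf m d × Cf m d =>
    (x.1, (t, x.2)))).aemeasurable).symm

lemma Psi_scale (hd0 : 0 < d) (r ρ : ℝ) (p : Jx m d → ℝ) (q : Fin m → Jx m d → ℝ)
    (ω w : Cf m d) :
    Psi r ρ p q ω w = √(d : ℝ) ^ m * Psi r ρ p (fun k => (√(d : ℝ))⁻¹ • q k) ω w := by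
  have hq : (0 : ℝ) < √(d : ℝ) := Real.sqrt_pos.2 (by exact_mod_cast hd0)
  rw [Psi_smul (inv_nonneg.2 hq.le), ← mul_assoc, ← mul_pow, mul_inv_cancel₀ hq.ne', one_pow, one_mul]

lemma inv_smul_dot_le (hd0 : 0 < d) {q : Jx m d → ℝ} {c : ℝ} (h : q ⬝ᵥ q ≤ d * c) :
    ((√(d : ℝ))⁻¹ • q) ⬝ᵥ ((√(d : ℝ))⁻¹ • q) ≤ c := by
  have hd1 : (0 : ℝ) < d := by exact_mod_cast hd0
  rw [smul_dotProduct, dotProduct_smul, smul_eq_mul, smul_eq_mul, ← mul_assoc, ← mul_inv,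
    Real.mul_self_sqrt hd1.le, inv_mul_le_iff₀ hd1]
  exact h

lemma indicator_dft_le (C : Set (Jx m d)) (t : Fin m → ℝ) (k : Fin m) :
    C.indicator (dft d t k) ⬝ᵥ C.indicator (dft d t k) ≤ d * 1 := by
  rw [mul_one]; exact (indicator_dot_le _ _).trans (dft_dot_self_le t k)

lemma mPsi_moment {r ρ : ℝ} (hρ : 0 < ρ) (h : r ^ 2 + ρ ^ 2 = 1) (hd0 : 0 < d)
    {T : Set (Fin m → ℝ)} (hT : MeasurableSet T) (C : Set (Jx m d)) (n : ℕ) :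
    ∫⁻ ω, ∫⁻ e, ENNReal.ofReal (|mPsi r ρ C ω e| ^ n) ∂((volume.restrict T).prod (Gs m d)) ∂(Gs m d)
      ≤ ENNReal.ofReal (√(d : ℝ) ^ m) ^ n * psiC m ρ n * volume T := by
  refine lintegral_block_le hT (H := fun ω e => ENNReal.ofReal (|mPsi r ρ C ω e| ^ n))
    ((measurable_norm.comp (measurable_mPsi r ρ C)).pow_const _).ennreal_ofReal fun t _ => ?_
  have hm := Psi_moment hρ h (C.indicator (ft d t)) (q := fun k => (√(d : ℝ))⁻¹ •
    C.indicator (dft d t k)) (fun k => inv_smul_dot_le hd0 (indicator_dft_le C t k)) n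
  refine le_trans (le_of_eq ?_) (mul_le_mul_right hm (ENNReal.ofReal (√(d : ℝ) ^ m) ^ n))
  rw [← lintegral_const_mul' _ _ (ENNReal.pow_ne_top ENNReal.ofReal_ne_top)]
  refine lintegral_congr fun x => ?_
  rw [mPsi, abs_of_nonneg (Psi_nonneg hρ _ _ _ _), Psi_scale hd0, mul_pow,
    ENNReal.ofReal_mul (by positivity), ENNReal.ofReal_pow (by positivity)]

lemma restrict_prod_univ (T : Set (Fin m → ℝ)) :
    ((volume.restrict T).prod (Gs m d)) Set.univ = volume T := by
  rw [← Set.univ_prod_univ, Measure.prod_prod, measure_univ (μ := Gs m d), mul_one,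
    Measure.restrict_apply_univ]

lemma blk_moment_le {r ρ : ℝ} (hρ : 0 < ρ) (h : r ^ 2 + ρ ^ 2 = 1) (hd0 : 0 < d)
    {T : Set (Fin m → ℝ)} (hT : MeasurableSet T) (hTf : volume T ≠ ⊤) (C : Set (Jx m d)) (n : ℕ) :
    ∫⁻ ω, ENNReal.ofReal (|blk r ρ T C ω| ^ (n + 1)) ∂(Gs m d)
      ≤ (volume T * ENNReal.ofReal (√(d : ℝ) ^ m)) ^ (n + 1) * psiC m ρ (n + 1) := by
  have : IsFiniteMeasure (volume.restrict T) := ⟨by simpa using hTf.lt_top⟩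
  refine (moment_integral_le _ _ (measurable_mPsi r ρ C) n).trans ?_
  refine (mul_le_mul_right (mPsi_moment hρ h hd0 hT C (n + 1)) _).trans (le_of_eq ?_)
  rw [restrict_prod_univ]
  ring

lemma integrable_mPsi {r ρ : ℝ} (hρ : 0 < ρ) (h : r ^ 2 + ρ ^ 2 = 1) (hd0 : 0 < d)
    {T : Set (Fin m → ℝ)} (hT : MeasurableSet T) (hTf : volume T ≠ ⊤) (C : Set (Jx m d)) :
    ∀ᵐ ω ∂(Gs m d), Integrable (mPsi r ρ C ω) ((volume.restrict T).prod (Gs m d)) := by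
  have hP := measurable_mPsi r ρ C
  have hlt := (mPsi_moment hρ h hd0 hT C 1).trans_lt (ENNReal.mul_lt_top (ENNReal.mul_lt_top
    (ENNReal.pow_lt_top ENNReal.ofReal_lt_top) (psiC_lt_top m ρ 1)) hTf.lt_top)
  filter_upwards [ae_lt_top (Measurable.lintegral_prod_right'
    ((measurable_norm.comp hP).pow_const 1).ennreal_ofReal) hlt.ne] with ω hω
  refine ⟨(measurable_mPsi_right r ρ C ω).aestronglyMeasurable, ?_⟩
  rw [hasFiniteIntegral_iff_norm]
  simpa using hω

lemma blk_sub_moment_le {r ρ c : ℝ} (hr0 : 0 ≤ r) (hr1 : r ≤ 1) (hρ : 0 < ρ)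
    (h : r ^ 2 + ρ ^ 2 = 1) (hd0 : 0 < d) (hc : 0 < c)
    {T : Set (Fin m → ℝ)} (hT : MeasurableSet T) (hTf : volume T ≠ ⊤) (C : Set (Jx m d))
    (h1 : ∀ t ∈ T, Cᶜ.indicator (ft d t) ⬝ᵥ Cᶜ.indicator (ft d t) ≤ c)
    (h2 : ∀ t ∈ T, ∀ k, Cᶜ.indicator (dft d t k) ⬝ᵥ Cᶜ.indicator (dft d t k) ≤ d * c) :
    ∫⁻ ω, ENNReal.ofReal (|blk r ρ T Set.univ ω - blk r ρ T C ω| ^ 2) ∂(Gs m d)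
      ≤ (volume T * ENNReal.ofReal (√(d : ℝ) ^ m)) ^ 2 * (ENNReal.ofReal c * dPsiC m ρ) := by
  have : IsFiniteMeasure (volume.restrict T) := ⟨by simpa using hTf.lt_top⟩
  have hDm : Measurable (Function.uncurry fun ω e => mPsi r ρ Set.univ ω e - mPsi r ρ C ω e) :=
    (measurable_mPsi r ρ Set.univ).sub (measurable_mPsi r ρ C)
  have e1 : ∫⁻ ω, ENNReal.ofReal (|blk r ρ T Set.univ ω - blk r ρ T C ω| ^ 2) ∂(Gs m d)
      = ∫⁻ ω, ENNReal.ofReal (|∫ e, mPsi r ρ Set.univ ω e - mPsi r ρ C ω e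
        ∂((volume.restrict T).prod (Gs m d))| ^ (1 + 1)) ∂(Gs m d) := by
    refine lintegral_congr_ae ?_
    filter_upwards [integrable_mPsi hρ h hd0 hT hTf Set.univ, integrable_mPsi hρ h hd0 hT hTf C]
      with ω h1 h2
    rw [integral_sub h1 h2]
    rfl
  rw [e1]
  refine (moment_integral_le _ _ hDm 1).trans ?_
  have hb := lintegral_block_le hT (H := fun ω e => ENNReal.ofReal
      (|mPsi r ρ Set.univ ω e - mPsi r ρ C ω e| ^ (1 + 1))) (B := ENNReal.ofReal (√(d : ℝ) ^ m) ^ 2 *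
    (ENNReal.ofReal c * dPsiC m ρ))
    ((measurable_norm.comp hDm).pow_const (1 + 1)).ennreal_ofReal (fun t ht => by
      have hcs : √c ^ 2 = c := Real.sq_sqrt hc.le
      have hsub : ∀ p : Jx m d → ℝ, (Set.univ : Set (Jx m d)).indicator p - C.indicator p
          = Cᶜ.indicator p := fun p => by rw [Set.indicator_univ, Set.indicator_compl]
      have hm := Psi_sub_moment hr0 hr1 hρ h (Real.sqrt_pos.2 hc)
        (p := (Set.univ : Set (Jx m d)).indicator (ft d t)) (p' := C.indicator (ft d t))
        (q := fun k => (√(d : ℝ))⁻¹ • (Set.univ : Set (Jx m d)).indicator (dft d t k))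
        (q' := fun k => (√(d : ℝ))⁻¹ • C.indicator (dft d t k))
        ((indicator_dot_le _ _).trans (ft_dot_self t).le)
        ((indicator_dot_le _ _).trans (ft_dot_self t).le)
        (by rw [hsub, hcs]; exact h1 t ht)
        (fun k => inv_smul_dot_le hd0 (indicator_dft_le _ t k))
        (fun k => inv_smul_dot_le hd0 (indicator_dft_le C t k))
        (fun k => by rw [← smul_sub, hsub, hcs]; exact inv_smul_dot_le hd0 (h2 t ht k))
      rw [hcs] at hm
      refine le_trans (le_of_eq ?_) (mul_le_mul_right hm (ENNReal.ofReal (√(d : ℝ) ^ m) ^ 2))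
      rw [← lintegral_const_mul' _ _ (ENNReal.pow_ne_top ENNReal.ofReal_ne_top)]
      refine lintegral_congr fun x => ?_
      rw [one_add_one_eq_two, sq_abs, mPsi, mPsi, ← ENNReal.ofReal_pow (by positivity),
        ← ENNReal.ofReal_mul (by positivity), ← mul_pow, mul_sub, ← Psi_scale hd0,
        ← Psi_scale hd0])
  refine (mul_le_mul_right hb _).trans (le_of_eq ?_)
  rw [restrict_prod_univ]
  ring
end

section

variable {m d : ℕ}

lemma row_comb (r ρ : ℝ) (x w : Cf m d) (ℓ : Fin m) (p : Jx m d → ℝ) :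
    p ⬝ᵥ row (r • x + ρ • w) ℓ = r * (p ⬝ᵥ row x ℓ) + ρ * (p ⬝ᵥ row w ℓ) := by
  change p ⬝ᵥ (r • row x ℓ + ρ • row w ℓ) = _
  simp only [dotProduct_add, dotProduct_smul, smul_eq_mul]

lemma lintegral_Nz_cond {r ρ : ℝ} (hρ : 0 < ρ) {T : Set (Fin m → ℝ)} (hT : IsSigmaCompact T)
    (ω : Cf m d) : ∫⁻ w, Nz d T (r • ω + ρ • w) ∂(Gs m d)
      = ∫⁻ e, ENNReal.ofReal (mPsi r ρ Set.univ ω e) ∂((volume.restrict T).prod (Gs m d)) := by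
  have hdet : Continuous fun t : Fin m → ℝ => detM (dft d t) ω :=
    continuous_detM.comp ((continuous_pi continuous_dft).prodMk continuous_const)
  have h := one_point (isFeat_ft (m := m) (d := d)) (c := fun t ℓ => r * (ft d t ⬝ᵥ row ω ℓ))
    (dc := fun t => r • detM (dft d t) ω) (hdet.const_smul r) (fun t => by
      refine hasFDerivAt_pi'' fun ℓ => ?_
      refine (((isFeat_ft.deriv t (row ω ℓ)).const_mul r).congr_fderiv ?_)
      ext h
      simp only [smul_apply, dotCLM_apply, ContinuousLinearMap.comp_apply,
        matCLM_apply, Matrix.smul_mulVec, smul_eq_mul]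
      simp [detM, Matrix.mulVec, dotProduct_comm h]) hρ hT
  rw [lintegral_prod _ (measurable_mPsi_right r ρ Set.univ ω).ennreal_ofReal.aemeasurable]
  refine Eq.trans (lintegral_congr fun w => ?_) (h.trans (lintegral_congr fun t => ?_))
  · simp only [Nz, row_comb]
    congr! 6
    exact add_comm _ _
  · rw [← lintegral_const_mul' _ _ ENNReal.ofReal_ne_top]
    refine lintegral_congr fun w => ?_
    rw [mPsi, Psi, ENNReal.ofReal_mul (mul_nonneg (by positivity) (gpdf_pos _).le)]
    simp only [Set.indicator_univ]
    congr 3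
    · exact congrArg _ (funext fun ℓ => (mul_assoc _ _ _).symm)
    · congr 1
      ext ℓ k
      simp only [detM_apply, row_comb, Matrix.add_apply, Matrix.smul_apply, smul_eq_mul]
      exact add_comm _ _

variable [NeZero m]

lemma ae_Nz_cond (hd : d ≠ 0) {r ρ : ℝ} (h : r ^ 2 + ρ ^ 2 = 1) {T : Set (Fin m → ℝ)}
    (hT : IsSigmaCompact T) :
    ∀ᵐ ω ∂(Gs m d), ∀ᵐ w ∂(Gs m d), Nz d T (r • ω + ρ • w) < ⊤ :=
  Measure.ae_ae_of_ae_prod ((stdG_rot_measurePreserving h).quasiMeasurePreserving.ae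
    (Nz_lt_top_ae hd hT))

lemma integral_nz_cond {r ρ : ℝ} (hρ : 0 < ρ) {T : Set (Fin m → ℝ)} (hT : IsSigmaCompact T)
    {ω : Cf m d} (hω : ∀ᵐ w ∂(Gs m d), Nz d T (r • ω + ρ • w) < ⊤) :
    ∫ w, nz d T (r • ω + ρ • w) ∂(Gs m d) = blk r ρ T Set.univ ω := by
  rw [blk, integral_eq_lintegral_of_nonneg_ae (Eventually.of_forall (mPsi_nonneg hρ Set.univ ω))
    (measurable_mPsi_right r ρ Set.univ ω).aestronglyMeasurable,
    ← lintegral_Nz_cond hρ hT]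
  exact integral_toReal ((measurable_Nz hT).comp (by fun_prop)).aemeasurable hω

lemma blk_iUnion {ι : Type*} [Fintype ι] {r ρ : ℝ} (hρ : 0 < ρ) (h : r ^ 2 + ρ ^ 2 = 1)
    (hd0 : 0 < d) {T : ι → Set (Fin m → ℝ)} (hT : ∀ b, IsSigmaCompact (T b))
    (hTd : Pairwise (Function.onFun Disjoint T)) (hA : volume (⋃ b, T b) ≠ ⊤) :
    ∀ᵐ ω ∂(Gs m d), blk r ρ (⋃ b, T b) Set.univ ω = ∑ b, blk r ρ (T b) Set.univ ω := by
  have hm := fun b => (hT b).measurableSet'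
  filter_upwards [integrable_mPsi hρ h hd0 (MeasurableSet.iUnion hm) hA Set.univ] with ω hω
  have e : (volume.restrict (⋃ b, T b)).prod (Gs m d)
      = Measure.sum fun b => (volume.restrict (T b)).prod (Gs m d) := by
    rw [Measure.restrict_iUnion hTd hm, Measure.prod_sum_left]
  rw [e] at hω
  rw [blk, e, integral_sum_measure hω, tsum_fintype]
  rfl
end

section

lemma indepFun_indicator {κ : Type*} [Fintype κ] (D : Set κ) :
    IndepFun (fun ω : κ → ℝ => D.indicator ω) (fun ω => Dᶜ.indicator ω) (stdG κ) := by
  classical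
  have h := (iIndepFun_pi (μ := fun _ : κ => gaussianReal 0 1) (X := fun _ x => x)
    fun _ => aemeasurable_id).indepFun_finset D.toFinset Dᶜ.toFinset
    (by rw [Set.disjoint_toFinset]; exact disjoint_compl_right) fun i => measurable_pi_apply i
  have hm : ∀ S : Finset κ, Measurable fun (y : S → ℝ) (i : κ) => if h : i ∈ S then y ⟨i, h⟩ else 0 :=
    fun S => measurable_pi_lambda _ fun i => by
      by_cases hi : i ∈ S
      · simpa [hi] using measurable_pi_apply _
      · simp [hi]
  convert! h.comp (hm _) (hm _) using 1 <;>
  · funext ω i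
    simp [Set.indicator_apply]

lemma iIndepFun_of_indicator {ι κ : Type*} [Fintype κ] {C : ι → Set κ}
    (hC : Pairwise (Function.onFun Disjoint C)) {F : ι → (κ → ℝ) → ℝ} (hF : ∀ b, Measurable (F b))
    (hFC : ∀ b ω, F b ((C b).indicator ω) = F b ω) : iIndepFun F (stdG κ) := by
  classical
  rw [iIndepFun_iff_measure_inter_preimage_eq_mul]
  intro S sets
  induction S using Finset.induction_on with
  | empty => simp
  | insert a s ha ih =>
    intro hs
    rw [Finset.set_biInter_insert, Finset.prod_insert ha,
      ← ih fun i hi => hs i (Finset.mem_insert_of_mem hi)]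
    have hE : MeasurableSet (⋂ i ∈ s, F i ⁻¹' sets i) :=
      Finset.measurableSet_biInter _ fun i hi => hF i (hs i (Finset.mem_insert_of_mem hi))
    have h := (indepFun_indicator (C a)).measure_inter_preimage_eq_mul (F a ⁻¹' sets a) _
      (hF a (hs a (Finset.mem_insert_self _ _))) hE
    have e1 : (fun ω : κ → ℝ => (C a).indicator ω) ⁻¹' (F a ⁻¹' sets a) = F a ⁻¹' sets a := by
      ext ω; simp only [Set.mem_preimage, hFC]
    have e2 : (fun ω : κ → ℝ => (C a)ᶜ.indicator ω) ⁻¹' (⋂ i ∈ s, F i ⁻¹' sets i)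
        = ⋂ i ∈ s, F i ⁻¹' sets i := by
      ext ω
      simp only [Set.mem_preimage, Set.mem_iInter]
      refine forall₂_congr fun i hi => ?_
      have hia : C i ⊆ (C a)ᶜ :=
        Set.disjoint_left.1 (hC fun h => ha (h ▸ hi))
      rw [← hFC i ((C a)ᶜ.indicator ω), Set.indicator_indicator, Set.inter_eq_left.2 hia, hFC]
    rwa [e1, e2] at h

lemma norm_cexp_sub_taylor_le (x : ℝ) :
    ‖Complex.exp (x * Complex.I) - (1 + x * Complex.I - x ^ 2 / 2)‖ ≤ 4 * |x| ^ 3 := by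
  rcases le_total |x| 1 with h | h
  · have h1 := Complex.norm_exp_sub_sum_le_norm_mul_exp (x * Complex.I) 3
    have e : ∑ k ∈ Finset.range 3, (x * Complex.I) ^ k / (k ! : ℂ)
        = 1 + x * Complex.I - x ^ 2 / 2 := by
      simp [Finset.sum_range_succ, mul_pow]
      ring
    have e2 : ‖(x : ℂ) * Complex.I‖ = |x| := by simp
    rw [e, e2] at h1
    refine h1.trans ?_
    rw [mul_comm]
    refine mul_le_mul_of_nonneg_right ?_ (by positivity)
    have := Real.exp_le_exp.2 h
    linarith [Real.exp_one_lt_d9]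
  · have h2 : ‖(1 : ℂ) + x * Complex.I - x ^ 2 / 2‖ ≤ 1 + |x| + |x| ^ 2 / 2 := by
      refine (norm_sub_le _ _).trans (add_le_add ((norm_add_le _ _).trans ?_) ?_) <;> simp
    refine (norm_sub_le _ _).trans ?_
    rw [Complex.norm_exp_ofReal_mul_I]
    nlinarith [pow_le_pow_right₀ h (by norm_num : 1 ≤ 3), pow_le_pow_right₀ h (by norm_num : 2 ≤ 3)]

lemma norm_prod_sub_prod_le {ι : Type*} (s : Finset ι) {a b : ι → ℂ} (ha : ∀ i, ‖a i‖ ≤ 1)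
    (hb : ∀ i, ‖b i‖ ≤ 1) : ‖∏ i ∈ s, a i - ∏ i ∈ s, b i‖ ≤ ∑ i ∈ s, ‖a i - b i‖ := by
  classical
  induction s using Finset.induction_on with
  | empty => simp
  | insert i s hi ih =>
    rw [Finset.prod_insert hi, Finset.prod_insert hi, Finset.sum_insert hi,
      show a i * ∏ j ∈ s, a j - b i * ∏ j ∈ s, b j
        = (a i - b i) * ∏ j ∈ s, a j + b i * (∏ j ∈ s, a j - ∏ j ∈ s, b j) by ring]
    refine (norm_add_le _ _).trans (add_le_add ?_ ?_)
    · rw [norm_mul, norm_prod]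
      exact mul_le_of_le_one_right (norm_nonneg _) (Finset.prod_le_one (fun _ _ => norm_nonneg _)
        fun j _ => ha j)
    · rw [norm_mul]
      exact (mul_le_of_le_one_left (norm_nonneg _) (hb i)).trans ih

section
variable {Ω : Type*} [MeasurableSpace Ω] {P : Measure Ω} [IsProbabilityMeasure P]

lemma charFun_map_eq {Y : Ω → ℝ} (hY : AEMeasurable Y P) (θ : ℝ) :
    charFun (P.map Y) θ = ∫ ω, Complex.exp ((θ * Y ω : ℝ) * Complex.I) ∂P := by
  rw [charFun_apply_real, integral_map hY (by fun_prop)]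
  simp

lemma norm_charFun_sub_le {Y : Ω → ℝ} (hY : MemLp Y 3 P) (h0 : ∫ ω, Y ω ∂P = 0) (θ : ℝ) :
    ‖charFun (P.map Y) θ - ((1 - θ ^ 2 * (∫ ω, Y ω ^ 2 ∂P) / 2 : ℝ) : ℂ)‖
      ≤ 4 * |θ| ^ 3 * ∫ ω, |Y ω| ^ 3 ∂P := by
  have h2 : Integrable (fun ω => Y ω ^ 2) P := (hY.mono_exponent (by norm_num)).integrable_sq
  have h1 : Integrable Y P := hY.integrable (by norm_num)
  have h3 : Integrable (fun ω => |Y ω| ^ 3) P := by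
    simpa using hY.integrable_norm_pow (by norm_num)
  have hi : Integrable (fun ω => Complex.exp ((θ * Y ω : ℝ) * Complex.I)) P :=
    Integrable.of_bound (by have := h1.1; fun_prop) 1 (Eventually.of_forall fun ω => by
      rw [Complex.norm_exp_ofReal_mul_I])
  have hq : Integrable (fun ω => (1 : ℂ) + (θ * Y ω : ℝ) * Complex.I - (θ * Y ω : ℝ) ^ 2 / 2) P := by
    refine ((integrable_const _).add ((h1.const_mul θ).ofReal.mul_const _)).sub ?_
    have := (h2.const_mul (θ ^ 2)).ofReal (𝕜 := ℂ)
    refine (this.div_const 2).congr (Eventually.of_forall fun ω => ?_)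
    push_cast; simp; ring
  have e : ((1 - θ ^ 2 * (∫ ω, Y ω ^ 2 ∂P) / 2 : ℝ) : ℂ)
      = ∫ ω, ((1 : ℂ) + (θ * Y ω : ℝ) * Complex.I - (θ * Y ω : ℝ) ^ 2 / 2) ∂P := by
    have e1 : ∀ ω, ((1 : ℂ) + (θ * Y ω : ℝ) * Complex.I - (θ * Y ω : ℝ) ^ 2 / 2)
        = ((1 - θ ^ 2 / 2 * Y ω ^ 2 : ℝ) : ℂ) + ((θ * Y ω : ℝ) : ℂ) * Complex.I := fun ω => by
      push_cast; ring
    simp_rw [e1]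
    have hr : Integrable (fun ω => 1 - θ ^ 2 / 2 * Y ω ^ 2) P :=
      (integrable_const _).sub (h2.const_mul _)
    rw [integral_add hr.ofReal ((h1.const_mul θ).ofReal.mul_const _), integral_complex_ofReal,
      integral_mul_const, integral_complex_ofReal, integral_const_mul, h0,
      integral_sub (integrable_const _) (h2.const_mul _), integral_const_mul]
    simp
    ring
  rw [charFun_map_eq h1.1.aemeasurable, e, ← integral_sub hi hq, ← integral_const_mul]
  refine norm_integral_le_of_norm_le (h3.const_mul _) (Eventually.of_forall fun ω => ?_)
  refine (norm_cexp_sub_taylor_le _).trans (le_of_eq ?_)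
  rw [abs_mul]; ring

lemma one_sub_sub_exp_le {u : ℝ} (hu : 0 ≤ u) : |1 - u - Real.exp (-u)| ≤ u ^ 2 := by
  have h1 := Real.add_one_le_exp (-u)
  have h2 : Real.exp (-u) * (1 + u) ≤ 1 := by
    have := mul_le_mul_of_nonneg_left (Real.add_one_le_exp u) (Real.exp_pos (-u)).le
    rw [← Real.exp_add, neg_add_cancel, Real.exp_zero] at this
    linarith
  rw [abs_of_nonpos (by linarith)]
  nlinarith [Real.exp_pos (-u)]

/-- Quantitative central limit theorem for a finite independent family. -/
lemma norm_charFun_sum_sub_le {ι : Type*} [Fintype ι] {Y : ι → Ω → ℝ} (hY : ∀ b, MemLp (Y b) 3 P)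
    (h0 : ∀ b, ∫ ω, Y b ω ∂P = 0) (hI : iIndepFun Y P) {B₂ B₃ : ℝ}
    (h2 : ∀ b, ∫ ω, Y b ω ^ 2 ∂P ≤ B₂) (h3 : ∀ b, ∫ ω, |Y b ω| ^ 3 ∂P ≤ B₃) (θ : ℝ) :
    ‖charFun (P.map fun ω => ∑ b, Y b ω) θ
        - (Real.exp (-(θ ^ 2 * (∫ ω, (∑ b, Y b ω) ^ 2 ∂P) / 2)) : ℂ)‖
      ≤ Fintype.card ι * (4 * |θ| ^ 3 * B₃ + (θ ^ 2 * B₂ / 2) ^ 2) := by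
  have hY2 : ∀ b, MemLp (Y b) 2 P := fun b => (hY b).mono_exponent (by norm_num)
  have hvar : ∫ ω, (∑ b, Y b ω) ^ 2 ∂P = ∑ b, ∫ ω, Y b ω ^ 2 ∂P := by
    have := IndepFun.variance_sum (s := Finset.univ) (fun b _ => hY2 b)
      fun i _ j _ hij => hI.indepFun hij
    rw [variance_of_integral_eq_zero (Finset.aemeasurable_sum _ fun b _ => (hY b).1.aemeasurable)]
      at this
    · simpa [variance_of_integral_eq_zero (hY _).1.aemeasurable (h0 _)] using this
    · simp [integral_finsetSum _ fun b _ => (hY2 b).integrable (by norm_num), h0]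
  rw [hI.charFun_map_fun_sum_eq_prod fun b => (hY b).1.aemeasurable, Finset.prod_apply, hvar,
    Finset.mul_sum, Finset.sum_div, ← Finset.sum_neg_distrib, Real.exp_sum, Complex.ofReal_prod]
  have hu : ∀ b, 0 ≤ θ ^ 2 * (∫ ω, Y b ω ^ 2 ∂P) / 2 := fun b => by positivity
  have hp : ∀ b, IsProbabilityMeasure (P.map (Y b)) := fun b =>
    Measure.isProbabilityMeasure_map (hY b).1.aemeasurable
  refine (norm_prod_sub_prod_le _ (fun b => norm_charFun_le_one _) fun b => ?_).trans ?_
  · rw [Complex.norm_real, Real.norm_eq_abs, abs_of_pos (Real.exp_pos _)]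
    exact Real.exp_le_one_iff.2 (neg_nonpos.2 (hu b))
  · rw [← nsmul_eq_mul, ← Finset.card_univ]
    refine Finset.sum_le_card_nsmul _ _ _ fun b _ => ?_
    refine (norm_sub_le_norm_sub_add_norm_sub _ ((1 - θ ^ 2 * (∫ ω, Y b ω ^ 2 ∂P) / 2 : ℝ) : ℂ)
      _).trans (add_le_add ((norm_charFun_sub_le (hY b) (h0 b) θ).trans ?_) ?_)
    · exact mul_le_mul_of_nonneg_left (h3 b) (by positivity)
    · rw [← Complex.ofReal_sub, Complex.norm_real]
      refine (one_sub_sub_exp_le (hu b)).trans (pow_le_pow_left₀ (hu b) ?_ 2)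
      have := h2 b
      gcongr

end
end

section

variable {m d : ℕ} [NeZero m]

lemma nz_add_compl {A : Set (Fin m → ℝ)} {ω : Cf m d} (h : Nz d Set.univ ω < ⊤) :
    nz d Set.univ ω = nz d A ω + nz d Aᶜ ω := by
  have e : Nz d Set.univ ω = Nz d A ω + Nz d Aᶜ ω := by
    rw [Nz, Nz, Nz, ← cnt_union (Set.disjoint_left.2 fun t h h' => h'.1 h.1)]
    congr 1
    ext t
    simp [← or_and_right, em]
  rw [e, ENNReal.add_lt_top] at h
  rw [nz, e, ENNReal.toReal_add h.1.ne h.2.ne]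
  rfl

lemma lintegral_nz_sub_blk_le (hd : 2 ≤ d) (hi : IntK m d 1) {r ρ : ℝ} (hρ : 0 < ρ)
    (h : r ^ 2 + ρ ^ 2 = 1) (hir : IntK m d r) {A : Set (Fin m → ℝ)} (hA : IsCompact A) :
    ∫⁻ ω, ENNReal.ofReal (|nz d Set.univ ω - √d ^ m * (muB Aᶜ).toReal - blk r ρ A Set.univ ω| ^ 2)
        ∂(Gs m d)
      ≤ ENNReal.ofReal (√d ^ m * (4 * (1 + Ik m d 1 - Ik m d r)
          + 2 * (muB Aᶜ).toReal * (1 + Jk m d))) := by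
  have hd0 : d ≠ 0 := by omega
  have hAs := hA.isSigmaCompact
  have hU : IsSigmaCompact (Set.univ : Set (Fin m → ℝ)) := isSigmaCompact_univ
  have hAc : IsSigmaCompact Aᶜ := by simpa using hU.inter_isOpen hA.isClosed.isOpen_compl
  have hrot : MeasurePreserving (fun p : Cf m d × Cf m d => r • p.1 + ρ • p.2)
      ((Gs m d).prod (Gs m d)) (Gs m d) := stdG_rot_measurePreserving h
  set c := √d ^ m * (muB Aᶜ).toReal
  have m1 : MemLp (fun p : Cf m d × Cf m d => nz d Set.univ p.1) 2 ((Gs m d).prod (Gs m d)) :=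
    (memLp_nz hd hi hU).comp_measurePreserving measurePreserving_fst
  have m2 : ∀ {B : Set (Fin m → ℝ)}, IsSigmaCompact B →
      MemLp (fun p : Cf m d × Cf m d => nz d B (r • p.1 + ρ • p.2)) 2 ((Gs m d).prod (Gs m d)) :=
    fun hB => (memLp_nz hd hi hB).comp_measurePreserving hrot
  have hG : MemLp (fun p : Cf m d × Cf m d => nz d Set.univ p.1 - c - nz d A (r • p.1 + ρ • p.2)) 2
      ((Gs m d).prod (Gs m d)) := (m1.sub (memLp_const c)).sub (m2 hAs)
  have hmeas : Measurable (fun p : Cf m d × Cf m d =>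
      nz d Set.univ p.1 - c - nz d A (r • p.1 + ρ • p.2)) :=
    (((measurable_nz hU).comp measurable_fst).sub_const c).sub
      ((measurable_nz hAs).comp (by fun_prop))
  calc _ = ∫⁻ ω, ENNReal.ofReal (|∫ w, (nz d Set.univ ω - c - nz d A (r • ω + ρ • w)) ∂(Gs m d)|
        ^ (1 + 1)) ∂(Gs m d) := by
        refine lintegral_congr_ae ?_
        filter_upwards [ae_Nz_cond hd0 h hAs, ((m2 hAs).integrable one_le_two).prod_right_ae]
          with ω h1 h2
        rw [integral_sub (integrable_const _) h2, integral_nz_cond hρ hAs h1]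
        simp
    _ ≤ ∫⁻ p, ENNReal.ofReal (|nz d Set.univ p.1 - c - nz d A (r • p.1 + ρ • p.2)| ^ (1 + 1))
        ∂((Gs m d).prod (Gs m d)) := by
        have := moment_integral_le (Gs m d) (Gs m d)
          (G := fun ω w => nz d Set.univ ω - c - nz d A (r • ω + ρ • w)) hmeas 1
        rwa [measure_univ, one_pow, one_mul, ← lintegral_prod (fun p : Cf m d × Cf m d =>
            ENNReal.ofReal (|nz d Set.univ p.1 - c - nz d A (r • p.1 + ρ • p.2)| ^ (1 + 1)))
          (hmeas.norm.pow_const 2).ennreal_ofReal.aemeasurable] at this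
    _ = ENNReal.ofReal (∫ p, (nz d Set.univ p.1 - c - nz d A (r • p.1 + ρ • p.2)) ^ 2
        ∂((Gs m d).prod (Gs m d))) := by
        rw [ofReal_integral_eq_lintegral_ofReal hG.integrable_sq
          (Eventually.of_forall fun _ => sq_nonneg _)]
        simp only [one_add_one_eq_two, sq_abs]
    _ ≤ _ := ENNReal.ofReal_le_ofReal ?_
  have m3 : Integrable (fun p => 2 * (nz d Set.univ p.1
      - nz d Set.univ (r • p.1 + ρ • p.2)) ^ 2) ((Gs m d).prod (Gs m d)) := (m1.sub (m2 hU)).integrable_sq.const_mul 2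
  have m4 : Integrable (fun p => 2 * (nz d Aᶜ (r • p.1 + ρ • p.2) - c) ^ 2)
      ((Gs m d).prod (Gs m d)) := ((m2 hAc).sub (memLp_const c)).integrable_sq.const_mul 2
  calc _ ≤ ∫ p, (2 * (nz d Set.univ p.1 - nz d Set.univ (r • p.1 + ρ • p.2)) ^ 2
        + 2 * (nz d Aᶜ (r • p.1 + ρ • p.2) - c) ^ 2) ∂((Gs m d).prod (Gs m d)) := by
        refine integral_mono_ae hG.integrable_sq (m3.add m4) ?_
        filter_upwards [hrot.quasiMeasurePreserving.ae (Nz_lt_top_ae hd0 hU)] with p hp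
        simp only [nz_add_compl (A := A) hp]
        nlinarith [sq_nonneg ((nz d Set.univ p.1 - (nz d A (r • p.1 + ρ • p.2)
          + nz d Aᶜ (r • p.1 + ρ • p.2))) - (nz d Aᶜ (r • p.1 + ρ • p.2) - c))]
    _ = 2 * (∫ p, (nz d Set.univ p.1 - nz d Set.univ (r • p.1 + ρ • p.2)) ^ 2
        ∂((Gs m d).prod (Gs m d))) + 2 * ∫ ω, (nz d Aᶜ ω - c) ^ 2 ∂(Gs m d) := by
        rw [integral_add m3 m4, integral_const_mul, integral_const_mul]
        congr 2
        have := integral_map (μ := (Gs m d).prod (Gs m d)) (f := fun ω => (nz d Aᶜ ω - c) ^ 2)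
          hrot.aemeasurable (((measurable_nz hAc).sub_const c).pow_const 2).aestronglyMeasurable
        rw [← this, hrot.map_eq]
    _ ≤ _ := by
        have h1 := integral_nz_sub_sq_le hd hi h hir
        have h2 := var_nz_le hd hi hAc
        linarith
end

section

lemma integral_abs_le_sq {Ω : Type*} [MeasurableSpace Ω] {P : Measure Ω} [IsProbabilityMeasure P]
    {U W : Ω → ℝ} (hU : MemLp U 2 P) (hW : MemLp W 2 P) {δ : ℝ} (hδ : 0 < δ) :
    ∫ ω, |U ω * W ω| ∂P ≤ δ * ∫ ω, W ω ^ 2 ∂P + (∫ ω, U ω ^ 2 ∂P) / δ := by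
  rw [← integral_const_mul, ← integral_div,
    ← integral_add (hW.integrable_sq.const_mul δ) (hU.integrable_sq.div_const δ)]
  refine integral_mono (hU.integrable_mul hW).abs
    ((hW.integrable_sq.const_mul δ).add (hU.integrable_sq.div_const δ)) fun ω => ?_
  have h : δ * W ω ^ 2 + U ω ^ 2 / δ - |U ω * W ω|
      = ((δ * |W ω| - |U ω|) ^ 2 + δ * |W ω| * |U ω|) / δ := by
    rw [abs_mul, ← sq_abs (W ω), ← sq_abs (U ω)]; field_simp; ring
  have : 0 ≤ δ * W ω ^ 2 + U ω ^ 2 / δ - |U ω * W ω| := h ▸ by positivity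
  simpa using this

lemma norm_charFun_sub_le_of_close {Ω : Type*} [MeasurableSpace Ω] {P : Measure Ω} [IsProbabilityMeasure P]
    {Z X : Ω → ℝ} (hZ : MemLp Z 2 P) (hX : MemLp X 2 P) (θ V : ℝ) (hV : 0 ≤ V)
    {δ : ℝ} (hδ : 0 < δ) (hδ1 : δ ≤ 1) (hD : ∫ ω, (Z ω - X ω) ^ 2 ∂P ≤ δ ^ 2) :
    ‖charFun (P.map Z) θ - (Real.exp (-(θ ^ 2 * V / 2)) : ℂ)‖
      ≤ ‖charFun (P.map X) θ - (Real.exp (-(θ ^ 2 * (∫ ω, X ω ^ 2 ∂P) / 2)) : ℂ)‖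
        + δ * (2 * |θ| + θ ^ 2 * (2 + ∫ ω, Z ω ^ 2 ∂P)) + θ ^ 2 * |∫ ω, Z ω ^ 2 ∂P - V| := by
  have hU : MemLp (fun ω => Z ω - X ω) 2 P := hZ.sub hX
  have hDδ : (∫ ω, (Z ω - X ω) ^ 2 ∂P) / δ ≤ δ := by
    rw [div_le_iff₀ hδ]; linarith [sq δ]
  have hexp : ∀ {Y : Ω → ℝ}, MemLp Y 2 P →
      Integrable (fun ω => Complex.exp ((θ * Y ω : ℝ) * Complex.I)) P := fun hY =>
    (integrable_const (1 : ℝ)).mono' (by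
      have := hY.1
      fun_prop) (Eventually.of_forall fun ω => by rw [Complex.norm_exp_ofReal_mul_I])
  have h1 : ‖charFun (P.map Z) θ - charFun (P.map X) θ‖ ≤ |θ| * (2 * δ) := by
    rw [charFun_map_eq hZ.1.aemeasurable, charFun_map_eq hX.1.aemeasurable,
      ← integral_sub (hexp hZ) (hexp hX)]
    have hi : Integrable (fun ω => |Z ω - X ω|) P := (hU.integrable one_le_two).abs
    refine (norm_integral_le_of_norm_le (hi.const_mul |θ|) (Eventually.of_forall fun ω => ?_)).trans ?_
    · have e : Complex.exp ((θ * Z ω : ℝ) * Complex.I) - Complex.exp ((θ * X ω : ℝ) * Complex.I)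
          = Complex.exp ((θ * X ω : ℝ) * Complex.I)
            * (Complex.exp (Complex.I * (θ * (Z ω - X ω) : ℝ)) - 1) := by
        rw [mul_sub, ← Complex.exp_add]; push_cast; ring_nf
      rw [e, norm_mul, Complex.norm_exp_ofReal_mul_I, one_mul, ← abs_mul]
      exact Real.norm_exp_I_mul_ofReal_sub_one_le
    · rw [integral_const_mul]
      have h := integral_abs_le_sq hU (memLp_const (1 : ℝ)) hδ
      simp only [mul_one, one_pow, integral_const, probReal_univ, smul_eq_mul] at h
      gcongr
      linarith
  have h2 : |∫ ω, X ω ^ 2 ∂P - V| ≤ δ * (4 + 2 * ∫ ω, Z ω ^ 2 ∂P) + |∫ ω, Z ω ^ 2 ∂P - V| := by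
    have hi : Integrable (fun ω => (Z ω - X ω) * Z ω) P := hU.integrable_mul hZ
    have e : ∫ ω, X ω ^ 2 ∂P - V = (∫ ω, (Z ω - X ω) ^ 2 ∂P)
        - 2 * (∫ ω, (Z ω - X ω) * Z ω ∂P) + (∫ ω, Z ω ^ 2 ∂P - V) := by
      rw [show (fun ω => X ω ^ 2) = fun ω => (Z ω - X ω) ^ 2 - 2 * ((Z ω - X ω) * Z ω) + Z ω ^ 2 by
        ext; ring, integral_add (f := fun ω => (Z ω - X ω) ^ 2 - 2 * ((Z ω - X ω) * Z ω))
          (hU.integrable_sq.sub (hi.const_mul 2)) hZ.integrable_sq,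
        integral_sub hU.integrable_sq (hi.const_mul 2), integral_const_mul]
      ring
    have h := (abs_integral_le_integral_abs (f := fun ω => (Z ω - X ω) * Z ω) (μ := P)).trans
      (integral_abs_le_sq hU hZ hδ)
    have h0 : 0 ≤ ∫ ω, (Z ω - X ω) ^ 2 ∂P := integral_nonneg fun ω => sq_nonneg _
    have h3 : δ ^ 2 ≤ δ := by nlinarith
    rw [e]
    refine (abs_add_le _ _).trans (add_le_add ((abs_sub _ _).trans ?_) le_rfl)
    rw [abs_of_nonneg h0, abs_mul, abs_two]
    linarith
  have h3 : ‖(Real.exp (-(θ ^ 2 * (∫ ω, X ω ^ 2 ∂P) / 2)) : ℂ) - (Real.exp (-(θ ^ 2 * V / 2)) : ℂ)‖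
      ≤ θ ^ 2 / 2 * |∫ ω, X ω ^ 2 ∂P - V| := by
    rw [← Complex.ofReal_sub, Complex.norm_real, Real.norm_eq_abs]
    have : 0 ≤ ∫ ω, X ω ^ 2 ∂P := integral_nonneg fun ω => sq_nonneg _
    refine (abs_exp_neg_sub_exp_neg_le (by positivity) (by positivity)).trans (le_of_eq ?_)
    rw [mul_div_right_comm, mul_div_right_comm, ← mul_sub, abs_mul, abs_of_nonneg (by positivity)]
  have h4 := norm_sub_le_norm_sub_add_norm_sub (charFun (P.map Z) θ) (charFun (P.map X) θ)
    (Real.exp (-(θ ^ 2 * V / 2)) : ℂ)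
  have h5 := norm_sub_le_norm_sub_add_norm_sub (charFun (P.map X) θ)
    (Real.exp (-(θ ^ 2 * (∫ ω, X ω ^ 2 ∂P) / 2)) : ℂ) (Real.exp (-(θ ^ 2 * V / 2)) : ℂ)
  have h6 := mul_le_mul_of_nonneg_left h2 (show 0 ≤ θ ^ 2 / 2 by positivity)
  have h7 := mul_nonneg (sq_nonneg θ) (abs_nonneg (∫ ω, Z ω ^ 2 ∂P - V))
  linarith

theorem tendsto_integral_gaussianReal_of_approx {Ω : ℕ → Type*} [∀ d, MeasurableSpace (Ω d)]
    {P : ∀ d, Measure (Ω d)} [∀ d, IsProbabilityMeasure (P d)] {Z : ∀ d, Ω d → ℝ}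
    (hZ : ∀ d, Measurable (Z d)) (hm : ∀ᶠ d in atTop, MemLp (Z d) 2 (P d)) {V : NNReal}
    (hV : Tendsto (fun d => ∫ ω, Z d ω ^ 2 ∂(P d)) atTop (nhds V))
    (happ : ∀ η > 0, ∃ X : ∀ d, Ω d → ℝ,
      (∀ᶠ d in atTop, MemLp (X d) 2 (P d) ∧ ∫ ω, (Z d ω - X d ω) ^ 2 ∂(P d) ≤ η) ∧
      ∀ θ, Tendsto (fun d => charFun ((P d).map (X d)) θ
        - (Real.exp (-(θ ^ 2 * (∫ ω, X d ω ^ 2 ∂(P d)) / 2)) : ℂ)) atTop (nhds 0))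
    (f : BoundedContinuousFunction ℝ ℝ) :
    Tendsto (fun d => ∫ ω, f (Z d ω) ∂(P d)) atTop (nhds (∫ x, f x ∂(gaussianReal 0 V))) := by
  have hp : ∀ d, IsProbabilityMeasure ((P d).map (Z d)) := fun d =>
    Measure.isProbabilityMeasure_map (hZ d).aemeasurable
  have h := (ProbabilityMeasure.tendsto_iff_tendsto_charFun
    (μ := fun d => (⟨(P d).map (Z d), hp d⟩ : ProbabilityMeasure ℝ))
    (μ₀ := ⟨gaussianReal 0 V, inferInstance⟩)).2 fun θ => ?_
  · have h2 := ProbabilityMeasure.tendsto_iff_forall_integral_tendsto.1 h f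
    refine h2.congr fun d => ?_
    exact integral_map (hZ d).aemeasurable f.continuous.aestronglyMeasurable
  have e : charFun (gaussianReal 0 V) θ = (Real.exp (-(θ ^ 2 * V / 2)) : ℂ) := by
    rw [charFun_gaussianReal]; push_cast; congr 1; ring
  change Tendsto (fun d => charFun ((P d).map (Z d)) θ) atTop (nhds (charFun (gaussianReal 0 V) θ))
  rw [e, tendsto_iff_norm_sub_tendsto_zero, Metric.tendsto_nhds]
  intro ε hε
  set M : ℝ := 2 * |θ| + θ ^ 2 * (2 + (V + 1)) + 1
  have hM : 0 < M := by positivity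
  set δ := min 1 (ε / 2 / M)
  have hδ : 0 < δ := by positivity
  obtain ⟨X, hX, hc⟩ := happ (δ ^ 2) (by positivity)
  have h0 : Tendsto (fun d => ‖charFun ((P d).map (X d)) θ
      - (Real.exp (-(θ ^ 2 * (∫ ω, X d ω ^ 2 ∂(P d)) / 2)) : ℂ)‖
      + θ ^ 2 * |∫ ω, Z d ω ^ 2 ∂(P d) - V|) atTop (nhds 0) := by
    have := (hc θ).norm.add (((hV.sub_const (V : ℝ)).abs).const_mul (θ ^ 2))
    simpa using this
  filter_upwards [hm, hX, h0.eventually_lt_const (half_pos hε),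
    hV.eventually_lt_const (lt_add_one (V : ℝ))] with d h1 h2 h3 h4
  have h5 := norm_charFun_sub_le_of_close h1 h2.1 θ V V.2 hδ (min_le_left _ _) h2.2
  have h6 : δ * (2 * |θ| + θ ^ 2 * (2 + ∫ ω, Z d ω ^ 2 ∂(P d))) ≤ ε / 2 := by
    calc _ ≤ δ * M := by
          have := mul_le_mul_of_nonneg_left h4.le (sq_nonneg θ)
          refine mul_le_mul_of_nonneg_left ?_ hδ.le
          linarith
      _ ≤ ε / 2 / M * M := by gcongr; exact min_le_right _ _
      _ = _ := by field_simp
  rw [Real.dist_eq, sub_zero, abs_of_nonneg (norm_nonneg _)]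
  linarith
end

section

variable {m d : ℕ}

lemma integrable_and_integral_le {Ω : Type*} [MeasurableSpace Ω] {P : Measure Ω} {f : Ω → ℝ}
    (hf : Measurable f) (h0 : ∀ ω, 0 ≤ f ω) {b : ℝ} (hb : 0 ≤ b)
    (h : ∫⁻ ω, ENNReal.ofReal (f ω) ∂P ≤ ENNReal.ofReal b) : Integrable f P ∧ ∫ ω, f ω ∂P ≤ b := by
  refine ⟨lintegral_ofReal_ne_top_iff_integrable hf.aestronglyMeasurable
    (Eventually.of_forall h0) |>.1 (h.trans_lt ENNReal.ofReal_lt_top).ne, ?_⟩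
  rw [integral_eq_lintegral_of_nonneg_ae (Eventually.of_forall h0) hf.aestronglyMeasurable]
  exact ENNReal.toReal_le_of_le_ofReal hb h

/-- Moments of the blocks as real numbers. -/
def blkC (m : ℕ) (ρ : ℝ) (n : ℕ) : ℝ := (psiC m ρ n).toReal

lemma blk_integral_le {r ρ v : ℝ} (hρ : 0 < ρ) (h : r ^ 2 + ρ ^ 2 = 1) (hd0 : 0 < d)
    {T : Set (Fin m → ℝ)} (hT : MeasurableSet T) (hv : 0 ≤ v) (hTv : volume T ≤ ENNReal.ofReal v)
    (C : Set (Jx m d)) (n : ℕ) :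
    Integrable (fun ω => |blk r ρ T C ω| ^ (n + 1)) (Gs m d) ∧
      ∫ ω, |blk r ρ T C ω| ^ (n + 1) ∂(Gs m d) ≤ (v * √d ^ m) ^ (n + 1) * blkC m ρ (n + 1) := by
  refine integrable_and_integral_le ((measurable_blk r ρ T C).norm.pow_const _)
    (fun _ => by positivity) (mul_nonneg (by positivity) ENNReal.toReal_nonneg)
    ((blk_moment_le hρ h hd0 hT (hTv.trans_lt ENNReal.ofReal_lt_top).ne C n).trans ?_)
  rw [ENNReal.ofReal_mul (by positivity), ENNReal.ofReal_pow (mul_nonneg hv (by positivity)),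
    ENNReal.ofReal_mul (p := v) hv, blkC, ENNReal.ofReal_toReal (psiC_lt_top ..).ne]
  gcongr

lemma memLp_blk {r ρ v : ℝ} (hρ : 0 < ρ) (h : r ^ 2 + ρ ^ 2 = 1) (hd0 : 0 < d)
    {T : Set (Fin m → ℝ)} (hT : MeasurableSet T) (hv : 0 ≤ v) (hTv : volume T ≤ ENNReal.ofReal v)
    (C : Set (Jx m d)) : MemLp (blk r ρ T C) 3 (Gs m d) := by
  rw [← integrable_norm_rpow_iff (measurable_blk r ρ T C).aestronglyMeasurable (by simp) (by simp)]
  have := (blk_integral_le hρ h hd0 hT hv hTv C 2).1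
  refine this.congr (Eventually.of_forall fun ω => ?_)
  simp only [ENNReal.toReal_ofNat, Real.norm_eq_abs]
  exact_mod_cast rfl

/-- The normalized centered blocks. -/
def nblk (r ρ : ℝ) (T : Set (Fin m → ℝ)) (C : Set (Jx m d)) (ω : Cf m d) : ℝ :=
  (blk r ρ T C ω - ∫ ω, blk r ρ T C ω ∂(Gs m d)) / √(√d ^ m)

lemma memLp_nblk {r ρ v : ℝ} (hρ : 0 < ρ) (h : r ^ 2 + ρ ^ 2 = 1) (hd0 : 0 < d)
    {T : Set (Fin m → ℝ)} (hT : MeasurableSet T) (hv : 0 ≤ v) (hTv : volume T ≤ ENNReal.ofReal v)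
    (C : Set (Jx m d)) : MemLp (nblk r ρ T C) 3 (Gs m d) :=
  (((memLp_blk hρ h hd0 hT hv hTv C).sub (memLp_const _)).mul_const (√(√d ^ m))⁻¹).congr_norm
    (((measurable_blk r ρ T C).sub_const _).div_const _).aestronglyMeasurable
    (Eventually.of_forall fun ω => by simp only [nblk, div_eq_mul_inv]; rfl)

lemma integral_nblk_abs_pow_le {r ρ v : ℝ} (hρ : 0 < ρ) (h : r ^ 2 + ρ ^ 2 = 1) (hd0 : 0 < d)
    {T : Set (Fin m → ℝ)} (hT : MeasurableSet T) (hv : 0 ≤ v) (hTv : volume T ≤ ENNReal.ofReal v)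
    (C : Set (Jx m d)) (n : ℕ) :
    ∫ ω, |nblk r ρ T C ω| ^ (n + 1) ∂(Gs m d) ≤
      2 ^ n * (v * √(√d ^ m)) ^ (n + 1) * (blkC m ρ (n + 1) + blkC m ρ 1 ^ (n + 1)) := by
  set s := √(√d ^ m)
  have hs : 0 < s := by positivity
  have hq : √(d : ℝ) ^ m = s ^ 2 := (Real.sq_sqrt (by positivity)).symm
  set e := ∫ ω, blk r ρ T C ω ∂(Gs m d)
  have he : |e| ≤ v * s ^ 2 * blkC m ρ 1 := by
    have := (blk_integral_le hρ h hd0 hT hv hTv C 0).2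
    simp only [zero_add, pow_one, hq] at this
    exact abs_integral_le_integral_abs.trans this
  obtain ⟨hi, hb⟩ := blk_integral_le hρ h hd0 hT hv hTv C n
  have hI : Integrable (fun ω => 2 ^ n * (|blk r ρ T C ω| ^ (n + 1) + |e| ^ (n + 1)) / s ^ (n + 1))
      (Gs m d) := ((hi.add (integrable_const _)).const_mul _).div_const _
  calc _ ≤ ∫ ω, 2 ^ n * (|blk r ρ T C ω| ^ (n + 1) + |e| ^ (n + 1)) / s ^ (n + 1) ∂(Gs m d) := by
        refine integral_mono_of_nonneg (Eventually.of_forall fun _ => by positivity) hI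
          (Eventually.of_forall fun ω => ?_)
        simp only [nblk, abs_div, div_pow]
        rw [abs_of_pos hs]
        gcongr
        refine (pow_le_pow_left₀ (abs_nonneg _) (abs_sub _ _) _).trans ?_
        simpa using add_pow_le (abs_nonneg _) (abs_nonneg _) (n + 1)
    _ = 2 ^ n * ((∫ ω, |blk r ρ T C ω| ^ (n + 1) ∂(Gs m d)) + |e| ^ (n + 1)) / s ^ (n + 1) := by
        rw [integral_div, integral_const_mul, integral_add hi (integrable_const _)]
        simp
    _ ≤ 2 ^ n * ((v * s ^ 2) ^ (n + 1) * blkC m ρ (n + 1) + (v * s ^ 2 * blkC m ρ 1) ^ (n + 1))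
          / s ^ (n + 1) := by
        rw [hq] at hb
        gcongr
    _ = _ := by
        simp only [mul_pow, ← pow_mul, mul_comm 2 (n + 1)]
        rw [pow_mul s]
        field_simp

variable {ι : Type*} [Fintype ι]

lemma norm_charFun_nblk_sub_le {r ρ v : ℝ} (hρ : 0 < ρ) (h : r ^ 2 + ρ ^ 2 = 1) (hd0 : 0 < d)
    (hv : 0 ≤ v) {T : ι → Set (Fin m → ℝ)} (hT : ∀ b, MeasurableSet (T b))
    (hTv : ∀ b, volume (T b) ≤ ENNReal.ofReal v) {C : ι → Set (Jx m d)}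
    (hC : Pairwise (Function.onFun Disjoint C)) (θ : ℝ) :
    ‖charFun ((Gs m d).map fun ω => ∑ b, nblk r ρ (T b) (C b) ω) θ
        - (Real.exp (-(θ ^ 2 * (∫ ω, (∑ b, nblk r ρ (T b) (C b) ω) ^ 2 ∂(Gs m d)) / 2)) : ℂ)‖
      ≤ Fintype.card ι * (4 * |θ| ^ 3 * (4 * (v * √(√d ^ m)) ^ 3 * (blkC m ρ 3 + blkC m ρ 1 ^ 3))
        + (θ ^ 2 * (2 * (v * √(√d ^ m)) ^ 2 * (blkC m ρ 2 + blkC m ρ 1 ^ 2)) / 2) ^ 2) := by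
  refine norm_charFun_sum_sub_le (fun b => memLp_nblk hρ h hd0 (hT b) hv (hTv b) _) (fun b => ?_)
    ?_ (fun b => ?_) (fun b => ?_) θ
  · have hi := (memLp_blk hρ h hd0 (hT b) hv (hTv b) (C b)).integrable (by norm_num)
    simp only [nblk]
    rw [integral_div, integral_sub hi (integrable_const _)]
    simp
  · exact (iIndepFun_of_indicator (C := fun b => Prod.snd ⁻¹' C b)
      (F := fun b => blk r ρ (T b) (C b)) (fun a b hab => (hC hab).preimage _)
      (fun b => measurable_blk ..) (fun b ω => blk_indicator ..)).comp
      (fun b x => (x - ∫ ω, blk r ρ (T b) (C b) ω ∂(Gs m d)) / √(√d ^ m)) (fun b => by fun_prop)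
  · simpa using integral_nblk_abs_pow_le hρ h hd0 (hT b) hv (hTv b) (C b) 1
  · refine (integral_nblk_abs_pow_le hρ h hd0 (hT b) hv (hTv b) (C b) 2).trans (le_of_eq ?_)
    norm_num

variable [NeZero m]

lemma integral_nz_sub_nblk_le (hd : 2 ≤ d) (hi : IntK m d 1) {r ρ v c : ℝ} (hr0 : 0 ≤ r)
    (hr1 : r ≤ 1) (hρ : 0 < ρ) (h : r ^ 2 + ρ ^ 2 = 1) (hir : IntK m d r) (hv : 0 ≤ v) (hc : 0 < c)
    {T : ι → Set (Fin m → ℝ)} (hT : ∀ b, IsCompact (T b)) (hTd : Pairwise (Function.onFun Disjoint T))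
    (hTv : ∀ b, volume (T b) ≤ ENNReal.ofReal v) {C : ι → Set (Jx m d)}
    (h1 : ∀ b, ∀ t ∈ T b, (C b)ᶜ.indicator (ft d t) ⬝ᵥ (C b)ᶜ.indicator (ft d t) ≤ c)
    (h2 : ∀ b, ∀ t ∈ T b, ∀ k,
      (C b)ᶜ.indicator (dft d t k) ⬝ᵥ (C b)ᶜ.indicator (dft d t k) ≤ d * c) :
    ∫ ω, ((nz d Set.univ ω - √d ^ m) / √(√d ^ m) - ∑ b, nblk r ρ (T b) (C b) ω) ^ 2 ∂(Gs m d)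
      ≤ 8 * (1 + Ik m d 1 - Ik m d r) + 4 * (muB (⋃ b, T b)ᶜ).toReal * (1 + Jk m d)
        + 2 * (Fintype.card ι * v) ^ 2 * √d ^ m * c * (dPsiC m ρ).toReal := by
  have hd0 : 0 < d := by omega
  set A := ⋃ b, T b
  have hA : IsCompact A := isCompact_iUnion hT
  set s := √(√d ^ m)
  have hs : 0 < s := by positivity
  have hq : √(d : ℝ) ^ m = s ^ 2 := (Real.sq_sqrt (by positivity)).symm
  set κ := √d ^ m * (muB Aᶜ).toReal
  set W : Cf m d → ℝ := fun ω => nz d Set.univ ω - κ - ∑ b, blk r ρ (T b) (C b) ω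
  have hTm := fun b => (hT b).measurableSet
  have hN := memLp_nz hd hi (isSigmaCompact_univ (X := Fin m → ℝ))
  have hS : ∀ b, MemLp (blk r ρ (T b) (C b)) 2 (Gs m d) := fun b =>
    (memLp_blk hρ h hd0 (hTm b) hv (hTv b) (C b)).mono_exponent (by norm_num)
  have hW : MemLp W 2 (Gs m d) := (hN.sub (memLp_const _)).sub (memLp_finsetSum _ fun b _ => hS b)
  have e1 : ∀ ω, (nz d Set.univ ω - √d ^ m) / s - ∑ b, nblk r ρ (T b) (C b) ω
      = (W ω - ∫ ω, W ω ∂(Gs m d)) / s := fun ω => by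
    have : ∫ ω, W ω ∂(Gs m d) = √d ^ m - κ - ∑ b, ∫ ω, blk r ρ (T b) (C b) ω ∂(Gs m d) := by
      have i1 := hN.integrable one_le_two
      have i2 := fun b => (hS b).integrable one_le_two
      simp only [W]
      rw [integral_sub (f := fun ω => nz d Set.univ ω - κ) (i1.sub (integrable_const _)) (integrable_finsetSum _ fun b _ => i2 b),
        integral_sub i1 (integrable_const _), integral_finsetSum _ fun b _ => i2 b,
        integral_nz hd0.ne' isSigmaCompact_univ, muB_univ]
      simp
    simp only [this, W, nblk, ← Finset.sum_div, Finset.sum_sub_distrib]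
    ring
  simp only [e1, div_pow]
  rw [integral_div, div_le_iff₀ (by positivity), integral_sub_sq hW rfl]
  refine (sub_le_self _ (sq_nonneg _)).trans ?_
  have hJ : 0 ≤ Jk m d := Jk_nonneg
  have hD : 0 ≤ 1 + Ik m d 1 - Ik m d r := by
    have := (integral_nonneg fun p => sq_nonneg _).trans (integral_nz_sub_sq_le hd hi h hir)
    exact nonneg_of_mul_nonneg_right this (by positivity)
  refine (integrable_and_integral_le (f := fun ω => W ω ^ 2) ?_ (fun _ => sq_nonneg _) ?_ ?_).2
  · have := measurable_nz (d := d) (isSigmaCompact_univ (X := Fin m → ℝ))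
    have := fun b => measurable_blk r ρ (T b) (C b)
    fun_prop
  · positivity
  have hbm := fun b C => measurable_blk (m := m) (d := d) r ρ (T b) C
  have hm1 : Measurable fun ω : Cf m d => nz d Set.univ ω - κ - blk r ρ A Set.univ ω :=
    ((measurable_nz isSigmaCompact_univ).sub_const _).sub (measurable_blk ..)
  have hv2 : volume A ≠ ⊤ := hA.measure_lt_top.ne
  calc ∫⁻ ω, ENNReal.ofReal (W ω ^ 2) ∂(Gs m d)
      ≤ ∫⁻ ω, (ENNReal.ofReal 2 * ENNReal.ofReal (|nz d Set.univ ω - κ - blk r ρ A Set.univ ω| ^ 2)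
        + ENNReal.ofReal (2 * Fintype.card ι) * ∑ b, ENNReal.ofReal
          (|blk r ρ (T b) Set.univ ω - blk r ρ (T b) (C b) ω| ^ 2)) ∂(Gs m d) := by
        refine lintegral_mono_ae ?_
        filter_upwards [blk_iUnion hρ h hd0 (fun b => (hT b).isSigmaCompact) hTd hv2] with ω hω
        have e2 : W ω = (nz d Set.univ ω - κ - blk r ρ A Set.univ ω)
            + ∑ b, (blk r ρ (T b) Set.univ ω - blk r ρ (T b) (C b) ω) := by
          rw [hω, Finset.sum_sub_distrib]; ring
        rw [← ENNReal.ofReal_sum_of_nonneg (fun _ _ => by positivity), ← ENNReal.ofReal_mul zero_le_two,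
          ← ENNReal.ofReal_mul (by positivity), ← ENNReal.ofReal_add (by positivity) (by positivity)]
        refine ENNReal.ofReal_le_ofReal ?_
        simp only [sq_abs]
        rw [e2]
        have h3 := sq_sum_le_card_mul_sum_sq (s := Finset.univ)
          (f := fun b => blk r ρ (T b) Set.univ ω - blk r ρ (T b) (C b) ω)
        have h4 := add_sq_le (a := nz d Set.univ ω - κ - blk r ρ A Set.univ ω)
          (b := ∑ b, (blk r ρ (T b) Set.univ ω - blk r ρ (T b) (C b) ω))
        rw [Finset.card_univ] at h3
        linarith
    _ = ENNReal.ofReal 2 * (∫⁻ ω, ENNReal.ofReal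
          (|nz d Set.univ ω - κ - blk r ρ A Set.univ ω| ^ 2) ∂(Gs m d))
        + ENNReal.ofReal (2 * Fintype.card ι) * ∑ b, ∫⁻ ω, ENNReal.ofReal
          (|blk r ρ (T b) Set.univ ω - blk r ρ (T b) (C b) ω| ^ 2) ∂(Gs m d) := by
        rw [lintegral_add_left ((hm1.abs.pow_const 2).ennreal_ofReal.const_mul _),
          lintegral_const_mul' _ _ ENNReal.ofReal_ne_top,
          lintegral_const_mul' _ _ ENNReal.ofReal_ne_top, lintegral_finsetSum _ fun b _ => ?_]
        have := hbm b
        fun_prop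
    _ ≤ ENNReal.ofReal 2 * ENNReal.ofReal (√d ^ m * (4 * (1 + Ik m d 1 - Ik m d r)
          + 2 * (muB Aᶜ).toReal * (1 + Jk m d))) + ENNReal.ofReal (2 * Fintype.card ι)
          * ∑ b : ι, ENNReal.ofReal ((v * √d ^ m) ^ 2 * (c * (dPsiC m ρ).toReal)) := by
        gcongr with b
        · exact lintegral_nz_sub_blk_le hd hi hρ h hir hA
        · refine (blk_sub_moment_le hr0 hr1 hρ h hd0 hc (hTm b)
            ((hTv b).trans_lt ENNReal.ofReal_lt_top).ne (C b) (h1 b) (h2 b)).trans ?_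
          rw [ENNReal.ofReal_mul (by positivity), ENNReal.ofReal_mul (p := c) hc.le,
            ENNReal.ofReal_pow (mul_nonneg hv (by positivity)), ENNReal.ofReal_mul (p := v) hv,
            ENNReal.ofReal_toReal (dPsiC_lt_top m ρ).ne]
          gcongr
          exact hTv b
    _ = _ := by
        rw [← ENNReal.ofReal_sum_of_nonneg (fun _ _ => by positivity), ← ENNReal.ofReal_mul zero_le_two,
          ← ENNReal.ofReal_mul (by positivity), ← ENNReal.ofReal_add (by positivity) (by positivity),
          Finset.sum_const, Finset.card_univ, nsmul_eq_mul, hq]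
        congr 1
        ring
end

section

variable {m d : ℕ}

/-- The blocks: points of the box `K⁻¹ ≤ |t k| ≤ K` whose cell of mesh `K / N` is `b`, at distance at
least `g` from its boundary. -/
def tblk (K g : ℝ) (N : ℕ) (b : Fin m → Fin N) : Set (Fin m → ℝ) :=
  {t | ∀ k, K⁻¹ ≤ |t k| ∧ b k * (K / N) + g ≤ |t k| ∧ |t k| + g ≤ (b k + 1) * (K / N)}

/-- The coefficient cells attached to the blocks. -/
def cblk (K : ℝ) (N : ℕ) (b : Fin m → Fin N) : Set (Jx m d) :=
  cell (fun k => b k * (K / N)) fun k => (b k + 1) * (K / N)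

lemma exists_add_one_le_of_ne {N : ℕ} {a b : Fin m → Fin N} (h : a ≠ b) :
    ∃ k, (a k : ℝ) + 1 ≤ b k ∨ (b k : ℝ) + 1 ≤ a k := by
  obtain ⟨k, hk⟩ := Function.ne_iff.1 h
  refine ⟨k, ?_⟩
  rcases lt_or_gt_of_ne hk with h | h
  · left; exact_mod_cast h
  · right; exact_mod_cast h

lemma pairwise_disjoint_cblk {K : ℝ} (hK : 0 ≤ K) (N : ℕ) :
    Pairwise (Function.onFun Disjoint fun b : Fin m → Fin N => (cblk K N b : Set (Jx m d))) := by
  have key : ∀ (x y : ℝ) (j : Jx m d) (k : Fin m), 0 ≤ x → x + 1 ≤ y →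
      ((j.1 k : ℕ) : ℝ) < ((x + 1) * (K / N)) ^ 2 * j.deg0 →
      (y * (K / N)) ^ 2 * j.deg0 ≤ (j.1 k : ℕ) → False := fun x y j k hx hxy h1 h2 => by
    have : ((x + 1) * (K / N)) ^ 2 * j.deg0 ≤ (y * (K / N)) ^ 2 * j.deg0 := by gcongr
    linarith
  refine fun a b hab => Set.disjoint_left.2 fun j ha hb => ?_
  obtain ⟨k, h | h⟩ := exists_add_one_le_of_ne hab
  · exact key _ _ j k (by positivity) h (ha k).2 (hb k).1
  · exact key _ _ j k (by positivity) h (hb k).2 (ha k).1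

lemma pairwise_disjoint_tblk {K g : ℝ} (hK : 0 ≤ K) (hg : 0 < g) (N : ℕ) :
    Pairwise (Function.onFun Disjoint (tblk K g N : (Fin m → Fin N) → Set (Fin m → ℝ))) := by
  refine fun a b hab => Set.disjoint_left.2 fun t ha hb => ?_
  have hKN : 0 ≤ K / N := by positivity
  obtain ⟨k, h | h⟩ := exists_add_one_le_of_ne hab
  · linarith [(ha k).2.2, (hb k).2.1, mul_le_mul_of_nonneg_right h hKN]
  · linarith [(ha k).2.1, (hb k).2.2, mul_le_mul_of_nonneg_right h hKN]

lemma cell_le {K : ℝ} (hK : 0 ≤ K) {N : ℕ} (i : Fin N) : ((i : ℝ) + 1) * (K / N) ≤ K := by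
  have hi : (i : ℝ) + 1 ≤ N := by exact_mod_cast i.2
  have hN : (0 : ℝ) < N := by have : (0 : ℝ) ≤ i := by positivity
                              linarith
  calc _ ≤ N * (K / N) := by gcongr
    _ = K := by field_simp

lemma tblk_subset {K g : ℝ} (hg : 0 ≤ g) (N : ℕ) (b : Fin m → Fin N) :
    tblk K g N b ⊆ Set.univ.pi fun k => Set.Icc (b k * (K / N)) ((b k + 1) * (K / N)) ∪
      Set.Icc (-((b k + 1) * (K / N))) (-(b k * (K / N))) := fun t ht k _ => by
  obtain ⟨-, h1, h2⟩ := ht k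
  rcases abs_cases (t k) with ⟨h, -⟩ | ⟨h, -⟩
  · left; constructor <;> linarith
  · right; constructor <;> linarith

lemma isCompact_tblk {K g : ℝ} (hg : 0 ≤ g) (N : ℕ) (b : Fin m → Fin N) :
    IsCompact (tblk K g N b) := by
  refine (isCompact_univ_pi fun k => isCompact_Icc.union isCompact_Icc).of_isClosed_subset ?_
    (tblk_subset hg N b)
  simp only [tblk, Set.ofPred_forall, Set.ofPred_and]
  refine isClosed_iInter fun k => (isClosed_le ?_ ?_).inter ((isClosed_le ?_ ?_).inter
    (isClosed_le ?_ ?_)) <;> fun_prop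

lemma volume_tblk_le {K g : ℝ} (hK : 0 ≤ K) (hg : 0 ≤ g) (N : ℕ) (b : Fin m → Fin N) :
    volume (tblk K g N b) ≤ ENNReal.ofReal ((2 * (K / N)) ^ m) := by
  refine (measure_mono (tblk_subset hg N b)).trans ?_
  rw [volume_pi, Measure.pi_pi, ENNReal.ofReal_pow (by positivity)]
  refine (Finset.prod_le_prod' fun k _ => ?_).trans_eq
    (by rw [Finset.prod_const, Finset.card_univ, Fintype.card_fin])
  refine (measure_union_le _ _).trans ?_
  rw [Real.volume_Icc, Real.volume_Icc, ← ENNReal.ofReal_add (by linarith [show 0 ≤ K / N by positivity])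
    (by linarith [show 0 ≤ K / N by positivity])]
  exact ENNReal.ofReal_le_ofReal (by linarith)

/-- Complement of the box. -/
def farSet (m : ℕ) (K : ℝ) : Set (Fin m → ℝ) := {t | ∃ k, |t k| < K⁻¹ ∨ K ≤ |t k|}

/-- Points close to the boundary of some cell in the `k`-th coordinate. -/
def gapSet (K g : ℝ) (N : ℕ) (k : Fin m) : Set (Fin m → ℝ) :=
  Set.univ.pi (Function.update (fun _ => Set.Icc (-K) K) k
    (⋃ i ∈ Finset.range (N + 1), (Metric.ball (i * (K / N)) g ∪ Metric.ball (-(i * (K / N))) g)))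

lemma compl_tblk_subset {K g : ℝ} (hK : 0 < K) {N : ℕ} (hN : 0 < N) :
    (⋃ b : Fin m → Fin N, tblk K g N b)ᶜ ⊆ farSet m K ∪ ⋃ k, gapSet K g N k := by
  intro t ht
  by_contra! hc
  simp only [Set.mem_union, farSet, Set.mem_ofPred_eq, not_or, not_exists, Set.mem_iUnion, not_le,
    not_lt] at hc
  obtain ⟨h1, h2⟩ := hc
  have hN' : (0 : ℝ) < N := by exact_mod_cast hN
  have hℓ : 0 < K / N := by positivity
  have h3 : ∀ k, ∀ i ≤ N, g ≤ |(|t k|) - i * (K / N)| := fun k i hi => by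
    by_contra! hlt
    refine h2 k fun k' _ => ?_
    rcases eq_or_ne k' k with rfl | hk
    · rw [Function.update_self]
      refine Set.mem_biUnion (x := i) (by simpa [Nat.lt_succ_iff] using hi) ?_
      rw [Set.mem_union, Metric.mem_ball, Metric.mem_ball, Real.dist_eq, Real.dist_eq]
      rcases abs_cases (t k') with ⟨h, -⟩ | ⟨h, -⟩
      · left; rwa [h] at hlt
      · right; rw [sub_neg_eq_add, add_comm]; rwa [h, ← abs_neg, neg_sub, sub_neg_eq_add] at hlt
    · rw [Function.update_of_ne hk]
      exact abs_le.1 (h1 k').2.le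
  have h4 : ∀ k, ⌊|t k| / (K / N)⌋₊ < N := fun k => by
    rw [Nat.floor_lt (by positivity), div_lt_iff₀ hℓ, mul_div_cancel₀ _ hN'.ne']
    exact (h1 k).2
  refine ht (Set.mem_iUnion.2 ⟨fun k => ⟨_, h4 k⟩, fun k => ⟨(h1 k).1, ?_⟩⟩)
  have h5 := h3 k _ (h4 k).le
  have h6 := h3 k _ (Nat.succ_le_of_lt (h4 k))
  have h7 := (le_div_iff₀ hℓ).1 (Nat.floor_le (show 0 ≤ |t k| / (K / N) by positivity))
  have h8 := (div_lt_iff₀ hℓ).1 (Nat.lt_floor_add_one (|t k| / (K / N)))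
  push_cast at h6
  rw [abs_of_nonneg (by linarith)] at h5
  rw [abs_of_nonpos (by linarith)] at h6
  exact ⟨by linarith, by linarith⟩

variable [NeZero m]

lemma muB_union_le (S T : Set (Fin m → ℝ)) : muB (S ∪ T) ≤ muB S + muB T :=
  lintegral_union_le _ _ _

lemma muB_gapSet_le {K g : ℝ} (hK : 0 ≤ K) (hg : 0 ≤ g) (N : ℕ) (k : Fin m) :
    muB (gapSet K g N k)
      ≤ ENNReal.ofReal (rho (0 : Fin m → ℝ) * ((2 * K) ^ (m - 1) * ((N + 1) * (4 * g)))) := by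
  have h0 : muB (gapSet K g N k) ≤ ENNReal.ofReal (rho (0 : Fin m → ℝ)) * volume (gapSet K g N k) := by
    rw [muB, ← setLIntegral_const]
    exact lintegral_mono fun t => ENNReal.ofReal_le_ofReal (rho_le_rho_zero t)
  refine h0.trans ?_
  rw [ENNReal.ofReal_mul (rho_pos _).le]
  gcongr
  rw [gapSet, volume_pi, Measure.pi_pi, ← Finset.mul_prod_erase _ _ (Finset.mem_univ k),
    Function.update_self, mul_comm, ENNReal.ofReal_mul (by positivity)]
  gcongr
  · rw [Finset.prod_congr rfl fun j hj => by
      rw [Function.update_of_ne (Finset.ne_of_mem_erase hj), Real.volume_Icc], Finset.prod_const,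
      Finset.card_erase_of_mem (Finset.mem_univ k), Finset.card_univ, Fintype.card_fin,
      ENNReal.ofReal_pow (by positivity)]
    gcongr
    linarith
  · refine (measure_biUnion_finset_le _ _).trans ((Finset.sum_le_sum fun i _ =>
      (measure_union_le _ _).trans ?_).trans_eq (Finset.sum_const (ENNReal.ofReal (4 * g))) |>.trans ?_)
    · rw [Real.volume_ball, Real.volume_ball, ← ENNReal.ofReal_add (by positivity) (by positivity)]
      exact ENNReal.ofReal_le_ofReal (by linarith)
    · rw [Finset.card_range, nsmul_eq_mul, ← ENNReal.ofReal_natCast,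
        ← ENNReal.ofReal_mul (by positivity), Nat.cast_add_one]

lemma tendsto_muB_farSet (m : ℕ) [NeZero m] :
    Tendsto (fun K : ℕ => (muB (farSet m K)).toReal) atTop (nhds 0) := by
  have hm : ∀ K : ℝ, MeasurableSet (farSet m K) := fun K => by
    simp only [farSet, Set.ofPred_exists, Set.ofPred_or]
    refine MeasurableSet.iUnion fun k => (measurableSet_lt ?_ ?_).union (measurableSet_le ?_ ?_) <;>
      fun_prop
  have hr : Measurable fun t : Fin m → ℝ => ENNReal.ofReal (rho t) :=
    continuous_rho.measurable.ennreal_ofReal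
  have h := tendsto_lintegral_of_dominated_convergence (μ := (volume : Measure (Fin m → ℝ)))
    (F := fun K : ℕ => (farSet m K).indicator fun t => ENNReal.ofReal (rho t)) (f := fun _ => 0)
    (fun t => ENNReal.ofReal (rho t)) (fun K => hr.indicator (hm K))
    (fun K => Eventually.of_forall fun t => Set.indicator_le_self _ _ t)
    (by have := muB_le_one (m := m) Set.univ
        rw [muB, Measure.restrict_univ] at this
        exact (this.trans_lt ENNReal.one_lt_top).ne)
    (by
      have h0 : ∀ᵐ t : Fin m → ℝ, ∀ k, t k ≠ 0 := ae_all_iff.2 fun k =>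
        Measure.ae_eval_ne (μ := fun _ : Fin m => (volume : Measure ℝ)) k 0
      filter_upwards [h0] with t ht
      refine tendsto_const_nhds.congr' ?_
      have h1 : ∀ᶠ K : ℕ in atTop, ∀ k, (K : ℝ)⁻¹ ≤ |t k| ∧ |t k| < K := by
        refine eventually_all.2 fun k => ?_
        filter_upwards [tendsto_natCast_atTop_atTop.eventually_gt_atTop |t k|,
          tendsto_natCast_atTop_atTop.eventually_ge_atTop |t k|⁻¹] with K h1 h2
        exact ⟨inv_le_of_inv_le₀ (abs_pos.2 (ht k)) h2, h1⟩
      filter_upwards [h1] with K hK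
      refine (Set.indicator_of_notMem ?_ _).symm
      rintro ⟨k, h | h⟩
      · exact h.not_ge (hK k).1
      · exact h.not_gt (hK k).2)
  simp only [lintegral_indicator (hm _), lintegral_zero] at h
  exact (ENNReal.tendsto_toReal ENNReal.zero_ne_top).comp h
end

section

variable {m d : ℕ}

lemma card_mul_pow_le {y P v L : ℝ} (hy : 1 ≤ y) (hP : y ^ 8 ≤ P) (hv : 0 ≤ v) (h : P * v = L) :
    P * (v * y ^ 5) ^ 3 ≤ L ^ 3 / y ∧ P * (v * y ^ 5) ^ 4 ≤ L ^ 4 / y := by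
  have hy0 : 0 < y := by linarith
  have hw : v * y ^ 8 ≤ L := by rw [← h, mul_comm]; gcongr
  have hL : 0 ≤ L := le_trans (by positivity) hw
  constructor
  · rw [le_div_iff₀ hy0]
    calc _ = (P * v) * (v * y ^ 8) ^ 2 := by ring
      _ ≤ L * L ^ 2 := by rw [h]; gcongr
      _ = L ^ 3 := by ring
  · rw [le_div_iff₀ hy0]
    calc _ ≤ P * (v * y ^ 5) ^ 4 * y ^ 4 := mul_le_mul_of_nonneg_left (le_self_pow₀ hy four_ne_zero) (by
        have := (pow_pos hy0 8).le.trans hP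
        positivity)
      _ = (P * v) * (v * y ^ 8) ^ 3 := by ring
      _ ≤ L * L ^ 3 := by rw [h]; gcongr
      _ = L ^ 4 := by ring

/-- The twentieth root of the degree, in terms of which the mesh of the cells is chosen. -/
def xd (d : ℕ) : ℝ := (d : ℝ) ^ (20 : ℝ)⁻¹

lemma xd_nonneg (d : ℕ) : 0 ≤ xd d := by unfold xd; positivity

lemma xd_pow (d : ℕ) : xd d ^ 20 = d := by
  rw [xd, ← Real.rpow_natCast, ← Real.rpow_mul (by positivity)]; norm_num

lemma sqrt_eq_xd (d : ℕ) : √(d : ℝ) = xd d ^ 10 := by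
  rw [← xd_pow, show xd d ^ 20 = (xd d ^ 10) ^ 2 by ring,
    Real.sqrt_sq (pow_nonneg (xd_nonneg d) _)]

lemma sqrt_pow_eq_xd (m d : ℕ) : √(√(d : ℝ) ^ m) = (xd d ^ m) ^ 5 := by
  rw [sqrt_eq_xd, show (xd d ^ 10) ^ m = ((xd d ^ m) ^ 5) ^ 2 by ring,
    Real.sqrt_sq (pow_nonneg (pow_nonneg (xd_nonneg d) _) _)]

lemma tendsto_xd : Tendsto xd atTop atTop :=
  (tendsto_rpow_atTop (by norm_num)).comp tendsto_natCast_atTop_atTop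

/-- The number of cells in each coordinate. -/
def Nd (d : ℕ) : ℕ := ⌈xd d ^ 8⌉₊

lemma tendsto_pow_mul_tau (m : ℕ) {K : ℝ} (hK : 0 < K) :
    Tendsto (fun d : ℕ => √(d : ℝ) ^ m * tau m d K (xd d ^ 9)⁻¹) atTop (nhds 0) := by
  set b := K⁻¹ / (1 + m * K ^ 2) with hb
  have hb0 : 0 < b := by positivity
  have h := ((tendsto_rpow_mul_exp_neg_mul_atTop_nhds_zero ((10 * m + 20 : ℕ) : ℝ) b hb0).comp
    tendsto_xd).const_mul (2 * m * (K + 1) ^ 2 * Real.exp (K ^ 4))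
  rw [mul_zero] at h
  refine h.congr' ?_
  filter_upwards [tendsto_xd.eventually_gt_atTop 0] with d hd
  have h1 : √(d : ℝ) * ((xd d ^ 9)⁻¹ * K⁻¹ / (1 + m * K ^ 2)) = b * xd d := by
    rw [sqrt_eq_xd, hb]; field_simp
  simp only [Function.comp_apply, tau, h1, Real.rpow_natCast]
  rw [sqrt_eq_xd, sub_eq_add_neg, Real.exp_add, ← xd_pow d, neg_mul]
  ring

lemma Nd_le (hd : 1 ≤ xd d) : ((Nd d : ℝ) + 1) * (4 * (xd d ^ 9)⁻¹) ≤ 12 / xd d := by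
  have h1 : (Nd d : ℝ) < xd d ^ 8 + 1 := Nat.ceil_lt_add_one (by positivity)
  have h2 : 1 ≤ xd d ^ 8 := one_le_pow₀ hd
  calc _ ≤ (3 * xd d ^ 8) * (4 * (xd d ^ 9)⁻¹) := by gcongr; linarith
    _ = 12 / xd d := by field_simp; norm_num

variable [NeZero m]

lemma muB_compl_tblk_le {K : ℝ} (hK : 0 < K) (hd : 1 ≤ xd d) :
    (muB (⋃ b : Fin m → Fin (Nd d), tblk K (xd d ^ 9)⁻¹ (Nd d) b)ᶜ).toReal
      ≤ (muB (farSet m K)).toReal + m * (rho (0 : Fin m → ℝ) * ((2 * K) ^ (m - 1) * (12 / xd d))) := by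
  have hN : 0 < Nd d := Nat.ceil_pos.2 (by positivity)
  have hr := (rho_pos (0 : Fin m → ℝ)).le
  have hfin : muB (farSet m K) ≠ ⊤ := ((muB_le_one _).trans_lt ENNReal.one_lt_top).ne
  have hsum : ∀ S : Fin m → Set (Fin m → ℝ), muB (⋃ k, S k) ≤ ∑ k, muB (S k) := fun S => by
    simp only [muB]
    exact (lintegral_iUnion_le _ _).trans_eq (tsum_fintype _)
  refine ENNReal.toReal_le_of_le_ofReal (by positivity) ?_
  rw [ENNReal.ofReal_add (by positivity) (by positivity), ENNReal.ofReal_toReal hfin]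
  refine (lintegral_mono_set (compl_tblk_subset hK hN)).trans ((muB_union_le _ _).trans ?_)
  gcongr
  refine (hsum _).trans ((Finset.sum_le_sum fun k _ =>
    (muB_gapSet_le hK.le (by positivity) (Nd d) k).trans (ENNReal.ofReal_le_ofReal
      (mul_le_mul_of_nonneg_left (mul_le_mul_of_nonneg_left (Nd_le hd) (by positivity)) hr))).trans_eq
    ?_)
  rw [Finset.sum_const, Finset.card_univ, Fintype.card_fin, nsmul_eq_mul,
    ENNReal.ofReal_mul m.cast_nonneg, ENNReal.ofReal_natCast]

/-- The sum of the normalised block functionals attached to the cells. -/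
def Xd (m : ℕ) (r ρ K : ℝ) (d : ℕ) (ω : Cf m d) : ℝ :=
  ∑ b : Fin m → Fin (Nd d), nblk r ρ (tblk K (xd d ^ 9)⁻¹ (Nd d) b) (cblk K (Nd d) b) ω

/-- The standardised number of roots. -/
def Zd (m d : ℕ) (ω : Cf m d) : ℝ := (nz d Set.univ ω - √(d : ℝ) ^ m) / √(√(d : ℝ) ^ m)

lemma volume_tblk_le' {K : ℝ} (hK : 0 ≤ K) (b : Fin m → Fin (Nd d)) :
    volume (tblk K (xd d ^ 9)⁻¹ (Nd d) b) ≤ ENNReal.ofReal ((2 * (K / Nd d)) ^ m) :=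
  volume_tblk_le hK (by have := xd_nonneg d; positivity) _ b

lemma measurableSet_tblk {K : ℝ} (b : Fin m → Fin (Nd d)) :
    MeasurableSet (tblk K (xd d ^ 9)⁻¹ (Nd d) b) :=
  (isCompact_tblk (by have := xd_nonneg d; positivity) _ b).measurableSet

lemma card_mul_v (m : ℕ) {N : ℕ} (hN : 0 < N) (K : ℝ) :
    (N : ℝ) ^ m * (2 * (K / N)) ^ m = (2 * K) ^ m := by
  rw [← mul_pow]; congr 1; field_simp

lemma tendsto_charFun_Xd {r ρ K : ℝ} (hρ : 0 < ρ) (h : r ^ 2 + ρ ^ 2 = 1) (hK : 0 ≤ K) (θ : ℝ) :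
    Tendsto (fun d => charFun ((Gs m d).map (Xd m r ρ K d)) θ
      - (Real.exp (-(θ ^ 2 * (∫ ω, Xd m r ρ K d ω ^ 2 ∂(Gs m d)) / 2)) : ℂ)) atTop (nhds 0) := by
  set A := 16 * |θ| ^ 3 * (blkC m ρ 3 + blkC m ρ 1 ^ 3) with hA
  set B := (θ ^ 2 * (blkC m ρ 2 + blkC m ρ 1 ^ 2)) ^ 2 with hB
  have hA0 : 0 ≤ A := by simp only [hA, blkC]; positivity
  have hx : Tendsto (fun d => xd d ^ m) atTop atTop :=
    (tendsto_pow_atTop (NeZero.ne m)).comp tendsto_xd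
  refine squeeze_zero_norm' ?_ (hx.const_div_atTop (A * ((2 * K) ^ m) ^ 3 + B * ((2 * K) ^ m) ^ 4))
  filter_upwards [tendsto_xd.eventually_ge_atTop 1, eventually_gt_atTop 0] with d hd hd0
  have hN : 0 < Nd d := Nat.ceil_pos.2 (by positivity)
  refine (norm_charFun_nblk_sub_le hρ h hd0 (v := (2 * (K / Nd d)) ^ m) (by positivity)
    measurableSet_tblk (volume_tblk_le' hK) (pairwise_disjoint_cblk hK _) θ).trans ?_
  rw [Fintype.card_fun, Fintype.card_fin, Fintype.card_fin, sqrt_pow_eq_xd, Nat.cast_pow]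
  obtain ⟨h3, h4⟩ := card_mul_pow_le (y := xd d ^ m) (P := (Nd d : ℝ) ^ m)
    (v := (2 * (K / Nd d)) ^ m) (one_le_pow₀ hd)
    (by rw [← pow_mul, mul_comm, pow_mul]; gcongr; exact Nat.le_ceil _) (by positivity)
    (card_mul_v m hN K)
  calc _ = A * ((Nd d : ℝ) ^ m * ((2 * (K / Nd d)) ^ m * (xd d ^ m) ^ 5) ^ 3)
        + B * ((Nd d : ℝ) ^ m * ((2 * (K / Nd d)) ^ m * (xd d ^ m) ^ 5) ^ 4) := by rw [hA, hB]; ring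
    _ ≤ A * (((2 * K) ^ m) ^ 3 / xd d ^ m) + B * (((2 * K) ^ m) ^ 4 / xd d ^ m) := by gcongr
    _ = _ := by ring

lemma memLp_Xd {r ρ K : ℝ} (hρ : 0 < ρ) (h : r ^ 2 + ρ ^ 2 = 1) (hK : 0 ≤ K) (hd0 : 0 < d) :
    MemLp (Xd m r ρ K d) 2 (Gs m d) :=
  memLp_finsetSum _ fun b _ => (memLp_nblk hρ h hd0 (measurableSet_tblk b) (by positivity)
    (volume_tblk_le' hK b) _).mono_exponent (by norm_num)

lemma exists_block_approx (m : ℕ) [NeZero m] {η : ℝ} (hη : 0 < η) : ∃ X : ∀ d, Cf m d → ℝ,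
    (∀ᶠ d in atTop, MemLp (X d) 2 (Gs m d) ∧ ∫ ω, (Zd m d ω - X d ω) ^ 2 ∂(Gs m d) ≤ η) ∧
    ∀ θ, Tendsto (fun d => charFun ((Gs m d).map (X d)) θ
      - (Real.exp (-(θ ^ 2 * (∫ ω, X d ω ^ 2 ∂(Gs m d)) / 2)) : ℂ)) atTop (nhds 0) := by
  obtain ⟨r, hr0, hr1, hr⟩ := exists_II_gt m (η := η / 16) (by positivity)
  obtain ⟨J, hJ, hJk⟩ := exists_Jk_le m
  set ρ := √(1 - r ^ 2) with hρd
  have hr2 : 0 < 1 - r ^ 2 := by nlinarith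
  have hρ : 0 < ρ := Real.sqrt_pos.2 hr2
  have h : r ^ 2 + ρ ^ 2 = 1 := by rw [hρd, Real.sq_sqrt hr2.le]; ring
  obtain ⟨K, hK1, hK⟩ : ∃ K : ℕ, 1 ≤ K ∧
      (muB (farSet m K)).toReal < η / (16 * (1 + J)) :=
    ((eventually_ge_atTop 1).and
      ((tendsto_muB_farSet m).eventually_lt_const (by positivity))).exists
  have hK1' : (1 : ℝ) ≤ K := by exact_mod_cast hK1
  have hK0 : (0 : ℝ) < K := by linarith
  refine ⟨Xd m r ρ K, ?_, tendsto_charFun_Xd hρ h hK0.le⟩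
  have e1 : ∀ᶠ d in atTop, 8 * (1 + Ik m d 1 - Ik m d r) < η / 2 :=
    ((((tendsto_Ik zero_le_one le_rfl).const_add 1).sub (tendsto_Ik hr0 hr1.le)).const_mul
      8).eventually_lt_const (by linarith)
  have e2 : ∀ᶠ d in atTop, m * (rho (0 : Fin m → ℝ) * ((2 * K) ^ (m - 1) * (12 / xd d)))
      < η / (32 * (1 + J)) := by
    have := ((((tendsto_xd.const_div_atTop 12).const_mul ((2 * (K : ℝ)) ^ (m - 1))).const_mul
      (rho (0 : Fin m → ℝ))).const_mul (m : ℝ))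
    simp only [mul_zero] at this
    exact this.eventually_lt_const (by positivity)
  have e3 : ∀ᶠ d : ℕ in atTop, 2 * ((2 * K : ℝ) ^ m) ^ 2 * (dPsiC m ρ).toReal *
      (√(d : ℝ) ^ m * tau m d K (xd d ^ 9)⁻¹) < η / 8 := by
    have := (tendsto_pow_mul_tau m hK0).const_mul (2 * ((2 * K : ℝ) ^ m) ^ 2 * (dPsiC m ρ).toReal)
    rw [mul_zero] at this
    exact this.eventually_lt_const (by positivity)
  filter_upwards [e1, e2, e3, tendsto_xd.eventually_ge_atTop 1, eventually_ge_atTop (m + 3),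
    eventually_ge_atTop (K ^ 4)] with d e1 e2 e3 hx hd hdK
  have hd0 : 0 < d := by lia
  refine ⟨memLp_Xd hρ h hK0.le hd0, ?_⟩
  have hN : 0 < Nd d := Nat.ceil_pos.2 (by positivity)
  have hg : 0 < (xd d ^ 9)⁻¹ := by positivity
  have hcell : ∀ b : Fin m → Fin (Nd d), ∀ t ∈ tblk (K : ℝ) (xd d ^ 9)⁻¹ (Nd d) b, _ :=
    fun b t ht => off_cell_le t (fun k => b k * (K / Nd d)) (fun k => (b k + 1) * (K / Nd d)) hK1'
      hg.le (by exact_mod_cast hdK) hd0 (fun k => by positivity) (fun k => cell_le hK0.le (b k))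
      (fun k => (ht k).1) (fun k => (ht k).2.1) fun k => (ht k).2.2
  have hτ : 0 < tau m d K (xd d ^ 9)⁻¹ := by
    have : (0 : ℝ) < m := by exact_mod_cast NeZero.pos m
    unfold tau; positivity
  refine (integral_nz_sub_nblk_le (by lia) (intK_of_le zero_le_one le_rfl hd) hr0 hr1.le hρ h
    (intK_of_le hr0 hr1.le hd) (v := (2 * (K / Nd d)) ^ m) (by positivity) hτ
    (isCompact_tblk hg.le _) (pairwise_disjoint_tblk hK0.le hg _) (volume_tblk_le' hK0.le)
    (C := cblk K (Nd d)) (fun b t ht => (hcell b t ht).1) fun b t ht => (hcell b t ht).2).trans ?_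
  rw [Fintype.card_fun, Fintype.card_fin, Fintype.card_fin, Nat.cast_pow, card_mul_v m hN]
  have hmu := muB_compl_tblk_le (m := m) hK0 hx
  have e4 : 4 * (muB (⋃ b : Fin m → Fin (Nd d), tblk K (xd d ^ 9)⁻¹ (Nd d) b)ᶜ).toReal
      * (1 + Jk m d) ≤ 4 * (η / (16 * (1 + J)) + η / (32 * (1 + J))) * (1 + J) := by
    gcongr
    · have := Jk_nonneg (m := m) (d := d); linarith
    · linarith
    · exact hJk d hd
  have e5 : 4 * (η / (16 * (1 + J)) + η / (32 * (1 + J))) * (1 + J) = 3 * η / 8 := by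
    field_simp; ring
  linarith

/-- The limiting variance. -/
def limV (m : ℕ) [NeZero m] : NNReal := ⟨1 + II m 1, (one_add_II_pos m).le⟩

lemma measurable_Zd (m : ℕ) [NeZero m] (d : ℕ) : Measurable (Zd m d) :=
  ((measurable_nz isSigmaCompact_univ).sub_const _).div_const _

theorem tendsto_integral_Zd (m : ℕ) [NeZero m] (f : BoundedContinuousFunction ℝ ℝ) :
    Tendsto (fun d => ∫ ω, f (Zd m d ω) ∂(Gs m d)) atTop
      (nhds (∫ x, f x ∂(gaussianReal 0 (limV m)))) := by
  refine tendsto_integral_gaussianReal_of_approx (measurable_Zd m) ?_ ?_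
    (fun η hη => exists_block_approx m hη) f
  · filter_upwards [eventually_ge_atTop (m + 3)] with d hd
    exact ((memLp_nz (by lia) (intK_of_le zero_le_one le_rfl hd) isSigmaCompact_univ).sub
      (memLp_const _)).mul_const _
  · refine ((tendsto_Ik (m := m) zero_le_one le_rfl).const_add 1).congr' ?_
    filter_upwards [eventually_ge_atTop (m + 3)] with d hd
    have hd0 : (0 : ℝ) < d := by exact_mod_cast (by lia : 0 < d)
    simp only [Zd, div_pow]
    rw [integral_div, var_nz_univ (by lia) (intK_of_le zero_le_one le_rfl hd),
      Real.sq_sqrt (by positivity)]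
    field_simp
end

lemma kssVar_eq (m d : ℕ) (i : kssIndex m d) : (kssVar m d i : ℝ) = mw i.2 := by
  simp [kssVar, mw, Jx.deg0]

/-- The coordinatewise scaling taking standard Gaussian coefficients to the KSS coefficients. -/
def kssScale (m d : ℕ) : (kssIndex m d → ℝ) ≃ᵐ (kssIndex m d → ℝ) :=
  MeasurableEquiv.piCongrRight fun i => MeasurableEquiv.mulLeft₀ (√(mw i.2))
    (Real.sqrt_pos.2 (mw_pos i.2)).ne'

lemma kssScale_apply (m d : ℕ) (ω : kssIndex m d → ℝ) (i : kssIndex m d) :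
    kssScale m d ω i = √(mw i.2) * ω i := rfl

lemma map_kssScale (m d : ℕ) : (Gs m d).map (kssScale m d) = kssMeasure m d := by
  have h : ∀ i : kssIndex m d,
      (gaussianReal 0 1).map (√(mw i.2) * ·) = gaussianReal 0 (kssVar m d i) := fun i => by
    rw [gaussianReal_map_const_mul, mul_zero]
    congr 1
    ext
    simp [kssVar_eq, Real.sq_sqrt (mw_pos i.2).le]
  have : ∀ i : kssIndex m d, SigmaFinite ((gaussianReal 0 1).map (√(mw i.2) * ·)) := fun i => by
    rw [h]; infer_instance
  rw [kssMeasure, ← funext h, ← Measure.pi_map_pi (fun i => by fun_prop)]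
  rfl

lemma ft_dot_row_eq (m d : ℕ) (ω : kssIndex m d → ℝ) (ℓ : Fin m) (t : Fin m → ℝ) :
    ft d t ⬝ᵥ row ω ℓ = (nrm t)⁻¹ ^ d * kssPoly m d (kssScale m d ω) ℓ t := by
  simp only [dotProduct, kssPoly, Finset.mul_sum, kssScale_apply]
  refine Finset.sum_congr rfl fun j _ => ?_
  have hj : (nrm t)⁻¹ ^ d = (∏ k, (nrm t)⁻¹ ^ (j.1 k : ℕ)) * (nrm t)⁻¹ ^ j.deg0 := by
    rw [Finset.prod_pow_eq_pow_sum, ← pow_add, Jx.deg0, Nat.add_sub_cancel' j.2]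
  simp only [ft, homE, monoE, vs, row, Pi.smul_apply, xh_succ, xh_zero, smul_eq_mul, mul_one,
    mul_pow, Finset.prod_mul_distrib, hj]
  ring

lemma kssCount_kssScale (m d : ℕ) (ω : kssIndex m d → ℝ) :
    (kssCount m d (kssScale m d ω) : ℝ) = nz d Set.univ ω := by
  have h : ∀ ℓ t, kssPoly m d (kssScale m d ω) ℓ t = 0 ↔ ft d t ⬝ᵥ row ω ℓ = 0 := fun ℓ t => by
    have := nrm_pos t
    rw [ft_dot_row_eq, mul_eq_zero_iff_left (by positivity)]
  simp only [kssCount, nz, Nz, cnt, h, Set.mem_univ, true_and]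
  rw [Set.ncard_def]
  cases Set.encard {t : Fin m → ℝ | ∀ ℓ, ft d t ⬝ᵥ row ω ℓ = 0} <;> simp
end

/-- Central Limit Theorem for the number of real roots of the `m × m` KSS system:
there exists a finite positive variance `V` such that the law of
`(N_{P_d} - d^{m/2}) / d^{m/4}` converges weakly, as `d → ∞`, to the centered Gaussian
measure on `ℝ` with variance `V` (weak convergence being tested against all bounded
continuous functions). -/
theorem kss_clt (m : ℕ) (hm : 1 ≤ m) :
    ∃ V : NNReal, 0 < V ∧
      ∀ f : BoundedContinuousFunction ℝ ℝ,
        Filter.Tendsto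
          (fun d : ℕ =>
            ∫ ω, f (((kssCount m d ω : ℝ) - (d : ℝ) ^ ((m : ℝ) / 2)) / (d : ℝ) ^ ((m : ℝ) / 4))
              ∂(kssMeasure m d))
          Filter.atTop (nhds (∫ x, f x ∂(gaussianReal 0 V))) := by
  have : NeZero m := ⟨by lia⟩
  refine ⟨limV m, one_add_II_pos m, fun f => (tendsto_integral_Zd m f).congr fun d => ?_⟩
  rw [← map_kssScale, integral_map_equiv]
  simp only [kssCount_kssScale, Zd]
  have h2 : (d : ℝ) ^ ((m : ℝ) / 2) = √(d : ℝ) ^ m := by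
    rw [Real.sqrt_eq_rpow, ← Real.rpow_mul_natCast d.cast_nonneg]; ring_nf
  have h4 : (d : ℝ) ^ ((m : ℝ) / 4) = √(√(d : ℝ) ^ m) := by
    rw [← h2, Real.sqrt_eq_rpow, ← Real.rpow_mul d.cast_nonneg]; ring_nf
  rw [h2, h4]
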